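/- The following complete multipartite graphs have paintability 8: χ_P(K_{2⋆1,3⋆5}) = 8, χ_P(K_{3⋆6}) = 8, χ_P(K_{2⋆4,3⋆3}) = 8, and χ_P(K_{2⋆3,3⋆4}) = 8. -/

import Mathlib

/-- `PainterWinsIn G r fuel U t` : in the online list coloring game on `G` with threshold `r`,
where `U` is the set of currently unpainted vertices and `t v` is the number of times vertex `v`
has been presented so far, Painter can guarantee to win within `fuel` further rounds.
In each round Lister presents a nonempty set `S` of unpainted vertices; Painter chooses an
independent subset `I ⊆ S` and paints it; Painter wins once all vertices are painted, and loses
if some unpainted vertex has been presented `r` times. -/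
def PainterWinsIn {V : Type*} [Fintype V] [DecidableEq V] (G : SimpleGraph V) (r : ℕ) :
    ℕ → Finset V → (V → ℕ) → Prop
  | 0, U, _ => U = ∅
  | fuel + 1, U, t => U = ∅ ∨
      ∀ S ⊆ U, S.Nonempty →
        ∃ I ⊆ S, (∀ u ∈ I, ∀ v ∈ I, ¬ G.Adj u v) ∧
          (U \ I = ∅ ∨
            ((∀ v ∈ U \ I, t v + (if v ∈ S then 1 else 0) < r) ∧
              PainterWinsIn G r fuel (U \ I) (fun v => t v + if v ∈ S then 1 else 0)))

/-- `G` is `r`-paintable: Painter has a winning strategy in the online list coloring game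
on `G` with threshold `r`. -/
def Paintable {V : Type*} [Fintype V] [DecidableEq V] (G : SimpleGraph V) (r : ℕ) : Prop :=
  ∃ fuel, PainterWinsIn G r fuel Finset.univ (fun _ => 0)

/-- The paintability `χ_P(G)`: the least `r` such that `G` is `r`-paintable. -/
noncomputable def paintability {V : Type*} [Fintype V] [DecidableEq V] (G : SimpleGraph V) : ℕ :=
  sInf {r | Paintable G r}

/-! ### The game on a partitioned vertex set -/

/-- Painter wins from the set `U` of unpainted vertices, where `ρ` names the parts and `f v` is the
number of presentations of `v` after which Painter has lost. -/
inductive PainterWins {V : Type*} [DecidableEq V] (ρ : V → ℕ) : Finset V → (V → ℕ) → Prop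
  | intro {U : Finset V} {f : V → ℕ} (σ : Finset V → Finset V) (hf : ∀ v ∈ U, 1 ≤ f v)
      (hσ : ∀ S ⊆ U, S.Nonempty → σ S ⊆ S ∧ ∀ u ∈ σ S, ∀ v ∈ σ S, ρ u = ρ v)
      (hw : ∀ S ⊆ U, S.Nonempty →
        PainterWins ρ (U \ σ S) (fun v => f v - if v ∈ S then 1 else 0)) :
      PainterWins ρ U f

namespace PainterWins

variable {V V' : Type*} [DecidableEq V] [DecidableEq V'] {ρ : V → ℕ} {ρ' : V' → ℕ}
  {U : Finset V} {f : V → ℕ}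

theorem of_forall (hf : ∀ v ∈ U, 1 ≤ f v)
    (h : ∀ S ⊆ U, S.Nonempty → ∃ I ⊆ S, (∀ u ∈ I, ∀ v ∈ I, ρ u = ρ v) ∧
      PainterWins ρ (U \ I) (fun v => f v - if v ∈ S then 1 else 0)) :
    PainterWins ρ U f := by
  choose! σ h₁ h₂ h₃ using h
  exact ⟨σ, hf, fun S hS hn => ⟨h₁ S hS hn, h₂ S hS hn⟩, h₃⟩

theorem one_le (h : PainterWins ρ U f) : ∀ v ∈ U, 1 ≤ f v := by
  cases h; assumption

theorem exists_move (h : PainterWins ρ U f) {S : Finset V} (hS : S ⊆ U) (hn : S.Nonempty) :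
    ∃ I ⊆ S, (∀ u ∈ I, ∀ v ∈ I, ρ u = ρ v) ∧
      PainterWins ρ (U \ I) (fun v => f v - if v ∈ S then 1 else 0) := by
  cases h with
  | intro σ _ hσ hw => exact ⟨σ S, (hσ S hS hn).1, (hσ S hS hn).2, hw S hS hn⟩

theorem of_embedding (h : PainterWins ρ U f) : ∀ {U' : Finset V'} {f' : V' → ℕ} (φ : V' → V),
    (∀ u ∈ U', φ u ∈ U) → Set.InjOn φ U' →
    (∀ u ∈ U', ∀ v ∈ U', ρ (φ u) = ρ (φ v) → ρ' u = ρ' v) →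
    (∀ u ∈ U', f (φ u) ≤ f' u) → PainterWins ρ' U' f' := by
  induction h with
  | @intro U f σ hf hσ hw ih =>
    intro U' f' φ hm hi hr ht
    refine of_forall (fun v hv => (hf _ (hm v hv)).trans (ht v hv)) fun S hS hn => ?_
    have hS' : S.image φ ⊆ U := by
      intro x hx
      obtain ⟨u, hu, rfl⟩ := Finset.mem_image.1 hx
      exact hm u (hS hu)
    obtain ⟨h₁, h₂⟩ := hσ _ hS' (hn.image φ)
    refine ⟨S.filter (φ · ∈ σ (S.image φ)), Finset.filter_subset _ _, ?_, ?_⟩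
    · intro u hu v hv
      rw [Finset.mem_filter] at hu hv
      exact hr u (hS hu.1) v (hS hv.1) (h₂ _ hu.2 _ hv.2)
    · refine ih _ hS' (hn.image φ) φ ?_ (hi.mono (by simp)) ?_ ?_
      · intro u hu
        rw [Finset.mem_sdiff, Finset.mem_filter] at hu
        refine Finset.mem_sdiff.2 ⟨hm u hu.1, fun hx => hu.2 ⟨?_, hx⟩⟩
        obtain ⟨w, hw, he⟩ := Finset.mem_image.1 (h₁ hx)
        rwa [← hi (hS hw) hu.1 he]
      · intro u hu v hv
        exact hr u (Finset.mem_sdiff.1 hu).1 v (Finset.mem_sdiff.1 hv).1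
      · intro u hu
        have := ht u (Finset.mem_sdiff.1 hu).1
        by_cases hx : u ∈ S
        · simp only [hx, Finset.mem_image_of_mem φ hx, if_true]; omega
        · simp only [hx, if_false]; omega

theorem mono (h : PainterWins ρ U f) {U' : Finset V} {f' : V → ℕ} (hU : U' ⊆ U)
    (hf : ∀ v ∈ U', f v ≤ f' v) : PainterWins ρ U' f' :=
  h.of_embedding id (fun _ hu => hU hu) (Set.injOn_id _) (fun _ _ _ _ h => h) hf

theorem empty : PainterWins ρ ∅ f :=
  of_forall (by simp) fun S hS hn => absurd (Finset.subset_empty.1 hS) hn.ne_empty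

/-- It suffices to answer the moves of Lister that meet at least two parts. -/
theorem of_forall_two (hf : ∀ v ∈ U, 1 ≤ f v)
    (h : ∀ S ⊆ U, (∃ u ∈ S, ∃ v ∈ S, ρ u ≠ ρ v) → ∃ I ⊆ S, (∀ u ∈ I, ∀ v ∈ I, ρ u = ρ v) ∧
      PainterWins ρ (U \ I) (fun v => f v - if v ∈ S then 1 else 0)) :
    PainterWins ρ U f := by
  suffices H : ∀ n, ∀ X ⊆ U, X.card = n → PainterWins ρ X f from H _ U subset_rfl rfl
  intro n
  induction n using Nat.strong_induction_on with
  | _ n ih =>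
    intro X hX hn
    refine of_forall (fun v hv => hf v (hX hv)) fun S hS hSn => ?_
    by_cases h2 : ∃ u ∈ S, ∃ v ∈ S, ρ u ≠ ρ v
    · obtain ⟨I, hI, hr, hw⟩ := h S (hS.trans hX) h2
      exact ⟨I, hI, hr, hw.mono (Finset.sdiff_subset_sdiff hX subset_rfl) fun _ _ => le_rfl⟩
    · push Not at h2
      refine ⟨S, subset_rfl, h2, ?_⟩
      have hc : (X \ S).card < n := by
        rw [← hn]
        exact Finset.card_lt_card (Finset.sdiff_ssubset hS hSn)
      refine (ih _ hc _ (Finset.sdiff_subset.trans hX) rfl).mono subset_rfl fun v hv => ?_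
      simp [(Finset.mem_sdiff.1 hv).2]

/-- Vertices with more presentations to spare than vertices in other parts can be ignored. -/
theorem of_sdiff : ∀ {U W : Finset V} {f : V → ℕ}, PainterWins ρ (U \ W) f →
    (∀ v ∈ U, v ∈ W → (U.filter (ρ · ≠ ρ v)).card < f v) → PainterWins ρ U f := by
  suffices H : ∀ n (U W : Finset V) f, U.card = n → PainterWins ρ (U \ W) f →
      (∀ v ∈ U, v ∈ W → (U.filter (ρ · ≠ ρ v)).card < f v) → PainterWins ρ U f from by
    intro U W f h hW
    exact H _ U W f rfl h hW
  intro n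
  induction n using Nat.strong_induction_on with
  | _ n ih =>
    intro U W f hn h hW
    refine of_forall (fun v hv => ?_) fun S hS hSn => ?_
    · by_cases hv' : v ∈ W
      · exact Nat.one_le_of_lt (hW v hv hv')
      · exact h.one_le v (Finset.mem_sdiff.2 ⟨hv, hv'⟩)
    obtain ⟨I, hIS, hIn, hr, hw⟩ : ∃ I ⊆ S, I.Nonempty ∧ (∀ u ∈ I, ∀ v ∈ I, ρ u = ρ v) ∧
        PainterWins ρ ((U \ W) \ I) (fun v => f v - if v ∈ S then 1 else 0) := by
      by_cases h0 : (S \ W).Nonempty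
      · obtain ⟨I, hI, hr, hw⟩ := h.exists_move (Finset.sdiff_subset_sdiff hS subset_rfl) h0
        have hw' : PainterWins ρ ((U \ W) \ I) (fun v => f v - if v ∈ S then 1 else 0) := by
          refine hw.mono subset_rfl fun v hv => ?_
          have hvW := (Finset.mem_sdiff.1 (Finset.mem_sdiff.1 hv).1).2
          simp [hvW]
        rcases I.eq_empty_or_nonempty with rfl | hne
        · obtain ⟨x, hx⟩ := h0
          refine ⟨{x}, by simpa using (Finset.mem_sdiff.1 hx).1, by simp, by simp, ?_⟩
          exact hw'.mono (Finset.sdiff_subset_sdiff subset_rfl (by simp)) fun _ _ => le_rfl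
        · exact ⟨I, hI.trans Finset.sdiff_subset, hne, hr, hw'⟩
      · rw [Finset.not_nonempty_iff_eq_empty, Finset.sdiff_eq_empty_iff_subset] at h0
        obtain ⟨x, hx⟩ := hSn
        refine ⟨{x}, by simpa using hx, by simp, by simp, ?_⟩
        refine h.mono Finset.sdiff_subset fun v hv => ?_
        have hvS : v ∉ S := fun hvS =>
          (Finset.mem_sdiff.1 (Finset.mem_sdiff.1 hv).1).2 (h0 hvS)
        simp [hvS]
    obtain ⟨x, hx⟩ := hIn
    have hsub : I ⊆ S.filter (ρ · = ρ x) := fun u hu =>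
      Finset.mem_filter.2 ⟨hIS hu, hr u hu x hx⟩
    refine ⟨S.filter (ρ · = ρ x), Finset.filter_subset _ _, ?_, ?_⟩
    · intro u hu v hv
      rw [(Finset.mem_filter.1 hu).2, (Finset.mem_filter.1 hv).2]
    have hxS := hIS hx
    have hlt : (U \ S.filter (ρ · = ρ x)).card < n := by
      rw [← hn]
      exact Finset.card_lt_card (Finset.sdiff_ssubset ((Finset.filter_subset _ _).trans hS)
        ⟨x, hsub hx⟩)
    refine ih _ hlt _ W _ rfl (hw.mono ?_ fun _ _ => le_rfl) fun v hv hvW => ?_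
    · intro v hv
      simp only [Finset.mem_sdiff, Finset.mem_filter] at hv ⊢
      exact ⟨⟨hv.1.1, hv.2⟩, fun hvI => hv.1.2 ⟨hIS hvI, hr v hvI x hx⟩⟩
    · rw [Finset.mem_sdiff, Finset.mem_filter] at hv
      have h1 := hW v hv.1 hvW
      by_cases hvS : v ∈ S
      · have h2 : (({u ∈ U \ {u ∈ S | ρ u = ρ x} | ρ u ≠ ρ v} : Finset V)).card <
            ({u ∈ U | ρ u ≠ ρ v} : Finset V).card := by
          refine Finset.card_lt_card (Finset.ssubset_iff_subset_ne.2
            ⟨Finset.filter_subset_filter _ Finset.sdiff_subset, fun he => ?_⟩)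
          have hm : x ∈ ({u ∈ U | ρ u ≠ ρ v} : Finset V) :=
            Finset.mem_filter.2 ⟨hS hxS, fun he => hv.2 ⟨hvS, he.symm⟩⟩
          rw [← he, Finset.mem_filter, Finset.mem_sdiff, Finset.mem_filter] at hm
          exact hm.1.2 ⟨hxS, rfl⟩
        simp only [hvS, if_true]
        omega
      · have h2 := Finset.card_le_card (Finset.filter_subset_filter (ρ · ≠ ρ v)
          (Finset.sdiff_subset : U \ {u ∈ S | ρ u = ρ x} ⊆ U))
        simp only [hvS, if_false]
        omega

end PainterWins

/-! ### Positions given by lists of rows -/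

/-- A position: the numbers of remaining presentations, part by part. -/
abbrev Row := List ℕ

def cells (s : List Row) : Finset (ℕ × ℕ) :=
  (Finset.range s.length).biUnion fun i => (Finset.range (s.getD i []).length).image (Prod.mk i)

def tok (s : List Row) (v : ℕ × ℕ) : ℕ := (s.getD v.1 []).getD v.2 0

/-- Painter wins the position `s`. -/
def Win (s : List Row) : Prop := PainterWins Prod.fst (cells s) (tok s)

theorem mem_cells {s : List Row} {v : ℕ × ℕ} : v ∈ cells s ↔ v.2 < (s.getD v.1 []).length := by
  obtain ⟨i, j⟩ := v
  simp only [cells, Finset.mem_biUnion, Finset.mem_range, Finset.mem_image, Prod.mk.injEq]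
  constructor
  · rintro ⟨i, _, j, hj, rfl, rfl⟩; exact hj
  · intro h
    refine ⟨i, ?_, j, h, rfl, rfl⟩
    by_contra hi
    rw [List.getD_eq_default _ _ (not_lt.1 hi)] at h
    simp at h

theorem fst_lt_of_mem_cells {s : List Row} {v : ℕ × ℕ} (hv : v ∈ cells s) : v.1 < s.length := by
  by_contra h
  rw [mem_cells, List.getD_eq_default _ _ (not_lt.1 h)] at hv
  simp at hv

/-- The vertices in `A` with values `g` embed into the row `t`. -/
def RowEmb (A : Set ℕ) (g : ℕ → ℕ) (t : Row) : Prop :=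
  ∃ φ : ℕ → ℕ, Set.InjOn φ A ∧ ∀ j ∈ A, φ j < t.length ∧ t.getD (φ j) 0 ≤ g j

/-- The row `t` is at least as good for Painter as the row `q`. -/
def RowGe (t q : Row) : Prop := RowEmb {j | j < t.length} (t.getD · 0) q

theorem RowEmb.mono {A B : Set ℕ} {g h : ℕ → ℕ} {t : Row} (H : RowEmb A g t) (hB : B ⊆ A)
    (hg : ∀ j ∈ B, g j ≤ h j) : RowEmb B h t := by
  obtain ⟨φ, hi, hφ⟩ := H
  exact ⟨φ, hi.mono hB, fun j hj => ⟨(hφ j (hB hj)).1, (hφ j (hB hj)).2.trans (hg j hj)⟩⟩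

theorem RowEmb.trans {A : Set ℕ} {g : ℕ → ℕ} {t q : Row} (H : RowEmb A g t) (h : RowGe t q) :
    RowEmb A g q := by
  obtain ⟨φ, hi, hφ⟩ := H
  obtain ⟨ψ, hj, hψ⟩ := h
  refine ⟨ψ ∘ φ, hj.comp hi fun j hj => (hφ j hj).1, fun j hj => ?_⟩
  have := hφ j hj
  exact ⟨(hψ _ this.1).1, (hψ _ this.1).2.trans this.2⟩

theorem RowGe.trans {t q r : Row} (h : RowGe t q) (h' : RowGe q r) : RowGe t r :=
  RowEmb.trans h h'

theorem RowGe.refl (t : Row) : RowGe t t := ⟨id, Set.injOn_id _, fun _ hj => ⟨hj, le_rfl⟩⟩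

theorem RowGe.nil (q : Row) : RowGe [] q := ⟨id, Set.injOn_id _, fun _ hj => by simp at hj⟩

theorem RowGe.cons {a b : ℕ} {t q : Row} (hab : b ≤ a) (h : RowGe t q) :
    RowGe (a :: t) (b :: q) := by
  obtain ⟨φ, hi, hφ⟩ := h
  refine ⟨fun j => Nat.casesOn j 0 fun j => φ j + 1, ?_, ?_⟩
  · rintro (_ | j) hj (_ | k) hk he
    · rfl
    · simp at he
    · simp at he
    · simp only [Nat.add_right_cancel_iff] at he
      rw [hi (by simpa using hj) (by simpa using hk) he]
  · rintro (_ | j) hj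
    · simpa using hab
    · simpa using hφ j (by simpa using hj)

theorem exists_index_of_perm {α : Type*} (d : α) {l l' : List α} (h : l.Perm l') :
    ∃ φ : ℕ → ℕ, Set.InjOn φ {j | j < l.length} ∧
      ∀ j < l.length, φ j < l'.length ∧ l'.getD (φ j) d = l.getD j d := by
  induction h with
  | nil => exact ⟨id, Set.injOn_id _, by simp⟩
  | @cons a t q _ ih =>
    obtain ⟨φ, hi, hφ⟩ := ih
    refine ⟨fun j => Nat.casesOn j 0 fun j => φ j + 1, ?_, ?_⟩
    · rintro (_ | j) hj (_ | k) hk he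
      · rfl
      · simp at he
      · simp at he
      · simp only [Nat.add_right_cancel_iff] at he
        rw [hi (by simpa using hj) (by simpa using hk) he]
    · rintro (_ | j) hj
      · simp
      · simpa using hφ j (by simpa using hj)
  | @swap a b t =>
    refine ⟨fun j => Nat.casesOn j 1 fun j => Nat.casesOn j 0 fun j => j + 2, ?_, ?_⟩
    · rintro (_ | _ | j) hj (_ | _ | k) hk he <;> simp_all
    · rintro (_ | _ | j) hj <;> simp_all
  | trans _ _ ih₁ ih₂ =>
    obtain ⟨φ, hi, hφ⟩ := ih₁
    obtain ⟨ψ, hj, hψ⟩ := ih₂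
    refine ⟨ψ ∘ φ, hj.comp hi fun j hj => (hφ j hj).1, fun j hj => ?_⟩
    have := hφ j hj
    exact ⟨(hψ _ this.1).1, (hψ _ this.1).2.trans this.2⟩

theorem RowGe.of_perm {t q : Row} (h : t.Perm q) : RowGe t q := by
  obtain ⟨φ, hi, hφ⟩ := exists_index_of_perm 0 h
  exact ⟨φ, hi, fun j hj => ⟨(hφ j hj).1, (hφ j hj).2.le⟩⟩

theorem Win.of_rowEmb {s : List Row} (h : Win s) {U : Finset (ℕ × ℕ)} {f : ℕ × ℕ → ℕ} (π : ℕ → ℕ)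
    (hπ : ∀ u ∈ U, ∀ v ∈ U, π u.1 = π v.1 → u.1 = v.1)
    (hr : ∀ i, RowEmb {j | (i, j) ∈ U} (fun j => f (i, j)) (s.getD (π i) [])) :
    PainterWins Prod.fst U f := by
  choose φ hi hφ using hr
  refine PainterWins.of_embedding h (fun v => (π v.1, φ v.1 v.2)) ?_ ?_ hπ ?_
  · rintro ⟨i, j⟩ hv
    exact mem_cells.2 (hφ i j hv).1
  · rintro ⟨i, j⟩ hv ⟨k, l⟩ hw he
    simp only [Prod.mk.injEq] at he
    have := hπ _ hv _ hw he.1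
    simp only at this
    subst this
    rw [hi i hv hw he.2]
  · rintro ⟨i, j⟩ hv
    exact (hφ i j hv).2

/-- The position `ts` is at least as good for Painter as `qs`, by matching rows. -/
inductive Dom : List Row → List Row → Prop
  | nil (qs) : Dom [] qs
  | empty {ts qs} : Dom ts qs → Dom ([] :: ts) qs
  | cons {t q ts qs qs'} : RowGe t q → Dom ts qs → (q :: qs).Perm qs' → Dom (t :: ts) qs'

theorem Dom.exists_index {ts qs : List Row} (h : Dom ts qs) :
    ∃ π : ℕ → ℕ, Set.InjOn π {i | ts.getD i [] ≠ []} ∧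
      (∀ i, ts.getD i [] ≠ [] → π i < qs.length) ∧
      ∀ i, RowGe (ts.getD i []) (qs.getD (π i) []) := by
  induction h with
  | nil => exact ⟨id, by simp [Set.InjOn], by simp, fun i => by simpa using RowGe.nil _⟩
  | empty _ ih =>
    obtain ⟨π, hi, hl, hg⟩ := ih
    refine ⟨fun j => Nat.casesOn j 0 π, ?_, ?_, ?_⟩
    · rintro (_ | j) hj (_ | k) hk he
      · rfl
      · simp at hj
      · simp at hk
      · rw [hi (by simpa using hj) (by simpa using hk) he]
    · rintro (_ | j) hj
      · simp at hj
      · exact hl j (by simpa using hj)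
    · rintro (_ | j)
      · simpa using RowGe.nil _
      · simpa using hg j
  | @cons t q ts qs qs' h _ hp ih =>
    obtain ⟨π, hi, hl, hg⟩ := ih
    obtain ⟨σ, hs, hσ⟩ := exists_index_of_perm [] hp
    have key : ∀ i, ts.getD i [] ≠ [] → π i + 1 < (q :: qs).length := fun i h => by
      simpa using hl i h
    refine ⟨fun j => Nat.casesOn j (σ 0) fun j => if ts.getD j [] = [] then 0 else σ (π j + 1),
      ?_, ?_, ?_⟩
    · rintro (_ | j) hj (_ | k) hk he
      · rfl
      · simp only [Set.mem_ofPred_eq, List.getD_cons_succ] at hk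
        simp only [hk, if_false] at he
        simpa using hs (by simp) (key k hk) he
      · simp only [Set.mem_ofPred_eq, List.getD_cons_succ] at hj
        simp only [hj, if_false] at he
        simpa using hs (key j hj) (by simp) he
      · simp only [Set.mem_ofPred_eq, List.getD_cons_succ] at hj hk
        simp only [hj, hk, if_false] at he
        have := hs (key j hj) (key k hk) he
        rw [hi hj hk (by omega)]
    · rintro (_ | j) hj
      · exact (hσ 0 (by simp)).1
      · simp only [List.getD_cons_succ] at hj
        simpa only [hj, if_false] using (hσ _ (key j hj)).1
    · rintro (_ | j)
      · have := (hσ 0 (by simp)).2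
        simp only [List.getD_cons_zero] at this
        change RowGe t (qs'.getD (σ 0) [])
        rwa [this]
      · simp only [List.getD_cons_succ]
        by_cases hj : ts.getD j [] = []
        · rw [hj]; exact RowGe.nil _
        · simp only [hj, if_false, (hσ _ (key j hj)).2]
          simpa using hg j

theorem Dom.win {ts qs : List Row} (h : Dom ts qs) (hw : Win qs) : Win ts := by
  obtain ⟨π, hi, -, hg⟩ := h.exists_index
  have ne : ∀ v ∈ cells ts, ts.getD v.1 [] ≠ [] := fun v hv h0 => by
    rw [mem_cells, h0] at hv
    simp at hv
  refine hw.of_rowEmb π (fun u hu v hv he => hi (ne u hu) (ne v hv) he) fun i => ?_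
  exact RowEmb.mono (hg i) (fun j hj => mem_cells.1 hj) fun j _ => le_rfl

theorem Dom.of_forall₂ {ts qs : List Row} (h : List.Forall₂ RowGe ts qs) : Dom ts qs := by
  induction h with
  | nil => exact .nil _
  | cons h _ ih => exact .cons h ih (List.Perm.refl _)

theorem Dom.of_perm_append {ts qs l : List Row} (h : qs.Perm (ts ++ l)) : Dom ts qs := by
  induction ts generalizing qs with
  | nil => exact .nil _
  | cons t ts ih => exact .cons (RowGe.refl t) (ih (List.Perm.refl _)) h.symm

theorem Dom.of_perm {ts qs : List Row} (h : qs.Perm ts) : Dom ts qs :=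
  .of_perm_append (l := []) (by simpa using h)

theorem Dom.trans_perm {ts qs qs' : List Row} (h : Dom ts qs) (hp : qs.Perm qs') : Dom ts qs' := by
  induction h generalizing qs' with
  | nil => exact .nil _
  | empty _ ih => exact .empty (ih hp)
  | cons h h' hp' _ => exact .cons h h' (hp'.trans hp)

theorem Win.perm {ts qs : List Row} (h : ts.Perm qs) (hw : Win ts) : Win qs :=
  (Dom.of_perm h).win hw

/-! ### Moves of Lister, row by row -/

/-- The row `l` after the presentation of the entries selected by `p`, if they are not painted. -/
def decP : (ℕ → Bool) → Row → Row
  | _, [] => []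
  | p, a :: l => (a - if p 0 then 1 else 0) :: decP (fun j => p (j + 1)) l

/-- The row `l` without the entries selected by `p`. -/
def remP : (ℕ → Bool) → Row → Row
  | _, [] => []
  | p, a :: l => if p 0 then remP (fun j => p (j + 1)) l else a :: remP (fun j => p (j + 1)) l

theorem length_decP (p : ℕ → Bool) (l : Row) : (decP p l).length = l.length := by
  induction l generalizing p with
  | nil => rfl
  | cons a l ih => simp [decP, ih]

theorem getD_decP (p : ℕ → Bool) (l : Row) (j : ℕ) :
    (decP p l).getD j 0 = l.getD j 0 - if p j then 1 else 0 := by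
  induction l generalizing p j with
  | nil => simp [decP]
  | cons a l ih =>
    cases j with
    | zero => simp [decP]
    | succ j => simpa [decP] using ih (fun j => p (j + 1)) j

theorem rowEmb_remP (p : ℕ → Bool) (l : Row) :
    RowEmb {j | j < l.length ∧ p j = false} (l.getD · 0) (remP p l) := by
  induction l generalizing p with
  | nil => exact ⟨id, by simp [Set.InjOn], by simp⟩
  | cons a l ih =>
    obtain ⟨φ, hi, hφ⟩ := ih fun j => p (j + 1)
    by_cases hp : p 0 = true
    · refine ⟨fun j => φ (j - 1), ?_, ?_⟩
      · rintro (_ | j) hj (_ | k) hk he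
        · rfl
        · simp [hp] at hj
        · simp [hp] at hk
        · rw [hi (x₁ := j) (x₂ := k) (by simpa [hp] using hj) (by simpa using hk)
            (by simpa using he)]
      · rintro (_ | j) hj
        · simp [hp] at hj
        · simpa [remP, hp] using hφ j (by simpa using hj)
    · refine ⟨fun j => Nat.casesOn j 0 fun j => φ j + 1, ?_, ?_⟩
      · rintro (_ | j) hj (_ | k) hk he
        · rfl
        · simp at he
        · simp at he
        · simp only [Nat.add_right_cancel_iff] at he
          rw [hi (by simpa using hj) (by simpa using hk) he]
      · rintro (_ | j) hj
        · simp [remP, hp]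
        · simpa [remP, hp] using hφ j (by simpa using hj)

/-- The selection of the entries of row `i` that lie in `S`. -/
def sel (S : Finset (ℕ × ℕ)) (i : ℕ) (j : ℕ) : Bool := decide ((i, j) ∈ S)

/-- If Painter wins after painting the vertices of `S` in the row `i`, this answers `S`. -/
theorem Win.answer {L L' : List Row} {S : Finset (ℕ × ℕ)} (i : ℕ) (h : Win L')
    (hi : RowGe (remP (sel S i) (L.getD i [])) (L'.getD i []))
    (hk : ∀ k ≠ i, RowGe (decP (sel S k) (L.getD k [])) (L'.getD k [])) :
    PainterWins Prod.fst (cells L \ S.filter (·.1 = i))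
      (fun v => tok L v - if v ∈ S then 1 else 0) := by
  refine h.of_rowEmb id (fun _ _ _ _ h => h) fun k => ?_
  by_cases hki : k = i
  · subst hki
    refine ((rowEmb_remP _ _).trans hi).mono (fun j hj => ?_) fun j hj => ?_
    · simp only [Set.mem_ofPred_eq, Finset.mem_sdiff, mem_cells, Finset.mem_filter, and_true] at hj
      exact ⟨hj.1, by simp [sel, hj.2]⟩
    · simp only [Set.mem_ofPred_eq, Finset.mem_sdiff, Finset.mem_filter, and_true] at hj
      simp [hj.2, tok]
  · refine RowEmb.mono (hk k hki) (fun j hj => ?_) fun j hj => ?_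
    · simp only [Set.mem_ofPred_eq, Finset.mem_sdiff, mem_cells] at hj
      simpa [length_decP] using hj.1
    · rw [getD_decP]
      simp [sel, tok]

def insT (a : ℕ) (l : Row) : Row :=
  List.rec (motive := fun _ => Row) [a]
    (fun b l ih => bif Nat.ble a b then a :: b :: l else b :: ih) l

/-- The possible effects of a move on a sorted row: the row if the presented entries are not
painted, and if they are. -/
def splits (l : Row) : List (Row × Row) :=
  List.rec (motive := fun _ => List (Row × Row)) [([], [])]
    (fun a _ ih => (ih.map fun p => (insT (Nat.sub a (nat_lit 1)) p.1, p.2)) ++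
      (ih.map fun p => (insT a p.1, a :: p.2))) l

theorem insT_perm (a : ℕ) (l : Row) : (insT a l).Perm (a :: l) := by
  induction l with
  | nil => exact List.Perm.refl _
  | cons b l ih =>
    change (bif Nat.ble a b then a :: b :: l else b :: insT a l).Perm _
    cases Nat.ble a b
    · exact (ih.cons b).trans (List.Perm.swap a b l)
    · exact List.Perm.refl _

theorem splits_cons (a : ℕ) (l : Row) : splits (a :: l) =
    ((splits l).map fun p => (insT (a - 1) p.1, p.2)) ++
      ((splits l).map fun p => (insT a p.1, a :: p.2)) := rfl

theorem exists_mem_splits (p : ℕ → Bool) (l : Row) :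
    ∃ o ∈ splits l, o.1.Perm (decP p l) ∧ o.2 = remP p l := by
  induction l generalizing p with
  | nil => exact ⟨([], []), List.mem_singleton_self _, List.Perm.refl _, rfl⟩
  | cons a l ih =>
    obtain ⟨o, ho, h1, h2⟩ := ih fun j => p (j + 1)
    rw [splits_cons]
    by_cases hp : p 0 = true
    · refine ⟨_, List.mem_append_left _ (List.mem_map_of_mem ho), ?_, ?_⟩
      · simpa [decP, hp] using (insT_perm _ _).trans (h1.cons _)
      · simp [remP, hp, h2]
    · refine ⟨_, List.mem_append_right _ (List.mem_map_of_mem ho), ?_, ?_⟩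
      · simpa [decP, hp] using (insT_perm _ _).trans (h1.cons _)
      · simp [remP, hp, h2]

theorem exists_of_mem_splits {l : Row} {o : Row × Row} (ho : o ∈ splits l) :
    ∃ p, o.1.Perm (decP p l) ∧ o.2 = remP p l := by
  induction l generalizing o with
  | nil =>
    obtain rfl := List.mem_singleton.1 ho
    exact ⟨fun _ => false, List.Perm.refl _, rfl⟩
  | cons a l ih =>
    rw [splits_cons, List.mem_append, List.mem_map, List.mem_map] at ho
    rcases ho with ⟨o, ho, rfl⟩ | ⟨o, ho, rfl⟩ <;> obtain ⟨p, h1, h2⟩ := ih ho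
    · refine ⟨fun j => Nat.casesOn j true p, ?_, ?_⟩
      · simpa [decP] using (insT_perm _ _).trans (h1.cons _)
      · simp [remP, h2]
    · refine ⟨fun j => Nat.casesOn j false p, ?_, ?_⟩
      · simpa [decP] using (insT_perm _ _).trans (h1.cons _)
      · simp [remP, h2]

theorem length_remP_le (p : ℕ → Bool) (l : Row) : (remP p l).length ≤ l.length := by
  induction l generalizing p with
  | nil => simp [remP]
  | cons a l ih =>
    have := ih fun j => p (j + 1)
    by_cases h : p 0 = true <;> simp [remP, h] <;> omega

theorem length_remP_of_sel {p : ℕ → Bool} {l : Row} {j : ℕ} (hj : j < l.length) (hp : p j = true) :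
    (remP p l).length < (decP p l).length := by
  rw [length_decP]
  induction l generalizing p j with
  | nil => simp at hj
  | cons a l ih =>
    cases j with
    | zero =>
      have := length_remP_le (fun j => p (j + 1)) l
      simp [remP, hp]
      omega
    | succ j =>
      have := ih (p := fun j => p (j + 1)) (j := j) (by simpa using hj) hp
      by_cases h : p 0 = true <;> simp [remP, h] <;> omega

/-! ### The certificate checker -/

structure Opt where
  idx : ℕ
  dec : Row
  rem : Row
  hit : Bool

/-- Painter wins by painting the presented vertices of a suitable row. -/
def Resp (X : List Opt) : Prop :=
  ∃ xs o ys, X = xs ++ o :: ys ∧ Win (xs.map Opt.dec ++ o.rem :: ys.map Opt.dec)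

theorem Resp.perm {X Y : List Opt} (h : X.Perm Y) (hX : Resp X) : Resp Y := by
  obtain ⟨xs, o, ys, rfl, hw⟩ := hX
  obtain ⟨xs', ys', rfl⟩ :=
    List.append_of_mem (h.subset (List.mem_append_right xs (by simp : o ∈ o :: ys)))
  refine ⟨xs', o, ys', rfl, hw.perm ?_⟩
  have h1 : (xs ++ ys).Perm (xs' ++ ys') :=
    (List.perm_middle.symm.trans (h.trans List.perm_middle)).cons_inv
  refine List.perm_middle.trans (List.Perm.trans ?_ List.perm_middle.symm)
  have h2 := h1.map Opt.dec
  rw [List.map_append, List.map_append] at h2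
  exact h2.cons _

theorem Win.of_resp {L : List Row} (hpos : ∀ l ∈ L, ∀ a ∈ l, 1 ≤ a) (os : Row → List Opt)
    (hos : ∀ l ∈ L, ∀ o ∈ splits l, ∃ x ∈ os l, x.dec = o.1 ∧ x.rem = o.2 ∧
      (x.rem.length < x.dec.length → x.hit = true))
    (H : ∀ X, List.Forall₂ (fun l x => x ∈ os l) L X → 2 ≤ X.countP Opt.hit → Resp X) :
    Win L := by
  have hget : ∀ i, L.getD i [] ≠ [] → L.getD i [] ∈ L := by
    intro i hi
    rw [List.getD_eq_getElem?_getD] at hi ⊢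
    cases h : L[i]? with
    | none => simp [h] at hi
    | some l => simpa using List.mem_of_getElem? h
  refine PainterWins.of_forall_two (fun v hv => ?_) fun S hS hS2 => ?_
  · rw [mem_cells] at hv
    have hne : L.getD v.1 [] ≠ [] := fun h => by rw [h] at hv; simp at hv
    rw [tok, List.getD_eq_getElem _ _ hv]
    exact hpos _ (hget _ hne) _ (List.getElem_mem _)
  have hx : ∀ i < L.length, ∃ x ∈ os (L.getD i []), x.dec.Perm (decP (sel S i) (L.getD i [])) ∧
      x.rem = remP (sel S i) (L.getD i []) ∧ (x.rem.length < x.dec.length → x.hit = true) := by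
    intro i hi
    obtain ⟨o, ho, h1, h2⟩ := exists_mem_splits (sel S i) (L.getD i [])
    have hm : L.getD i [] ∈ L := by rw [List.getD_eq_getElem _ _ hi]; exact List.getElem_mem hi
    obtain ⟨x, hx, h3, h4, h5⟩ := hos _ hm o ho
    exact ⟨x, hx, h3 ▸ h1, h4.trans h2, h5⟩
  have : Inhabited Opt := ⟨⟨0, [], [], false⟩⟩
  choose! x hx1 hx2 hx3 hx4 using hx
  have hX : List.Forall₂ (fun l x => x ∈ os l) L ((List.range L.length).map x) := by
    rw [List.forall₂_iff_get]
    refine ⟨by simp, fun i hi hi' => ?_⟩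
    have := hx1 i hi
    rw [List.getD_eq_getElem _ _ hi] at this
    simpa using this
  have hhit : ∀ v ∈ S, v.1 < L.length ∧ (x v.1).hit = true := by
    intro v hv
    have hc := mem_cells.1 (hS hv)
    have hl : v.1 < L.length := by
      by_contra h
      rw [List.getD_eq_default _ _ (not_lt.1 h)] at hc
      simp at hc
    refine ⟨hl, hx4 _ hl ?_⟩
    rw [hx3 _ hl, (hx2 _ hl).length_eq]
    exact length_remP_of_sel hc (by simp [sel, hv])
  have hcount : 2 ≤ ((List.range L.length).map x).countP Opt.hit := by
    obtain ⟨u, hu, v, hv, huv⟩ := hS2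
    rw [List.countP_map, List.countP_eq_length_filter]
    have h1 : ({u.1, v.1} : Finset ℕ) ⊆ ((List.range L.length).filter (Opt.hit ∘ x)).toFinset := by
      intro i hi
      rw [List.mem_toFinset, List.mem_filter, List.mem_range]
      rcases Finset.mem_insert.1 hi with rfl | hi
      · exact hhit u hu
      · rw [Finset.mem_singleton.1 hi]; exact hhit v hv
    have h2 := (Finset.card_le_card h1).trans (List.toFinset_card_le _)
    rwa [Finset.card_pair huv] at h2
  obtain ⟨xs, o, ys, he, hw⟩ := H _ hX hcount
  have hlen := congrArg List.length he
  simp only [List.length_map, List.length_range, List.length_append, List.length_cons] at hlen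
  have hg : ∀ k < L.length, (xs ++ o :: ys)[k]? = some (x k) := by
    intro k hk
    rw [← he]
    simp [hk]
  have ho : x xs.length = o := by
    have := hg xs.length (by omega)
    simpa using this.symm
  refine ⟨S.filter (·.1 = xs.length), Finset.filter_subset _ _, ?_, hw.answer _ ?_ ?_⟩
  · intro u hu v hv
    rw [(Finset.mem_filter.1 hu).2, (Finset.mem_filter.1 hv).2]
  · have : (xs.map Opt.dec ++ o.rem :: ys.map Opt.dec).getD xs.length [] = o.rem := by
      rw [List.getD_eq_getElem?_getD, List.getElem?_append_right (by simp)]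
      simp
    rw [this, ← hx3 _ (by omega), ho]
    exact RowGe.refl _
  · intro k hk
    by_cases hkl : k < L.length
    · have : (xs.map Opt.dec ++ o.rem :: ys.map Opt.dec).getD k [] = (x k).dec := by
        have h1 := hg k hkl
        rw [List.getD_eq_getElem?_getD]
        rcases lt_or_gt_of_ne hk with h | h
        · rw [List.getElem?_append_left h] at h1
          rw [List.getElem?_append_left (by simpa using h)]
          simp [h1]
        · rw [List.getElem?_append_right h.le] at h1
          rw [List.getElem?_append_right (by simpa using h.le)]
          obtain ⟨d, hd⟩ := Nat.exists_eq_add_of_lt h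
          rw [show k - xs.length = d + 1 by omega] at h1
          rw [List.length_map, show k - xs.length = d + 1 by omega]
          simp only [List.getElem?_cons_succ] at h1 ⊢
          simp [h1]
      rw [this]
      exact RowGe.of_perm (hx2 k hkl).symm
    · rw [List.getD_eq_default _ _ (not_lt.1 hkl)]
      exact RowGe.nil _

structure RS where
  same : Bool
  os : List Opt
  pm : Row

/-- Binary tries of numbers, branching on the lowest binary digit first. -/
inductive Tbl where
  | leaf (n : ℕ)
  | node (l r : Tbl)

noncomputable section

/-- Force a natural number. -/
def fN (n : ℕ) (k : ℕ → Bool) : Bool :=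
  Nat.rec (motive := fun _ => Bool) (k 0) (fun m _ => k m) (Nat.add n (nat_lit 1))

def fRow (l : Row) : (Row → Bool) → Bool :=
  List.rec (motive := fun _ => (Row → Bool) → Bool) (fun k => k [])
    (fun a _ ih k => fN a fun a' => ih fun l' => k (a' :: l')) l

def Tbl.get (t : Tbl) : ℕ → ℕ :=
  Tbl.rec (motive := fun _ => ℕ → ℕ) (fun n _ => n)
    (fun _ _ ihl ihr i => bif Nat.beq (Nat.land i (nat_lit 1)) (nat_lit 0)
      then ihl (Nat.div i (nat_lit 2)) else ihr (Nat.div i (nat_lit 2))) t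

/-- The codes of the rows that occur in the table, twelve binary digits each. -/
def rowDict : ℕ := 0x888322221422541f61ff1441331222f22f32651642533661552542f42332f52433333f62f33f72f43752882872ff2742743863772652662432444442443f63ff3762883f73f44753873744773f83663f53553543653644763f55884f88555664855754544854764864874875f64755ff4554f84774f85f74f54ff5f75655654885f87f65666665887886f66765775766865ff8866f77776777ff7ff6f86f76877876111fff

/-- The position whose rows are numbered by the lowest `n` bytes of `e`. -/
def expand (n : ℕ) : ℕ → ℕ :=
  Nat.rec (motive := fun _ => ℕ → ℕ) (fun _ => nat_lit 0) (fun _ ih e =>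
    Nat.add (Nat.mod (Nat.shiftRight rowDict (Nat.mul (nat_lit 12) (Nat.mod e (nat_lit 256))))
      (nat_lit 4096)) (Nat.mul (nat_lit 4096) (ih (Nat.div e (nat_lit 256))))) n

def entry (t : Tbl) (i : ℕ) : ℕ :=
  expand (nat_lit 7) (Nat.mod
    (Nat.shiftRight (t.get (Nat.div i (nat_lit 32)))
      (Nat.mul (nat_lit 56) (Nat.mod i (nat_lit 32))))
    (nat_lit 72057594037927936))

def geC (t : Row) : ℕ → Bool :=
  List.rec (motive := fun _ => ℕ → Bool) (fun _ => true)
    (fun a _ ih c => bif Nat.ble (Nat.mod c (nat_lit 16)) a then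
      bif Nat.ble a (nat_lit 14) then ih (Nat.div c (nat_lit 16)) else false else false) t

def pick (t : Row) (cs : List ℕ) : (List ℕ → Bool) → Bool :=
  List.rec (motive := fun _ => (List ℕ → Bool) → Bool) (fun _ => false)
    (fun c cs ih k => bif geC t c then (bif k cs then true else ih fun cs' => k (c :: cs'))
      else ih fun cs' => k (c :: cs')) cs

def dom (ts : List Row) : List ℕ → Bool :=
  List.rec (motive := fun _ => List ℕ → Bool) (fun _ => true)
    (fun t _ ih cs => List.rec (motive := fun _ => Bool) (ih cs) (fun _ _ _ => pick t cs ih) t) ts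

/-- Row codes of a position, last row first. -/
def codes (n : ℕ) : ℕ → List ℕ → (List ℕ → Bool) → Bool :=
  Nat.rec (motive := fun _ => ℕ → List ℕ → (List ℕ → Bool) → Bool) (fun _ acc k => k acc)
    (fun _ ih q acc k => fN (Nat.add (Nat.mod q (nat_lit 4096)) (nat_lit 61440)) fun c =>
      bif Nat.beq c (nat_lit 65535) then k acc else
      fN (Nat.div q (nat_lit 4096)) fun q' => ih q' (c :: acc) k) n

def eqRow (l : Row) : Row → Bool :=
  List.rec (motive := fun _ => Row → Bool)
    (fun r => List.rec (motive := fun _ => Bool) true (fun _ _ _ => false) r)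
    (fun a _ ih r => List.rec (motive := fun _ => Bool) false
      (fun b r _ => bif Nat.beq a b then ih r else false) r) l

def memP (p : Row × Row) (l : List (Row × Row)) : Bool :=
  List.rec (motive := fun _ => Bool) false
    (fun q _ ih => bif eqRow p.1 q.1 then bif eqRow p.2 q.2 then true else ih else ih) l

def dedup (l : List (Row × Row)) : List (Row × Row) :=
  List.rec (motive := fun _ => List (Row × Row)) []
    (fun p _ ih => bif memP p ih then ih else p :: ih) l

def lenR (r : Row) : ℕ :=
  List.rec (motive := fun _ => ℕ) (nat_lit 0) (fun _ _ ih => Nat.add ih (nat_lit 1)) r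

/-- Forced list of options, numbered from `i`. -/
def fOpts (l : List (Row × Row)) : ℕ → (List Opt → Bool) → Bool :=
  List.rec (motive := fun _ => ℕ → (List Opt → Bool) → Bool) (fun _ k => k [])
    (fun p _ ih i k => fRow p.1 fun d => fRow p.2 fun r => fN i fun i' =>
      ih (Nat.add i' (nat_lit 1)) fun os =>
      bif Nat.blt (lenR r) (lenR d) then k (⟨i', d, r, true⟩ :: os)
      else k (⟨i', d, r, false⟩ :: os)) l

def zipMin (l : Row) : Row → Row :=
  List.rec (motive := fun _ => Row → Row) (fun _ => [])
    (fun a _ ih r => List.rec (motive := fun _ => Row) []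
      (fun b r _ => (bif Nat.ble a b then a else b) :: ih r) r) l

/-- Pointwise minimum of the decs. -/
def pmin (os : List Opt) : Row :=
  List.rec (motive := fun _ => Row) []
    (fun o t ih => List.rec (motive := fun _ => Row) o.dec (fun _ _ _ => zipMin o.dec ih) t) os

/-- Forced pmin. -/
def mkRS (s : Bool) (os : List Opt) (k : RS → Bool) : Bool :=
  fRow (pmin os) fun p => k ⟨s, os, p⟩

def dropIdx (lo : ℕ) (os : List Opt) : List Opt :=
  List.rec (motive := fun _ => List Opt) []
    (fun o t ih => bif Nat.ble lo o.idx then o :: t else ih) os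

/-- Propagate lower bound on the index from the previous row (with options `os`); `d` is the
result on a contradiction -/
def prop (d : Bool) (st : List RS) : List Opt → (List RS → Bool) → Bool :=
  List.rec (motive := fun _ => List Opt → (List RS → Bool) → Bool) (fun _ k => k [])
    (fun r rest ih os k => bif r.same then
        List.rec (motive := fun _ => Bool) (k (r :: rest)) (fun o _ _ =>
          List.rec (motive := fun _ => Bool) (k (r :: rest)) (fun p _ _ =>
            bif Nat.ble o.idx p.idx then k (r :: rest) else
            (fun os' => List.rec (motive := fun _ => Bool) d (fun _ _ _ =>
              mkRS true os' fun r' => ih os' fun rest' => k (r' :: rest')) os')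
              (dropIdx o.idx r.os)) r.os) os
      else k (r :: rest)) st

/-- Replace the options of row `i`. -/
def setO (d : Bool) (st : List RS) : ℕ → List Opt → (List RS → Bool) → Bool :=
  List.rec (motive := fun _ => ℕ → List Opt → (List RS → Bool) → Bool) (fun _ _ _ => false)
    (fun r rest ih i os k => Nat.rec (motive := fun _ => Bool)
      (mkRS r.same os fun r' => prop d rest os fun rest' => k (r' :: rest'))
      (fun j _ => ih j os fun rest' => k (r :: rest')) i) st

/-- The `x`-th option, and the other options. -/
def nthO (os : List Opt) : ℕ → (Opt → List Opt → Bool) → Bool :=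
  List.rec (motive := fun _ => ℕ → (Opt → List Opt → Bool) → Bool) (fun _ _ => false)
    (fun o t ih x k => Nat.rec (motive := fun _ => Bool) (k o t)
      (fun y _ => ih y fun p ts => k p (o :: ts)) x) os

/-- Options of row `i`, and pmins of the rows as a function of the `i`-th one -/
def rowAt (st : List RS) : ℕ → (List Opt → (Row → List Row) → Bool) → Bool :=
  List.rec (motive := fun _ => ℕ → (List Opt → (Row → List Row) → Bool) → Bool) (fun _ _ => false)
    (fun r rest ih i k => Nat.rec (motive := fun _ => Bool)
      (k r.os fun t => t :: rest.map RS.pm)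
      (fun j _ => ih j fun os f => k os fun t => r.pm :: f t) i) st

/-- Whether at least `n` rows can be hit. -/
def hits (st : List RS) : ℕ → Bool :=
  List.rec (motive := fun _ => ℕ → Bool) (fun n => Nat.ble n (nat_lit 0))
    (fun r _ ih n => Nat.rec (motive := fun _ => Bool) true
      (fun m _ => List.rec (motive := fun _ => Bool) (ih (Nat.succ m))
        (fun o _ _ => bif o.hit then ih m else ih (Nat.succ m)) r.os) n) st

def totR (r : List Row) : ℕ :=
  List.rec (motive := fun _ => ℕ) (nat_lit 0) (fun a _ ih => Nat.add ih (lenR a)) r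

def dropBig (b : ℕ) (r : Row) : Row :=
  List.rec (motive := fun _ => Row) [] (fun a _ ih => bif Nat.ble a b then a :: ih else ih) r
def sweep (ts : List Row) : List Row :=
  (fun n => ts.map fun r => dropBig (Nat.sub n (lenR r)) r) (totR ts)
def norm (n : ℕ) (ts : List Row) : List Row :=
  Nat.rec (motive := fun _ => List Row) ts (fun _ ih => sweep ih) n

def leafOk (T : Tbl) (m ref flag : ℕ) (ts : List Row) : Bool :=
  bif Nat.blt ref m then
    codes (nat_lit 7) (entry T ref) [] fun cs =>
      bif Nat.beq flag (nat_lit 0) then dom ts cs else dom (norm (nat_lit 12) ts) cs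
  else false

/-- A step of a certificate: split off option `x` of row `i`; if `leaf` holds then answer it by
painting in row `i`, reaching a position that dominates the entry `ref`. -/
structure Cmd where
  leaf : Bool
  i : ℕ
  x : ℕ
  flag : ℕ
  ref : ℕ

/-- Read the reference of a leaf from `w`; the number `rs` packs the four most recent ones. -/
def readRef (w rs : ℕ) (k : ℕ → ℕ → ℕ → Bool) : Bool :=
  (fun (f : ℕ → ℕ → ℕ → Bool) => bif Nat.ble (nat_lit 4) (Nat.mod w (nat_lit 16)) then
      f (nat_lit 3) (Nat.add (Nat.mul (Nat.mod (Nat.div w (nat_lit 16)) (nat_lit 256)) (nat_lit 12))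
        (Nat.sub (Nat.mod w (nat_lit 16)) (nat_lit 4))) (Nat.div w (nat_lit 4096))
    else f (Nat.mod w (nat_lit 16))
      (Nat.mod (Nat.shiftRight rs (Nat.mul (nat_lit 12) (Nat.mod w (nat_lit 16)))) (nat_lit 4096))
      (Nat.div w (nat_lit 16)))
  fun c ref w => fN ref fun ref => fN w fun w =>
    fN (Nat.add ref (Nat.mul (nat_lit 4096)
      (Nat.add (Nat.mod rs (Nat.pow (nat_lit 2) (Nat.mul (nat_lit 12) c)))
        (Nat.shiftLeft (Nat.shiftRight rs (Nat.mul (nat_lit 12) (Nat.add c (nat_lit 1))))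
          (Nat.mul (nat_lit 12) c))))) fun rs => k ref w rs

/-- Read a command from `w`. -/
def readCmd (w rs : ℕ) (k : Cmd → ℕ → ℕ → Bool) : Bool :=
  (fun (f : ℕ → ℕ → ℕ → ℕ → Bool) =>
    bif Nat.beq (Nat.mod w (nat_lit 8)) (nat_lit 7) then
      fN (Nat.mod (Nat.div w (nat_lit 16)) (nat_lit 8)) fun i =>
      fN (Nat.mod (Nat.div w (nat_lit 128)) (nat_lit 8)) fun x =>
      fN (Nat.mod (Nat.div w (nat_lit 1024)) (nat_lit 4)) fun g =>
      fN (Nat.div w (nat_lit 4096)) fun w' =>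
      f i x g w'
    else fN (Nat.mod w (nat_lit 8)) fun i => fN (Nat.div w (nat_lit 16)) fun w' =>
      f i (nat_lit 0) (nat_lit 0) w')
  fun i x g w' => bif Nat.testBit w (nat_lit 3) then k ⟨false, i, x, g, nat_lit 0⟩ w' rs
    else readRef w' rs fun ref w' rs => k ⟨true, i, x, g, ref⟩ w' rs

def go (T : Tbl) (m : ℕ) (fuel : ℕ) : ℕ → ℕ → List (List RS) → Bool :=
  Nat.rec (motive := fun _ => ℕ → ℕ → List (List RS) → Bool) (fun _ _ _ => false)
    (fun _ ih w rs stack => List.rec (motive := fun _ => Bool) true (fun st rest _ =>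
      bif hits st (nat_lit 2) then readCmd w rs fun c w rs =>
        rowAt st c.i fun os f => nthO os c.x fun o os' =>
        bif c.leaf then
          bif leafOk T m c.ref c.flag (f o.rem) then
            List.rec (motive := fun _ => Bool) (ih w rs rest)
              (fun _ _ _ => setO (ih w rs rest) st c.i os' fun st' => ih w rs (st' :: rest)) os'
          else false
        else
          List.rec (motive := fun _ => Bool) (ih w rs (st :: rest)) (fun _ _ _ =>
            (fun k => setO (k rest) st c.i os' fun st' => k (st' :: rest))
              fun rest' => setO (ih w rs rest') st c.i [o] fun st' => ih w rs (st' :: rest')) os'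
      else ih w rs rest) stack) fuel

/-- Tokens of a row code. -/
def toks (n : ℕ) : ℕ → Row :=
  Nat.rec (motive := fun _ => ℕ → Row) (fun _ => [])
    (fun _ ih c => bif Nat.ble (Nat.mod c (nat_lit 16)) (nat_lit 14) then
      Nat.mod c (nat_lit 16) :: ih (Nat.div c (nat_lit 16)) else []) n

def rowsOf (n : ℕ) : ℕ → List Row :=
  Nat.rec (motive := fun _ => ℕ → List Row) (fun _ => [])
    (fun _ ih q => toks (nat_lit 3) q :: ih (Nat.div q (nat_lit 4096))) n

/-- All tokens are positive. -/
def posR (r : Row) : Bool :=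
  List.rec (motive := fun _ => Bool) true
    (fun a _ ih => bif Nat.ble (nat_lit 1) a then ih else false) r

/-- Initial state. -/
def start (ss : List Row) : Row → (List RS → Bool) → Bool :=
  List.rec (motive := fun _ => Row → (List RS → Bool) → Bool) (fun _ k => k [])
    (fun s _ ih p k => List.rec (motive := fun _ => Bool) (ih p k) (fun _ _ _ =>
      bif posR s then fRow s fun s' => fOpts (dedup (splits s')) (nat_lit 0) fun os =>
      mkRS (eqRow p s') os fun r => ih s' fun st => k (r :: st)
      else false) s) ss

def chkM (T : Tbl) (m w : ℕ) : Bool :=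
  start (rowsOf (nat_lit 7) (entry T m)) [] fun st => go T m (nat_lit 20000) w (nat_lit 0) [st]

def chkMs (T : Tbl) (ws : List ℕ) : ℕ → Bool :=
  List.rec (motive := fun _ => ℕ → Bool) (fun _ => true)
    (fun w _ ih m => bif chkM T m w then ih (Nat.add m (nat_lit 1)) else false) ws
end

theorem fN_eq (n : ℕ) (k : ℕ → Bool) : fN n k = k n := rfl

theorem fRow_eq (l : Row) (k : Row → Bool) : fRow l k = k l := by
  induction l generalizing k with
  | nil => rfl
  | cons a l ih => exact ih fun xs => k (a :: xs)

/-- `AllWin T m`: Painter wins the first `m` positions of the table `T`. -/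
def AllWin (T : Tbl) (m : ℕ) : Prop := ∀ i < m, Win (rowsOf 7 (entry T i))

theorem and_of_cond {a b : Bool} (h : (bif a then b else false) = true) : a = true ∧ b = true := by
  cases a <;> simp_all

theorem toks_zero (c : ℕ) : toks 0 c = [] := rfl

theorem toks_succ (n c : ℕ) : toks (n + 1) c =
    bif Nat.ble (c % 16) 14 then c % 16 :: toks n (c / 16) else [] := rfl

theorem geC_cons (a : ℕ) (t : Row) (c : ℕ) : geC (a :: t) c =
    bif Nat.ble (c % 16) a then bif Nat.ble a 14 then geC t (c / 16) else false else false := rfl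

theorem rowGe_of_geC (n : ℕ) {t : Row} {c : ℕ} (h : geC t c = true)
    (hc : c / 16 ^ n % 16 = 15) : RowGe t (toks n c) := by
  induction n generalizing t c with
  | zero =>
    cases t with
    | nil => exact RowGe.nil _
    | cons a t =>
      rw [geC_cons] at h
      obtain ⟨h1, h2⟩ := and_of_cond h
      obtain ⟨h2, -⟩ := and_of_cond h2
      have h1 := Nat.le_of_ble_eq_true h1
      have h2 := Nat.le_of_ble_eq_true h2
      rw [pow_zero, Nat.div_one] at hc
      omega
  | succ n ih =>
    cases t with
    | nil => exact RowGe.nil _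
    | cons a t =>
      rw [geC_cons] at h
      obtain ⟨h1, h2⟩ := and_of_cond h
      obtain ⟨h2, h3⟩ := and_of_cond h2
      have h1 := Nat.le_of_ble_eq_true h1
      have h2 := Nat.le_of_ble_eq_true h2
      rw [toks_succ, Nat.ble_eq_true_of_le (h1.trans h2)]
      refine RowGe.cons h1 (ih h3 ?_)
      rwa [Nat.div_div_eq_div_mul, ← pow_succ']

theorem exists_of_codes (n : ℕ) {q : ℕ} {acc : List ℕ} {k : List ℕ → Bool}
    (h : codes n q acc k = true) (hacc : ∀ c ∈ acc, c / 16 ^ 3 % 16 = 15) :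
    ∃ cs, k cs = true ∧ (∀ c ∈ cs, c / 16 ^ 3 % 16 = 15) ∧
      Dom (cs.map (toks 3)) (rowsOf n q ++ acc.map (toks 3)) := by
  induction n generalizing q acc with
  | zero => exact ⟨acc, h, hacc, Dom.of_perm (List.Perm.refl _)⟩
  | succ n ih =>
    change (bif Nat.beq (q % 4096 + 61440) 65535 then k acc else
      codes n (q / 4096) ((q % 4096 + 61440) :: acc) k) = true at h
    have htoks : toks 3 (q % 4096 + 61440) = toks 3 q := by
      simp only [toks_succ, toks_zero]
      rw [show (q % 4096 + 61440) % 16 = q % 16 by omega,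
        show (q % 4096 + 61440) / 16 % 16 = q / 16 % 16 by omega,
        show (q % 4096 + 61440) / 16 / 16 % 16 = q / 16 / 16 % 16 by omega]
    cases hb : Nat.beq (q % 4096 + 61440) 65535 with
    | true =>
      rw [hb] at h
      exact ⟨acc, h, hacc, Dom.of_perm_append List.perm_append_comm⟩
    | false =>
      rw [hb] at h
      obtain ⟨cs, h1, h2, h3⟩ := ih h (by
        intro c hc
        rcases List.mem_cons.1 hc with rfl | hc
        · omega
        · exact hacc c hc)
      refine ⟨cs, h1, h2, h3.trans_perm ?_⟩
      rw [List.map_cons, htoks]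
      exact List.perm_middle

theorem exists_of_pick {t : Row} {cs : List ℕ} {k : List ℕ → Bool} (h : pick t cs k = true) :
    ∃ c cs', geC t c = true ∧ k cs' = true ∧ (c :: cs').Perm cs := by
  induction cs generalizing k with
  | nil => exact absurd h Bool.false_ne_true
  | cons c cs ih =>
    change (bif geC t c then (bif k cs then true else pick t cs fun cs' => k (c :: cs'))
      else pick t cs fun cs' => k (c :: cs')) = true at h
    have key : pick t cs (fun cs' => k (c :: cs')) = true →
        ∃ c' cs', geC t c' = true ∧ k cs' = true ∧ (c' :: cs').Perm (c :: cs) := by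
      intro h
      obtain ⟨c', cs', h1, h2, h3⟩ := ih h
      exact ⟨c', c :: cs', h1, h2, (List.Perm.swap _ _ _).trans (h3.cons c)⟩
    cases hg : geC t c with
    | false => rw [hg] at h; exact key h
    | true =>
      rw [hg] at h
      cases hk : k cs with
      | true => exact ⟨c, cs, hg, hk, List.Perm.refl _⟩
      | false => rw [hk] at h; exact key h

theorem dom_sound {ts : List Row} {cs : List ℕ} (h : dom ts cs = true)
    (hcs : ∀ c ∈ cs, c / 16 ^ 3 % 16 = 15) : Dom ts (cs.map (toks 3)) := by
  induction ts generalizing cs with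
  | nil => exact .nil _
  | cons t ts ih =>
    cases t with
    | nil => exact .empty (ih h hcs)
    | cons a t =>
      obtain ⟨c, cs', h1, h2, h3⟩ := exists_of_pick (k := dom ts) h
      have hc := hcs c (h3.subset (by simp))
      refine .cons (rowGe_of_geC 3 h1 hc) (ih h2 fun c' hc' => hcs c' (h3.subset (by simp [hc'])))
        ?_
      exact h3.map (toks 3)

theorem lenR_eq (l : Row) : lenR l = l.length := by
  induction l with
  | nil => rfl
  | cons a l ih => exact congrArg (· + 1) ih

theorem totR_eq (ts : List Row) : totR ts = (ts.map List.length).sum := by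
  induction ts with
  | nil => rfl
  | cons t ts ih =>
    change totR ts + lenR t = _
    rw [ih, lenR_eq, List.map_cons, List.sum_cons, add_comm]

theorem card_cells (ts : List Row) : (cells ts).card = totR ts := by
  rw [cells, Finset.card_biUnion, totR_eq]
  · have h : ∀ i, ((Finset.range (ts.getD i []).length).image (Prod.mk i)).card =
        (ts.getD i []).length := fun i => by
      rw [Finset.card_image_of_injective _ (Prod.mk_right_injective i), Finset.card_range]
    simp only [h]
    rw [← Fin.sum_univ_eq_sum_range (fun i => (ts.getD i []).length), ← Fin.sum_univ_getElem]
    refine Fintype.sum_equiv (finCongr (by simp)) _ _ fun i => ?_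
    simp
  · intro i _ j _ hij
    rw [Function.onFun, Finset.disjoint_left]
    intro v hv hw
    obtain ⟨a, _, rfl⟩ := Finset.mem_image.1 hv
    obtain ⟨b, _, hb⟩ := Finset.mem_image.1 hw
    exact hij (Prod.mk.inj hb).1.symm

theorem card_filter_cells (ts : List Row) (i : ℕ) :
    ((cells ts).filter (Prod.fst · ≠ i)).card = totR ts - (ts.getD i []).length := by
  have h : ((cells ts).filter (Prod.fst · = i)).card = (ts.getD i []).length := by
    suffices h : (cells ts).filter (Prod.fst · = i) =
        (Finset.range (ts.getD i []).length).image (Prod.mk i) by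
      rw [h, Finset.card_image_of_injective _ (Prod.mk_right_injective i), Finset.card_range]
    refine Finset.ext ?_
    rintro ⟨k, j⟩
    simp only [Finset.mem_filter, mem_cells, Finset.mem_image, Finset.mem_range, Prod.mk.injEq]
    constructor
    · rintro ⟨h, rfl⟩; exact ⟨j, h, rfl, rfl⟩
    · rintro ⟨j, h, rfl, rfl⟩; exact ⟨h, rfl⟩
  have := Finset.card_filter_add_card_filter_not (s := cells ts) (Prod.fst · = i)
  rw [h, card_cells] at this
  simp only [ne_eq]
  omega

theorem dropBig_eq (b : ℕ) (l : Row) :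
    dropBig b l = remP (fun j => decide (b < l.getD j 0)) l := by
  induction l with
  | nil => rfl
  | cons a l ih =>
    change (bif Nat.ble a b then a :: dropBig b l else dropBig b l) = _
    rw [ih, remP]
    by_cases h : a ≤ b
    · simp [h]
    · have : Nat.ble a b = false := by
        rw [← Bool.not_eq_true]; exact fun h' => h (Nat.le_of_ble_eq_true h')
      simp [this, not_le.1 h]

theorem Win.of_sweep {ts : List Row} (h : Win (sweep ts)) : Win ts := by
  let g := fun r => dropBig (totR ts - lenR r) r
  have hs : ∀ i, (sweep ts).getD i [] = g (ts.getD i []) := by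
    intro i
    change (ts.map g).getD i [] = _
    rw [List.getD_eq_getElem?_getD, List.getD_eq_getElem?_getD, List.getElem?_map]
    cases ts[i]? <;> rfl
  refine PainterWins.of_sdiff
    (W := (cells ts).filter fun v => totR ts - (ts.getD v.1 []).length < tok ts v) ?_ ?_
  · refine h.of_rowEmb id (fun _ _ _ _ h => h) fun i => ?_
    rw [id, hs]
    change RowEmb _ _ (dropBig _ _)
    rw [dropBig_eq]
    refine (rowEmb_remP _ _).mono (fun j hj => ?_) fun j _ => le_rfl
    simp only [Set.mem_ofPred_eq, Finset.mem_sdiff, Finset.mem_filter, not_and] at hj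
    refine ⟨mem_cells.1 hj.1, ?_⟩
    have := hj.2 hj.1
    rw [lenR_eq]
    simpa [tok] using this
  · intro v hv hvW
    rw [card_filter_cells]
    exact (Finset.mem_filter.1 hvW).2

theorem Win.of_norm {n : ℕ} {ts : List Row} (h : Win (norm n ts)) : Win ts := by
  induction n with
  | zero => exact h
  | succ n ih => exact ih (Win.of_sweep h)

theorem leafOk_sound {T : Tbl} {m ref flag : ℕ} {ts : List Row} (hT : AllWin T m)
    (h : leafOk T m ref flag ts = true) : Win ts := by
  obtain ⟨h1, h2⟩ := and_of_cond h
  have hw := hT ref (Nat.le_of_ble_eq_true h1)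
  obtain ⟨cs, h3, h4, h5⟩ := exists_of_codes 7 h2 (by simp)
  rw [List.map_nil, List.append_nil] at h5
  have hw := h5.win hw
  cases hf : Nat.beq flag 0 with
  | true =>
    rw [show (nat_lit 0) = 0 from rfl, hf] at h3
    exact (dom_sound h3 h4).win hw
  | false =>
    rw [show (nat_lit 0) = 0 from rfl, hf] at h3
    exact Win.of_norm ((dom_sound h3 h4).win hw)

/-- Options sorted by index, with the trivial ones last. -/
def WellSorted (os : List Opt) : Prop :=
  os.Pairwise (fun x y => x.idx ≤ y.idx ∧ (y.hit = true → x.hit = true)) ∧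
    ∃ n, ∀ x ∈ os, x.dec.length = n

theorem WellSorted.sublist {os os' : List Opt} (h : WellSorted os) (hs : os'.Sublist os) :
    WellSorted os' :=
  ⟨h.1.sublist hs, h.2.imp fun _ hn x hx => hn x (hs.subset hx)⟩

def RS.Valid (r : RS) : Prop :=
  WellSorted r.os ∧ ∀ x ∈ r.os, List.Forall₂ (· ≤ ·) r.pm x.dec

theorem zipMin_le (a b : Row) (h : a.length = b.length) :
    List.Forall₂ (· ≤ ·) (zipMin a b) a ∧ List.Forall₂ (· ≤ ·) (zipMin a b) b := by
  induction a generalizing b with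
  | nil =>
    cases b with
    | nil => exact ⟨.nil, .nil⟩
    | cons b bs => simp at h
  | cons a as ih =>
    cases b with
    | nil => simp at h
    | cons b bs =>
      obtain ⟨h1, h2⟩ := ih bs (by simpa using h)
      have hmin : (bif Nat.ble a b then a else b) ≤ a ∧ (bif Nat.ble a b then a else b) ≤ b := by
        cases hb : Nat.ble a b with
        | true => exact ⟨le_rfl, Nat.le_of_ble_eq_true hb⟩
        | false =>
          refine ⟨le_of_not_ge fun h => ?_, le_rfl⟩
          rw [Nat.ble_eq_true_of_le (m := b) h] at hb
          exact Bool.false_ne_true hb.symm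
      exact ⟨.cons hmin.1 h1, .cons hmin.2 h2⟩

theorem forall₂_le_trans {a b c : Row} (h : List.Forall₂ (· ≤ ·) a b)
    (h' : List.Forall₂ (· ≤ ·) b c) : List.Forall₂ (· ≤ ·) a c := by
  induction h generalizing c with
  | nil => exact h'
  | cons h _ ih =>
    cases h' with
    | cons h1 h2 => exact .cons (le_trans h h1) (ih h2)

theorem pmin_le {os : List Opt} (h : ∃ n, ∀ x ∈ os, x.dec.length = n) :
    ∀ x ∈ os, List.Forall₂ (· ≤ ·) (pmin os) x.dec := by
  induction os with
  | nil => simp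
  | cons o os ih =>
    cases os with
    | nil =>
      intro x hx
      rw [List.mem_singleton.1 hx]
      exact List.forall₂_refl _
    | cons p os =>
      obtain ⟨n, hn⟩ := h
      have ih := ih ⟨n, fun x hx => hn x (List.mem_cons_of_mem _ hx)⟩
      have hl : o.dec.length = (pmin (p :: os)).length := by
        rw [(ih p (by simp)).length_eq, hn o (by simp), hn p (by simp)]
      obtain ⟨h1, h2⟩ := zipMin_le _ _ hl
      intro x hx
      rcases List.mem_cons.1 hx with rfl | hx
      · exact h1
      · exact forall₂_le_trans h2 (ih x hx)

theorem mkRS_eq (s : Bool) (os : List Opt) (k : RS → Bool) : mkRS s os k = k ⟨s, os, pmin os⟩ :=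
  fRow_eq _ _

theorem WellSorted.valid {os : List Opt} (h : WellSorted os) (s : Bool) :
    RS.Valid ⟨s, os, pmin os⟩ :=
  ⟨h, pmin_le h.2⟩

/-- The choices of options in a state; in a row equal to the previous one, the index of the option
is at least that of the previous one (`lo` for the first row). -/
inductive Box : ℕ → List RS → List Opt → Prop
  | nil (lo) : Box lo [] []
  | cons {lo r st x X} : x ∈ r.os → (r.same = true → lo ≤ x.idx) → Box x.idx st X →
      Box lo (r :: st) (x :: X)

def Good (st : List RS) : Prop := ∀ X, Box 0 st X → 2 ≤ X.countP Opt.hit → Resp X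

theorem dropIdx_sublist (lo : ℕ) (os : List Opt) : (dropIdx lo os).Sublist os := by
  induction os with
  | nil => exact List.Sublist.refl _
  | cons o os ih =>
    change (bif Nat.ble lo o.idx then o :: os else dropIdx lo os).Sublist _
    cases Nat.ble lo o.idx
    · exact ih.cons _
    · exact List.Sublist.refl _

theorem mem_dropIdx {lo : ℕ} {os : List Opt} {x : Opt} (hx : x ∈ os) (h : lo ≤ x.idx) :
    x ∈ dropIdx lo os := by
  induction os with
  | nil => simp at hx
  | cons o os ih =>
    change x ∈ (bif Nat.ble lo o.idx then o :: os else dropIdx lo os)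
    cases hb : Nat.ble lo o.idx
    · rcases List.mem_cons.1 hx with rfl | hx
      · rw [Nat.ble_eq_true_of_le h] at hb
        exact absurd hb.symm Bool.false_ne_true
      · exact ih hx
    · exact hx

theorem prop_sound {d : Bool} {st : List RS} {os : List Opt} {k : List RS → Bool}
    (h : prop d st os k = true) (hos : WellSorted os) (hst : ∀ r ∈ st, r.Valid) :
    (d = true ∧ ∀ x ∈ os, ∀ X, ¬ Box x.idx st X) ∨
      ∃ st', (∀ r ∈ st', r.Valid) ∧ k st' = true ∧
        ∀ x ∈ os, ∀ X, Box x.idx st X → Box x.idx st' X := by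
  induction st generalizing os k with
  | nil => exact .inr ⟨[], hst, h, fun _ _ _ h => h⟩
  | cons r rest ih =>
    have triv : k (r :: rest) = true → (d = true ∧ ∀ x ∈ os, ∀ X, ¬ Box x.idx (r :: rest) X) ∨
        ∃ st', (∀ r ∈ st', r.Valid) ∧ k st' = true ∧
          ∀ x ∈ os, ∀ X, Box x.idx (r :: rest) X → Box x.idx st' X :=
      fun h => .inr ⟨r :: rest, hst, h, fun _ _ _ h => h⟩
    change (bif r.same then _ else k (r :: rest)) = true at h
    cases hs : r.same with
    | false => rw [hs] at h; exact triv h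
    | true =>
      rw [hs] at h
      cases os with
      | nil => exact triv h
      | cons o os =>
        change List.rec (motive := fun _ => Bool) _ _ r.os = true at h
        cases hr : r.os with
        | nil => rw [hr] at h; exact triv h
        | cons p ps =>
          rw [hr] at h
          change (bif Nat.ble o.idx p.idx then k (r :: rest) else _) = true at h
          cases hb : Nat.ble o.idx p.idx with
          | true => rw [hb] at h; exact triv h
          | false =>
            rw [hb, ← hr] at h
            change (List.rec (motive := fun _ => Bool) d (fun _ _ _ =>
              mkRS true (dropIdx o.idx r.os) fun r' => prop d rest (dropIdx o.idx r.os)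
                fun rest' => k (r' :: rest')) (dropIdx o.idx r.os)) = true at h
            have hmem : ∀ x ∈ o :: os, ∀ y ∈ r.os, x.idx ≤ y.idx → y ∈ dropIdx o.idx r.os := by
              intro x hx y hy hxy
              refine mem_dropIdx hy ?_
              rcases List.mem_cons.1 hx with rfl | hx
              · exact hxy
              · exact ((List.pairwise_cons.1 hos.1).1 x hx).1.trans hxy
            have hsort : WellSorted (dropIdx o.idx r.os) :=
              (hst r (by simp)).1.sublist (dropIdx_sublist _ _)
            cases hd : dropIdx o.idx r.os with
            | nil =>
              rw [hd] at h hmem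
              refine .inl ⟨h, fun x hx X hX => ?_⟩
              cases hX with
              | cons hy hlo _ => exact absurd (hmem x hx _ hy (hlo hs)) (by simp)
            | cons q qs =>
              rw [hd] at h
              change mkRS true (q :: qs) _ = true at h
              rw [← hd, mkRS_eq] at h
              rcases ih h hsort fun r hr => hst r (List.mem_cons_of_mem _ hr) with
                ⟨h1, h2⟩ | ⟨st', h1, h2, h3⟩
              · refine .inl ⟨h1, fun x hx X hX => ?_⟩
                cases hX with
                | cons hy hlo hX => exact h2 _ (hmem x hx _ hy (hlo hs)) _ hX
              · refine .inr ⟨_ :: st', ?_, h2, fun x hx X hX => ?_⟩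
                · rintro r' hr'
                  rcases List.mem_cons.1 hr' with rfl | hr'
                  · exact hsort.valid true
                  · exact h1 r' hr'
                · cases hX with
                  | cons hy hlo hX =>
                    have hy' := hmem x hx _ hy (hlo hs)
                    exact .cons hy' (fun _ => hlo hs) (h3 _ hy' _ hX)

theorem setO_append (d : Bool) (st : List RS) (r : RS) (st' : List RS) (os : List Opt)
    (k : List RS → Bool) : setO d (st ++ r :: st') st.length os k =
      prop d st' os fun rest => k (st ++ ⟨r.same, os, pmin os⟩ :: rest) := by
  induction st generalizing k with
  | nil => exact mkRS_eq r.same os fun r' => prop d st' os fun rest' => k (r' :: rest')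
  | cons s st ih => exact ih fun rest' => k (s :: rest')

theorem Box.exists_split {lo : ℕ} {st st' : List RS} {r : RS} {X : List Opt}
    (h : Box lo (st ++ r :: st') X) : ∃ xs x ys, X = xs ++ x :: ys ∧ xs.length = st.length ∧
      x ∈ r.os ∧ List.Forall₂ (fun r x => x ∈ RS.os r) st xs ∧
      List.Forall₂ (fun r x => x ∈ RS.os r) st' ys ∧ Box x.idx st' ys ∧
      ∀ r' st'', x ∈ r'.os → r'.same = r.same → Box x.idx st'' ys →
        Box lo (st ++ r' :: st'') X := by
  have all : ∀ {lo st X}, Box lo st X → List.Forall₂ (fun r x => x ∈ RS.os r) st X := by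
    intro lo st X h
    induction h with
    | nil => exact .nil
    | cons hx _ _ ih => exact .cons hx ih
  induction st generalizing lo X with
  | nil =>
    cases h with
    | @cons _ _ _ x X hx hlo hX =>
      exact ⟨[], x, X, rfl, rfl, hx, .nil, all hX, hX, fun r' st'' h1 h2 h3 =>
        .cons h1 (fun h => hlo (h2 ▸ h)) h3⟩
  | cons s st ih =>
    cases h with
    | @cons _ _ _ x X hx hlo hX =>
      obtain ⟨xs, y, ys, rfl, h1, h2, h3, h4, h5, h6⟩ := ih hX
      exact ⟨x :: xs, y, ys, rfl, by simp [h1], h2, .cons hx h3, h4, h5, fun r' st'' h7 h8 h9 =>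
        .cons hx hlo (h6 r' st'' h7 h8 h9)⟩

theorem setO_sound {d : Bool} {st st' : List RS} {r : RS} {os : List Opt} {k : List RS → Bool}
    (h : setO d (st ++ r :: st') st.length os k = true) (hos : os.Sublist r.os)
    (hst : ∀ s ∈ st ++ r :: st', s.Valid) :
    (d = true ∧ ∀ xs, ∀ x ∈ os, ∀ ys, xs.length = st.length →
      ¬ Box 0 (st ++ r :: st') (xs ++ x :: ys)) ∨
    ∃ s, (∀ r ∈ s, r.Valid) ∧ k s = true ∧ ∀ xs, ∀ x ∈ os, ∀ ys, xs.length = st.length →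
      Box 0 (st ++ r :: st') (xs ++ x :: ys) → Box 0 s (xs ++ x :: ys) := by
  have hsort : WellSorted os := (hst r (by simp)).1.sublist hos
  have split : ∀ xs x ys, xs.length = st.length → Box 0 (st ++ r :: st') (xs ++ x :: ys) →
      Box x.idx st' ys ∧ ∀ r' st'', x ∈ r'.os → r'.same = r.same → Box x.idx st'' ys →
        Box 0 (st ++ r' :: st'') (xs ++ x :: ys) := by
    intro xs x ys hl hB
    obtain ⟨xs', x', ys', he, hl', -, -, -, h5, h6⟩ := hB.exists_split
    obtain ⟨rfl, he'⟩ := List.append_inj he (hl.trans hl'.symm)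
    obtain ⟨rfl, rfl⟩ := List.cons.inj he'
    exact ⟨h5, h6⟩
  rw [setO_append] at h
  rcases prop_sound h hsort fun r hr => hst r (by simp [hr]) with ⟨h1, h2⟩ | ⟨s, h1, h2, h3⟩
  · exact .inl ⟨h1, fun xs x hx ys hl hB => h2 x hx ys (split xs x ys hl hB).1⟩
  · refine .inr ⟨_, ?_, h2, fun xs x hx ys hl hB => ?_⟩
    · intro r' hr'
      rcases List.mem_append.1 hr' with hr' | hr'
      · exact hst _ (by simp [hr'])
      · rcases List.mem_cons.1 hr' with rfl | hr'
        · exact hsort.valid _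
        · exact h1 _ hr'
    · obtain ⟨h4, h5⟩ := split xs x ys hl hB
      exact h5 _ _ hx rfl (h3 x hx ys h4)

theorem exists_of_nthO {os : List Opt} {x : ℕ} {k : Opt → List Opt → Bool}
    (h : nthO os x k = true) : ∃ o os', k o os' = true ∧ o ∈ os ∧ os'.Sublist os ∧
      ∀ y ∈ os, y = o ∨ y ∈ os' := by
  induction os generalizing x k with
  | nil => exact absurd h Bool.false_ne_true
  | cons o os ih =>
    cases x with
    | zero => exact ⟨o, os, h, by simp, List.sublist_cons_self _ _, by simp⟩
    | succ x =>
      obtain ⟨p, os', h1, h2, h3, h4⟩ := ih (k := fun p t' => k p (o :: t')) h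
      refine ⟨p, o :: os', h1, by simp [h2], h3.cons_cons _, fun y hy => ?_⟩
      rcases List.mem_cons.1 hy with rfl | hy
      · simp
      · exact (h4 y hy).imp_right fun h => List.mem_cons_of_mem _ h

theorem exists_of_rowAt {st : List RS} {i : ℕ} {k : List Opt → (Row → List Row) → Bool}
    (h : rowAt st i k = true) : ∃ A r B, st = A ++ r :: B ∧ A.length = i ∧
      k r.os (fun t => A.map RS.pm ++ t :: B.map RS.pm) = true := by
  induction st generalizing i k with
  | nil => exact absurd h Bool.false_ne_true
  | cons s st ih =>
    cases i with
    | zero => exact ⟨[], s, st, rfl, rfl, h⟩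
    | succ i =>
      obtain ⟨A, r, B, rfl, h1, h2⟩ := ih (k := fun os f => k os fun t => s.pm :: f t) h
      exact ⟨s :: A, r, B, rfl, by simp [h1], h2⟩

theorem countP_lt_of_hits {st : List RS} {n lo : ℕ} (h : hits st n = false)
    (hst : ∀ r ∈ st, r.Valid) {X : List Opt} (hX : Box lo st X) : X.countP Opt.hit < n := by
  induction st generalizing n lo X with
  | nil =>
    cases hX
    cases n with
    | zero => exact absurd h (by decide)
    | succ n => simp
  | cons r st ih =>
    cases n with
    | zero => exact absurd h.symm Bool.false_ne_true
    | succ n =>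
      cases hX with
      | @cons _ _ _ x X hx _ hX =>
        have hst' := fun r hr => hst r (List.mem_cons_of_mem _ hr)
        change List.rec (motive := fun _ => Bool) (hits st (n + 1))
          (fun o _ _ => bif o.hit then hits st n else hits st (n + 1)) r.os = false at h
        have hr := (hst r (by simp)).1.1
        cases ho : r.os with
        | nil => rw [ho] at hx; simp at hx
        | cons o os =>
          rw [ho] at h hr hx
          change (bif o.hit then hits st n else hits st (n + 1)) = false at h
          rw [List.countP_cons]
          cases hh : o.hit with
          | true =>
            rw [hh] at h
            have := ih h hst' hX
            split <;> omega
          | false =>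
            rw [hh] at h
            have hxh : ¬ x.hit = true := by
              rcases List.mem_cons.1 hx with rfl | hx
              · simp [hh]
              · intro hx'
                rw [((List.pairwise_cons.1 hr).1 x hx).2 hx'] at hh
                exact Bool.false_ne_true hh.symm
            rw [if_neg hxh]
            exact ih h hst' hX

theorem RowGe.of_forall₂ {t q : Row} (h : List.Forall₂ (· ≤ ·) q t) : RowGe t q := by
  induction h with
  | nil => exact RowGe.nil _
  | cons h _ ih => exact RowGe.cons h ih

theorem resp_of_win {A B : List RS} {xs ys : List Opt} {x : Opt}
    (hA : List.Forall₂ (fun r x => x ∈ RS.os r) A xs)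
    (hB : List.Forall₂ (fun r x => x ∈ RS.os r) B ys) (hAv : ∀ r ∈ A, r.Valid)
    (hBv : ∀ r ∈ B, r.Valid) (h : Win (A.map RS.pm ++ x.rem :: B.map RS.pm)) :
    Resp (xs ++ x :: ys) := by
  have key : ∀ {A : List RS} {xs : List Opt}, List.Forall₂ (fun r x => x ∈ RS.os r) A xs →
      (∀ r ∈ A, r.Valid) → List.Forall₂ RowGe (xs.map Opt.dec) (A.map RS.pm) := by
    intro A xs h hv
    induction h with
    | nil => exact .nil
    | cons h _ ih =>
      exact .cons (RowGe.of_forall₂ ((hv _ (by simp)).2 _ h))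
        (ih fun r hr => hv r (List.mem_cons_of_mem _ hr))
  refine ⟨xs, x, ys, rfl, (Dom.of_forall₂ ?_).win h⟩
  exact List.rel_append (key hA hAv) (.cons (RowGe.refl _) (key hB hBv))

theorem exists_of_readRef {w rs : ℕ} {k : ℕ → ℕ → ℕ → Bool} (h : readRef w rs k = true) :
    ∃ ref w' rs', k ref w' rs' = true := by
  unfold readRef at h
  simp only [fN_eq] at h
  cases hc : Nat.ble (nat_lit 4) (Nat.mod w (nat_lit 16)) <;> rw [hc] at h <;> exact ⟨_, _, _, h⟩

theorem exists_of_readCmd {w rs : ℕ} {k : Cmd → ℕ → ℕ → Bool} (h : readCmd w rs k = true) :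
    ∃ c w' rs', k c w' rs' = true := by
  unfold readCmd at h
  simp only [fN_eq] at h
  cases hc : Nat.beq (Nat.mod w (nat_lit 8)) (nat_lit 7) <;>
    cases hb : Nat.testBit w (nat_lit 3) <;> simp only [hc, hb, cond_true, cond_false] at h <;>
    first | exact ⟨_, _, _, h⟩ | (obtain ⟨_, _, _, h⟩ := exists_of_readRef h; exact ⟨_, _, _, h⟩)

theorem go_sound {T : Tbl} {m : ℕ} (hT : AllWin T m) {fuel w rs : ℕ} {stack : List (List RS)}
    (h : go T m fuel w rs stack = true) (hs : ∀ st ∈ stack, ∀ r ∈ st, r.Valid) :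
    ∀ st ∈ stack, Good st := by
  induction fuel generalizing w rs stack with
  | zero => exact absurd h Bool.false_ne_true
  | succ fuel ih =>
    cases stack with
    | nil => simp
    | cons st rest =>
      have hv := hs st (by simp)
      have hrest : ∀ st ∈ rest, ∀ r ∈ st, r.Valid := fun st h => hs st (List.mem_cons_of_mem _ h)
      have cons_valid : ∀ {s : List RS} {t : List (List RS)}, (∀ r ∈ s, r.Valid) →
          (∀ st ∈ t, ∀ r ∈ st, r.Valid) → ∀ st ∈ s :: t, ∀ r ∈ st, r.Valid := by
        intro s t h1 h2 st hst
        rcases List.mem_cons.1 hst with rfl | hst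
        · exact h1
        · exact h2 st hst
      suffices H : Good st ∧ ∀ st ∈ rest, Good st by simpa using H
      change (bif hits st 2 then readCmd w rs fun c w rs =>
        rowAt st c.i fun os f => nthO os c.x fun o os' =>
        bif c.leaf then
          bif leafOk T m c.ref c.flag (f o.rem) then
            List.rec (motive := fun _ => Bool) (go T m fuel w rs rest)
              (fun _ _ _ => setO (go T m fuel w rs rest) st c.i os'
                fun st' => go T m fuel w rs (st' :: rest)) os'
          else false
        else
          List.rec (motive := fun _ => Bool) (go T m fuel w rs (st :: rest)) (fun _ _ _ =>
            (fun k => setO (k rest) st c.i os' fun st' => k (st' :: rest))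
              fun rest' => setO (go T m fuel w rs rest') st c.i [o]
                fun st' => go T m fuel w rs (st' :: rest')) os'
        else go T m fuel w rs rest) = true at h
      cases hh : hits st 2 with
      | false =>
        rw [hh] at h
        exact ⟨fun X hX h2 => absurd (countP_lt_of_hits hh hv hX) (by omega), ih h hrest⟩
      | true =>
        rw [hh, cond_true] at h
        obtain ⟨c, w, rs, h⟩ := exists_of_readCmd h
        obtain ⟨A, r, B, rfl, hA, h⟩ := exists_of_rowAt h
        obtain ⟨o, os', h, ho, hsub, hor⟩ := exists_of_nthO h
        have split : ∀ X, Box 0 (A ++ r :: B) X → ∃ xs x ys, X = xs ++ x :: ys ∧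
            xs.length = A.length ∧ (x = o ∨ x ∈ os') ∧
            List.Forall₂ (fun r x => x ∈ RS.os r) A xs ∧
            List.Forall₂ (fun r x => x ∈ RS.os r) B ys := by
          intro X hX
          obtain ⟨xs, x, ys, h1, h2, h3, h4, h5, -⟩ := hX.exists_split
          exact ⟨xs, x, ys, h1, h2, hor x h3, h4, h5⟩
        have others : ∀ (p : Prop) (k : List (List RS) → Bool),
            (∀ t, k t = true → (∀ st ∈ t, ∀ r ∈ st, r.Valid) → p ∧ ∀ st ∈ t, Good st) →
            setO (k rest) (A ++ r :: B) c.i os' (fun st' => k (st' :: rest)) = true →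
            p ∧ (∀ st ∈ rest, Good st) ∧ ∀ xs, ∀ x ∈ os', ∀ ys, xs.length = A.length →
              Box 0 (A ++ r :: B) (xs ++ x :: ys) → 2 ≤ (xs ++ x :: ys).countP Opt.hit →
              Resp (xs ++ x :: ys) := by
          intro p k hk h
          rw [← hA] at h
          rcases setO_sound h hsub hv with ⟨h1, h2⟩ | ⟨s, h1, h2, h3⟩
          · obtain ⟨hp, hg⟩ := hk _ h1 hrest
            exact ⟨hp, hg, fun xs x hx ys hl hB => absurd hB (h2 xs x hx ys hl)⟩
          · obtain ⟨hp, hg⟩ := hk _ h2 (cons_valid h1 hrest)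
            exact ⟨hp, fun st hst => hg st (by simp [hst]), fun xs x hx ys hl hB h2 =>
              hg s (by simp) _ (h3 xs x hx ys hl hB) h2⟩
        cases hb : c.leaf with
        | true =>
          rw [hb, cond_true] at h
          obtain ⟨hleaf, h⟩ := and_of_cond h
          have hw := leafOk_sound hT hleaf
          have first : ∀ xs ys, List.Forall₂ (fun r x => x ∈ RS.os r) A xs →
              List.Forall₂ (fun r x => x ∈ RS.os r) B ys → Resp (xs ++ o :: ys) :=
            fun xs ys h1 h2 => resp_of_win h1 h2 (fun r hr => hv r (by simp [hr]))
              (fun r hr => hv r (by simp [hr])) hw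
          cases hos : os' with
          | nil =>
            rw [hos] at h
            refine ⟨fun X hX _ => ?_, ih h hrest⟩
            obtain ⟨xs, x, ys, rfl, -, hx, h4, h5⟩ := split X hX
            rw [hos] at hx
            obtain rfl : x = o := by simpa using hx
            exact first xs ys h4 h5
          | cons p ps =>
            rw [hos] at h
            rw [hos] at others hor split
            obtain ⟨-, hg, h6⟩ := others True (fun t => go T m fuel w rs t)
              (fun t ht hv => ⟨trivial, ih ht hv⟩) h
            refine ⟨fun X hX h2 => ?_, hg⟩
            obtain ⟨xs, x, ys, rfl, hl, hx, h4, h5⟩ := split X hX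
            rcases hx with rfl | hx
            · exact first xs ys h4 h5
            · exact h6 xs x hx ys hl hX h2
        | false =>
          rw [hb, cond_false] at h
          cases hos : os' with
          | nil =>
            rw [hos] at h
            simpa using ih h hs
          | cons p ps =>
            rw [hos] at h
            rw [hos] at others hor split
            obtain ⟨h7, hg, h6⟩ := others (∀ xs ys, xs.length = A.length →
                Box 0 (A ++ r :: B) (xs ++ o :: ys) → 2 ≤ (xs ++ o :: ys).countP Opt.hit →
                Resp (xs ++ o :: ys))
              (fun t => setO (go T m fuel w rs t) (A ++ r :: B) c.i [o]
                fun st' => go T m fuel w rs (st' :: t)) (fun t ht hvt => by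
                rw [← hA] at ht
                rcases setO_sound ht (List.singleton_sublist.2 ho) hv with
                  ⟨h1, h2⟩ | ⟨s, h1, h2, h3⟩
                · exact ⟨fun xs ys hl hB => absurd hB (h2 xs o (by simp) ys hl), ih h1 hvt⟩
                · have hg := ih h2 (cons_valid h1 hvt)
                  exact ⟨fun xs ys hl hB h2 => hg s (by simp) _ (h3 xs o (by simp) ys hl hB) h2,
                    fun st hst => hg st (by simp [hst])⟩) h
            refine ⟨fun X hX h2 => ?_, hg⟩
            obtain ⟨xs, x, ys, rfl, hl, hx, h4, h5⟩ := split X hX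
            rcases hx with rfl | hx
            · exact h7 xs ys hl hX h2
            · exact h6 xs x hx ys hl hX h2

theorem eqRow_sound {a b : Row} (h : eqRow a b = true) : a = b := by
  induction a generalizing b with
  | nil =>
    cases b with
    | nil => rfl
    | cons b bs => exact absurd h Bool.false_ne_true
  | cons a as ih =>
    cases b with
    | nil => exact absurd h Bool.false_ne_true
    | cons b bs =>
      obtain ⟨h1, h2⟩ := and_of_cond h
      rw [Nat.eq_of_beq_eq_true h1, ih h2]

theorem mem_of_memP {p : Row × Row} {l : List (Row × Row)} (h : memP p l = true) : p ∈ l := by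
  induction l with
  | nil => exact absurd h Bool.false_ne_true
  | cons q l ih =>
    change (bif eqRow p.1 q.1 then bif eqRow p.2 q.2 then true else memP p l else memP p l) = true
      at h
    cases h1 : eqRow p.1 q.1 with
    | false => rw [h1] at h; exact List.mem_cons_of_mem _ (ih h)
    | true =>
      cases h2 : eqRow p.2 q.2 with
      | false => rw [h1, h2] at h; exact List.mem_cons_of_mem _ (ih h)
      | true => rw [Prod.ext (eqRow_sound h1) (eqRow_sound h2)]; simp

theorem dedup_sublist (l : List (Row × Row)) : (dedup l).Sublist l := by
  induction l with
  | nil => exact List.Sublist.refl _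
  | cons p l ih =>
    change (bif memP p (dedup l) then dedup l else p :: dedup l).Sublist _
    cases memP p (dedup l)
    · exact ih.cons_cons _
    · exact ih.cons _

theorem mem_dedup {p : Row × Row} {l : List (Row × Row)} (h : p ∈ l) : p ∈ dedup l := by
  induction l with
  | nil => simp at h
  | cons q l ih =>
    change p ∈ (bif memP q (dedup l) then dedup l else q :: dedup l)
    cases hb : memP q (dedup l)
    · rcases List.mem_cons.1 h with rfl | h
      · exact List.mem_cons_self
      · exact List.mem_cons_of_mem _ (ih h)
    · rcases List.mem_cons.1 h with rfl | h
      · exact mem_of_memP hb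
      · exact ih h

/-- The options numbered from `i`. -/
def mkOpts : List (Row × Row) → ℕ → List Opt
  | [], _ => []
  | p :: l, i => ⟨i, p.1, p.2, Nat.blt (lenR p.2) (lenR p.1)⟩ :: mkOpts l (i + 1)

theorem fOpts_eq (l : List (Row × Row)) (i : ℕ) (k : List Opt → Bool) :
    fOpts l i k = k (mkOpts l i) := by
  induction l generalizing i k with
  | nil => rfl
  | cons p l ih =>
    change fRow p.1 (fun d => fRow p.2 fun r => fOpts l (i + 1) fun os =>
      bif Nat.blt (lenR r) (lenR d) then k (⟨i, d, r, true⟩ :: os)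
      else k (⟨i, d, r, false⟩ :: os)) = _
    rw [fRow_eq, fRow_eq, ih, mkOpts]
    cases Nat.blt (lenR p.2) (lenR p.1) <;> rfl

theorem mem_mkOpts {l : List (Row × Row)} {i : ℕ} {x : Opt} (h : x ∈ mkOpts l i) :
    i ≤ x.idx ∧ (x.dec, x.rem) ∈ l ∧ (x.hit = true ↔ x.rem.length < x.dec.length) := by
  induction l generalizing i with
  | nil => simp [mkOpts] at h
  | cons p l ih =>
    rw [mkOpts] at h
    rcases List.mem_cons.1 h with rfl | h
    · simp [lenR_eq]
    · obtain ⟨h1, h2, h3⟩ := ih h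
      exact ⟨by omega, List.mem_cons_of_mem _ h2, h3⟩

theorem exists_mem_mkOpts {l : List (Row × Row)} (i : ℕ) {o : Row × Row} (h : o ∈ l) :
    ∃ x ∈ mkOpts l i, x.dec = o.1 ∧ x.rem = o.2 := by
  induction l generalizing i with
  | nil => simp at h
  | cons p l ih =>
    rw [mkOpts]
    rcases List.mem_cons.1 h with rfl | h
    · exact ⟨_, List.mem_cons_self, rfl, rfl⟩
    · obtain ⟨x, hx, h1⟩ := ih (i + 1) h
      exact ⟨x, List.mem_cons_of_mem _ hx, h1⟩

theorem mkOpts_pairwise {l : List (Row × Row)} (i : ℕ)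
    (h : l.Pairwise fun p q => q.2.length < q.1.length → p.2.length < p.1.length) :
    (mkOpts l i).Pairwise fun x y => x.idx ≤ y.idx ∧ (y.hit = true → x.hit = true) := by
  induction l generalizing i with
  | nil => exact .nil
  | cons p l ih =>
    rw [List.pairwise_cons] at h
    rw [mkOpts, List.pairwise_cons]
    refine ⟨fun y hy => ?_, ih _ h.2⟩
    obtain ⟨h1, h2, h3⟩ := mem_mkOpts hy
    refine ⟨by simp only; omega, fun hh => ?_⟩
    simpa [lenR_eq] using h.1 _ h2 (h3.1 hh)

theorem length_of_mem_splits {l : Row} {o : Row × Row} (h : o ∈ splits l) :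
    o.1.length = l.length ∧ o.2.length ≤ l.length := by
  obtain ⟨p, h1, h2⟩ := exists_of_mem_splits h
  rw [h1.length_eq, length_decP, h2]
  exact ⟨rfl, length_remP_le p l⟩

theorem splits_pairwise (l : Row) :
    (splits l).Pairwise fun p q => q.2.length < q.1.length → p.2.length < p.1.length := by
  induction l with
  | nil => exact List.pairwise_singleton _ _
  | cons a l ih =>
    rw [splits_cons, List.pairwise_append, List.pairwise_map, List.pairwise_map]
    have hit : ∀ p ∈ splits l, p.2.length < (insT (a - 1) p.1).length := by
      intro p hp
      obtain ⟨h1, h2⟩ := length_of_mem_splits hp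
      rw [(insT_perm _ _).length_eq, List.length_cons]
      omega
    refine ⟨?_, ?_, ?_⟩
    · exact ih.imp_of_mem fun hp _ _ _ => hit _ hp
    · refine ih.imp fun h => ?_
      simp only [(insT_perm _ _).length_eq, List.length_cons]
      omega
    · rintro _ hp _ _ _
      obtain ⟨p, hq, rfl⟩ := List.mem_map.1 hp
      exact hit p hq

def opts (s : Row) : List Opt := mkOpts (dedup (splits s)) 0

theorem opts_wellSorted (s : Row) : WellSorted (opts s) :=
  ⟨mkOpts_pairwise 0 ((splits_pairwise s).sublist (dedup_sublist _)), s.length, fun _ hx =>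
    (length_of_mem_splits ((dedup_sublist _).subset (mem_mkOpts hx).2.1)).1⟩

/-- The initial state for the rows `ss`, following the row `p`. -/
def mkState : Row → List Row → List RS
  | _, [] => []
  | p, s :: ss => ⟨eqRow p s, opts s, pmin (opts s)⟩ :: mkState s ss

theorem mkState_valid (p : Row) (ss : List Row) : ∀ r ∈ mkState p ss, r.Valid := by
  induction ss generalizing p with
  | nil => simp [mkState]
  | cons s ss ih =>
    intro r hr
    rcases List.mem_cons.1 hr with rfl | hr
    · exact (opts_wellSorted s).valid _
    · exact ih s r hr

theorem Box.change_zero {p q : Row} {ss : List Row} {X : List Opt}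
    (h : Box 0 (mkState p ss) X) : Box 0 (mkState q ss) X := by
  cases ss with
  | nil => exact h
  | cons s ss =>
    cases h with
    | cons hx _ hX => exact .cons hx (fun _ => Nat.zero_le _) hX

theorem Box.exists_insert {s : Row} {L : List Row} {x : Opt} {X : List Opt} {lo : ℕ}
    (hx : x ∈ opts s) (hlo : lo ≤ x.idx) (h : Box lo (mkState s L) X) :
    ∃ X', X'.Perm (x :: X) ∧ Box lo (mkState s (s :: L)) X' := by
  induction L generalizing s X lo with
  | nil => exact ⟨x :: X, .refl _, .cons hx (fun _ => hlo) (by cases h; exact .nil _)⟩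
  | cons t L ih =>
    cases h with
    | @cons _ _ _ y Y hy hylo hY =>
      by_cases hc : eqRow s t = true ∧ y.idx ≤ x.idx
      · obtain rfl := eqRow_sound hc.1
        obtain ⟨Z, hZ, hB⟩ := ih hx hc.2 hY
        exact ⟨y :: Z, (hZ.cons y).trans (.swap _ _ _), .cons hy (fun _ => hylo hc.1) hB⟩
      · refine ⟨x :: y :: Y, .refl _, .cons hx (fun _ => hlo) (.cons hy (fun h => ?_) hY)⟩
        by_contra h'
        exact hc ⟨h, (not_le.1 h').le⟩

theorem exists_box {L : List Row} {X : List Opt}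
    (h : List.Forall₂ (fun l x => x ∈ opts l) L X) :
    ∃ X', X'.Perm X ∧ Box 0 (mkState [] L) X' := by
  induction h with
  | nil => exact ⟨[], .refl _, .nil _⟩
  | @cons s x L X hx _ ih =>
    obtain ⟨X', hp, hB⟩ := ih
    obtain ⟨Z, hZ, hB⟩ := hB.change_zero.exists_insert hx (Nat.zero_le _)
    exact ⟨Z, hZ.trans (hp.cons x), hB.change_zero⟩

theorem exists_of_start {ss : List Row} {p : Row} {k : List RS → Bool} (h : start ss p k = true) :
    ∃ L, Dom ss L ∧ (∀ l ∈ L, ∀ a ∈ l, 1 ≤ a) ∧ k (mkState p L) = true := by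
  induction ss generalizing p k with
  | nil => exact ⟨[], .nil _, by simp, h⟩
  | cons s ss ih =>
    cases s with
    | nil =>
      obtain ⟨L, h1, h2⟩ := ih (k := k) h
      exact ⟨L, .empty h1, h2⟩
    | cons a s =>
      obtain ⟨h1, h2⟩ := and_of_cond h
      change fRow (a :: s) (fun s' => fOpts (dedup (splits s')) 0 fun os =>
        mkRS (eqRow p s') os fun r => start ss s' fun st => k (r :: st)) = true at h2
      rw [fRow_eq, fOpts_eq, mkRS_eq] at h2
      obtain ⟨L, h3, h4, h5⟩ := ih (k := fun st => k (_ :: st)) h2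
      refine ⟨(a :: s) :: L, .cons (RowGe.refl _) h3 (.refl _), ?_, h5⟩
      have pos : ∀ l : Row, posR l = true → ∀ a ∈ l, 1 ≤ a := by
        intro l
        induction l with
        | nil => simp
        | cons b l ih =>
          intro h a ha
          obtain ⟨h1, h2⟩ := and_of_cond h
          rcases List.mem_cons.1 ha with rfl | ha
          · exact Nat.le_of_ble_eq_true h1
          · exact ih h2 a ha
      intro l hl
      rcases List.mem_cons.1 hl with rfl | hl
      · exact pos _ h1
      · exact h4 l hl

theorem chkM_sound {T : Tbl} {m w : ℕ} (hT : AllWin T m) (h : chkM T m w = true) :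
    Win (rowsOf 7 (entry T m)) := by
  obtain ⟨L, h1, h2, h3⟩ := exists_of_start h
  refine h1.win (Win.of_resp h2 opts (fun l _ o ho => ?_) fun X hX hc => ?_)
  · obtain ⟨x, hx, h4, h5⟩ := exists_mem_mkOpts 0 (mem_dedup ho)
    exact ⟨x, hx, h4, h5, (mem_mkOpts hx).2.2.2⟩
  · obtain ⟨X', hp, hB⟩ := exists_box hX
    refine (go_sound hT h3 (by simpa using mkState_valid [] L) _ (by simp) X' hB ?_).perm hp
    rwa [hp.countP_eq]

theorem chkMs_sound {T : Tbl} {m : ℕ} {ws : List ℕ} (hT : AllWin T m)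
    (h : chkMs T ws m = true) : AllWin T (m + ws.length) := by
  induction ws generalizing m with
  | nil => exact hT
  | cons w ws ih =>
    obtain ⟨h1, h2⟩ := and_of_cond h
    have hT' : AllWin T (m + 1) := by
      intro i hi
      rcases Nat.lt_succ_iff_lt_or_eq.1 hi with hi | rfl
      · exact hT i hi
      · exact chkM_sound hT h1
    have := ih hT' h2
    rwa [List.length_cons, show m + (ws.length + 1) = m + 1 + ws.length by omega]

/-! ### Evaluation of coefficients of graph polynomials -/

noncomputable section

/-- Force a natural number. -/
def gN (n : ℕ) (k : ℕ → ℕ) : ℕ :=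
  Nat.rec (motive := fun _ => ℕ) (k 0) (fun m _ => k m) (Nat.add n (nat_lit 1))

/-- The table of the parities of the numbers of binary digits of the numbers below `2 ^ n`. -/
def parity (n : ℕ) : ℕ :=
  Nat.rec (motive := fun _ => ℕ) (nat_lit 0)
    (fun n p => Nat.add (Nat.mul (Nat.pow (nat_lit 2) (Nat.pow (nat_lit 2) n))
      (Nat.sub (Nat.pow (nat_lit 2) (Nat.pow (nat_lit 2) n)) (Nat.add p (nat_lit 1)))) p) n

/-- A term with coefficient `c` (modulo `2 ^ 32`) that uses the set of exponents `m`, and whose sign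
depends on the parity of the remaining exponents in `x`. -/
structure Tm where
  c : ℕ
  m : ℕ
  x : ℕ

def insC (t : Tm) (l : List Tm) : (List Tm → ℕ) → ℕ :=
  List.rec (motive := fun _ => (List Tm → ℕ) → ℕ) (fun k => k [t])
    (fun u l ih k => bif Nat.beq t.m u.m then
        bif Nat.beq t.x u.x then
          gN (Nat.mod (Nat.add t.c u.c) (nat_lit 4294967296)) fun c =>
          bif Nat.beq c (nat_lit 0) then k l else k (⟨c, u.m, u.x⟩ :: l)
        else ih fun xs => k (u :: xs)
      else ih fun xs => k (u :: xs)) l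

/-- Put the exponent `k` in front; drop the term if `k ≥ n` or if `k` is used already -/
def addI (n k : ℕ) (t : Tm) (d : ℕ) (f : Tm → ℕ) : ℕ :=
  bif Nat.ble n k then d else bif Nat.testBit t.m k then d else
    gN (bif Nat.testBit t.x k then
      Nat.mod (Nat.mul t.c (nat_lit 4294967295)) (nat_lit 4294967296) else t.c) fun c =>
    gN (Nat.xor t.m (Nat.pow (nat_lit 2) k)) fun m =>
    gN (Nat.xor t.x (Nat.sub (Nat.pow (nat_lit 2) k) (nat_lit 1))) fun x => f ⟨c, m, x⟩

/-- Loop from `n` down to `0` with an accumulator. -/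
def loop (f : ℕ → List Tm → (List Tm → ℕ) → ℕ) (n : ℕ) : List Tm → (List Tm → ℕ) → ℕ :=
  Nat.rec (motive := fun _ => List Tm → (List Tm → ℕ) → ℕ) (fun acc k => f (nat_lit 0) acc k)
    (fun i ih acc k => f (Nat.succ i) acc fun acc' => ih acc' k) n

def oneTm : Tm := ⟨nat_lit 1, nat_lit 0, nat_lit 0⟩

def terms (n : ℕ) (r : Row) (k : List Tm → ℕ) : ℕ :=
  List.rec (motive := fun _ => ℕ) (k [oneTm]) (fun a r _ =>
    gN (Nat.sub a (nat_lit 1)) fun a =>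
    List.rec (motive := fun _ => ℕ)
      (addI n a oneTm (k []) fun t => k [t])
      (fun b r _ => gN (Nat.sub b (nat_lit 1)) fun b =>
        List.rec (motive := fun _ => ℕ)
          (loop (fun t acc k =>
            addI n (Nat.add b (Nat.add t (nat_lit 1))) oneTm (k acc) fun T =>
            addI n (Nat.sub a t) T (k acc) fun T => insC T acc k) a [] k)
          (fun c _ _ => gN (Nat.sub c (nat_lit 1)) fun c =>
            loop (fun t₁ acc k => loop (fun t₂ acc k =>
              addI n (Nat.add (Nat.add c (nat_lit 2)) (Nat.add t₁ t₂)) oneTm (k acc) fun T =>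
              gN (Nat.sub a t₂) fun a' =>
              loop (fun t₃ acc k =>
                addI n (Nat.add (Nat.sub b t₁) (Nat.add t₃ (nat_lit 1))) T (k acc) fun T =>
                addI n (Nat.sub a' t₃) T (k acc) fun T => insC T acc k) a' acc k)
                a acc k) b [] k) r) r) r

def packL (l : List Tm) : ℕ :=
  List.rec (motive := fun _ => ℕ) (nat_lit 0) (fun t _ ih =>
    Nat.add (Nat.mod t.c (nat_lit 4294967296)) (Nat.mul (nat_lit 4294967296)
      (Nat.add t.m (Nat.mul (nat_lit 65536) (Nat.add t.x (Nat.mul (nat_lit 65536) ih)))))) l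

def packT (n c : ℕ) : ℕ := terms n (toks (nat_lit 3) c) packL

def unpack (n : ℕ) : ℕ → (List Tm → Bool) → Bool :=
  Nat.rec (motive := fun _ => ℕ → (List Tm → Bool) → Bool) (fun _ _ => false)
    (fun _ ih q k => bif Nat.beq q (nat_lit 0) then k [] else
      fN (Nat.mod q (nat_lit 4294967296)) fun c =>
      fN (Nat.mod (Nat.div q (nat_lit 4294967296)) (nat_lit 65536)) fun m =>
      fN (Nat.mod (Nat.div q (nat_lit 281474976710656)) (nat_lit 65536)) fun x =>
      fN (Nat.div q (nat_lit 18446744073709551616)) fun q' => ih q' fun l => k (⟨c, m, x⟩ :: l)) n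

def allTerms (n : ℕ) (rs : List ℕ) : (List (List Tm) → Bool) → Bool :=
  List.rec (motive := fun _ => (List (List Tm) → Bool) → Bool) (fun k => k [])
    (fun r _ ih k => bif posR (toks (nat_lit 3) r) then
      fN (packT n r) fun q => unpack (nat_lit 64) q fun t => ih fun l => k (t :: l) else false) rs

def ev (P : ℕ) (rows : List (List Tm)) : ℕ → ℕ :=
  List.rec (motive := fun _ => ℕ → ℕ) (fun _ => nat_lit 1)
    (fun row _ ih m => List.rec (motive := fun _ => ℕ) (nat_lit 0)
      (fun t _ acc => bif Nat.beq (Nat.land m t.m) t.m then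
        gN (Nat.xor m t.m) fun m' => Nat.add acc (Nat.mul (bif Nat.testBit P (Nat.land m t.x)
          then Nat.mul t.c (nat_lit 4294967295) else t.c) (ih m'))
        else acc) row) rows

/-- Codes of the rows present, last row first. -/
def rowCodes (n : ℕ) : ℕ → List ℕ → (List ℕ → Bool) → Bool :=
  Nat.rec (motive := fun _ => ℕ → List ℕ → (List ℕ → Bool) → Bool) (fun _ acc k => k acc)
    (fun _ ih q acc k => fN (Nat.mod q (nat_lit 4096)) fun c =>
      fN (Nat.div q (nat_lit 4096)) fun q' =>
      bif Nat.beq c (nat_lit 4095) then ih q' acc k else ih q' (c :: acc) k) n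

def chkA (P : ℕ) (e : ℕ) : Bool :=
  rowCodes (nat_lit 7) e [] fun rs => fN (totR (rs.map (toks (nat_lit 3)))) fun n =>
    bif Nat.ble n (nat_lit 15) then allTerms n rs fun ts =>
      fN (Nat.sub (Nat.pow (nat_lit 2) n) (nat_lit 1)) fun m =>
      Nat.blt (nat_lit 0) (Nat.mod (ev P ts m) (nat_lit 4294967296)) else false

def chkAs (T : Tbl) (n : ℕ) (i : ℕ) : Bool :=
  fN (parity (nat_lit 15)) fun P =>
  Nat.rec (motive := fun _ => ℕ → Bool) (fun _ => true) (fun _ ih i =>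
    bif chkA P (entry T i) then ih (Nat.add i (nat_lit 1)) else false) n i

end

/-! ### Graph polynomials and Painter's strategy -/

section GraphPolynomial

open MvPolynomial

/-- The product of the differences `X y - X x` with `x` in `xs` and `y` in `ys`. -/
noncomputable def cross (xs ys : List ℕ) : MvPolynomial ℕ ℤ :=
  (xs.map fun x => (ys.map fun y => X y - X x).prod).prod

/-- The graph polynomial of the complete multipartite graph with the given parts. -/
noncomputable def graphPoly : List (List ℕ) → MvPolynomial ℕ ℤ
  | [] => 1
  | xs :: ls => cross xs ls.flatten * graphPoly ls

/-- The linear functional with the given values on monomials. -/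
noncomputable def weigh (w : (ℕ →₀ ℕ) → ℤ) : MvPolynomial ℕ ℤ →ₗ[ℤ] ℤ :=
  (basisMonomials ℕ ℤ).constr ℤ w

theorem weigh_monomial (w : (ℕ →₀ ℕ) → ℤ) (e : ℕ →₀ ℕ) (c : ℤ) :
    weigh w (monomial e c) = c * w e := by
  have h : monomial e c = c • basisMonomials ℕ ℤ e := by
    rw [coe_basisMonomials, smul_monomial, smul_eq_mul, mul_one]
  rw [h, map_smul, weigh, Module.Basis.constr_basis, smul_eq_mul]

theorem weigh_eq_sum (w : (ℕ →₀ ℕ) → ℤ) (F : MvPolynomial ℕ ℤ) :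
    weigh w F = ∑ e ∈ F.support, coeff e F * w e := by
  conv_lhs => rw [F.as_sum]
  rw [map_sum]
  exact Finset.sum_congr rfl fun e _ => weigh_monomial _ _ _

/-- Substitution of `1` for the variables in `I`. -/
noncomputable def evalOne (I : Finset ℕ) : MvPolynomial ℕ ℤ →ₐ[ℤ] MvPolynomial ℕ ℤ :=
  aeval fun v => if v ∈ I then 1 else X v

theorem weigh_evalOne {w : (ℕ →₀ ℕ) → ℤ} {I : Finset ℕ}
    (hw : ∀ e e' : ℕ →₀ ℕ, (∀ v ∉ I, e v = e' v) → w e = w e') (F : MvPolynomial ℕ ℤ) :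
    weigh w (evalOne I F) = weigh w F := by
  induction F using MvPolynomial.induction_on' with
  | add p q hp hq => rw [map_add, map_add, map_add, hp, hq]
  | monomial e c =>
    have h : evalOne I (monomial e c) = monomial (e.filter fun v => v ∉ I) c := by
      rw [evalOne, aeval_monomial, monomial_eq, algebraMap_eq,
        Finsupp.prod_of_support_subset (e.filter fun v => v ∉ I) (s := e.support) (by simp) _
          fun _ _ => pow_zero _]
      refine congrArg _ (Finset.prod_congr rfl fun v _ => ?_)
      beta_reduce
      by_cases hv : v ∈ I
      · rw [if_pos hv, one_pow, Finsupp.filter_apply_neg (fun v => v ∉ I) _ (not_not.2 hv),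
          pow_zero]
      · rw [if_neg hv, Finsupp.filter_apply_pos (fun v => v ∉ I) _ hv]
    rw [h, weigh_monomial, weigh_monomial, hw]
    intro v hv
    exact Finsupp.filter_apply_pos (fun v => v ∉ I) _ hv

theorem prod_filter_dvd {α : Type*} (p : α → Bool) {f g : α → MvPolynomial ℕ ℤ} {l : List α}
    (h : ∀ a ∈ l, p a = true → f a ∣ g a) : ((l.filter p).map f).prod ∣ (l.map g).prod := by
  induction l with
  | nil => simp
  | cons a l ih =>
    have ih := ih fun b hb => h b (List.mem_cons_of_mem _ hb)
    by_cases hp : p a = true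
    · rw [List.filter_cons_of_pos hp]
      simpa using mul_dvd_mul (h a (by simp) hp) ih
    · rw [List.filter_cons_of_neg hp]
      simpa using ih.mul_left (g a)

theorem evalOne_cross (I : Finset ℕ) (xs ys : List ℕ) : evalOne I (cross xs ys) =
    (xs.map fun x => (ys.map fun y => evalOne I (X y) - evalOne I (X x)).prod).prod := by
  simp [cross, map_list_prod, Function.comp_def]

theorem evalOne_X (I : Finset ℕ) (v : ℕ) : evalOne I (X v) = if v ∈ I then 1 else X v := by
  rw [evalOne, aeval_X]

theorem cross_filter_dvd (I : Finset ℕ) (xs ys : List ℕ) :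
    cross (xs.filter (· ∉ I)) (ys.filter (· ∉ I)) ∣ evalOne I (cross xs ys) := by
  rw [evalOne_cross]
  refine prod_filter_dvd _ fun x _ hx => prod_filter_dvd _ fun y _ hy => ?_
  rw [evalOne_X, evalOne_X, if_neg (by simpa using hy), if_neg (by simpa using hx)]

theorem flatten_map_filter (p : ℕ → Bool) (ls : List (List ℕ)) :
    (ls.map (List.filter p)).flatten = ls.flatten.filter p := by
  induction ls with
  | nil => rfl
  | cons xs ls ih =>
    rw [List.map_cons, List.flatten_cons, ih, List.flatten_cons, List.filter_append]

theorem graphPoly_filter_dvd (I : Finset ℕ) (ls : List (List ℕ)) :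
    graphPoly (ls.map (List.filter (· ∉ I))) ∣ evalOne I (graphPoly ls) := by
  induction ls with
  | nil => simp [graphPoly]
  | cons xs ls ih =>
    rw [List.map_cons, graphPoly, graphPoly, map_mul, flatten_map_filter]
    exact mul_dvd_mul (cross_filter_dvd I _ _) ih

theorem evalOne_cross_eq_zero {I : Finset ℕ} {xs ys : List ℕ} {x y : ℕ} (hx : x ∈ xs) (hy : y ∈ ys)
    (hxI : x ∈ I) (hyI : y ∈ I) : evalOne I (cross xs ys) = 0 := by
  rw [evalOne_cross]
  refine List.prod_eq_zero (List.mem_map.2 ⟨x, hx, List.prod_eq_zero (List.mem_map.2 ⟨y, hy, ?_⟩)⟩)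
  rw [evalOne_X, evalOne_X, if_pos hxI, if_pos hyI, sub_self]

theorem exists_part_of_ne_zero {I : Finset ℕ} {ls : List (List ℕ)}
    (h : evalOne I (graphPoly ls) ≠ 0) {u v : ℕ} (hu : u ∈ I) (hv : v ∈ I) (hul : u ∈ ls.flatten)
    (hvl : v ∈ ls.flatten) : ∃ xs ∈ ls, u ∈ xs ∧ v ∈ xs := by
  induction ls with
  | nil => simp at hul
  | cons xs ls ih =>
    rw [graphPoly, map_mul] at h
    rw [List.flatten_cons, List.mem_append] at hul hvl
    rcases hul with hul | hul <;> rcases hvl with hvl | hvl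
    · exact ⟨xs, by simp, hul, hvl⟩
    · exact absurd (evalOne_cross_eq_zero hul hvl hu hv) (left_ne_zero_of_mul h)
    · exact absurd (evalOne_cross_eq_zero hvl hul hv hu) (left_ne_zero_of_mul h)
    · obtain ⟨ys, h1, h2⟩ := ih (right_ne_zero_of_mul h) hul hvl
      exact ⟨ys, List.mem_cons_of_mem _ h1, h2⟩

theorem exists_isHomogeneous_prod {α : Type*} (l : List α) {f : α → MvPolynomial ℕ ℤ}
    (h : ∀ a, ∃ n, (f a).IsHomogeneous n) : ∃ n, (l.map f).prod.IsHomogeneous n := by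
  induction l with
  | nil => exact ⟨0, by simpa using isHomogeneous_one ℕ ℤ⟩
  | cons a l ih =>
    obtain ⟨n, hn⟩ := ih
    obtain ⟨m, hm⟩ := h a
    exact ⟨m + n, by simpa using hm.mul hn⟩

theorem exists_isHomogeneous_graphPoly (ls : List (List ℕ)) :
    ∃ n, (graphPoly ls).IsHomogeneous n := by
  induction ls with
  | nil => exact ⟨0, isHomogeneous_one ℕ ℤ⟩
  | cons xs ls ih =>
    obtain ⟨n, hn⟩ := ih
    obtain ⟨m, hm⟩ := exists_isHomogeneous_prod xs
      (f := fun x => (ls.flatten.map fun y => X y - X x).prod) fun x =>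
        exists_isHomogeneous_prod _ fun y => ⟨1, (isHomogeneous_X _ _).sub (isHomogeneous_X _ _)⟩
    exact ⟨m + n, hm.mul hn⟩

open Classical in
/-- The exponents with smaller entries on `J` and the same entries outside of `S`. -/
noncomputable def lowWeight (S : Finset ℕ) (d : ℕ →₀ ℕ) (J : Finset ℕ) (e : ℕ →₀ ℕ) : ℤ :=
  (∏ v ∈ J, if e v < d v then 1 else 0) * if ∀ v ∉ S, e v = d v then 1 else 0

open Classical in
theorem exists_weigh_ne_zero {F : MvPolynomial ℕ ℤ} {n : ℕ} (hF : F.IsHomogeneous n) {d : ℕ →₀ ℕ}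
    (hd : coeff d F ≠ 0) (S : Finset ℕ) : ∃ J ⊆ S, weigh (lowWeight S d J) F ≠ 0 := by
  by_contra! h
  refine hd ?_
  have key : ∑ J ∈ S.powerset, (-1 : ℤ) ^ J.card * weigh (lowWeight S d J) F = coeff d F := by
    simp only [weigh_eq_sum, Finset.mul_sum]
    rw [Finset.sum_comm, Finset.sum_eq_single d]
    · rw [Finset.sum_eq_single ∅]
      · simp [lowWeight]
      · intro J _ hJ
        obtain ⟨v, hv⟩ := Finset.nonempty_iff_ne_empty.2 hJ
        rw [lowWeight, Finset.prod_eq_zero hv (if_neg (lt_irrefl _))]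
        simp
      · simp
    · intro e he hne
      have h1 := Finset.prod_sub (fun _ => (1 : ℤ)) (fun v => if e v < d v then (1 : ℤ) else 0) S
      simp only [Finset.prod_const_one, mul_one] at h1
      have h2 : ∀ J ∈ S.powerset, (-1 : ℤ) ^ J.card * (coeff e F * lowWeight S d J e) =
          (if ∀ v ∉ S, e v = d v then coeff e F else 0) *
            ((-1 : ℤ) ^ J.card * ∏ v ∈ J, if e v < d v then (1 : ℤ) else 0) := by
        intro J _
        rw [lowWeight]
        split_ifs <;> ring
      rw [Finset.sum_congr rfl h2, ← Finset.mul_sum]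
      by_cases h3 : ∀ v ∉ S, e v = d v
      · obtain ⟨v, hv, hlt⟩ : ∃ v ∈ S, e v < d v := by
          by_contra! hge
          have hle : d ≤ e := fun v => by
            by_cases hv : v ∈ S
            · exact hge v hv
            · exact (h3 v hv).ge
          have h4 := hF hd
          have h5 := hF (mem_support_iff.1 he)
          obtain ⟨c, rfl⟩ := exists_add_of_le hle
          rw [map_add, h4, Nat.add_eq_left, Pi.one_def, ← Finsupp.degree_eq_weight_one,
            Finsupp.degree_eq_zero_iff] at h5
          exact hne (by rw [h5, add_zero])
        have h6 : ∑ J ∈ S.powerset, (-1 : ℤ) ^ J.card *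
            ∏ v ∈ J, (if e v < d v then (1 : ℤ) else 0) = 0 := by
          rw [← h1]
          exact Finset.prod_eq_zero hv (by simp [hlt])
        rw [h6, mul_zero]
      · rw [if_neg h3, zero_mul]
    · intro h
      simp [notMem_support_iff.1 h]
  rw [← key]
  refine Finset.sum_eq_zero fun J hJ => ?_
  rw [h J (Finset.mem_powerset.1 hJ), mul_zero]

theorem exists_le_coeff_ne_zero {F G : MvPolynomial ℕ ℤ} {e : ℕ →₀ ℕ} (h : F ∣ G)
    (he : coeff e G ≠ 0) : ∃ e' ≤ e, coeff e' F ≠ 0 := by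
  obtain ⟨Q, rfl⟩ := h
  rw [coeff_mul] at he
  obtain ⟨p, hp, hne⟩ := Finset.exists_ne_zero_of_sum_ne_zero he
  exact ⟨p.1, Finset.HasAntidiagonal.mem_antidiagonal.1 hp ▸ le_self_add, left_ne_zero_of_mul hne⟩

open Classical in
/-- Painter wins if a coefficient of the graph polynomial does not vanish whose exponents are
smaller than the numbers of presentations. -/
theorem PainterWins.of_coeff_ne_zero {ρ f : ℕ → ℕ} {ls : List (List ℕ)} {d : ℕ →₀ ℕ}
    (hρ : ∀ xs ∈ ls, ∀ u ∈ xs, ∀ v ∈ xs, ρ u = ρ v) (hd : coeff d (graphPoly ls) ≠ 0)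
    (hf : ∀ v ∈ ls.flatten, d v < f v) : PainterWins ρ ls.flatten.toFinset f := by
  induction hn : ∑ v ∈ ls.flatten.toFinset, f v using Nat.strong_induction_on
    generalizing ls d f with
  | _ n ih =>
    refine of_forall (fun v hv => Nat.one_le_of_lt (hf v (List.mem_toFinset.1 hv)))
      fun S hS hSn => ?_
    obtain ⟨m, hm⟩ := exists_isHomogeneous_graphPoly ls
    obtain ⟨J, hJ, hne⟩ := exists_weigh_ne_zero hm hd S
    rw [← weigh_evalOne (I := S \ J)] at hne
    · have h0 : evalOne (S \ J) (graphPoly ls) ≠ 0 := fun h => by simp [h] at hne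
      rw [weigh_eq_sum] at hne
      obtain ⟨e, -, he⟩ := Finset.exists_ne_zero_of_sum_ne_zero hne
      obtain ⟨e', hle, he'⟩ := exists_le_coeff_ne_zero (graphPoly_filter_dvd _ _)
        (left_ne_zero_of_mul he)
      have hw := right_ne_zero_of_mul he
      rw [lowWeight] at hw
      have hlt : ∀ v ∈ J, e v < d v := fun v hv => by
        by_contra h
        exact left_ne_zero_of_mul hw (Finset.prod_eq_zero hv (if_neg h))
      have heq : ∀ v ∉ S, e v = d v := by
        by_contra h
        exact right_ne_zero_of_mul hw (if_neg h)
      have hU : (ls.map (List.filter (· ∉ S \ J))).flatten.toFinset =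
          ls.flatten.toFinset \ (S \ J) := by
        rw [flatten_map_filter, List.toFinset_filter]
        ext v
        simp only [Finset.mem_filter, Finset.mem_sdiff (s := List.toFinset _), decide_eq_true_iff]
      have hf' : ∀ v ∈ (ls.map (List.filter (· ∉ S \ J))).flatten,
          e' v < f v - if v ∈ S then 1 else 0 := by
        intro v hv
        rw [flatten_map_filter, List.mem_filter] at hv
        have h1 := hf v hv.1
        have h2 := hle v
        by_cases hvS : v ∈ S
        · have h3 := hlt v (by simpa [hvS] using hv.2)
          rw [if_pos hvS]
          omega
        · have h3 := heq v hvS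
          rw [if_neg hvS]
          omega
      refine ⟨S \ J, Finset.sdiff_subset, fun u hu v hv => ?_, ?_⟩
      · obtain ⟨xs, hxs, h1, h2⟩ := exists_part_of_ne_zero h0 hu hv
          (List.mem_toFinset.1 (hS (Finset.sdiff_subset hu)))
          (List.mem_toFinset.1 (hS (Finset.sdiff_subset hv)))
        exact hρ xs hxs u h1 v h2
      · rw [← hU]
        refine ih _ ?_ ?_ he' hf' rfl
        · rw [← hn, hU]
          obtain ⟨x, hx⟩ := hSn
          have hxf := hf x (List.mem_toFinset.1 (hS hx))
          refine (Finset.sum_le_sum_of_subset Finset.sdiff_subset).trans_lt ?_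
          refine Finset.sum_lt_sum (fun v _ => Nat.sub_le _ _) ⟨x, hS hx, ?_⟩
          rw [if_pos hx]
          omega
        · intro xs hxs u hu v hv
          obtain ⟨ys, hys, rfl⟩ := List.mem_map.1 hxs
          exact hρ ys hys u (List.mem_filter.1 hu).1 v (List.mem_filter.1 hv).1
    · intro e e' h
      simp only [lowWeight]
      congr 1
      · refine Finset.prod_congr rfl fun v hv => ?_
        rw [h v (by simp [hv])]
      · refine if_congr (forall₂_congr fun v hv => ?_) rfl rfl
        rw [h v (by simp [hv])]

end GraphPolynomial

section Coefficients

open MvPolynomial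

/-- The product of the differences `X y - X x` with `x` before `y` in the list. -/
noncomputable def vand : List ℕ → MvPolynomial ℕ ℤ
  | [] => 1
  | x :: xs => (xs.map fun y => X y - X x).prod * vand xs

theorem vand_append (xs ys : List ℕ) : vand (xs ++ ys) = cross xs ys * (vand xs * vand ys) := by
  induction xs with
  | nil => simp [vand, cross]
  | cons x xs ih =>
    rw [List.cons_append, vand, ih, vand, List.map_append, List.prod_append, cross, cross,
      List.map_cons, List.prod_cons]
    ring

theorem vand_flatten (ls : List (List ℕ)) :
    vand ls.flatten = graphPoly ls * (ls.map vand).prod := by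
  induction ls with
  | nil => simp [vand, graphPoly]
  | cons xs ls ih =>
    rw [List.flatten_cons, vand_append, ih, graphPoly, List.map_cons, List.prod_cons]
    ring

theorem vand_range' (s n : ℕ) : vand (List.range' s n) =
    ∏ i : Fin n, ∏ j ∈ Finset.Ioi i, (X (s + j : ℕ) - X (s + i : ℕ)) := by
  induction n generalizing s with
  | zero => simp [vand]
  | succ n ih =>
    rw [List.range'_succ, vand, ih, Fin.prod_univ_succ, Fin.prod_Ioi_zero]
    congr 1
    · rw [List.range'_eq_map_range, List.map_map, ← Fin.prod_univ_getElem]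
      refine Fintype.prod_equiv (finCongr (by simp)) _ _ fun i => ?_
      simp [add_assoc, add_comm 1]
    · refine Finset.prod_congr rfl fun i _ => ?_
      rw [Fin.prod_Ioi_succ]
      refine Finset.prod_congr rfl fun j _ => ?_
      simp [add_assoc, add_comm 1]

/-- Coefficients are computed modulo `2 ^ 32`. -/
abbrev Coef := ZMod 4294967296

/-- The coefficient with the exponents in a list. -/
noncomputable def co (F : MvPolynomial ℕ ℤ) (ks : List ℕ) : Coef :=
  ((coeff ks.toFinsupp F : ℤ) : Coef)

theorem coeff_add_single (Q : MvPolynomial ℕ ℤ) {v w : ℕ} (hvw : v ≠ w) (a : ℕ) (m : ℕ →₀ ℕ)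
    (hm : m v = 0) : coeff (m + Finsupp.single v a) Q = ∑ t ∈ Finset.range (a + 1),
      coeff (m + Finsupp.single v (a - t) + Finsupp.single w (t + 1)) (Q * (X w - X v)) := by
  have h1 : ∀ n : ℕ →₀ ℕ, coeff (n + Finsupp.single w 1) (Q * (X w - X v)) =
      coeff n Q - coeff (n + Finsupp.single w 1) (Q * X v) := fun n => by
    rw [mul_sub, coeff_sub, coeff_mul_X]
  induction a generalizing m with
  | zero =>
    rw [Finset.sum_range_one, h1, coeff_mul_X', if_neg, sub_zero]
    simp [hm, hvw.symm]
  | succ a ih =>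
    rw [Finset.sum_range_succ', Finset.sum_congr rfl (g := fun t =>
      coeff (m + Finsupp.single w 1 + Finsupp.single v (a - t) + Finsupp.single w (t + 1))
        (Q * (X w - X v)))]
    · rw [← ih _ (by simp [hm, hvw.symm]), h1,
        show m + Finsupp.single v (a + 1 - 0) + Finsupp.single w 1 =
          m + Finsupp.single w 1 + Finsupp.single v a + Finsupp.single v 1 by
            rw [Nat.sub_zero, Finsupp.single_add]; abel, coeff_mul_X]
      simp
    · intro t _
      congr 1
      rw [Nat.add_sub_add_right, Finsupp.single_add w (t + 1) 1]
      abel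

theorem toFinsupp_append_cons (pre post : List ℕ) (a : ℕ) : (pre ++ a :: post).toFinsupp =
    (pre ++ 0 :: post).toFinsupp + Finsupp.single pre.length a := by
  ext i
  rw [Finsupp.add_apply, List.toFinsupp_apply, List.toFinsupp_apply, Finsupp.single_apply]
  rcases lt_trichotomy i pre.length with h | rfl | h
  · rw [List.getD_append _ _ _ _ h, List.getD_append _ _ _ _ h, if_neg h.ne', add_zero]
  · rw [List.getD_append_right _ _ _ _ le_rfl, List.getD_append_right _ _ _ _ le_rfl]
    simp
  · rw [List.getD_append_right _ _ _ _ h.le, List.getD_append_right _ _ _ _ h.le, if_neg h.ne]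
    obtain ⟨c, hc⟩ := Nat.exists_eq_add_of_lt h
    rw [show i - pre.length = c + 1 by omega]
    simp

/-- Division by `X w - X v`. -/
theorem co_eq_sum (Q : MvPolynomial ℕ ℤ) (pre mid post : List ℕ) (a b : ℕ) {v w : ℕ}
    (hv : v = pre.length) (hw : w = pre.length + 1 + mid.length) :
    co Q (pre ++ a :: (mid ++ b :: post)) = ∑ t ∈ Finset.range (a + 1),
      co (Q * (X w - X v)) (pre ++ (a - t) :: (mid ++ (b + 1 + t) :: post)) := by
  have h : ∀ a b, (pre ++ a :: (mid ++ b :: post)).toFinsupp =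
      (pre ++ 0 :: (mid ++ 0 :: post)).toFinsupp + Finsupp.single v a + Finsupp.single w b := by
    intro a b
    have h1 := toFinsupp_append_cons (pre ++ a :: mid) post b
    simp only [List.append_assoc, List.cons_append, List.length_append, List.length_cons] at h1
    rw [h1, toFinsupp_append_cons pre (mid ++ 0 :: post) a, hv, hw]
    congr 2
    omega
  simp only [co]
  rw [h, add_right_comm, coeff_add_single Q (w := w) (by omega), Int.cast_sum]
  · refine Finset.sum_congr rfl fun t _ => ?_
    rw [h _ (b + 1 + t), add_assoc b, add_comm 1 t, Finsupp.single_add w b]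
    congr 2
    rw [add_right_comm _ (Finsupp.single w b), add_assoc _ (Finsupp.single w b)]
  · rw [Finsupp.add_apply, List.toFinsupp_apply, Finsupp.single_apply, if_neg (by omega), hv,
      List.getD_append_right _ _ _ _ le_rfl]
    simp

/-- The sum over the exponents that arise from those in `r` by division by the differences of the
variables. -/
def divSum {R : Type*} [AddCommMonoid R] (φ : List ℕ → R) : List ℕ → R
  | [] => φ []
  | [a] => φ [a]
  | [a, b] => ∑ t ∈ Finset.range (a + 1), φ [a - t, b + 1 + t]
  | a :: b :: c :: _ => ∑ t₁ ∈ Finset.range (b + 1), ∑ t₂ ∈ Finset.range (a + 1),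
      ∑ t₃ ∈ Finset.range (a - t₂ + 1), φ [a - t₂ - t₃, b - t₁ + 1 + t₃, c + 1 + t₁ + 1 + t₂]

theorem divSum_congr {R : Type*} [AddCommMonoid R] {φ ψ : List ℕ → R} {r : List ℕ}
    (hr : r.length ≤ 3) (h : ∀ ks, ks.length = r.length → φ ks = ψ ks) :
    divSum φ r = divSum ψ r := by
  match r, hr with
  | [], _ => exact h _ rfl
  | [a], _ => exact h _ rfl
  | [a, b], _ => exact Finset.sum_congr rfl fun _ _ => h _ rfl
  | [a, b, c], _ => exact Finset.sum_congr rfl fun _ _ => Finset.sum_congr rfl fun _ _ =>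
      Finset.sum_congr rfl fun _ _ => h _ rfl

theorem co_eq_divSum (Q : MvPolynomial ℕ ℤ) (pre r post : List ℕ) (hr : r.length ≤ 3) :
    co Q (pre ++ (r ++ post)) = divSum
      (fun ks => co (Q * vand (List.range' pre.length r.length)) (pre ++ (ks ++ post))) r := by
  match r, hr with
  | [], _ => simp [divSum, vand]
  | [a], _ => simp [divSum, vand]
  | [a, b], _ =>
    have h := co_eq_sum Q pre [] post a b rfl rfl
    simpa [divSum, vand, List.range'] using h
  | [a, b, c], _ =>
    have h1 := co_eq_sum Q (pre ++ [a]) [] post b c (v := pre.length + 1) (w := pre.length + 1 + 1)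
      (by simp) (by simp)
    have h2 := fun Q b c => co_eq_sum Q pre [b] post a c (v := pre.length)
      (w := pre.length + 1 + 1) rfl (by simp)
    have h3 := fun Q a b c => co_eq_sum Q pre [] (c :: post) a b rfl rfl
    simp only [List.append_assoc, List.cons_append, List.nil_append, List.length_nil,
      add_zero] at h1 h2 h3
    simp only [List.cons_append, List.nil_append, divSum]
    rw [h1]
    refine Finset.sum_congr rfl fun t₁ _ => ?_
    rw [h2]
    refine Finset.sum_congr rfl fun t₂ _ => ?_
    rw [h3]
    refine Finset.sum_congr rfl fun t₃ _ => ?_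
    congr 1
    simp only [List.length_cons, List.length_nil, List.range', vand, List.map_cons, List.map_nil,
      List.prod_cons, List.prod_nil]
    ring

/-- Iterated `divSum`. -/
def divSums {R : Type*} [AddCommMonoid R] : List (List ℕ) → (List ℕ → R) → R
  | [], φ => φ []
  | r :: rows, φ => divSum (fun ks => divSums rows fun l => φ (ks ++ l)) r

/-- Consecutive intervals with the lengths of the given rows. -/
def blocks : ℕ → List (List ℕ) → List (List ℕ)
  | _, [] => []
  | o, r :: rows => List.range' o r.length :: blocks (o + r.length) rows

theorem co_eq_divSums (Q : MvPolynomial ℕ ℤ) (pre : List ℕ) {rows : List (List ℕ)}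
    (hr : ∀ r ∈ rows, r.length ≤ 3) : co Q (pre ++ rows.flatten) = divSums rows fun l =>
      co (Q * ((blocks pre.length rows).map vand).prod) (pre ++ l) := by
  induction rows generalizing Q pre with
  | nil => simp [divSums, blocks]
  | cons r rows ih =>
    rw [List.flatten_cons, co_eq_divSum _ _ _ _ (hr r (by simp)), divSums]
    refine divSum_congr (hr r (by simp)) fun ks hks => ?_
    rw [← List.append_assoc, ih _ _ fun r hr' => hr r (List.mem_cons_of_mem _ hr')]
    simp [blocks, hks, mul_assoc]

theorem flatten_blocks (o : ℕ) (rows : List (List ℕ)) :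
    (blocks o rows).flatten = List.range' o rows.flatten.length := by
  induction rows generalizing o with
  | nil => rfl
  | cons r rows ih =>
    rw [blocks, List.flatten_cons, ih, List.flatten_cons, List.length_append,
      ← List.range'_append_1]

theorem co_graphPoly {rows : List (List ℕ)} (hr : ∀ r ∈ rows, r.length ≤ 3) :
    co (graphPoly (blocks 0 rows)) rows.flatten =
      divSums rows (co (vand (List.range' 0 rows.flatten.length))) := by
  have h := co_eq_divSums (graphPoly (blocks 0 rows)) [] hr
  simp only [List.nil_append, List.length_nil] at h
  rw [h, ← vand_flatten, flatten_blocks]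

/-! ### Coefficients of the Vandermonde determinant -/

/-- The sign of the number of binary digits. -/
def sgn (y : ℕ) : Coef := ∏ i ∈ Finset.range 16, if y.testBit i then -1 else 1

/-- The sign with which the exponent `k` is removed from the set of exponents `M`. -/
def remove (k : ℕ) (g : ℕ → Coef) (M : ℕ) : Coef :=
  if M.testBit k then sgn (M &&& (2 ^ k - 1)) * g (M ^^^ 2 ^ k) else 0

/-- The coefficients of the Vandermonde determinant, by Laplace expansion. -/
def alt : List ℕ → ℕ → Coef
  | [], _ => 1
  | k :: ks, M => remove k (alt ks) M

theorem sgn_and_mask {n : ℕ} {c : Fin n → ℕ} (hc : StrictMono c) (hn : ∀ i, c i < 16) {M : ℕ}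
    (hM : ∀ x, M.testBit x = true ↔ ∃ j, c j = x) (j : Fin n) :
    sgn (M &&& (2 ^ c j - 1)) = (-1) ^ (j : ℕ) := by
  have h : (Finset.range 16).filter (fun i => (M &&& (2 ^ c j - 1)).testBit i = true) =
      (Finset.Iio j).image c := by
    ext x
    simp only [Finset.mem_filter, Finset.mem_range, Nat.testBit_and, Nat.testBit_two_pow_sub_one,
      Bool.and_eq_true, decide_eq_true_eq, hM, Finset.mem_image, Finset.mem_Iio]
    constructor
    · rintro ⟨-, ⟨i, rfl⟩, hi⟩
      exact ⟨i, hc.lt_iff_lt.1 hi, rfl⟩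
    · rintro ⟨i, hi, rfl⟩
      exact ⟨hn i, ⟨i, rfl⟩, hc hi⟩
  rw [sgn, Finset.prod_ite, Finset.prod_const, Finset.prod_const_one, mul_one, h,
    Finset.card_image_of_injective _ hc.injective, Fin.card_Iio]

theorem det_eq_alt {M : ℕ} (ks : List ℕ) {c : Fin ks.length → ℕ} (hc : StrictMono c)
    (hn : ∀ i, c i < 16)
    (hM : ∀ x, M.testBit x = true ↔ ∃ j, c j = x) :
    (Matrix.of fun i j : Fin ks.length => if ks[i] = c j then (1 : Coef) else 0).det =
      alt ks M := by
  induction ks generalizing M with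
  | nil => simp [alt]
  | cons k ks ih =>
    rw [Matrix.det_succ_row_zero, alt, remove]
    split_ifs with h
    · obtain ⟨j, hj⟩ := (hM _).1 h
      have hs := sgn_and_mask hc hn hM j
      rw [hj] at hs
      refine (Finset.sum_eq_single (M := Coef) (ι := Fin (ks.length + 1)) j ?_ ?_).trans ?_
      rotate_left 2
      · rw [hs]
        have := ih (c := c ∘ j.succAbove) (M := M ^^^ 2 ^ k)
          (hc.comp (Fin.strictMono_succAbove j)) (fun i => hn _) fun x => by
            rw [Nat.testBit_xor, Nat.testBit_two_pow, bne_iff_ne, ne_eq]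
            by_cases hx : k = x
            · simp only [← hx, h, decide_true, not_true_eq_false, false_iff, not_exists]
              intro i hi
              exact j.succAbove_ne i (hc.injective (hi.trans hj.symm))
            · simp only [hx, decide_false, Bool.not_eq_false, hM]
              constructor
              · rintro ⟨i, rfl⟩
                obtain ⟨i, rfl⟩ := Fin.exists_succAbove_eq (fun h => hx (by rw [h, hj]) : i ≠ j)
                exact ⟨i, rfl⟩
              · rintro ⟨i, rfl⟩
                exact ⟨_, rfl⟩
        rw [← this]
        simp [Matrix.submatrix, hj]
      · intro i _ hi
        simp [← hj, hc.injective.eq_iff, Ne.symm hi]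
      · simp
    · refine Finset.sum_eq_zero fun j _ => ?_
      have : k ≠ c j := fun hk => h ((hM _).2 ⟨j, hk.symm⟩)
      simp [this]

theorem co_vand {ks : List ℕ} (hn : ks.length ≤ 16) :
    co (vand (List.range' 0 ks.length)) ks = alt ks (2 ^ ks.length - 1) := by
  rw [← det_eq_alt ks (c := Fin.val) Fin.val_strictMono (fun i => i.2.trans_le hn) fun x => by
    rw [Nat.testBit_two_pow_sub_one, decide_eq_true_iff]
    exact ⟨fun h => ⟨⟨x, h⟩, rfl⟩, fun ⟨j, hj⟩ => hj ▸ j.2⟩]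
  rw [vand_range', co]
  simp only [zero_add]
  rw [← Matrix.det_vandermonde (fun i : Fin ks.length => (X (i : ℕ) : MvPolynomial ℕ ℤ)),
    Matrix.det_apply', Matrix.det_apply', coeff_sum, Int.cast_sum]
  refine Finset.sum_congr rfl fun σ _ => ?_
  have h1 : ∏ i, Matrix.vandermonde (fun i : Fin ks.length => (X (i : ℕ) : MvPolynomial ℕ ℤ))
      (σ i) i = monomial (∑ i : Fin ks.length, Finsupp.single (σ i : ℕ) (i : ℕ)) 1 := by
    simp only [monomial_sum_one, Matrix.vandermonde_apply, X_pow_eq_monomial]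
  have h2 : (∑ i : Fin ks.length, Finsupp.single (σ i : ℕ) (i : ℕ)) = ks.toFinsupp ↔
      ∀ i, ks[σ i] = (i : ℕ) := by
    have h3 : ∀ i, (∑ i : Fin ks.length, Finsupp.single (σ i : ℕ) (i : ℕ)) (σ i : ℕ) = i := by
      intro i
      rw [Finsupp.finsetSum_apply, Finset.sum_eq_single i]
      · simp
      · intro j _ hj
        rw [Finsupp.single_apply, if_neg fun h => hj (σ.injective (Fin.ext h))]
      · simp
    constructor
    · intro h i
      rw [← h3 i, h, List.toFinsupp_apply]
      simp
    · intro h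
      ext v
      by_cases hv : v < ks.length
      · obtain ⟨i, hi⟩ := σ.surjective ⟨v, hv⟩
        obtain rfl : (σ i : ℕ) = v := congrArg Fin.val hi
        rw [h3, ← h i, List.toFinsupp_apply]
        simp
      · rw [List.toFinsupp_apply, List.getD_eq_default _ _ (not_lt.1 hv), Finsupp.finsetSum_apply]
        refine Finset.sum_eq_zero fun i _ => ?_
        rw [Finsupp.single_apply, if_neg]
        have := (σ i).2
        omega
  rw [h1, ← eq_intCast (C : ℤ →+* MvPolynomial ℕ ℤ), coeff_C_mul, coeff_monomial, Int.cast_mul]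
  congr 1
  simp only [Matrix.of_apply]
  rw [Fintype.prod_ite_zero]
  simp [h2]

end Coefficients

section Terms

theorem natBeq_eq_decide (a b : ℕ) : Nat.beq a b = decide (a = b) := by
  rw [Bool.eq_iff_iff, Nat.beq_eq, decide_eq_true_iff]

theorem sgn_xor (x y : ℕ) : sgn (x ^^^ y) = sgn x * sgn y := by
  rw [sgn, sgn, sgn, ← Finset.prod_mul_distrib]
  refine Finset.prod_congr rfl fun i _ => ?_
  rw [Nat.testBit_xor]
  cases x.testBit i <;> cases y.testBit i <;> simp

theorem sgn_zero : sgn 0 = 1 := by simp [sgn]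

theorem sgn_two_pow {k : ℕ} (hk : k < 16) : sgn (2 ^ k) = -1 := by
  rw [sgn, Finset.prod_eq_single k]
  · simp
  · intro i _ hi
    simp [hi.symm]
  · simp [hk]

theorem parity_succ (n : ℕ) : parity (n + 1) =
    2 ^ 2 ^ n * (2 ^ 2 ^ n - (parity n + 1)) + parity n := rfl

theorem parity_lt (n : ℕ) : parity n < 2 ^ 2 ^ n := by
  induction n with
  | zero => exact Nat.two_pow_pos _
  | succ n ih =>
    rw [parity_succ, pow_succ 2 n, mul_two, pow_add]
    calc _ < 2 ^ 2 ^ n * (2 ^ 2 ^ n - (parity n + 1)) + 2 ^ 2 ^ n := by omega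
      _ = 2 ^ 2 ^ n * (2 ^ 2 ^ n - (parity n + 1) + 1) := by ring
      _ ≤ _ := Nat.mul_le_mul_left _ (by omega)

theorem sgn_eq_parity {n : ℕ} (hn : n ≤ 16) {y : ℕ} (hy : y < 2 ^ n) :
    sgn y = if (parity n).testBit y then -1 else 1 := by
  induction n generalizing y with
  | zero =>
    obtain rfl : y = 0 := by omega
    simp [sgn_zero, parity]
  | succ n ih =>
    rw [parity_succ, Nat.testBit_two_pow_mul_add _ (parity_lt n)]
    split_ifs with h1 h2 h2
    · rw [ih (by omega) h1, if_pos h2]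
    · rw [ih (by omega) h1, if_neg h2]
    all_goals
      rw [pow_succ] at hy
      have h3 : y = (y - 2 ^ n) ^^^ 2 ^ n := by
        have h4 : y - 2 ^ n < 2 ^ n := by omega
        have h5 := Nat.two_pow_add_eq_or_of_lt h4 1
        have h6 : 2 ^ n * 1 + (y - 2 ^ n) = y := by omega
        refine Nat.eq_of_testBit_eq fun i => ?_
        rw [← h6, h5, Nat.testBit_or, Nat.testBit_xor, ← h5, h6, mul_one, Nat.testBit_two_pow]
        by_cases hi : n = i
        · subst hi
          simp [Nat.testBit_lt_two_pow h4]
        · simp [hi]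
      rw [Nat.testBit_two_pow_sub_succ (parity_lt n)] at h2
      have h4 : y - 2 ^ n < 2 ^ n := by omega
      rw [h3, sgn_xor, sgn_two_pow (by omega), ih (by omega) h4]
      simp only [h4, decide_true, Bool.true_and, Bool.not_eq_true', Bool.not_eq_false] at h2
      simp [h2]

/-- The operator given by a term. -/
def act (t : Tm) (g : ℕ → Coef) (M : ℕ) : Coef :=
  if M &&& t.m = t.m then t.c * sgn (M &&& t.x) * g (M ^^^ t.m) else 0

/-- The operator given by a list of terms. -/
def actL (l : List Tm) (g : ℕ → Coef) (M : ℕ) : Coef := (l.map fun t => act t g M).sum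

/-- The removal of several exponents. -/
def opsL : List ℕ → (ℕ → Coef) → ℕ → Coef
  | [], g => g
  | k :: ks, g => remove k (opsL ks g)

/-- Equality of two functions on the subsets of `{0, …, n - 1}`. -/
def EqBelow (n : ℕ) (g h : ℕ → Coef) : Prop := ∀ M < 2 ^ n, g M = h M

theorem remove_congr {n k : ℕ} {g h : ℕ → Coef} (e : EqBelow n g h) :
    EqBelow n (remove k g) (remove k h) := by
  intro M hM
  rw [remove, remove]
  split_ifs with hk
  · rw [e _ (Nat.xor_lt_two_pow hM (Nat.pow_lt_pow_right (by norm_num) ?_))]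
    by_contra hkn
    rw [Nat.testBit_lt_two_pow (hM.trans_le (Nat.pow_le_pow_right (by norm_num)
      (not_lt.1 hkn)))] at hk
    cases hk
  · rfl

theorem opsL_congr {n : ℕ} {g h : ℕ → Coef} (e : EqBelow n g h) (ks : List ℕ) :
    EqBelow n (opsL ks g) (opsL ks h) := by
  induction ks with
  | nil => exact e
  | cons k ks ih => exact remove_congr ih

theorem remove_of_le {n k : ℕ} (hk : n ≤ k) (g : ℕ → Coef) : EqBelow n (remove k g) 0 := by
  intro M hM
  rw [remove, if_neg]
  · rfl
  rw [Nat.testBit_lt_two_pow (hM.trans_le (Nat.pow_le_pow_right (by norm_num) hk))]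
  simp

theorem remove_zero (k : ℕ) : remove k 0 = 0 := by
  funext M
  simp [remove]

theorem remove_act_of_testBit {k : ℕ} {t : Tm} (h : t.m.testBit k = true) (g : ℕ → Coef) :
    remove k (act t g) = 0 := by
  funext M
  rw [remove]
  split_ifs with hk
  · rw [act, if_neg, mul_zero]
    · rfl
    intro h'
    have := congrArg (fun z => Nat.testBit z k) h'
    simp [hk, h] at this
  · rfl

theorem act_cons {k : ℕ} (hk : k < 16) {t : Tm} (h : t.m.testBit k = false) {c : ℕ}
    (hc : (c : Coef) = if t.x.testBit k then -(t.c : Coef) else t.c) (g : ℕ → Coef) :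
    act ⟨c, t.m ^^^ 2 ^ k, t.x ^^^ (2 ^ k - 1)⟩ g = remove k (act t g) := by
  funext M
  have h1 : M &&& (t.m ^^^ 2 ^ k) = t.m ^^^ 2 ^ k ↔
      M.testBit k = true ∧ (M ^^^ 2 ^ k) &&& t.m = t.m := by
    constructor
    · intro h'
      have h2 := fun i => congrArg (fun z => Nat.testBit z i) h'
      simp only [Nat.testBit_and, Nat.testBit_xor, Nat.testBit_two_pow] at h2
      refine ⟨by simpa [h] using h2 k, Nat.eq_of_testBit_eq fun i => ?_⟩
      have h3 := h2 i
      rw [Nat.testBit_and, Nat.testBit_xor, Nat.testBit_two_pow]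
      by_cases hi : k = i
      · subst hi
        simp [h]
      · simpa [hi] using h3
    · rintro ⟨hk, h'⟩
      refine Nat.eq_of_testBit_eq fun i => ?_
      have h3 := congrArg (fun z => Nat.testBit z i) h'
      simp only [Nat.testBit_and, Nat.testBit_xor, Nat.testBit_two_pow] at h3 ⊢
      by_cases hi : k = i
      · subst hi
        simp [hk]
      · simpa [hi] using h3
  rw [act, remove]
  simp only [h1, ite_and]
  by_cases hM : M.testBit k = true
  swap
  · rw [if_neg hM, if_neg hM]
  rw [if_pos hM, if_pos hM, act]
  by_cases hm : (M ^^^ 2 ^ k) &&& t.m = t.m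
  swap
  · rw [if_neg hm, if_neg hm, mul_zero]
  rw [if_pos hm, if_pos hm]
  have h2 : (M ^^^ 2 ^ k) &&& t.x = (M &&& t.x) ^^^ (if t.x.testBit k then 2 ^ k else 0) := by
    refine Nat.eq_of_testBit_eq fun i => ?_
    rw [Nat.testBit_and, Nat.testBit_xor, Nat.testBit_two_pow, Nat.testBit_xor, Nat.testBit_and]
    by_cases hi : k = i
    · subst hi
      cases hx : t.x.testBit k <;> simp
    · split_ifs <;> simp [hi]
  rw [Nat.and_xor_distrib_left, sgn_xor, h2, sgn_xor, hc,
    show M ^^^ (t.m ^^^ 2 ^ k) = M ^^^ 2 ^ k ^^^ t.m by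
      rw [Nat.xor_comm t.m, Nat.xor_assoc]]
  split_ifs
  · rw [sgn_two_pow hk]
    ring
  · rw [sgn_zero]
    ring

theorem act_one (g : ℕ → Coef) : act oneTm g = g := by
  funext M
  rw [act]
  simp [oneTm, sgn_zero]

/-- The list of terms represents the operator. -/
def TermsRep (n : ℕ) (H : (ℕ → Coef) → ℕ → Coef) (l : List Tm) : Prop :=
  (∀ t ∈ l, t.m < 2 ^ n ∧ t.x < 2 ^ n) ∧ ∀ g, EqBelow n (actL l g) (H g)

/-- The operator is added to the accumulator. -/
def Step (n : ℕ) (F : List Tm → (List Tm → ℕ) → ℕ) (H : (ℕ → Coef) → ℕ → Coef) : Prop :=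
  ∀ acc H0, TermsRep n H0 acc → ∃ acc', TermsRep n (H0 + H) acc' ∧ ∀ k, F acc k = k acc'

theorem Step.congr {n : ℕ} {F : List Tm → (List Tm → ℕ) → ℕ} {H H' : (ℕ → Coef) → ℕ → Coef}
    (h : Step n F H) (e : ∀ g, EqBelow n (H g) (H' g)) : Step n F H' := by
  intro acc H0 h0
  obtain ⟨acc', ⟨h1, h2⟩, h3⟩ := h acc H0 h0
  refine ⟨acc', ⟨h1, fun g M hM => ?_⟩, h3⟩
  rw [h2 g M hM, Pi.add_apply, Pi.add_apply, Pi.add_apply, Pi.add_apply, e g M hM]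

theorem natCast_mod_coef (a : ℕ) : ((a % 4294967296 : ℕ) : Coef) = a := ZMod.natCast_mod a _

theorem natCast_coef_max : ((4294967295 : ℕ) : Coef) = -1 := by
  rw [eq_neg_iff_add_eq_zero]
  exact_mod_cast ZMod.natCast_self 4294967296

theorem insC_spec (t : Tm) (l : List Tm) : ∃ l', (∀ k, insC t l k = k l') ∧
    (∀ g M, actL l' g M = act t g M + actL l g M) ∧
    ∀ u ∈ l', ∃ v ∈ t :: l, u.m = v.m ∧ u.x = v.x := by
  induction l with
  | nil => exact ⟨[t], fun _ => rfl, by simp [actL], by simp⟩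
  | cons u l ih =>
    obtain ⟨l', h1, h2, h3⟩ := ih
    have key : ∀ k, insC t (u :: l) k = bif Nat.beq t.m u.m then
        bif Nat.beq t.x u.x then
          bif Nat.beq ((t.c + u.c) % 4294967296) 0 then k l
          else k (⟨(t.c + u.c) % 4294967296, u.m, u.x⟩ :: l)
        else insC t l fun xs => k (u :: xs)
      else insC t l fun xs => k (u :: xs) := fun k => rfl
    have other : (∀ k, insC t (u :: l) k = insC t l fun xs => k (u :: xs)) →
      ∃ l', (∀ k, insC t (u :: l) k = k l') ∧
        (∀ g M, actL l' g M = act t g M + actL (u :: l) g M) ∧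
        ∀ w ∈ l', ∃ v ∈ t :: u :: l, w.m = v.m ∧ w.x = v.x := by
      intro h
      refine ⟨u :: l', fun k => by rw [h, h1], fun g M => ?_, ?_⟩
      · have := h2 g M
        simp only [actL, List.map_cons, List.sum_cons] at this ⊢
        rw [this]
        ring
      · simp only [List.mem_cons, forall_eq_or_imp]
        refine ⟨⟨u, by simp⟩, fun w hw => ?_⟩
        obtain ⟨v, hv, e⟩ := h3 w hw
        refine ⟨v, ?_, e⟩
        rcases List.mem_cons.1 hv with h | h <;> simp [h]
    by_cases hm : t.m = u.m
    swap
    · exact other fun k => by rw [key, natBeq_eq_decide]; simp [hm]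
    by_cases hx : t.x = u.x
    swap
    · exact other fun k => by rw [key]; simp [natBeq_eq_decide, hm, hx]
    have hsum : ∀ g M, act ⟨(t.c + u.c) % 4294967296, u.m, u.x⟩ g M = act t g M + act u g M := by
      intro g M
      simp only [act, hm, hx]
      split_ifs
      · rw [natCast_mod_coef]
        push_cast
        ring
      · rw [add_zero]
    by_cases hc : (t.c + u.c) % 4294967296 = 0
    · refine ⟨l, fun k => by rw [key]; simp [hm, hx, hc], fun g M => ?_, ?_⟩
      · have h0 := hsum g M
        rw [hc, act] at h0
        simp only [Nat.cast_zero, zero_mul, ite_self] at h0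
        simp only [actL, List.map_cons, List.sum_cons]
        rw [← add_assoc, ← h0, zero_add]
      · intro w hw
        exact ⟨w, by simp [hw], rfl, rfl⟩
    · refine ⟨_, fun k => by rw [key]; simp only [natBeq_eq_decide, hm, hx, hc, decide_true,
        decide_false, cond_true, cond_false]; rfl, fun g M => ?_, ?_⟩
      · simp only [actL, List.map_cons, List.sum_cons]
        rw [hsum, add_assoc]
      · simp only [List.mem_cons, forall_eq_or_imp]
        exact ⟨⟨u, by simp⟩, fun w hw => ⟨w, by simp [hw], rfl, rfl⟩⟩

theorem step_insC {n : ℕ} {t : Tm} (hm : t.m < 2 ^ n) (hx : t.x < 2 ^ n) :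
    Step n (insC t) (act t) := by
  intro acc H0 h0
  obtain ⟨l', h1, h2, h3⟩ := insC_spec t acc
  refine ⟨l', ⟨fun u hu => ?_, fun g M hM => ?_⟩, h1⟩
  · obtain ⟨v, hv, e1, e2⟩ := h3 u hu
    rw [e1, e2]
    rcases List.mem_cons.1 hv with rfl | hv
    exacts [⟨hm, hx⟩, h0.1 v hv]
  · rw [h2, h0.2 g M hM, add_comm]
    rfl

theorem addI_spec {n : ℕ} (hn : n ≤ 16) (k : ℕ) {t : Tm} (hm : t.m < 2 ^ n) (hx : t.x < 2 ^ n) :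
    ((∀ g, EqBelow n (remove k (act t g)) 0) ∧ ∀ d f, addI n k t d f = d) ∨
    ∃ T : Tm, T.m < 2 ^ n ∧ T.x < 2 ^ n ∧ (∀ g, act T g = remove k (act t g)) ∧
      ∀ d f, addI n k t d f = f T := by
  have key : ∀ d f, addI n k t d f = bif Nat.ble n k then d else bif t.m.testBit k then d else
      f ⟨bif t.x.testBit k then t.c * 4294967295 % 4294967296 else t.c, t.m ^^^ 2 ^ k,
        t.x ^^^ (2 ^ k - 1)⟩ := fun d f => rfl
  by_cases h1 : n ≤ k
  · exact Or.inl ⟨fun g => remove_of_le h1 _, fun d f => by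
      rw [key, Nat.ble_eq_true_of_le h1, cond_true]⟩
  have h1' : Nat.ble n k = false := by
    rw [← Bool.not_eq_true, Nat.ble_eq]
    exact h1
  by_cases h2 : t.m.testBit k = true
  · exact Or.inl ⟨fun g => by rw [remove_act_of_testBit h2]; exact fun _ _ => rfl, fun d f => by
      rw [key, h1', h2, cond_true, cond_false]⟩
  · have hk : 2 ^ k < 2 ^ n := Nat.pow_lt_pow_right (by norm_num) (not_le.1 h1)
    refine Or.inr ⟨_, Nat.xor_lt_two_pow hm hk, Nat.xor_lt_two_pow hx (by omega),
      act_cons (by omega) ((Bool.not_eq_true _).mp h2) ?_,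
      fun d f => by rw [key, h1', (Bool.not_eq_true _).mp h2, cond_false, cond_false]⟩
    cases t.x.testBit k
    · rfl
    · rw [cond_true, natCast_mod_coef, Nat.cast_mul, natCast_coef_max]
      simp

theorem step_addI {n : ℕ} (hn : n ≤ 16) {k : ℕ} {t : Tm} (hm : t.m < 2 ^ n) (hx : t.x < 2 ^ n)
    {F : Tm → List Tm → (List Tm → ℕ) → ℕ} {H : (ℕ → Coef) → ℕ → Coef}
    (h0 : (∀ g, EqBelow n (remove k (act t g)) 0) → ∀ g, EqBelow n (H g) 0)
    (hF : ∀ T : Tm, T.m < 2 ^ n → T.x < 2 ^ n → (∀ g, act T g = remove k (act t g)) →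
      Step n (F T) H) :
    Step n (fun acc κ => addI n k t (κ acc) fun T => F T acc κ) H := by
  rcases addI_spec hn k hm hx with ⟨h1, h2⟩ | ⟨T, h1, h2, h3, h4⟩
  · intro acc H0 hacc
    refine ⟨acc, ⟨hacc.1, fun g M hM => ?_⟩, fun κ => h2 _ _⟩
    rw [hacc.2 g M hM, Pi.add_apply, Pi.add_apply, h0 h1 g M hM, Pi.zero_apply, add_zero]
  · intro acc H0 hacc
    obtain ⟨acc', h5, h6⟩ := hF T h1 h2 h3 acc H0 hacc
    exact ⟨acc', h5, fun κ => (h4 _ _).trans (h6 κ)⟩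

theorem step_loop {n : ℕ} {f : ℕ → List Tm → (List Tm → ℕ) → ℕ}
    {H : ℕ → (ℕ → Coef) → ℕ → Coef} (h : ∀ i, Step n (f i) (H i)) (b : ℕ) :
    Step n (loop f b) (∑ i ∈ Finset.range (b + 1), H i) := by
  induction b with
  | zero =>
    rw [Finset.sum_range_one]
    exact h 0
  | succ b ih =>
    intro acc H0 h0
    obtain ⟨acc', h1, h2⟩ := h (b + 1) acc H0 h0
    obtain ⟨acc'', h3, h4⟩ := ih acc' _ h1
    refine ⟨acc'', ?_, fun k => ?_⟩
    · rw [Finset.sum_range_succ, add_comm (∑ i ∈ Finset.range (b + 1), H i), ← add_assoc]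
      exact h3
    · exact (h2 _).trans (h4 k)

theorem rep_nil (n : ℕ) : TermsRep n 0 [] := ⟨by simp, fun _ _ _ => rfl⟩

theorem rep_singleton {n : ℕ} {t : Tm} (hm : t.m < 2 ^ n) (hx : t.x < 2 ^ n) :
    TermsRep n (act t) [t] :=
  ⟨by simp [hm, hx], fun g M _ => by simp [actL]⟩

/-- Two removals after a term. -/
theorem step_addI_addI {n : ℕ} (hn : n ≤ 16) (k l : ℕ) {t : Tm} (hm : t.m < 2 ^ n)
    (hx : t.x < 2 ^ n) :
    Step n (fun acc κ => addI n k t (κ acc) fun T => addI n l T (κ acc) fun T => insC T acc κ)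
      (fun g => remove l (remove k (act t g))) := by
  refine step_addI hn hm hx (fun h g => ?_) fun T h1 h2 h3 => ?_
  · have := remove_congr (k := l) (h g)
    rwa [remove_zero] at this
  · refine step_addI hn h1 h2 (fun h g => ?_) fun T' h4 h5 h6 => ?_
    · rw [← h3]
      exact h g
    · refine (step_insC h4 h5).congr fun g => ?_
      rw [h6, h3]
      exact fun _ _ => rfl

theorem terms_spec {n : ℕ} (hn : n ≤ 16) (r : Row) : ∃ l,
    TermsRep n (fun g M => divSum (fun ks => opsL ks g M) (r.map (· - 1))) l ∧
      ∀ k, terms n r k = k l := by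
  have hone : oneTm.m < 2 ^ n := Nat.two_pow_pos n
  have hone' : oneTm.x < 2 ^ n := Nat.two_pow_pos n
  match r with
  | [] =>
    refine ⟨[oneTm], ?_, fun _ => rfl⟩
    have := rep_singleton hone hone'
    rwa [show act oneTm = fun g M => g M from funext act_one] at this
  | [a] =>
    have key : ∀ k, terms n [a] k = addI n (a - 1) oneTm (k []) fun t => k [t] := fun k => rfl
    rcases addI_spec hn (a - 1) hone hone' with ⟨h1, h2⟩ | ⟨T, h1, h2, h3, h4⟩
    · refine ⟨[], ⟨by simp, fun g M hM => ?_⟩, fun k => by rw [key, h2]⟩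
      have := h1 g M hM
      rw [act_one] at this
      exact this.symm
    · refine ⟨[T], ⟨by simp [h1, h2], fun g M hM => ?_⟩, fun k => by rw [key, h4]⟩
      have := congrFun (h3 g) M
      rw [act_one] at this
      simpa [actL, divSum, opsL] using this
  | [a, b] =>
    obtain ⟨l, h1, h2⟩ := step_loop (fun t => step_addI_addI hn (b - 1 + (t + 1)) (a - 1 - t)
      hone hone') (a - 1) [] 0 (rep_nil n)
    refine ⟨l, ⟨h1.1, fun g M hM => (h1.2 g M hM).trans ?_⟩, h2⟩
    simp [divSum, opsL, act_one, add_assoc, add_comm 1]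
  | a :: b :: c :: r =>
    have h : Step n (loop (fun t₁ => loop (fun t₂ acc k =>
        addI n (c - 1 + 2 + (t₁ + t₂)) oneTm (k acc) fun T =>
          loop (fun t₃ acc k =>
            addI n (b - 1 - t₁ + (t₃ + 1)) T (k acc) fun T =>
            addI n (a - 1 - t₂ - t₃) T (k acc) fun T => insC T acc k) (a - 1 - t₂) acc k)
          (a - 1)) (b - 1)) _ := step_loop (fun t₁ => step_loop (fun t₂ => step_addI
            (H := ∑ t₃ ∈ Finset.range (a - 1 - t₂ + 1), fun g => remove (a - 1 - t₂ - t₃)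
              (remove (b - 1 - t₁ + (t₃ + 1)) (remove (c - 1 + 2 + (t₁ + t₂)) g)))
            hn hone hone' (fun h g M hM => ?_) fun T h1 h2 h3 => ?_) (a - 1)) (b - 1)
    · obtain ⟨l, h1, h2⟩ := h [] 0 (rep_nil n)
      refine ⟨l, ⟨h1.1, fun g M hM => (h1.2 g M hM).trans ?_⟩, h2⟩
      simp only [divSum, opsL, List.map_cons, zero_add, Finset.sum_apply]
      refine Finset.sum_congr rfl fun t₁ _ => Finset.sum_congr rfl fun t₂ _ =>
        Finset.sum_congr rfl fun t₃ _ => ?_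
      rw [show b - 1 - t₁ + (t₃ + 1) = b - 1 - t₁ + 1 + t₃ by omega,
        show c - 1 + 2 + (t₁ + t₂) = c - 1 + 1 + t₁ + 1 + t₂ by omega]
    · rw [Finset.sum_apply, Finset.sum_apply]
      refine Finset.sum_eq_zero fun t₃ _ => ?_
      have h1 := h g
      rw [act_one] at h1
      have h2 := remove_congr (k := a - 1 - t₂ - t₃)
        (remove_congr (k := b - 1 - t₁ + (t₃ + 1)) h1)
      rw [remove_zero, remove_zero] at h2
      exact h2 M hM
    · refine step_loop (fun t₃ => (step_addI_addI hn _ _ h1 h2).congr fun g => ?_) _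
      rw [h3, act_one]
      exact fun _ _ => rfl

theorem packL_cons (t : Tm) (l : List Tm) : packL (t :: l) = t.c % 4294967296 +
    4294967296 * (t.m + 65536 * (t.x + 65536 * packL l)) := rfl

theorem actL_eq_zero {l : List Tm} (h : packL l = 0) (g : ℕ → Coef) (M : ℕ) :
    actL l g M = 0 := by
  induction l with
  | nil => rfl
  | cons t l ih =>
    rw [packL_cons] at h
    have h1 := ih (by omega)
    have h2 : ((t.c : ℕ) : Coef) = 0 := by
      rw [← natCast_mod_coef, show t.c % 4294967296 = 0 by omega, Nat.cast_zero]
    simp only [actL, List.map_cons, List.sum_cons] at h1 ⊢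
    rw [h1, act, h2]
    simp

theorem unpack_sound {N : ℕ} {l : List Tm} {k : List Tm → Bool}
    (hl : ∀ t ∈ l, t.m < 65536 ∧ t.x < 65536) (h : unpack N (packL l) k = true) :
    ∃ l', k l' = true ∧ ∀ g M, actL l' g M = actL l g M := by
  induction N generalizing l k with
  | zero => cases h
  | succ N ih =>
    have key : ∀ q, unpack (N + 1) q k = bif Nat.beq q 0 then k [] else
      unpack N (q / 18446744073709551616) fun l => k (⟨q % 4294967296, q / 4294967296 % 65536,
        q / 281474976710656 % 65536⟩ :: l) := fun q => rfl
    rw [key] at h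
    by_cases hq : packL l = 0
    · rw [hq] at h
      exact ⟨[], h, fun g M => (actL_eq_zero hq g M).symm⟩
    · cases l with
      | nil => exact absurd rfl hq
      | cons t l =>
        rw [natBeq_eq_decide, decide_eq_false hq, cond_false] at h
        obtain ⟨h1, h2⟩ := hl t (by simp)
        have h3 := packL_cons t l
        rw [show packL (t :: l) / 18446744073709551616 = packL l by omega,
          show packL (t :: l) % 4294967296 = t.c % 4294967296 by omega,
          show packL (t :: l) / 4294967296 % 65536 = t.m by omega,
          show packL (t :: l) / 281474976710656 % 65536 = t.x by omega] at h
        obtain ⟨l', h4, h5⟩ := ih (fun u hu => hl u (by simp [hu])) h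
        refine ⟨_, h4, fun g M => ?_⟩
        have h6 := h5 g M
        simp only [actL, List.map_cons, List.sum_cons] at h6 ⊢
        rw [h6, act, act, natCast_mod_coef]

/-- The value of `ev` modulo `2 ^ 32`. -/
def evC : List (List Tm) → ℕ → Coef
  | [], _ => 1
  | l :: ls, M => actL l (evC ls) M

theorem ev_cons (P : ℕ) (l : List Tm) (ls : List (List Tm)) (M : ℕ) : ev P (l :: ls) M =
    (l.map fun t => bif Nat.beq (M &&& t.m) t.m then (bif P.testBit (M &&& t.x)
      then t.c * 4294967295 else t.c) * ev P ls (M ^^^ t.m) else 0).sum := by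
  have key : ev P (l :: ls) M = List.rec (motive := fun _ => ℕ) 0
      (fun t _ acc => bif Nat.beq (M &&& t.m) t.m then
        acc + (bif P.testBit (M &&& t.x)
          then t.c * 4294967295 else t.c) * ev P ls (M ^^^ t.m)
        else acc) l := rfl
  rw [key]
  clear key
  induction l with
  | nil => rfl
  | cons t l ih =>
    rw [List.map_cons, List.sum_cons, ← ih]
    dsimp only
    cases Nat.beq (M &&& t.m) t.m
    · rw [cond_false, cond_false, zero_add]
    · rw [cond_true, cond_true, add_comm]

theorem ev_eq {n : ℕ} (hn : n ≤ 15) (ls : List (List Tm)) {M : ℕ} (hM : M < 2 ^ n) :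
    ((ev (parity 15) ls M : ℕ) : Coef) = evC ls M := by
  induction ls generalizing M with
  | nil => exact Nat.cast_one
  | cons l ls ih =>
    rw [ev_cons, evC, actL, Nat.cast_list_sum, List.map_map]
    congr 1
    refine List.map_congr_left fun t _ => ?_
    rw [Function.comp, act]
    by_cases ht : M &&& t.m = t.m
    · have h1 : M ^^^ t.m < 2 ^ n := Nat.xor_lt_two_pow hM (ht ▸ Nat.and_le_left.trans_lt hM)
      rw [if_pos ht, natBeq_eq_decide, decide_eq_true ht, cond_true, Nat.cast_mul, ih h1]
      have h2 : M &&& t.x < 2 ^ 15 := (Nat.and_le_left.trans_lt hM).trans_le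
        (Nat.pow_le_pow_right (by norm_num) hn)
      rw [sgn_eq_parity (by norm_num) h2]
      congr 1
      cases (parity 15).testBit (M &&& t.x)
      · simp
      · rw [cond_true, Nat.cast_mul, natCast_coef_max]
        simp
    · rw [if_neg ht, natBeq_eq_decide, decide_eq_false ht, cond_false, Nat.cast_zero]

end Terms

section Evaluation

open MvPolynomial

theorem remove_sum {ι : Type*} (k : ℕ) (s : Finset ι) (f : ι → ℕ → Coef) (M : ℕ) :
    ∑ i ∈ s, remove k (f i) M = remove k (fun M => ∑ i ∈ s, f i M) M := by
  simp only [remove]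
  split_ifs
  · rw [Finset.mul_sum]
  · exact Finset.sum_const_zero

theorem divSum_remove (k : ℕ) (φ : List ℕ → ℕ → Coef) (r : List ℕ) (M : ℕ) :
    divSum (fun l => remove k (φ l) M) r = remove k (fun M => divSum (fun l => φ l M) r) M := by
  match r with
  | [] => rfl
  | [a] => rfl
  | [a, b] => exact remove_sum _ _ _ _
  | a :: b :: c :: _ => simp only [divSum, remove_sum]

theorem divSums_remove (k : ℕ) (φ : List ℕ → ℕ → Coef) (rows : List (List ℕ)) (M : ℕ) :
    divSums rows (fun l => remove k (φ l) M) =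
      remove k (fun M => divSums rows fun l => φ l M) M := by
  induction rows generalizing φ with
  | nil => rfl
  | cons r rows ih =>
    simp only [divSums, ih]
    exact divSum_remove k _ r M

theorem divSums_alt_append (ks : List ℕ) (rows : List (List ℕ)) (M : ℕ) :
    divSums rows (fun l => alt (ks ++ l) M) = opsL ks (fun M => divSums rows (alt · M)) M := by
  induction ks generalizing M with
  | nil => rfl
  | cons k ks ih =>
    simp only [List.cons_append, alt, opsL]
    rw [divSums_remove]
    simp only [ih]

theorem length_toks (n c : ℕ) : (toks n c).length ≤ n := by
  induction n generalizing c with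
  | zero => simp [toks_zero]
  | succ n ih =>
    rw [toks_succ]
    cases Nat.ble (c % 16) 14 <;> simp [ih]

theorem one_le_of_posR {l : Row} (h : posR l = true) : ∀ a ∈ l, 1 ≤ a := by
  induction l with
  | nil => simp
  | cons a l ih =>
    have h : (bif Nat.ble 1 a then posR l else false) = true := h
    obtain ⟨h1, h2⟩ := and_of_cond h
    simp only [List.mem_cons, forall_eq_or_imp]
    exact ⟨Nat.le_of_ble_eq_true h1, ih h2⟩

theorem allTerms_sound {n : ℕ} (hn : n ≤ 15) {rs : List ℕ} {k : List (List Tm) → Bool}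
    (h : allTerms n rs k = true) : (∀ r ∈ rs, ∀ a ∈ toks 3 r, 1 ≤ a) ∧ ∃ ls, k ls = true ∧
      EqBelow n (evC ls)
        fun M => divSums (rs.map fun r => (toks 3 r).map (· - 1)) (alt · M) := by
  induction rs generalizing k with
  | nil => exact ⟨by simp, [], h, fun _ _ => rfl⟩
  | cons r rs ih =>
    have h : (bif posR (toks 3 r) then fN (packT n r) fun q => unpack 64 q fun t =>
      allTerms n rs fun l => k (t :: l) else false) = true := h
    rw [fN_eq, packT] at h
    obtain ⟨h1, h2⟩ := and_of_cond h
    change unpack 64 (terms n (toks 3 r) packL) _ = true at h2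
    obtain ⟨l, h3, h4⟩ := terms_spec (hn.trans (by norm_num)) (toks 3 r)
    rw [h4] at h2
    have h5 : 2 ^ n ≤ 65536 := (Nat.pow_le_pow_right (by norm_num) hn).trans (by norm_num)
    obtain ⟨l', h6, h7⟩ := unpack_sound
      (fun t ht => ⟨(h3.1 t ht).1.trans_le h5, (h3.1 t ht).2.trans_le h5⟩) h2
    obtain ⟨h8, ls, h9, h10⟩ := ih h6
    refine ⟨?_, l' :: ls, h9, fun M hM => ?_⟩
    · simp only [List.mem_cons, forall_eq_or_imp]
      exact ⟨one_le_of_posR h1, h8⟩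
    · rw [evC, h7, h3.2 _ M hM]
      dsimp only [List.map_cons, divSums]
      refine divSum_congr ?_ fun ks _ => ?_
      · rw [List.length_map]
        exact length_toks 3 r
      · rw [divSums_alt_append]
        exact opsL_congr h10 ks M hM

theorem rowCodes_sound {n q : ℕ} {acc : List ℕ} {k : List ℕ → Bool}
    (h : rowCodes n q acc k = true) : ∃ cs ds, k cs = true ∧ cs.Perm (ds ++ acc) ∧
      Dom (rowsOf n q) (ds.map (toks 3)) := by
  induction n generalizing q acc with
  | zero => exact ⟨acc, [], h, List.Perm.refl _, Dom.nil _⟩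
  | succ n ih =>
    have h : (bif Nat.beq (q % 4096) 4095 then rowCodes n (q / 4096) acc k
      else rowCodes n (q / 4096) (q % 4096 :: acc) k) = true := h
    have hr : rowsOf (n + 1) q = toks 3 q :: rowsOf n (q / 4096) := rfl
    rw [hr]
    cases hb : Nat.beq (q % 4096) 4095 with
    | true =>
      rw [hb] at h
      obtain ⟨cs, ds, h1, h2, h3⟩ := ih h
      refine ⟨cs, ds, h1, h2, ?_⟩
      rw [toks_succ, show q % 16 = 15 by have := Nat.eq_of_beq_eq_true hb; omega]
      exact Dom.empty h3
    | false =>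
      rw [hb] at h
      obtain ⟨cs, ds, h1, h2, h3⟩ := ih h
      refine ⟨cs, q % 4096 :: ds, h1, h2.trans List.perm_middle, ?_⟩
      have htoks : toks 3 (q % 4096) = toks 3 q := by
        simp only [toks_succ, toks_zero]
        rw [show q % 4096 % 16 = q % 16 by omega,
          show q % 4096 / 16 % 16 = q / 16 % 16 by omega,
          show q % 4096 / 16 / 16 % 16 = q / 16 / 16 % 16 by omega]
      rw [List.map_cons, htoks]
      exact Dom.cons (RowGe.refl _) h3 (List.Perm.refl _)

/-- The position of a cell in the list of all cells. -/
def cellPos : List (List ℕ) → ℕ → ℕ → ℕ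
  | r :: rows, i + 1, j => r.length + cellPos rows i j
  | _, _, j => j

/-- The row that contains a given position of the list of all cells. -/
def rowIdx : List (List ℕ) → ℕ → ℕ
  | [], _ => 0
  | r :: rows, x => if x < r.length then 0 else rowIdx rows (x - r.length) + 1

theorem cellPos_spec (rows : List (List ℕ)) {i j : ℕ} (h : j < (rows.getD i []).length) :
    cellPos rows i j < rows.flatten.length ∧
      rows.flatten.getD (cellPos rows i j) 0 = (rows.getD i []).getD j 0 ∧
      rowIdx rows (cellPos rows i j) = i := by
  induction rows generalizing i with
  | nil => simp at h
  | cons r rows ih =>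
    cases i with
    | zero =>
      have h : j < r.length := h
      refine ⟨?_, List.getD_append _ _ _ _ h, if_pos h⟩
      rw [List.flatten_cons, List.length_append]
      exact h.trans_le (Nat.le_add_right _ _)
    | succ i =>
      obtain ⟨h1, h2, h3⟩ := ih (i := i) h
      rw [List.flatten_cons, List.length_append, cellPos]
      refine ⟨by omega, ?_, ?_⟩
      · rw [List.getD_append_right _ _ _ _ (Nat.le_add_right _ _), Nat.add_sub_cancel_left, h2]
        rfl
      · rw [rowIdx, if_neg (by omega), Nat.add_sub_cancel_left, h3]

theorem cellPos_eq (rows : List (List ℕ)) (i j : ℕ) : cellPos rows i j = cellPos rows i 0 + j := by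
  induction rows generalizing i with
  | nil => simp [cellPos]
  | cons r rows ih =>
    cases i with
    | zero => simp [cellPos]
    | succ i => rw [cellPos, cellPos, ih, add_assoc]

theorem rowIdx_of_mem_blocks {rows : List (List ℕ)} {o : ℕ} {xs : List ℕ}
    (h : xs ∈ blocks o rows) : ∃ i, ∀ u ∈ xs, o ≤ u ∧ rowIdx rows (u - o) = i := by
  induction rows generalizing o with
  | nil => simp [blocks] at h
  | cons r rows ih =>
    rcases List.mem_cons.1 h with rfl | h
    · refine ⟨0, fun u hu => ?_⟩
      rw [List.mem_range'_1] at hu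
      exact ⟨hu.1, if_pos (by omega)⟩
    · obtain ⟨i, hi⟩ := ih h
      refine ⟨i + 1, fun u hu => ?_⟩
      obtain ⟨h1, h2⟩ := hi u hu
      refine ⟨by omega, ?_⟩
      rw [rowIdx, if_neg (by omega), Nat.sub_sub, h2]

theorem Win.of_coeff_ne_zero {ts : List Row} (hpos : ∀ r ∈ ts, ∀ a ∈ r, 1 ≤ a)
    (h : coeff (ts.map (List.map (· - 1))).flatten.toFinsupp
      (graphPoly (blocks 0 (ts.map (List.map (· - 1))))) ≠ 0) : Win ts := by
  set rows := ts.map (List.map (· - 1)) with hrows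
  have hflat : rows.flatten = ts.flatten.map (· - 1) := by rw [hrows, List.map_flatten]
  have hlen : rows.flatten.length = ts.flatten.length := by rw [hflat, List.length_map]
  have hmem : ∀ v ∈ (blocks 0 rows).flatten, v < ts.flatten.length := fun v hv => by
    rw [flatten_blocks, List.mem_range'_1] at hv
    omega
  refine (PainterWins.of_coeff_ne_zero (ρ := rowIdx ts) (f := fun v => ts.flatten.getD v 0)
    ?_ h ?_).of_embedding (fun v => cellPos ts v.1 v.2) ?_ ?_ ?_ ?_
  · intro xs hxs u hu v hv
    have hb : ∀ o ts, blocks o (ts.map (List.map (· - 1))) = blocks o ts := by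
      intro o ts
      induction ts generalizing o with
      | nil => rfl
      | cons r ts ih => rw [List.map_cons, blocks, blocks, ih, List.length_map]
    rw [hrows, hb] at hxs
    obtain ⟨i, hi⟩ := rowIdx_of_mem_blocks hxs
    exact (hi u hu).2.trans (hi v hv).2.symm
  · intro v hv
    have hv := hmem v hv
    rw [List.toFinsupp_apply, hflat, List.getD_eq_getElem _ _ (by rwa [List.length_map]),
      List.getD_eq_getElem _ _ hv, List.getElem_map]
    obtain ⟨r, hr, ha⟩ := List.mem_flatten.1 (List.getElem_mem hv)
    have := hpos r hr _ ha
    omega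
  · intro v hv
    rw [List.mem_toFinset, flatten_blocks, List.mem_range'_1, hlen, zero_add]
    exact ⟨Nat.zero_le _, (cellPos_spec ts (mem_cells.1 hv)).1⟩
  · rintro ⟨i, j⟩ hu ⟨i', j'⟩ hv e
    have h1 := (cellPos_spec ts (mem_cells.1 hu)).2.2
    have h2 := (cellPos_spec ts (mem_cells.1 hv)).2.2
    dsimp only at e h1 h2
    obtain rfl : i = i' := by rw [← h1, e, h2]
    rw [cellPos_eq, cellPos_eq ts i j'] at e
    rw [Nat.add_left_cancel e]
  · intro u hu v hv e
    rw [(cellPos_spec ts (mem_cells.1 hu)).2.2, (cellPos_spec ts (mem_cells.1 hv)).2.2] at e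
    exact e
  · intro u hu
    exact (cellPos_spec ts (mem_cells.1 hu)).2.1.le

theorem chkA_sound {e : ℕ} (h : chkA (parity 15) e = true) : Win (rowsOf 7 e) := by
  obtain ⟨rs, ds, h1, h2, h3⟩ := rowCodes_sound h
  refine h3.win ?_
  rw [List.append_nil] at h2
  refine (Dom.of_perm (h2.map (toks 3))).win ?_
  set n := totR (rs.map (toks 3)) with hn
  have h1 : (bif Nat.ble n 15 then allTerms n rs fun ts =>
    Nat.blt 0 (ev (parity 15) ts (2 ^ n - 1) % 4294967296) else false) = true := h1
  obtain ⟨h4, h5⟩ := and_of_cond h1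
  have h4 := Nat.le_of_ble_eq_true h4
  obtain ⟨h6, ls, h7, h8⟩ := allTerms_sound h4 h5
  have hM : 2 ^ n - 1 < 2 ^ n := Nat.sub_lt (Nat.two_pow_pos n) one_pos
  refine Win.of_coeff_ne_zero (fun r hr => ?_) fun h0 => ?_
  · obtain ⟨c, hc, rfl⟩ := List.mem_map.1 hr
    exact h6 c hc
  · set rows := (rs.map (toks 3)).map (List.map (· - 1)) with hrows
    have hlen : ∀ r ∈ rows, r.length ≤ 3 := by
      intro r hr
      simp only [hrows, List.map_map, List.mem_map, Function.comp] at hr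
      obtain ⟨c, _, rfl⟩ := hr
      rw [List.length_map]
      exact length_toks 3 c
    have htot : rows.flatten.length = n := by
      rw [hn, totR_eq, hrows, List.length_flatten]
      simp [Function.comp_def]
    have h9 := co_graphPoly hlen
    rw [co, h0, Int.cast_zero, htot] at h9
    have h10 : divSums rows (co (vand (List.range' 0 n))) = divSums rows (alt · (2 ^ n - 1)) := by
      have hd : ∀ {rows : List (List ℕ)} {φ ψ : List ℕ → Coef}, (∀ r ∈ rows, r.length ≤ 3) →
          (∀ l, l.length = rows.flatten.length → φ l = ψ l) → divSums rows φ = divSums rows ψ := by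
        intro rows
        induction rows with
        | nil => exact fun _ h => h [] rfl
        | cons r rows ih =>
          intro φ ψ hr h
          refine divSum_congr (hr r (by simp)) fun ks hks => ?_
          refine ih (fun r hr' => hr r (List.mem_cons_of_mem _ hr')) fun l hl => ?_
          exact h _ (by rw [List.length_append, List.flatten_cons, List.length_append, hks, hl])
      refine hd hlen fun l hl => ?_
      rw [htot] at hl
      rw [← hl]
      exact co_vand (by omega)
    have h11 := h8 _ hM
    rw [hrows, List.map_map] at h10 h9
    change evC ls _ = divSums (rs.map (List.map (· - 1) ∘ toks 3)) _ at h11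
    rw [← h10, ← h9, ← ev_eq h4 ls hM, ZMod.natCast_eq_zero_iff] at h11
    rw [Nat.blt_eq, Nat.mod_eq_zero_of_dvd h11] at h7
    exact lt_irrefl _ h7

theorem AllWin.succ {T : Tbl} {i : ℕ} (h : AllWin T i) (hi : Win (rowsOf 7 (entry T i))) :
    AllWin T (i + 1) := fun j hj =>
  (Nat.lt_succ_iff_lt_or_eq.1 hj).elim (h j) fun e => e ▸ hi

theorem chkAs_sound {T : Tbl} {n i : ℕ} (hT : AllWin T i) (h : chkAs T n i = true) :
    AllWin T (i + n) := by
  rw [chkAs, fN_eq] at h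
  induction n generalizing i with
  | zero => exact hT
  | succ n ih =>
    obtain ⟨h1, h2⟩ := and_of_cond h
    rw [Nat.add_comm n, ← Nat.add_assoc]
    exact ih (hT.succ (chkA_sound h1)) h2

end Evaluation

/-! ### Strategies of Lister -/

theorem exists_index_remP (p : ℕ → Bool) (l : Row) :
    ∃ ψ : ℕ → ℕ, Set.InjOn ψ {j | j < (remP p l).length} ∧ ∀ j < (remP p l).length,
      ψ j < l.length ∧ p (ψ j) = false ∧ l.getD (ψ j) 0 = (remP p l).getD j 0 := by
  induction l generalizing p with
  | nil => exact ⟨id, Set.injOn_id _, by simp [remP]⟩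
  | cons a l ih =>
    obtain ⟨ψ, hi, hψ⟩ := ih fun j => p (j + 1)
    by_cases hp : p 0 = true
    · refine ⟨fun j => ψ j + 1, fun j hj k hk he => ?_, fun j hj => ?_⟩
      · simp only [remP, hp, if_true] at hj hk
        exact hi hj hk (Nat.succ.inj he)
      · simp only [remP, hp, if_true] at hj ⊢
        simpa using hψ j hj
    · refine ⟨fun j => Nat.casesOn j 0 fun j => ψ j + 1, ?_, ?_⟩
      · rintro (_ | j) hj (_ | k) hk he
        · rfl
        · simp at he
        · simp at he
        · simp only [Nat.add_right_cancel_iff] at he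
          rw [hi (by simpa [remP, hp] using hj) (by simpa [remP, hp] using hk) he]
      · rintro (_ | j) hj
        · simp [remP, hp]
        · simpa [remP, hp] using hψ j (by simpa [remP, hp] using hj)

/-- The position after the vertices selected by `p` are presented, and those in row `i` painted. -/
def reply (p : ℕ → ℕ → Bool) (L : List Row) (i : ℕ) : List Row :=
  (List.range L.length).map fun k =>
    bif Nat.beq k i then remP (p k) (L.getD k []) else decP (p k) (L.getD k [])

theorem getD_reply (p : ℕ → ℕ → Bool) (L : List Row) (i k : ℕ) : (reply p L i).getD k [] =
    if k = i then remP (p k) (L.getD k []) else decP (p k) (L.getD k []) := by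
  by_cases hk : k < L.length
  · by_cases hi : k = i
    · subst hi; simp [reply, hk]
    · have : Nat.beq k i = false := by simpa [natBeq_eq_decide] using hi
      simp [reply, hk, hi, this]
  · rw [List.getD_eq_default _ _ (by simpa [reply] using hk),
      List.getD_eq_default _ _ (not_lt.1 hk)]
    simp [remP, decP]

theorem Win.exists_reply {L : List Row} (hL : Win L) {p : ℕ → ℕ → Bool}
    (hp : ∃ v ∈ cells L, p v.1 v.2 = true) : ∃ i < L.length, Win (reply p L i) := by
  obtain ⟨v, hv, hpv⟩ := hp
  obtain ⟨I, hI, hr, hw⟩ := hL.exists_move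
    (Finset.filter_subset (fun v => p v.1 v.2 = true) (cells L)) ⟨v, Finset.mem_filter.2 ⟨hv, hpv⟩⟩
  obtain ⟨i, hi, hIi⟩ : ∃ i < L.length, ∀ u ∈ I, u.1 = i := by
    rcases I.eq_empty_or_nonempty with rfl | ⟨u, hu⟩
    · exact ⟨v.1, fst_lt_of_mem_cells hv, by simp⟩
    · exact ⟨u.1, fst_lt_of_mem_cells (Finset.mem_filter.1 (hI hu)).1, fun w hw => hr w hw u hu⟩
  refine ⟨i, hi, ?_⟩
  obtain ⟨ψ, hψ, hψ'⟩ := exists_index_remP (p i) (L.getD i [])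
  have mem : ∀ {k j}, (k, j) ∈ cells (reply p L i) → if k = i then
      j < (remP (p i) (L.getD i [])).length else j < (L.getD k []).length := by
    intro k j h
    rw [mem_cells, getD_reply] at h
    split_ifs with hk
    · subst hk; simpa using h
    · simpa [hk, length_decP] using h
  refine hw.of_embedding (fun v => if v.1 = i then (i, ψ v.2) else v) ?_ ?_ ?_ ?_
  · rintro ⟨k, j⟩ h
    have h := mem h
    by_cases hk : k = i
    · simp only [hk, if_true] at h ⊢
      obtain ⟨h1, h2, -⟩ := hψ' j h
      refine Finset.mem_sdiff.2 ⟨mem_cells.2 h1, fun hm => ?_⟩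
      have := (Finset.mem_filter.1 (hI hm)).2
      simp [h2] at this
    · simp only [hk, if_false] at h ⊢
      exact Finset.mem_sdiff.2 ⟨mem_cells.2 h, fun hm => hk (hIi _ hm)⟩
  · rintro ⟨k, j⟩ h ⟨k', j'⟩ h' he
    have h := mem (Finset.mem_coe.1 h)
    have h' := mem (Finset.mem_coe.1 h')
    by_cases hk : k = i <;> by_cases hk' : k' = i <;>
      simp only [hk, hk', if_true, if_false, Prod.mk.injEq] at h h' he ⊢
    · exact ⟨trivial, hψ h h' he.2⟩
    · exact absurd he.1.symm (by simpa using hk')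
    · exact absurd he.1 (by simp)
    · exact he
  · rintro ⟨k, j⟩ - ⟨k', j'⟩ - he
    by_cases hk : k = i <;> by_cases hk' : k' = i <;> simp_all
  · rintro ⟨k, j⟩ h
    have h := mem h
    by_cases hk : k = i
    · subst hk
      simp only [if_true] at h ⊢
      rw [tok, tok, getD_reply, if_pos rfl]
      exact (Nat.sub_le _ _).trans (hψ' j h).2.2.le
    · simp only [hk, if_false] at h ⊢
      rw [tok, tok, getD_reply, if_neg hk]
      simp only [getD_decP, Finset.mem_filter, mem_cells, h, true_and, le_refl]

def geB : Row → Row → Bool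
  | [], _ => true
  | _ :: _, [] => false
  | a :: t, b :: q => Nat.ble b a && geB t q

def domB : List Row → List Row → Bool
  | [], _ => true
  | t :: ts, qs => qs.any fun q => geB t q && domB ts (qs.erase q)

theorem geB_sound {t q : Row} (h : geB t q = true) : RowGe t q := by
  induction t generalizing q with
  | nil => exact .nil _
  | cons a t ih =>
    cases q with
    | nil => exact absurd h Bool.false_ne_true
    | cons b q =>
      rw [geB, Bool.and_eq_true] at h
      exact .cons (Nat.le_of_ble_eq_true h.1) (ih h.2)

theorem domB_sound {ts qs : List Row} (h : domB ts qs = true) : Dom ts qs := by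
  induction ts generalizing qs with
  | nil => exact .nil _
  | cons t ts ih =>
    rw [domB, List.any_eq_true] at h
    obtain ⟨q, hq, h⟩ := h
    rw [Bool.and_eq_true] at h
    exact .cons (geB_sound h.1) (ih h.2) (List.perm_cons_erase hq).symm

/-- Lister wins the position `L` by the move `M`, as the positions in `prev` are lost by Painter:
`R` shows which of them settles the reply in each of the rows. -/
def loses (prev : List (List Row)) (L : List Row) (M R : List ℕ) : Bool :=
  ((List.range L.length).any fun i =>
    (List.range (L.getD i []).length).any fun j => (M.getD i 0).testBit j) &&
  (List.range L.length).all fun i => (fun t : List Row =>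
    (t.any fun l => l.any (Nat.beq 0)) || domB (prev.getD (R.getD i 0) [[0]]) t)
    (reply (fun k => (M.getD k 0).testBit) L i)

theorem not_win_of_zero {t : List Row} (h : (t.any fun l => l.any (Nat.beq 0)) = true) :
    ¬ Win t := by
  simp only [List.any_eq_true] at h
  obtain ⟨l, hl, a, ha, h0⟩ := h
  obtain ⟨k, hk, rfl⟩ := List.getElem_of_mem hl
  obtain ⟨j, hj, rfl⟩ := List.getElem_of_mem ha
  intro hw
  have h1 := hw.one_le (k, j) (mem_cells.2 (by rwa [List.getD_eq_getElem _ _ hk]))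
  rw [tok, List.getD_eq_getElem _ _ hk, List.getD_eq_getElem _ _ hj,
    ← Nat.eq_of_beq_eq_true h0] at h1
  exact absurd h1 (by simp)

theorem loses_sound {prev : List (List Row)} (hprev : ∀ q ∈ prev, ¬ Win q) {L : List Row}
    {M R : List ℕ} (h : loses prev L M R = true) : ¬ Win L := by
  intro hL
  simp only [loses, Bool.and_eq_true, List.any_eq_true (l := List.range _), List.all_eq_true,
    List.mem_range, Bool.or_eq_true] at h
  obtain ⟨⟨i, hi, j, hj, hp⟩, h⟩ := h
  obtain ⟨i, hi, hw⟩ := hL.exists_reply (p := fun k => (M.getD k 0).testBit)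
    ⟨(i, j), mem_cells.2 hj, hp⟩
  rcases h i hi with h | h
  · exact not_win_of_zero h hw
  · refine (?_ : ¬ Win (prev.getD (R.getD i 0) [[0]])) ((domB_sound h).win hw)
    rw [List.getD_eq_getElem?_getD]
    cases hq : prev[R.getD i 0]? with
    | none => exact not_win_of_zero (by decide)
    | some q => exact hprev q (List.mem_of_getElem? hq)

def losesAll : List (List Row × List ℕ × List ℕ) → List (List Row) → List Row → Bool
  | [], prev, root => domB (prev.getD 0 [[0]]) root
  | (L, M, R) :: es, prev, root => loses prev L M R && losesAll es (L :: prev) root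

theorem losesAll_sound {es : List (List Row × List ℕ × List ℕ)} {prev : List (List Row)}
    {root : List Row} (h : losesAll es prev root = true) (hprev : ∀ q ∈ prev, ¬ Win q) :
    ¬ Win root := by
  induction es generalizing prev with
  | nil =>
    cases prev with
    | nil => exact fun hw => not_win_of_zero (t := [[0]]) (by decide) ((domB_sound h).win hw)
    | cons q prev => exact fun hw => hprev q (by simp) ((domB_sound h).win hw)
  | cons e es ih =>
    rw [losesAll, Bool.and_eq_true] at h
    refine ih h.2 fun q hq => ?_
    rcases List.mem_cons.1 hq with rfl | hq
    · exact loses_sound hprev h.1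
    · exact hprev q hq

/-- Decodes a position won by Lister, 24 bits for each row: the tokens in the row, the set of
presented vertices, and a position that settles the reply in this row. -/
def lossOf (w : ℕ) : List Row × List ℕ × List ℕ :=
  (fun vs : List ℕ =>
    (vs.map fun v => [v % 16, v / 16 % 16, v / 256 % 16].filter (Nat.ble 1),
      vs.map fun v => v / 4096 % 16, vs.map (· / 65536)))
    (((List.range 7).map fun k => w / 16777216 ^ k % 16777216).filter (Nat.ble 1))

/-- Positions won by Lister, with winning moves. -/
def lossesSix : List ℕ :=
  [0x1001001001, 0x1011001002, 0x11002011002011002, 0x11111001003, 0x10011021003021002,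
   0x3022031021, 0x3022001003041001, 0x42021051003051002, 0x11061003061003, 0x62021071003071003,
   0x2221081003081002, 0x14211071004071002, 0x7222081031, 0xa32220b10030b1002, 0x71221001004001002,
   0x51022051022091003, 0x610220620210a1004, 0xe10030e10030e10030e1003, 0x2021081004081003081002,
   0x920320c20310d1003, 0xa1032111022131003, 0xb1032142021131004, 0x30220c1031001004,
   0xd10220d1022111004, 0x62032111004111003060001, 0x720310f10040f1003060002,
   0x81022101004101003101002, 0x92021111004111004111002, 0x122032152031161004,
   0xb1022131004131004131002, 0x1022001022011004011003, 0x7322001005001003101001,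
   0x71322161004161003161002, 0x72321171004171004171002, 0x41022041022051005051003,
   0x206332151032161003, 0xf4322162042000003, 0x810431b20321e2031, 0x235322171005171003171002,
   0x94321181005181004000002, 0xa10421610221e10041e1003, 0xb20320b2032111004111003,
   0xc10220c10220d10050d1004, 0xe1043282032242041, 0x1a10220e10050e10040e10030e1002,
   0x2c3043142031101005101002, 0x102032102032161005161003, 0x112032112032171004171004,
   0x1e1032161005161004161003161002, 0x2e2031131005131005131003000002, 0x2814222814222c1003,
   0x192042030031161005161004, 0x1620321620321c10051c1004, 0x231004231004231004231004231004,
   0x20411c10051c10041c1004000002, 0x12032191005191004191003191003, 0x2e14222e1422321004,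
   0x154432154432150003, 0xe14323930431d1032, 0x56431131005131005131003131002,
   0x3964311410523210053b1003, 0x144422162052181005140003, 0x2c6432171006171004171003171002,
   0x2620532d2042262051131004, 0x820532e2041121006121004080002, 0xf10522f10322710063e1004401003,
   0xa20320a20320d10060d10050d1004, 0x2525322525322b10042b1003, 0x945320945320a2053,
   0x3365423365420b10040b1003, 0x3455333455330c10040c1003, 0x111005111005111005111005111005111005,
   0x3665423665420e10040e1004, 0x3765320b10530b1053461004, 0x2c25322c2532321005321005,
   0xb15324a3053171052481005, 0x133433133433133433, 0x1755330e1062341005341004341003,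
   0x3c6541121053111006111004111003, 0x71533171006171005171004171003171003, 0x165533165533165533,
   0x1916331916331c10051c10041c1003, 0x4016334016331d10534f1004, 0x915330915330820630e1005,
   0x815330815330910530f1006, 0x1d16331d1633201005201005201003, 0x1c75331c75331c7533051004,
   0x201642201642541006541005561003, 0x221642553064171062461005571003,
   0x211633211633241005241005241004, 0x217533217533217533091005, 0x256643256643141005141004141004,
   0x242642242642271006271005271004, 0x251633251633281006281005281004,
   0x2856425d30640f10624c10055d1004, 0x4776334776334776330e1004,
   0x186643101063121006121005121004121004, 0x497633497633497633101005,
   0x1a10061a10061a10061a10061a10061a10061a1006, 0x1a56431a56431a5643601004,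
   0x2e56432e56431b30631b10051b1004, 0x4d77334d77334d77334d1005, 0x1d56431d56431d5643631005,
   0x816430816430a1063551006641004, 0x566643566643131064141054, 0xa16430a16430c1063661006661005,
   0x281733281733271053351007671005, 0xa26430a26430d10060d10060d10050d1004,
   0x31644031644031644052064, 0x1c75441c75441c75441c7544, 0x103644103644103644071006071005,
   0x135744135744135744081006081005, 0x1f76441f76441f76441f7644,
   0x105744105744051064071007071006071005, 0x1f77441f77441f77440b3064051005,
   0xc76440c76440c76440c7644021005, 0x937440937440937440e30640e1006,
   0xe76440e76440e76440e7644041006, 0x63655063655063655063655051006,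
   0x53755053755053755073075021007021006, 0xb77550b77550b77550b7755073075,
   0x87655087655087655087655087655, 0xa77550a77550a77550a7755031007031006,
   0x33766033766033766033766001076021007, 0x57766057766057766057766057766021007,
   0x13777013777013777013777013777001077]

/-- Positions won by Lister, with winning moves. -/
def lossesSeven : List ℕ :=
  [0x1001001001, 0x1011001002, 0x1111001002, 0x21002021002021002, 0x11021003021002, 0x3022031021,
   0x3022001003041001, 0x32021051003051002, 0x7222001003051001, 0x12221071003071002,
   0x63222081003081002, 0x41221001004001002, 0x3022041031001003, 0x51022051022071003,
   0xa10030a10030a10030a1003, 0x2021071004071003071002, 0xf30330910220a1002, 0x920320a20310b1003,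
   0xa10220a10220c1004, 0x7332001004001003071001, 0x31333102032030002, 0x7332091041001003,
   0x103033103032103032, 0x863320c10040c10030c1002, 0x1463310c10050c10030c1002,
   0x943210d10050d1004000002, 0xb20420b2041081004081003, 0xc10040c10040c10040c10040c1004,
   0xd5433041042061004061002, 0xb30330b30420b3042061004, 0xb30330b30330b3033071004,
   0x844330a20420a2042, 0x7442071051001004001003, 0x7432071051001005001003,
   0xf30330f30330f30330b1005, 0x764420b10050b10040b10030b1002, 0x233053091042091042201004,
   0x91005091005091005091005091005091005, 0x257543041052041052221004, 0x245330a20520a2052071005,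
   0xc5543041052071005071004071003, 0x253064041043041043041043, 0x73044073044073044073044001005,
   0x83044083044083044083044011006, 0x287644041053041053041053, 0x115644041053041053061005061004,
   0x81006081006081006081006081006081006081006, 0x136754011054011054011054021005,
   0x63075063054063054063054063054, 0x53055053055053055053055053055001006,
   0x63055063055063055063055063055011007, 0x21755031055031055031055031055,
   0x13066013066013066013066013066013066011007, 0x23766013066013066013066013066013066,
   0x13777003077003077003077003077003077003077]

theorem not_win_six :
    ¬ Win [[7, 7], [7, 7, 7], [7, 7, 7], [7, 7, 7], [7, 7, 7], [7, 7, 7]] :=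
  losesAll_sound (es := lossesSix.map lossOf) (prev := []) (by decide +kernel) (by simp)

theorem not_win_seven :
    ¬ Win [[7, 7], [7, 7], [7, 7], [7, 7], [7, 7], [7, 7], [7, 7, 7]] :=
  losesAll_sound (es := lossesSeven.map lossOf) (prev := []) (by decide +kernel) (by simp)

/-! ### The tables of positions won by Painter -/

/-- Positions won by Painter. -/
def painterTable : Tbl :=
  (.node (.node (.node (.node (.node (.node (.node (.leaf
  0xc0705051303080c0705051308120c0705051303020c07050513120200070404110e100c070a0a0a090e0c070a0a0a0b0e0c070a0a0a0b0d0c070a0a05090e0c070a0a050b0f0c070a0a050b0d0c070a05050b0e0c07050505090d0c0705040408090c0705040402090c07050404080b0c07050404020b0c0704040403090c07040404030b07060a0a0a080907060a0a0a020907060a0a05080907060a0a05020907060a0505080907060a0505020907060505050809070605050502090706050504080207060505040309070605040403080706050404030200000000000001)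
  (.leaf
  0x2343594600000623434f5800000623434f46000c1c231e2f2e000c1c231e2e19000c1c233a2f2e000c1c233a2e1900001c1e1e1a190000061e252e1900061c111e1e1900061c2340402f00061c2340401900001c431d333900001c4332383500001c16253b39000623111b1e4200071c4316253500001c2525292e00001c25252e3b00001c25253b330006431b1b1e2e001c230a161639001c230a25253b0006234316402e00001c4325193900001c4325333500001c4325444a00071c43251d2e00061c432525330000002525222b0000001d1d19220000001d1d2239))
  (.node (.leaf
  0xa110d10290000111f0f10200000111b0f0d100000111f0d102d000017161027290000171627282900000c16292c3300001c1627292e0000071c1a192200001c0a292c330000002d242c3e00001c05241a2c00001c05282c3e00001c23242c3c00001c23292c3e070630170409270007060426103b0c07060a04102907061c17040e1007061c17040f1007061c1704102707061c17040e200c07170a1f260f000706043120290c07060a04202907061c170427200007061c15141a00070a1b0209260007041f080926000c061c14241a000c061c14292c0c07060a020b0e)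
  (.leaf 0))) (.node (.node (.leaf
  0x61c111b202900061c1121202907061c23161e2907061c041b1e2000061c1b1b202900061c2121142007061c0a211e140706230a1b21140c07062321202e00061c1b1b142000061c1b21142000061c1b21203b00061c2121202907061c0a1b3a2907061c231b0f1007061c231e1e2907061c0411111407061c1111111507061c23110e1507061c23161624000706111b142e07061c04111b1407061c11111b1507061c23161e2407061c231b0e1507061c231e1e2400061c231625220006040411162e00061c1116162f00061c1116163900061c1616161a0007061c252e19)
  (.leaf
  0x706061c0e0f310706061c0e31310c07061c0f0f0d0c07061c0f0d0d0c07061c0e0e270c0706021818180007060926263100070609263131000706093131310007060b2626310007060b2631310007060b31313107061c1c0b313107061c1c0b0f3107061c1c0b0f0f0c07061c0e0f270c07061c0e27270c070618181818000706262626310007062626313100070626313131000706313131310007062127272707061c1c31313107061c1c0f31310c07061c0f0f270c07061c0f27270707061c23143b070606041818180706061f1818180706060409181800061c11153131))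
  (.node (.leaf
  0x61c161e102700061c161e273d00061c43151431000c061c142c3b000623300e1510000c061c242c3b0007061c24202e07061c230a151407061c2304142707061c2304144107061c23432d2400061c2315273b00070605102427000c061c142e3b00061c2315413b0007061c10242c0007061c14282c0c0706230514390c061c2343143b0c061c23432d2e00061c2315103d00061c230e105000061c3015273b00061c301029410007061c103b3300061c23102941000706210e272800061c3015413b000c061c143b33000706210b274c000c061c243b330c07061c23242b)
  (.leaf 0)))) (.node (.node (.node (.leaf
  0x7061c1f03080207061c1f03081807061c1b030812000706090b180f0007060b180f310007060918260f0c07060403090f0c07060403260f0c07060403260d0c07061f03090e0c07061f03090d0c07061f03260d0c0706160812090c07061e0302090c0706160812260c07061b03020d0c07061b03180f07061c0408120207061c0403120907061c0408121807061c0403021807061c1f08120207061c1f03120907061c1f08121807061c1f03021807061c1b03120207061c1b031218000706090e18260007060918260d00070618260f310c07060412090f0c07060412260f)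
  (.leaf
  0x7040808020200070408020202000704020202020007040409092600070404090b26000704040b0b260000110909092600001109090b26000011090b0b260000110b0b0b2600070404092626000704040b262600001109092626000011090b26260000110b0b2626000706090909090007060909090b00070609090b0b000706090b0b0b0007060b0b0b0b00061c1115151500061c111114140007060909092600070609090b26000706090b0b260007060b0b0b2600061c1b15151500061c111b141400071c23162f2f00071c23162f2e00070609092626000706090b2626))
  (.node (.leaf
  0x231632252200001c23321d3600001c231d1d2b0000061c232b45000000231d4737000000231d373600000023444737000000234437360000061c2337450000002343384800001c2343384700001c2343383600000623431d4600061c2343322b00071c2332252200071c2332402200001c2343444500061c2343252b00061c2343402b00071c23323222000006231d2f22000006231d192200061c23431d3400061c23431d2200000616162e3500061c1116161907061c2311251400061c231640220000062325192b00061c2343442200061c2343443407061c2311162e)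
  (.leaf 0))) (.node (.node (.leaf
  0x71c2325292e0c061c0a040f200c061c04040e0f0c061c0a110e0f07061c30110e1007061c30110f1007061c0a110e2607061c0a11260f00071c110e152600071c110e103100071c1b0e261007061c231615310c061c111f0e2607061c3011102707061c0a1126270c061c2315183100071c11260f1000071c110f103100071c1110312707061c231610310c071c2316142707061c2316312000071c1131204107061c301127280c071c231610200c071c2316203d0c061c0a1f0e150c061c0a1f0f200c061c0a1b0e0f07061c301b0e1007061c301b0f100c07061c0e3129)
  (.leaf
  0x6d6d6d6d6d6d00301313131313000c0303030303000008080808083030306d6d6d6d30303030131313303030301703030c1717170303120c171717050808000a0a0a0808180c070a0a0808180c070a050808180c070505080818303030303003120c1717170312120c171717050802))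
  (.node (.leaf
  0x7061b1b29330c07061b1e1e2907061c1f1b1e2007061c1b1b211007061c1b1b1e0f07061c1b1b1e0d07061c1b1b1e270c07061f1b10270c07061f210f2807061c30210d100c07061c1e283307061c231e0f4107061c231e0d4107061c171b274107061c3021102707061c3021104107061c172127410c07061c1e10330c07061c1e203307061c231e274107061c232110410c07061f21273d07061c3021272007061c3021204107061c3021413d0c07061c1e3d3307061c232120410006111f1b1e14000c1c2121141a00061c1e1e1e1a00071c1b1b202e00071c211e2029)
  (.leaf 0))))) (.node (.node (.node (.node (.leaf
  0xc07170a0426270c070a0a050b0e000706110e150d000706110e0d28000706110f0d1000071c1116102907061c041b080f07061c041b080e07061c0a1b260f07061c0a1b090e07061c0a1b0b0f07061c041b090b07061c041b020e07061c041b092607061c041b020f0c070a0505090f07061c1f1b080f07061c1f1b080e07061c1b1b080907061c1b1b080b07061c1b1b08260c071705050b100c070a050526270c07050505090e0c070505050b0e0007061b0e0d100007061b0e0d280007061b0f0d100c07061b16090e0c07061b1e0b0e0c071c1b1b0e260c07061b1e090f)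
  (.leaf
  0x2322222200000043323636000000004f5858000000004f5557000a0a0a08080800070404090909000011110f0f0f000706110e0e0e000706110e0e0f000706110e0f0f000706110f0f0f0007061b0e0e0f0007061b0e0f0f0007061b0f0f0f0007061c29292900061c231e2e2e00061c2323193900001c234336490000061c2e2e2e0007061b1515150007061c14141400061c23161a2e00061c23162e2e00061c2323393900061c1c232f1900061c2323191900001c23432b2b00001c2343353600000023433658000000234336460000000043585a0000002343585d))
  (.node (.leaf
  0x7061c1f1b263107061c1b1b18260006041f1b0e0f00071f1f1b0e1500071f1f1b0e2000071f1f1b0f200004040404041500040404040410000504111f1f1500001b1b1b142e000c0404041014000c04041f1014000c041f1f1514000c041f1f1014000c1f1f1f1514000c1f1f1f101400071b1b1b1b1a00061b1b1b1b1400170a0a04090f000a0a0504090b000604041f0e15000604041b0910001c04041b0b0e000604041b2610000004111d1529000a0a0a040b26000a0a041f08260030050404090e001c0404040910000004040e2029000c0411110e2000070404042028)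
  (.leaf 0))) (.node (.node (.leaf
  0x61c231e292c00061c2316241a00061c231e241a00061c2325142400061c2325282c07061c231609150c07061116090e07061c23160b150c070623162d240c07062316151407061c2311150d07061c2311152707061c231615260c071c23090e270007061c2d1a290007061c101a290c07061c16101a0c07061c161a200c07061c161a2807061c2316092007061c23160910000706110e102707061c17110e270c07061c162d2e07061c23110e2007061c23160b2007061c23110e1007061c23160e0d07061c23160b1007061c23160e27000706110f102707061c17110f27)
  (.leaf
  0xc0706040926310c0706040b26310c0706040931310c0706040b31310c0717051818180c0706042626310c0706042631310c07060431313107061c2311202007061c04040f0f07061c041f0f0f00061c1b21141407061c231b202007061c232120200706170a0a09090706170a05090907061705050909000604041f15150006041f1f1515000a0a03030312000a0a0303121200170a0a08081800070404090931000a0a0312121200170a0a08021800170a0a081818000a0a12121212000a0a05020202000a0a0504090900060a0a0b0b0b00170a0a02021800170a0a021818))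
  (.node (.leaf
  0x704041b0f20001c3004160f1000061704161027000c061116292c000706040d102800061c0416103b00062304160f14001c2304160d10000c0611163b3300062304162729000623041620510007061b0d10410c0706111f10270007061c20292e07061c301b0d100c07061c16283307061c2311104107061c231b10410007061c283b3307061c3011104107061c301b2d2707061c30160f2707061c30160f4107061c30160d410c07061c1610330c07062316203b07061c23160f4107061c23160d410c07060421273d07061c3011204107061c3011413d07061c301b2720)
  (.leaf 0)))) (.node (.node (.node (.leaf
  0xc070a05050e260c070505050e2606170a0a0a0a0906170a0a0a0a0b06170a0a0a0a2606170a0a0a05260c060a0a0a09260c060a0a0509260c060a050509260c0605050509260c060404040410061c0a0a04040e061c0a0a050410061c0a05051f10061c0a0a04040d061c0a0504042700000a160f102000000014241a2e00000c16141a2e0000001014293400000a160d102d00000a160e151000000c3214241a000000241a2933000005160d102d000007322d242c0000111111141a000000321a2f190000110b18260d000011090b180f000c04040b180d000c04040b180f)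
  (.leaf
  0xc1717171702020c070a0a0808080c070a0a0808020c070a0a08020207060604040e0f0c070a0a0202020c070a0a04090907060604040f0f07061c1c1b20200c070a050808080c070a050808020c070a050802020c070a050202020c070a050409090c0705050808080c0705050808020c0705050802020c0705050202020c0706040909090706061c1115150c07060409090b0c070604090b0b0c0706040b0b0b0c0706040909260706061c1115100706061c1115200c070604090b260c0706040b0b260c0706040926260006061b0e0f0f0707061c1115200c0706040b2626))
  (.node (.leaf
  0x1c231a193b00061c2311193b0c061c231115200007062315143b07061c23431420000006251420290007062343193500061c230f142007061c230a101407061c230a14200007062310143b0007062314203b0007062315293b000006232e19330c061c230a142907061c230a20290007062310293b0007062320293b07061c23431029000000231d2b470000001c2345460000001c4f474500001c2311353700061c23431a3900061c05162c3d00061c171629330007061121292c07061c2343163907061c2343202900061c1716242c0007061c252c3e0007061f16292c)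
  (.leaf 0))) (.node (.node (.leaf
  0x7300409262d0007060a0e20290007060a0f203b0007060a0d202907063017040e2607063017040e3107061717042631070630171f0e26070630171f0e31070617171f26310007061b0e27200007061e0f31200c0706041b10270c071c0a1b0e2007061c171b09100c0630051f26270007060a2720290706301704260d07063017043127070630171f260f070630171f31270c07060a1b203d07061c17040f2007061c171f0f2007061c171b0f270000060e1024270000060f1014270000060e1020280007060a0f1029000c061c14292e00061c231527290000060d102729)
  (.leaf 0)) (.node (.leaf
  0x61c23434f2b00071c2325403400062343114039000c062343393700061c23435435000000003f45460000000043555a00000000384558000000233f3845000000064345580000002343595800000023433f480000002343535800000023434f5700001c23324436000007234347370000072343373600001c231d442b0000071c43374500001c2343564700001c2343563600001c23433f4700001c23434f5500061c2343543400061c234354220000002343474500001c23432b3500061c2343253700001c2343353700061c23434f5300001c2343194700001c23434739)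
  (.leaf 0)))))) (.node (.node (.node (.node (.node (.leaf
  0x70404110f1007060a04041b0e0007061b1b141a0007061b2515140c070604110f100c0706111f0f100c0706041b0f1007061c111b1b1507061c1b1b160f00070404110d10000704041b0e15000704041b0d10070605050411100c0705041b160e0007061b1b241a000706161e10140c070604110e100c070604110d100c0706111f0e100c0706111f0d100c0706041b0e100c0706041b0d100c07061f1b0e100c07061f1b0d100c07061b161e2407061c111b1b1007061c1b1b160e07061c1b1b160d001c231111161a00061c111b162207061c041b1b1407060a04040415)
  (.leaf
  0x6235c480000071c43554500000623431d580000062343385f0000061c234f6a0000002343385700000023435545000000234353460000002343555b0000000043586600000000435b5a00000023435b4500001c322525220000072325222b0000072340223700001c2344442b00000000535d46000000004f58460000001c6753450000072332222b00061c23433f3900061c2343444900061c23433f56000000434f3f4500000000385f58000000001d5846000000003f5c69000000431d3845000000433253450000001c4f3f48000000234f3f58000000234f3f46))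
  (.node (.leaf
  0x1c0404040e0f001c0404042610001c0404040e27000a0a0505314100300404042631000004110f1020000004110f203d0000041131203b0000041111294200170a0a1f260f000c0a0a260f27000c0404042029000c0411112720001c0404040f27001c04041b312700170a0a040b0e0c170a0a05040e00070a040410240c07170a040b0e0c07170a040e260c070a0404161007061704041b10000706040e0d3b0c0706041110270c070604110f200c070604110d2007061c040426270c07060411272007061c040431270c06300a04090e0c073004040b0d0706300a04090b)
  (.leaf 0))) (.node (.node (.leaf
  0x7061c14202e0007061c1a28290c07061c1e102e0c07061c1e202e07061c231e092007061c231e0910000706210e0d10000706210e10270c07061f210e100007061c10292c0007061c2d293307061c171b0e2707061c17210e270c0706231e2d2907061c231b0e2007061c231e0b2007061c231b0e1007061c23210e1007061c23210e2007061c231e0e0d07061c231e0b1007061c231e0e270007061b0f10270007061b0f2728000706210f0d10000706210f27200c07061f1b27200c07061f210f1007061c17210f0d07061c17210f270c0706231e10290c0706231e2029)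
  (.leaf
  0xc0706080802180c0706080818180c0705031212120c0730050802180c0730050818180007040802021800070408021818000704081818180007041f0826260c0706080202020c0706080202180c07061c0e0d270c0706080218180c0706081818180c0705121212120c0730050202180c0730050218180c073005181818000704020202180000110909093100001109090b31000011090b0b310000110b0b0b3100070402021818000011090926310000110b0b2631000011090931310000110b0b313100070402181818000011092626310000110b26263100001109263131))
  (.node (.leaf
  0x14243c3b00000c32242c3b0000061614293b00001716102941000000141a3b3300002125090e2700000c25142e3b00000616153b33000000241a3b4b000005161027200000111e0b0d2000000616103b4b00000a111027290000111b0e102700000716142c3b00001c1615293b000023160e102e00000a1610272800000c161a294b00000716143b4b000000143b334b00000a16272028000011210e273d00000c161a3b4b000000243b334b000011210d2720000000292e2c3b00001f160d10270000111b0f1027000030250d10140000171627202900001c16294133)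
  (.leaf 0)))) (.node (.node (.node (.leaf
  0xc070a040409180c070a040418260706170a0a092607060a0a05182607061705040209070617050409180706170504183107061704041209070617040402180000061615141a00070a0402090e00070504020e260007171108260f00061c11080e1500061c1b080e1500061c160809150007171b02260d0000060e0f10240000060e0d10140000060f0d1029000c06110e1510000c06110d102d000c061b0e1510000c061b0d1028000c06160e0f10000c06160e0d1000070602090b0e00070616090e10000706160b0e1000070616090f10000706160b0f10000706160e2610)
  (.leaf
  0x7061b0d27270c07061c0d272707061c1c2329290707061c2324290707061c23243b0c07061c2727270707061c2329290707061c23293b0707061c233b3b07061c1c1b101007061c1c21101000061c233a1a1a07061c1c1b102007061c1c21102000061c231e1a2e00061c233a1a2e07060604040e0e070606041f0e0e0706061f1f0e0e07070604040e0f070706041f0e0f0707061f1f0e0f0006061c1e1a2e07070604040f0f070706041f0f0f0706061c1b20200c061c1c1114140706061c21202000061c233a2e2e000c1c234322220707061f1f0f0f00061c1b1b1414))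
  (.node (.leaf
  0x7061c28292e0007061c292c3d0007061c2c3d3b0007061c243d330c071c230a292c0c07061c432a3507061c2343283b07061c2343293d07061c2343242007061c234328290007061c293d330007061c3d3b330c07061c173b4e0c07061c21292e0c07061c433b4d0c07061c234c3707061c23433d3b07061c2304161907061c2343252c00061c23161a2900061c2316201900061c2316292e00061c23161a3b07061c23041e1907061c231b1e1a07061c231b3a1a0c071c2343142e00061c231e1a2900061c233a1a2900061c231e292e00061c231e1a3b00061c233a292e)
  (.leaf 0))) (.node (.node (.leaf
  0x61c1b0e0f310c061c231114270c061c231b14270c061c231626140c061c231614310c061c23161027061c23301b263100061c110f314100061c1131274100061c1b2631200c061c23160f200c061c231627200c0706230e26100c061c231e0e150c061c231e150f0c061c231e14310c061c231e15270c061c231e102700061c1b0f312700061c1b31274100061c210f312700061c213127410c061c231e0f100c061c231e272000071c23161a2e00071c2325241a00061c0a16151a00061c0416101400061c0416142000061c1116151000071c2325242e00061c110e260f)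
  (.leaf 0)) (.node (.leaf
  0xc071c111b1e1407061c041b1e15000706111b292e0c0706111b1e2c07061c041b1e10000705111110270007051b1b102700060511110d27000605111b0d2700061c111610200007231b1b102907061c232115410c07061c1e2d3300070a111b10270006171b1b104100060a1b1b0d2700063011160e10000706110f1041000730111110240006051b1b0d2700061c1111103b000006162e3d3b00063016160e4100063016160f41000c061616143b000623161610310006231616092000070511112728000705111b273d000704041e0e27000c061616243b00062311160e20)
  (.leaf 0))))) (.node (.node (.node (.node (.leaf
  0x170a0a0a261000170a0a04260d000a0a0a05090e000a0a0a050b0e0000111111102f000c040404102900060404040e1000060404040f10000a0a0a0a0b0e071717050505100c170a0a0a040f07170a0a0a040907170a0a0a040b07170a0a0a042607170a0a0504260717050505040b071705050504260c070a0a05090d0c0704040411100706040404040f07060404041b260c1717170a1b2000070a11110f100007061616151400061c1111151400061c111b151400061c1616150f000004110e1510000011110f0d100000111b0e0f1000070a111b0e100000061610142e)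
  (.leaf
  0x61c1c14141400001c232f2f2f00001c232f2f2e00001c232f2e2e00001c232e2e2e00061c23232e2200001c2343224700001c23432236000606110e0e0e0006061b0e0e0e0006061c14141400061c1c232e22000606110e0e0f000606111b141400001c16162f2f00071c1c162f2f0006061b0e0e0f00071c1c14142000071c1c14141400061c23232f1900061c23232f2f000606110e0f0f0006060614141400001c1c2f2f2f00061c1c1c2e2200001c2323224700001c2323223600000023434758000000234347460006061c14142000001c1c2f2f2e00001c1c2f2e2e))
  (.node (.leaf
  0xa0a0a050e26000a0a04040918000011110e1027000011110d2d27000011110e0f20000011110e0d20000011110f0d2000001111261020000a0a0a052627000011110e2720000011110f2720000011110d2720000a0a0a1f092600300a0a1b3127000011110f1027000011110f27280000111131273b00001111112019000a0a0a04090b000a050504090b0005050504090b0c0a0a0a0504090c0a0a0a05040b0c170a0505040d0c0a0a050504090c0a05050504090c05050505040907170a0a05040907170a0505040907170a05050426071705050504090c070404041b10)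
  (.leaf 0))) (.node (.node (.leaf
  0x1c11252e190000001c3f37360000061c3f192200001c23322f2200001c231d2f1900001c23382e1900000623252f2b00061c231e141a00061c2325152e0000111f16242c000011161610240000051616283e000000322c193c00001c16162c1907061c040416140007061c321a2f00061c0a1614290007061c322e1900061c2316142e00061c2316242c00061c2316292c00061c1b160f1400061c16160f2007061c041b16150000061614282e0007061616142800001b1b0e0f100007051b1b0e1000061711110e100000061624202c000c061616142900070616161420)
  (.leaf
  0xc0705051f090900070404090b31000704040b0b310c07061f0909310706061c2115200c07061f090b310c07061f0b0b310706061f1f0e0f0c0705050218180c0705051f092600070404092631000704040b263100070404093131000704040b31310c07061f0926310c07061f0b26310c07061f0931310c07061f0b31310c0705051818180c0705051f2626000704042631310c07061f2626310c07061f2631310c07061f31313107061c1f1f0f0f00061c2121141400001c1e1e2f2f07060a0a0a090907060a0a05090907060a050509090706050505090900061f1f1f1515))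
  (.node (.leaf
  0x61c1616104100061c16160f3d00061c16160d3d00061c1616273d0006231111272900062311160d100006231b160f100006231b160d100006231b161027000623161626100007040421272000000616203b4b000006163d3b330006301116413d0006301b1627200006301b16415100063016162741000c0616253d3b0006231111413b0006231116413d000623111627200006231b1627200006231b1620410006231b164151000623161631200000111116202e00001b1616101400001b1616142000001b16162029001c0a1b16162000071c1116202900071c1b161420)
  (.leaf 0)))) (.node (.node (.node (.leaf
  0x3017171717170917171717171702000a0a0a0a090f30171717171726000a0a0a0a260f303030301704270c0a0a0a0a0a0f0617171705040f303017170a0a02303017170a05080c0a0a0a0a04090c0a0a0a0a040b0c1717170a08120c070504040b180c07040404120b00070404090b18000704040b18310c0705040408260c07040404032607060505040818070605040408120706050404031807060404040312000704040918260c070a0a0a26270c070a0a05260f0c07050505260d0c0705040409180c0705040402260c0705040418260c0704040412090c070404041226)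
  (.leaf
  0x7070505121212000604041818180c0606041818180c06061f18181807070a0a08121207070a0508121207070505081212000604040918180c0606040918180c06061f09181807070a0a08081207070a05080812070705050808120707060409091800061c1115153100061c1b15153100061c11150f3100061c1b150f31000606110f0f3107061c1c0f0f3100061c2314144100001c232f2f5100061c2343224b000604040909180c0606040909180c06061f09091807070a0a08080807070a0508080807070505080808070706040909090006061115150f00060611150f0f))
  (.node (.leaf
  0x61c041e202900001c23402f2200061c1121101400071c2340141a00061c233a141a00061c2340151a00061c2340101a00061c23401a2007061c23431a4100071c2314413b00061c2344413300001c232f3b4b00071c2343223307061c234315140c071c23431a29071c23433014410c071c23431a3b001c23301e202e00071c23252e3b00001c233b333900061c23431a2f001c233016202e000c1c23162e1900061c2325101a00061c3032142e000623171b141a00061c23251a2000061c23251a3d00001c16142e41001c230a161441000c1c23251a2e00071c23251a3b)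
  (.leaf 0))) (.node (.node (.leaf
  0xc06160e1027000c06160f1027000c06160d1027000c06160e0f20000c0616261020000706160e312000061c110e314100061c1b0e312700061c110b0f0d00061c1b0b0f0d00061c16090b0f00061c16020e0f00061c160b0e3100073004260f0d000730110b31410000060e0f20290000061031203b0000060e2720290000060f2720290000060d27203b000630110b2631000c0616103120000c06160e2720000c06160d2720000706160f31200007061631272000061c11020f1000061c1b020f1000061c160e180f00061c1609260f00061c160b260f00061c160e2631)
  (.leaf 0)) (.node (.leaf
  0x1c23442f19000000251a19390000231125193b000007231a2f39000007232e19390000072344192b0000062344223900001c2344223300001c23442f3900001c2344193900061c2343343b07061c2343324b07061c23431d540c061c23434f220c061c23434f34000023430a222b0000234316323600002343111d3600001c434f324700001c434f3236000023434f1647000023434f3237000000002b36450000002343364500001c232e225100062343171a2f0000001c222b3500071c23434f4700071c23434f3600001c23432b490000001c22354a0000001c193560)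
  (.leaf 0))))))) (.node (.node (.node (.node (.node (.node (.leaf
  0x7060a04041b0f0706040404040e0c0706041b150f0c0706041b0f200c0706041f0f140c07061f21150f0c07061f1b0f100006040404150f00060404040f20000604041f150f000604041f0f200006041f1f150f0006041f1f0f2000061f1f1f150f00061f1f1f0f1007061c0404090e00061c1b1e1d1407061c1b1b1b1507061c1b1b1b1000000015141a19000c17120209180c171717171209000a0a0a0a090e000011161615140c070a0a1303080c070a0a1308120c070a0a1303020c070a0a1312020c070a051303080c070a051308120c070a051303020c070a05131202)
  (.leaf
  0x234f535b00000023222b4200001c231d224b00061c2343325e00061c23431d6800001c2343674700001c2343675300000023435d5c0000002343675500000023435b5b000000004346660000001c434f5a0000001c435d4600001c23434f4500000000005a650000000043626200000000234f6400000000434f6300000723433f4600000023434f6200071c23431d2b00071c234332360000001c23455800000023432b58000000234337580000002343475c00000023432b460000002343374600001c2343385d00001c2343533700001c234353590000002343365c))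
  (.node (.leaf
  0x7061c04040e3107061c041f0e310c07300a1b0b270007060426203b0706300a0409260706300a0409310706300a040b310c0706041b0e200c0706041b0d2007061c041b093107061c041b0b310c07170a0431410c0717051f26270706300a0426310c0706041b272007061c04040f3107061c0404314107061c041f0f3107061c041f314107061c041b2631000000141a292e000017110e102c000000241a292c00000c16242e2c0000061615292e0000111f0e151000000014292e330000071614292e00000024292e330000111b0e0d1000000020292c3e00000028291933)
  (.leaf 0))) (.node (.node (.leaf
  0xc07061c1e282e07061c231b0f2007061c231b0d2007061c23210f2007061c2321272007061c231e262007061c231b0d1007061c231b102707061c231b272007061c23210f1007061c23210d1007061c2321102707061c2321272807061c23210d2007061c231e0f0d07061c231e261007061c231e0f2707061c2311150f07061c11111b1007061c041b161000061c1111142007061c23110f1000061c1111202900061c1b16102007061c0a11162907061c2316162907061c111b160f07061c0a11211a00061c1121142000061c1621102007061c04111b2900061c111b1420)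
  (.leaf
  0x11093131310000110b31313100001111272727000704181818180007041f2626260000111b0d0d0d0000112626263100001126263131000011263131310000113131313100001121272727000023162020200c0706020202020c07061c0e0e0d0c0706020202180007060909093100070609090b31000706090b0b310007060b0b0b3107061c1c0b0b0b0706061c0e0e310c07061c0e0f0d0c07061c0e0d0d0c07060202181800070609092631000706090b26310007060b0b263100070609093131000706090b31310007060b0b313107061c1c0b0b3107061c1c0b0b0f))
  (.node (.leaf
  0x1c1610293b000023320d10240000111b0f273d000030161020290000301610293d0000171629413d00000716293b3300001c16293d3b00002316102029000000293b334b0000111f27283d0000301629413b000011210f272800000c163b334b00001c16413b4b0000231610203b0000001d3b33520000303220294100003032413b5100000c1d3d3b4b0000231620293d0007041f1b0f100007041f1b0d10000617111b0f10000617111b2720000006401014240000061e2029330000061e28292c000706161e282900061c1b21102900061c161e0f1000061c161e0d10)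
  (.leaf 0)))) (.node (.node (.node (.leaf
  0x70616260f1000070616260d1000061c11090e0f00061c110b0e0d00061c11020e1000061c110e260d00061c11260f0d00061c1b090e0f00061c1b0b0e0d00061c1b020e1500061c1b0e260f00061c1b260f0d00061c16090b0e00061c16090e2600061c160b0e2600061c1609260d00061c160b26270c070604030b0e0c07061f030b0e0c07060403090d0c071c1b08120b0c071c1b030b18000706090b180d0007060b180d310c070604120b0e0c07061f120b0e0c07061b03080e0c071c1b12020b0c07061b12180d0c071c1b03082607061c0403080207061c04030818)
  (.leaf
  0xc061c1c1b141407070a0a0a090907070a0a05090907070a0505090907070505050909000604040415150c0606040415150c0606061115150c061c1c21141400071c231e2f2f00071c231e2f2e00061c1c3a1a1a000c1c2323222200071c233a2f2e00071c233a2e2e0c0606041f15150c071c1c1114140c06061f1f15150c06061c1b151500071c1b1b14140c071c1c1b14140c071c1c2114140006061b1b14140c0705050409090c070505040b0b000a0a03030303000a0a0a080802000a0a0a080202000a0a0a020202000a0a0a0409090007040808080800070408080802))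
  (.node (.leaf
  0x61c233a1a3b07061c2343402c00001c2332223900001c2332393500061c23431d3500061c23162e3b00061c23163b4b07061c23041d3b07061c234325330c07061c23293700061c231e2e3b00061c233a2e3b00061c233a3b4b0c071c23433b4b07061c2304403300061c231e3b3307061c2343403300061c2311254a00001c232539350007061c43393700001c2325223900001c2340223900001c2340394900061c2343443500061c2316322200061c2332252f0c061c2316161a0c061c23161e1a00071c23432f1900071c23432e2200001c23431d4500000032322237)
  (.leaf 0))) (.node (.node (.leaf
  0xc061c2316150f00061c0416102900071c2325142e00061c2325202e00060a11110e0f00060a111b0e0f00071c1116152900071c1b16101400060a1111261000060a111b261000060a111b103100060a1b1b261000060a1b1b1031001c3011110e1500071c1616102000061c16160e200006041111260d001c3016160e31000c1c1616142000061c16162720001c2311110f10001c23111b0f10001c3011110f10001c3016160f31001c3016163127000c1c1616203b001c23111b0f200c061c23160e150c061c23160f1000001c1614202900001c1620293b00071c2325141a)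
  (.leaf 0)) (.node (.leaf
  0x623111610410006231b160e200006231b16104100062316160d270007061b1b14330007061e1e14200c07061b1b1e2e07061c1b1b211507061c1b1b1e0e07061c30210e1007061c231e0e4107061c302115410c0706231e143d0c07061f2115270006301111103d0006171b1b272000000616283b4b0006301b1610410006171b16274100070616163b5100061c1616204100061c1616415100062311160d200006231b160f200006231b160d200006231616262000062316160f4100062316160d41000623161627410c0704041f1b100c07051f1b1b1007060a04041b27)
  (.leaf 0))))) (.node (.node (.node (.node (.leaf
  0x616142d1a00001c16161a2f000c061616151a000706161610140007061616142d00061c16160e1500061c1616150d000011110e0f10000011110f0d2d00070a11110e100000061610292e000c06161614240007061616102900061c1b16151000061c16160f10000011110e0d1000070511110e1500070511110d1000060511110e0d00001c16102429000006162d242c0000061616242b000c0616251024000c061616242a00061c1111101400061c111b101400061c1b1b101400061c16160e1000061c16160d100007061116151a000706110e0d100c07170a04090d)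
  (.leaf
  0x1c1c2f2f3b00061c23232f3900071c1c1e2f2f00061c2323223300001c2343473500001c2343474900001c1614142000001c1c1a1a2e000023231122220000004343474700001c1c1a2e2e0000060f0f0f0f00001c1c2e2e2e0000060d0d0d0d0007040409090b00070404090b0b000704040b0b0b000011110d0d0d000706110d0d0d0007061b0d0d0d000011090909090000110909090b00001109090b0b000011090b0b0b0000110b0b0b0b0000060e0e0e0e00001c1614141400001c1c1a1a1a000006231a1a2e000006231a2e2e000006232e2e2e000006232f2f2f))
  (.node (.leaf
  0x7060404041f0f07060404041f0e07060404041b0907060404041b0b000706110d1041000706110e0d20000706110f0d20000706110e2720000706110f27200007061e0d2d310007061b0e0d200007061b0f0d200c07061b1b0d4107061c1f1f0e310c071705050e27000706160d31200007061b0f27200c071c1f1b0e270c07061b1e0e310c07061b1b093d0c07061b160b2707061c1f1b093107061c1f1b0b3107061c1b1b0b1807061c1b1b02310c0730051131410c071c1b1b0f310c07061b1626270c071c1b1b312707061c1f1f0f3107061c1f1f312707061c1f1b180f)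
  (.leaf 0))) (.node (.node (.leaf
  0x61c16161527000704111f0e1000070616162d29000704041b0f1000061711110f1000061711110d10000617111110270006171111273d000617111b0d10000617111b10270006171b1b0d100006171b1b10270000061620292c0000061628292c000706161620290007061616282900061c1616102700061c161627280007061c251a2f0000061614202e0006230a16152900061c0416202900061c2325142900000616241a280007061f16242c0000061c2c193c00061c0516282c00061c051e282c000c061c252c220007061c241a2800061c2316242e00061c23162933)
  (.leaf
  0xc061c1f1f0f0f00071c2121141407171717170802071717171708080c0605050509090717171717020200050505050e0e0c1717131313130c3017170303120c3017170508080c07170a0808180c0717050808180c3017170312120c3017170508020c07170a0802180c07170a0818180c0717050802180c0717050818180c3017171212120c3017170502020c07170a0202180c07170a0218180c07170a1818180c07170502021800070a040b0b310c0706040909310706061c1b15200c070604090b310c0706040b0b31070606041f0e0f0c07170502181800070a040b2631))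
  (.node (.leaf
  0x7231616251400072316163229001c231116161400070404110e3d00063004160e14000c061132243b00062304320e1007061c2311154107061c231b154107061c2316093d07061c30110d1000070623142d3b000706232d243b07061c30160e0d0c07061c162d330007040421150f00060504111027000605041b10270006170416104100061c043229410007062314283b0c07061c16153307061c3011154107061c30160e2707061c30160e410c07061c162e3d07061c231b413d0c0706042110270007061c2d3b3307061c301b102707061c23160e41000704111f1027)
  (.leaf 0)))) (.node (.node (.node (.leaf
  0x7060a0a0a091807060a0a0a182607060a0a05091807060a0505091807060a050518260706050505091807060505051826070605050412090706050504021807060504041202070605040412180005050505090e000a050504080e000505040408260c070a0505090e061c0a041f1f09000a0a0505090e000a0a05050b0e000a0a0505260d000a050505090e000a0505050b0e000a050505260d00050505050e2600050505052627000a0a05040b26000a0505040b2600050505040b2607170a0a0a0a0e070a0a0a0a0509070a0a0a0a050b0c070a0a0a0e260c070a0a050e26)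
  (.leaf
  0x706061c0e0e0e0706061c0e0e0f0006061b15150f0706061c0e0f0f0006061b150f0f000604040909090c06060409090900071c110e0e0f00071c110e0f0f07061c1c0f0f0f07061c1c11151007061c1c1115150c06061f0909090c06061c0e0e0e0c06061c0e0e0f0c06061c0f0f0f00071c1b0e0e0f00071c1b0e0f0f0c071c1c0e0e0e0c071c1c0e0e0f07070623231424070706232324240c071c1c0f0f0f0c071c1c150f0f07061c1c1b151007061c2323141407061c2323142900061c23432f3907061c232329290c1717170303030c1717170a08080c171717170802))
  (.node (.leaf
  0x61c43252e4100001c232f2e3b00001c232e193b00061c2343223b00061c23432e3900000623432b3700071c23251a29000000252e1939000007161d2e1900001c1644292e00001c23252f2200061c2325151a00001c111d193b00002304251a19000006231d223900001c231d223300001c231d2f3900001c231d193900001c231a291900001c23292e1900000023223937000000233935370007061c141a3d00061c2327202900061c2314204100061c232029410c061c234314290c061c2343202e07061c2343143d07061c2343203b0000061e14202e00061c23112919)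
  (.leaf 0))) (.node (.node (.leaf
  0x61c16090f3100061c160b0f3100061c1609312700061c160b312700073004260f27000730040f3127000730043127410000062720283d00000627202941000c06110f1020000c061127203d000c061b0f1020000c061b27203d000c06160f2720000c061627204100061c11180f2000061c1b180f1000061c16260f3100061c16263127000730040915260c071705040e260007060a1014270706301704090e07063017040b0e070630171f090e070630171f0b0e0c07060a160d2007061c171b103107061c17040e1507061c171f0e1007061c171b0b1007061c171b2610)
  (.leaf 0)) (.node (.leaf
  0x2319342b00061c23432f3300000023325b4500000000435848000000431d1d58000000431d1d46000000431d385f000000434f1d5807061c2343321a07061c23434f3f07061c23434f3907061c23434f3800061c2343194b00061c2343394b00061c23434b42070623434f0a4207061c23434f5600001c233219220006234311323900061c2332401900061c23254019000c1c23432239000c1c2343393500001c2343374900001c2343494a00061c234f165e00061c23434f590000002343455d00001c23431d5c00001c23434f5b00061c23111d2200061c2332402f)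
  (.leaf 0)))))) (.node (.node (.node (.node (.node (.leaf
  0xc07061b1e0b0f0c07061b16260f0c07061b1e090d0c07061b1e0b0d0c07061b1e260d07061c0404090f07061c04040b0f07061c0404260f07061c041f090f07061c041f0b0f07061c041f260f07061c1f1f090f07061c1f1f0b0f07061c1f1f260f07061c1f1b020f07061c04040b0e07061c04040e2607061c0404260d07061c041f090e07061c041f0b0e07061c041f0e2607061c041f262707061c1f1f090e07061c1f1f0b0e07061c1f1f0e2607061c1f1f260d07061c1f1b090b07061c1f1b020e07061c1f1b092607061c1b1b020907061c1b1b020b07061c1b1b0226)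
  (.leaf
  0x1c23432b3700001c2343373700061c1c161a1a00001c2332222200061c1c1c2f2f00061c1c1e1a1a00001c232522220000062343373700000023435d4600001c234022220000002344474700000723434747000011110e0e0e000006161414140000061c2f2f2f00001c1c322222000000231d474700001c23232b2b000000234345450000001c2222220000002332363600000023234545000000004357570000000043465a00000000005a640000000023625a0000000043536c00000000436257000000004f535a0000000000556b0000000000636300000006235f48))
  (.node (.leaf
  0x704041b0e100c07170a04090f0c07060a080e260c070604110e2007061c0404092700170a0a04090d0000040410142700300a0404090e00300a04040b0e0030050404090f00300504040b0e00300404040926000004110e1020000004110d1020000c04040b0e18000c04040b2631000c040411102000070a040b0e18000705040e18260007040404102000060404040e20001c0404040b10000004040f2029000004040d202900300a04040e2600300504040e260030040404093100300404040b31000004111027200000041126202900070a0a09260f00060404043129)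
  (.leaf 0))) (.node (.node (.leaf
  0xc0706231610290c07061c16202c0c07062316282907061c23110f2007061c23110d2007061c23110d1007061c2311102707061c2311272007061c23160f0d07061c2316261007061c23160f2707061c2316262007061c231e09150007061c142d1a07061c23210e1507061c231e0b150007061c2d242e0c0706231e142d0007061c2d242c0c07061c1e2d2c0007061c141a280c07061c1e151a07061c231b150f07061c231b150d07061c231b152707061c2321150f07061c2321150d07061c2321152707061c231e15260007061b0e1027000706231e2c19000706210f1027)
  (.leaf
  0x170a0a181818000704042626310007040431313100062311112020000623111b20200006231b1b2020001c0404040f0f00002316162e2e000000431d37370c070a030303030c070a030303120c070a030312120c07300a0808180c070a031212120c07300a0802180c07300a0818180c070a121212120c07300a02021807061c0a040f0f0c07300a0218180c07300a1818180c0705030303030c0706080808080c070503030312000704080808180c0706080808020c0706080808180c0705030312120c07300508081800070408080218000704080818180c070608080202))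
  (.node (.leaf
  0x7061c301b204107061c301b413d07061c301627410c07061c163d3307061c2311204107061c231b204107061c2316274107061c231b162e00061c1b21101400061c16210f14000c1c1111141a00061c16161e1a000604111f1e1a000c1c111b141a000c1c1b1b142e000c1c1121141a000c1c1b21141a00061c161e1e1a0007111f1b09100000061e10292e000c06160927290007061b092729000706161e102900061c161e09290007061c142c3d0c07061c1f143e0c07062343143e07061c23431428000000141a2e3b00000716142e3b0000062515143b00000014241a33)
  (.leaf 0)))) (.node (.node (.node (.leaf
  0x11090b0e180000110918260f0000110b18260f000c040409180f000011090e18260000110918260d00001118260f31000c0404090e18000c040418260f0c3017171708090c301717040812000717040b0d310c071705040b0e0c071704110b180c30171717020900070a0409180f00070a040b180f0c07170404080d070617050408090706170404080207061704040309070617040408180c3017171702260c3017171709180c3017171718310006170409180f00070a0418260f00070404091831000704041826310c07170504090f0c07170504260f0c070a04040226)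
  (.leaf
  0xc070604262626000706110d0d27000706110d272707061c1c11101007061c1c1110200707061c1120200c07061f0909090c07061f09090b0c07061f090b0b0c07061f0b0b0b0c07061c0e0e0e0c07061f09092607061c1c1b151507061c1c2115150c07061f090b260c07061f0b0b260c07061c0e0e0f07061c1c2314140c07061f0926260c07061c150f0f0706061c2314140c07061f0b26260c07061c0e0f0f07061c1c2314240c07061f2626260c07061c0f0f0f07061c1c2314290c07061c0d0d0d0007061b0d0d270c07061c0d0d2707061c1c23242907061c1c232424))
  (.node (.leaf
  0x61c1716292c00061c1716243300061c17252c3d0007061b212933000706161e20290000061c33393e00061c1716292e00061c17253d330007061c25333e0000071c2c19350000061c2e193c0000061c2e39420000061c193c3300061c23042e1900061c23042e3900061c23042c1900061c2304193300061c230433390007061c433e4a00061c2343193300061c234333390007061c10142e0007061c24282c0007061c28292c0007061c242c3d0007061c282c3b0c07061c17243707061c431724280c071c2343242c0c071c2343243307061c2343243d0007061c24202c)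
  (.leaf 0))) (.node (.node (.leaf
  0x60f1020280000060d2427280007061f0d102800061c1710273d00061c1727203d00061c2310272900061c2327293d0c07061c260f140c07061c0d31290c07061c260d290c070630090e410c071c300b0e310c0706300b0d410c07061c2624270c07061c0e263b0c07061c0d313b000706182631270c071c300e26310c070630260d410c0706300e31410c0706300d31410c070623260f200c07061c0f31290c07062326272007061c230e18260c071c302631270c0706303127410007061c202e3b0c0706230f10310c07061c31272907061c301b150f00061c1b152631)
  (.leaf 0)) (.node (.leaf
  0x1c2343393600061c23434f37000a0404041b10000011161e15140000111140101400071111111e14000604041b1e2e00001725253d3300000032333e4200001111212933000011161e2029000007163239420000231632292e0000111111293300170404041b29000a0a041b1b10000011112510290000111125293d00071111111e29001c0404111e29000a0a05111610000c11111616240c0706111132240c0706111b162c0007061125151407061c04041e1400070611211a290c070611111e1a0007061111292c0c0706040427290c07061111402907061c04041e29)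
  (.leaf 0))))) (.node (.node (.node (.node (.leaf
  0xc07061f12090f0c07061f12090d0c07061f1226270c071c1b1202090c07061b12180f0c0706161202260c07061e12182607061c0412021807061c1f1202180706300a0a090f0706300a05090f07061c041b0e180c061c041b0e2607061c041b180f0c061c041b090e0c061c041b260f00061c1b1b15140706300505090e07061c1f1b0e1807061c1b1b120e07063004040209070630040409180c061c1f1b0e260c061c1b1b0e1807061c1b1b091807061c1b1b183107063004040226070630040418260c061c1f1b090f0c061c1f1b260f0c061c1b1b09260c061c1b1b180f)
  (.leaf
  0x61c110f0f0f0007060b0b2626000011092626260000110b26262600070404262626000706112727270007061b272727000011262626260000111b0f0f0f000706092626260007060b26262600061c1b0f0f0f00061c2314141400061c23161a1a00061c23432f2f00061c23432f1900061c2343191900061c2314142000061c231e1a1a00001c232f2f3b00061c23432e2200061c2343193900071c233a2f2f000c06234322220000071c4336360000001c43455f0000000023484800061c2343223300061c2314202000061c2320202000061c2343393900070626262626))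
  (.node (.leaf
  0x70623161a2f00070623162e1907061c2343161907061c2343162f07061c2343251a07061c2343252e0c071c2316251a0c061c23163a1a07061c23111e1a07061c23111e2e07061c23113a1a07061c23113a2e000706231e1a2f000706231e2e19000706233a1a19000706233a2e1900070623432f22000706234319220007062343443607061c23431e1907061c23433a1907061c23431e2f07061c23433a2f07061c2343401a07061c2343402e00061c23431a1900001c2343223700061c23432f2e00061c23432e19001c04040409200c070a041f080907061c1b1b0831)
  (.leaf 0))) (.node (.node (.leaf
  0x71c1b0e152600071c1b260f1000071c1b0e103100071c210e10310c071c23250e1507061c231e153107061c231e103107061c3016261007061c30210f100c07061c31294100071c1b10312700071c2110312707061c301b10410c071c231e14270c071c231e102007061c231e312007061c171b313d0c07062331273d00071c1b0f103100071c1b31204100071c210f103100071c213127200c071c23400f100c071c231e2729000a040404160e000711111116140006111111161000000a1616292e000000322e193900001c11321a1900001c11322e1900001c11251a19)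
  (.leaf
  0xa0a0a080218000a0a0a0818180c070a0a0802180c070a0a0818180c070a050802180c070a050818180c0705050802180c070505081818303030303012120c1717171212120c171717050202000a0a0a040b0b0c070a0a040b0b0c070a05040b0b000a0a0a020218000a0a0a1f0909000a0a0a021818000a0a0a181818000a0a0a1f26260c070a0a0202180c070a0a1f09090c070a0a0218180c070a0a1f09260c070a0a1818180c070a0a1f26260c070a050202180c070a051f09090c070a050218180c070a051f09260c070a051818180c070a051f26260c070505020218))
  (.node (.leaf
  0x11111b141a000711111b1614000604041b161a000005161e2819000000252c193c00000616252c1900001c2525242c00001c1625284d00060a0a160e15001c0504040d10000c1c1111242c00000616141a3d0006301b160e100006301b160f100007061616143d0007061616153b00061c1116152000061c1b16152000061c1616154100062311160e1000062311160f200006231b160e10000711111f0d270007111f1b0d2700071f1b1b0d27000630111610270006301b160f200006301b161027000c061616293b0007061616103b0007061616203b00061c16160d20)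
  (.leaf 0)))) (.node (.node (.node (.leaf
  0x1c16162f2e00001c16162e3900001c161e2f2e00001c161e2e3900001c1e1e2f2e00001c1e1e2e3900061c2316141a00001c2325383700061c2325252f00061c232525190007061111142e0c061c111111140c071c231b151400071c1b16151400071c2316163607061c2311161a07061c231616140c061c11111b1400061c23321e2207061c231b161a07061c2316211a07061c23161e140c061c111b1b1400061c231e1e2b07061c231b1b2f07061c23211e1a07061c231e1e14000706050f10140007060a0e1014000706050d10290000061c1419350007061c10141a)
  (.leaf
  0x706061f09181800061c1b1531310c061c1c1531310706060409091800061c110f0f310706061f09091800061c1b0f0f310c061c1c15153107061c23231a2000061c23432e3407061c23231a3d00061c2343343300061c2343344b0c061c1c150f310706060409090900061c1115150f00061c11150f0f0706061f09090900061c2115151500061c1121141400001c161e2f2f0706060a1f0e0f0706060a1f0f0f00061c1b15150f00061c1b150f0f00061c2115150f00001c1e14141400001c1e1414200c061c1c150f0f07061c1c21151007070a0a12121207070a05121212))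
  (.node (.leaf
  0x7061c15292e0c07064317144207061c2343101400061c231014410c061c2343102e0c061c2343293b07061c2343103b0c061c2343243b00061c300f101400061c300d10290007061f10272800061c3010142700061c301024410007061c203b3300061c2329413d00061c2310413b00061c231024410000061027203d0007061f27283d00061c3020294100061c3029413d00061c3010413b000c061c293b3300061c30413d3b0007061c143d330c07061c433b3500061c231441510c061c23432e3d07061c230a3d5000061c23413d3b001c233016143b00061c041e1420)
  (.leaf 0))) (.node (.node (.leaf
  0xc07060a091827000706160e10310007061626104100061c16080e0f00061c1609262700061c11080f1000061c1b080f1000071704090e260007171f090e260c0717051f090d0c0630041f0926070630171b0926070630171b09310007060a0d101400073004090e0d000730040b0e0d0000060d102d20000c06160e0d20000706160e1531000706160e262000070616260f2000061c110e151800061c1b0e181000061c16090e31000630040b0e2600073011090e310007041f0209260000060e0d20290000060f0d20290000062610202900063011090b2600063011090b31)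
  (.leaf 0)) (.node (.leaf
  0x1d1d3935000023111d1d39000006431d3f22000006431d3f3500002343321d2200061c2325402f0000001e333e5200001716252933000016211e203b000011211e292a000017323a3b33000007324033390000231120293b0000001d2e1933000023161e291900002343322e19000000432e39610000430a322e390000430a1d3b39000007431d3935000006432e3b3900071c211e282900061c171e293300061c0a3a3d330007061c403339001c231116212e000c1c23162f2e000000251a2f1900001c161e1a2f000007231a2f1900000623442f2200000623441922)
  (.leaf 0))))))))

set_option maxRecDepth 1000000 in
theorem allWin_307 : AllWin painterTable 307 :=
  chkAs_sound (n := 307) (i := 0) (fun i hi => absurd hi (Nat.not_lt_zero i)) (by decide +kernel)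

set_option maxRecDepth 1000000 in
theorem allWin_614 : AllWin painterTable 614 :=
  chkAs_sound (n := 307) (i := 307) allWin_307 (by decide +kernel)

set_option maxRecDepth 1000000 in
theorem allWin_921 : AllWin painterTable 921 :=
  chkAs_sound (n := 307) (i := 614) allWin_614 (by decide +kernel)

set_option maxRecDepth 1000000 in
theorem allWin_1229 : AllWin painterTable 1229 :=
  chkAs_sound (n := 308) (i := 921) allWin_921 (by decide +kernel)

set_option maxRecDepth 1000000 in
theorem allWin_1536 : AllWin painterTable 1536 :=
  chkAs_sound (n := 307) (i := 1229) allWin_1229 (by decide +kernel)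

set_option maxRecDepth 1000000 in
theorem allWin_1843 : AllWin painterTable 1843 :=
  chkAs_sound (n := 307) (i := 1536) allWin_1536 (by decide +kernel)

set_option maxRecDepth 1000000 in
theorem allWin_2151 : AllWin painterTable 2151 :=
  chkAs_sound (n := 308) (i := 1843) allWin_1843 (by decide +kernel)

set_option maxRecDepth 1000000 in
theorem allWin_2264 : AllWin painterTable 2264 :=
  chkMs_sound (ws := [
    0xb2d407b2e10497041701040700,
    0xaec407aea417004407b372a250aed28aeb1041789040704870427040709f040704170487,
    0xa250aed2aea4070407, 0xa1b0a1a0b393a1c02497b3828a1a0140796ca180407,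
    0xa551767233a4f0a4e1a1f0a243a4d108f2234278a202208fa4f0a4c087a54209f1407008701070097a1c097,
    0x6ce07681b3b000008700977670a7019701a7b3a187,
    0xa1b1a1a003b392a1c0249703b3828a1a014079ae8417804070417, 0xa0e06d9020b3a4b3d26bf0a0d41786ca0,
    0xa1f0b3a2a263b3d2a1b0a250b392, 0x206c90b3f36d502a416cf36d606ce3986d906c70b3a2,
    0x3d40b441b3c3b3e07660,
    0xfe23320843da03d928b4533d803d718b1109f3ce2930970af3d40b45308f103cf109f013d528b3c3003d61,
    0x380209010b463000fe02083, 0xae90b3d403a1e2ad600407, 0xa1f0a243a1e2a1d01407b392,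
    0x206bf0b494a1602a4134a1902498b4936cd36cc398bb482a182a17298aa140009a0f181407b3d2,
    0xaf6407ae841700440703b382a1c003af528af411417896ca1040704370427040709f040704070417,
    0x6c816bf00403b3d26c70b4b403aef28aee014079a2e41780407,
    0x6d50b3e26c9004b3f36d426bf004b493a6d502a41046cf36d60046ce396cb2046cd3b4c29a86c900096c818006ca1b3d2,
    0x6de0002b5005b4d369726b401005b4a3a6ae06ad18b3e26bf0, 0x295028c005b3e26bf0,
    0x30b3e26c90b3f46d502a41346d602498b3f36cf36ce398b6d906c70b3d2,
    0x6de1b4f26df02950b445b543b4f23cd3002b508705b4d4a6b806b9096c80b3e2,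
    0x6c816bf00403b3d2a2f024970403b4b28aee014079a2e41780407,
    0x6c906c81016bf00403b3d26d900403a342800aee11417804079a0d4070417,
    0xb1f417a1a0b241241703b382af741704170417043714278af4004171417aea407,
    0xb340b351aea417004407b372a250aed28aeb10417891417aea4070407,
    0xb1c00100976ca117ae84071314379bb592b1d4279aaf41a1b003b1e2a1c0043704279141786ca1140703b3820417809f04171407ae8487,
    0xb250b261a1a1a1b06ca003b592b1f407004407ad80870437b1d4279a1a1b240140703b38292417af4097ae84070407,
    0xada0011110106c803024248248cb5b3ad838b5a38b6bf1ad940724073447a2f00447824072447834370044378ad74378b9b5b2a1d4279ad8200442798b5a2ad742798a6bf1adb024070403b582a2e417824070403b4b289ad6134178ad5189ae8417a2e4070407,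
    0xa0e06d906bf00403b3d2aee004178a0d407,
    0x6b8000106e4186be009f0008f28c0a0819fe18b3e5b5c58b575a0759b56598db3e4b5c48b574a0749b56498cb5d2b5c28b572a0729b56298a6bd06e4099fe09a0641786bf0,
    0x6c61116be028c025258258d23238238bb3e2a0928b5728a6bd06ad4076bf1,
    0x6e409fe00504b562a0800504a3826ea00504a372989fe014079a3541780407,
    0x29e1b5e2295005b5446df014a3d1053405149d813138a3e3238cb5436fd3896fc389b687229e16ae00504b4d32b500514b64296e736e939b8a6b8000986fb09006891b562,
    0x68826de00129506df0970504b54368820029f0870130970504b4d3a6df005046fd32b5005046e73a8006b816fb186b9096c806891b572,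
    0xb550872ac028550210a789230000973220970af8b04b4532a5001b6618b6509ac30a73109fb4f0b45308f00011712b5f1170afb5e1a8006891,
    0x7c12bb21305b464b6733cb01010b9a2a503cc0bb551b4e1ba98b4533cd0,
    0x43db36e716891b4d0877651b560876cb03d60,
    0xad9417aee0adb11417a2f100441724249249c23239239bb582af829b4b29a6bf00417241704472437a2f00447043790417044714379af74270427914279a8ad6014079ad509804171417ae8407,
    0x6e416fb097009fe0970097a0819725259259d24249249cb572a0729b5629a6be01417a3609725170504b6a3831004417896bd06e4099fe09a35417814176bf0,
    0x29e16ae00504b4d32b5005046e7386ea105046e938969626ae10504b4a36e8205046e63b6426e5398a6ae00096e41810b5626bf1,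
    0x2ac005b694b6c032d074a405248d9b693749338a3a8b745074409746014a748374739bc8018318a9208773f073e0a08f9b5e073c09229a209773e11097a8b6b00073b107a969600091098b64096e80a73d09006cb1,
    0x10ef20ce131e3050f5438e1ab6d3384232b380af37c008f38d12a51b67308f09fb6930000022ac097,
    0x6c113050f54284338f038e223822384232b39a38d0972a50b67308f10009710872853022ac0a7,
    0x122306c2051044284307d01305394432b383120b4641308f2a51b67338d189a100110872853022ac1,
    0x6c00ce031e3053438e139b4a3840a70f50208728510187b651172ac097b693,
    0x20ce22bb136c3050f543bf138d0973bd08710108710412ac097b6522853023be2,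
    0x6c10df0972bb0284305104429d032b3053944828402a51070fe03bd12853013be097,
    0xda029d02840b67305b4642853003c40, 0x3c900e833dc000a700970087002aa03db3,
    0x270b7830f6010d18b475050f85b795a98db783b773b763b753a98b683b743b6f3b6e3a98cb0ed280af1091809f0dc00fa010b010a0b684ba908f10c00090fc18b4630fe0,
    0x390b7a30270b4730380, 0xaea417042704070417, 0xb7c0b2f01407aed204070407,
    0xb070b3d2b080a4d18a4f0a4e18a5420044278aa243b0b38b7d2b0a31427b09398b041780044278a09fa4c0b7d208fb050aff4079b0418b0600407,
    0x7680a653b7e000a7a640970087b3d0a1e0, 0xb540b7f4b3c3b5d07660,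
    0x6af0a5747650a58378e39b00a700a071176cc0b56187,
    0x6af0a5747650a59302a072004427a09097b570877a606cc0,
    0x3cf13cd06e7178f4b4d087a5d30168907a612417b5d1077660, 0x3d40b4406890b7f3b3e07680,
    0xfe0b8833da03d918b453333d718b14b8432084b87314b8633db4b853a98c3ce280af3cf109f3d40b84308f6bb00096ba186ce0b7f3,
    0x1ca003c4b890577000b700a70097b450872080, 0x30b473b8a410800ec21bd420b2b800000e809720c420a0a2080,
    0x10ec3b472b8a420e31080140ec11bd420b29800b70e8300010f5020c420d100022083,
    0x20ec3b471b8a420e20f8010b7140ec11bd420f2980e80b700a70f52104021441220d02080,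
    0x311082b8a420e1200ec0a71bd480f811be4031070a71bc48b0e80970f50b700a710412150b460872164012080,
    0x1080b8a40020e12170a9000e8117020f5127104137b4610703c404921648c2080,
    0x6c0284338b015158d0e840e748c06d038630538c438918284333d38386338818b0280af37b1809f2a50284310052413937c010050e7433d3a37e037d0ba908f303310050e7433d392a5031e338510e7433d3a37e037d0ba937b090ce0050f5431e31031d3a385037f0ba37b0a3840b6d3a9800387038a3,
    0xce028432015158d0e840e748c38b00538c4389182280af3bc109f0008f37e037b0900a700973bb183870285038a3,
    0x3c90200e830e738b3ca038c33c81800a70097008700003c603c73,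
    0x271b7830eb0b4750ec58d0ea00e91b965a8d9b7830d93b9539a8bb6830b64b9439a8bc0dc00db0a0df20de00dd0cb9a80e830e500e400e73a000e62,
    0x20b7830f6202700d930ea18b4750f85a050ec50f75a98db783b773a0d930d430cf3a98b683b743a0b630b530b43a98cb10209100ed0a98121280dc20db290df00ee0b980af0ef20f530f40020e60,
    0x271b7830eb00f851085b4750ec58cad0f610f8507f00cf3107589b683b74390b638b6f30b4389ab7831051106590d530cf3980cfb100ed0980dc109f0fa20f9180df10ee1b890ed290af010fc210430f400fd00af010fb213810440ff480f540f40ac0fe0010e62,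
    0xe81000e70a7575481056f18574009f56d3a00970bf020af56e008f00010200a70038a107,
    0x31b4d097b7f310689200a76e7178f3765078e3a86cc0b4c087,
    0x1042e30e809757621056d107010238a03db201a701b7b9b197,
    0x79d13d4102b442b3c3b7f4102100976e7178f386890b562b4c2026cc0, 0xb0c06ca0b7d20407,
    0xa6a0b3e2a6b0a642b3b3b7e4a661809fa670b9e208f10a69009f8a6809a4c0,
    0x3d41b441b3c3b7f4b9f07a61b3e0768010976cc1b57127,
    0x2ab1ba433d91233d71b2084b8732476e37940b714b8633db4b853a89c3da02379b179a00377f33db476e3ac8009779627970970af6ba07980978017992006ce178f3,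
    0xad9417aee024170403b5826bf0341704470437af74278ad60a0d4070417,
    0xada10000876bf10403b5b2ad9417241704470437a1d42786bf034170403b5828a0d407ad60870417,
    0x11016e416fb09725259259252592598d14149242498249c12129222298229aba73a0729ab5c39b28c0341704573447a0800457144793417045714479a1442704279a0f4279a86bd024170504ba63309004417050402b6a398a5c09fe09a5b0986bf00417,
    0x6c5005b4d36c4005b4a3a6ae06be06bd0a98b3e26bf0,
    0x6e416fb0976bd00504b5726be00504a5a386ad4076bd0870417, 0x6fd178f3a6c0006890a5a10417,
    0x79d13d41b442b7f37650109778f3800689087b5626cc2, 0xb441b7f3b9f0006890b5716cd1,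
    0x21688104bad3b661687204bac3b65104b9b3a970d17a8104bab374606f42256fa214a7aa37a93ab98baa17a71ab6b29ba906da09ba81800016892,
    0xb1c06ca1340703b592b0c0041781407a0d4870417, 0xb250a1a1a1b06ca003b592a0d4071407aea417,
    0x16d916c80316c9009fae526d90006bf107bb44ade48baf4824248248adf4228adc48a9cae43ad838add38bb43ade38baf389adf3ad838aadc389b01306c808704b5b3a2e41781004b5a2896bf06ca10407,
    0xa0e06bf0346d91004407149bb42adf29a016bf004b5b296ca10407,
    0x29500028c1076b8187a055158252589258d32328328a23353386cb3258bbb6268928bb548ac6be13407356fb015800440715812028128aa0430389ff38b96e406fb087026cb305ba749fe186e4005b5c4896bf10407,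
    0xb440b7f3b3e0a0a0,
    0x68a0b5508703b454b4f1bb85285331209732bad58b6606872688087bac48c901011701b65117b9b49dbc8ab4f0bb709b5f16870a98b5e18a6890,
    0x302a50bb93b8940de02d81bae3ba543bf042e4983bd002b6522a822a90b9d3, 0x295028c005b3e4b5d26bf0,
    0x6c61116be028c025258258db3e4248248cb5d2a0928b5728a6bd06ad4076bf1,
    0xb55001b66087902308709fab843b873b86398b650b8538c9ab0010a7bbc109f0110a79bbb010fb5e09a6890,
    0x3cc071417841b5e0b873b8639b8539ab2a500170d177e277f476e49c810a7baa109f0100a79b6b1a6960ba81278016890,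
    0xdc045a145c12a50b89445d045b23944ba55823bbe38b2a51bbd338d18942c0455145929ba433ce13cf0,
    0x6bc0b44569726c5115ab543b4d3ab6b806c616be0a89b3e26af06c71,
    0x6d7002b4436d84b542b4d3a6d506cf0b3f2,
    0x2a522ad029f0bc542af02ab42ae02aa498bc422229512a942ac22a8498a2b502a40b442b4d3,
    0xdf10de1bc602a50bb93b89410a02d81bae3ba54845f100a7b660972a91b5500fe0ba43,
    0x6b8010295028c025258258dbb6368938bb538b6be13407356fb0158004407158230389ff38b9bb62a0429b5628bb529ff298a28c1200503ba729fe186e400503b5c2896bf10407,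
    0x20b4f0bb84b5506881bad4b6606872bac4b65034a98bb83bad3bac3b9b3a98bbbb0bc809b5f06870ab5e2986890,
    0x10a0bc60bc932a50b894bbd342c045e18b8833cf0, 0x10b0bc602a50bb93b894bc400fe0b883]) allWin_2151
    (by decide +kernel)

set_option maxRecDepth 1000000 in
theorem allWin_2333 : AllWin painterTable 2333 :=
  chkMs_sound (ws := [
    0x216d909710106c90876bf107bb44ade48baf48ca2f1ada08704870044076c818734ad848adc48c9bb43adf39ade3ad8398baf3adc398bbb42adf29ade2ad8298baf2adc298a116c80200403b5b2a2e41786bf00403b5a2892407aee087ae8417,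
    0x6bf0a0e08704336d9100440704139bb42adf29a016bf00403b5b29a0d4170407,
    0x6b8010295028c025258258dbb6468948bb548c6be13407356fb0158004407158240489ff48c9bcd2a0429b5628bcc29ff298a28c1200504ba729fe186e400504b5c2896bf10407,
    0x6890b4d08704b7f3b9f078f376500478e39810006cc1b4c097,
    0x3cf130b54204b7f3106890976e71170478f38b5627a606cc26cd0, 0xb54114b9f0b7f378f38b006890b5716cd1,
    0xb54004b7f3b5d0a0a0,
    0x20b4f0bb85b5506881bad5b6606872bac5b650b9b5a98bd63bd53bd43bcf3a98bbbb0bce09bbc06870ab5e2986890,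
    0xb6e00b404a92982505052525ba98db9c404041bc4b9a4ba98c28802530159244ac49c30a025286015a4ab44aa4ac4a804a73a984a53980bf0280af4a61809fbd7008f00b6d038a0,
    0x6e419fe0050403b562a080050403a382a361050403a372989fe0140798a3540790407,
    0x6870b6c0870504bcf3745005047a9373e005047bc3986e50bd9087,
    0x708037f2688025b65215abd44bcf4ac708038427a8125745015a7aa47a94ac70506ec2256f5015a7c847bc4ac98bd43bcf3a7aa37a93a7c837bc3a98b6da07a8097c718bd926e526890,
    0x16e4100976fb19715159252598259dba74a0749b5c49c6bd0241705ba649fe0900441705b6a498ba73a0739b5c39ba639fe09b6a398bba72a0729b5c29ba629fe09b6a298a34171497045704473437afb41704570447143790044170457044714379142714279a1442704279ba0f4279a08fa5c09fe09a5b098aee00417,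
    0xb360aed2b1d00407049782407b2d427240711f14079a250042704170497149708faea40710f04070407,
    0x1a1b1a5436ca0bdd204070497ae84171417af400407,
    0xb2a0a1e3b3d4b2906c717672b2b28aa150bde4a1e3b281b2c208f2008fb29014178a008709fad602407901ad51178b27004070417,
    0xae70b5d5ae6003bdf21097a5c008f000097a5b180407, 0x6c400504b4a3be42a0b06bd0a2b407a98b5d2a140,
    0x6ae0016e40976bd09fe1a0809725259259d24249249c23239239bb572a0729b5629a6be0004417a36097050403b6a28a2b000900989fe114178140791417a06407,
    0x10106b806ae025258258dbcd468948bcc48c6be13407356fb0158004407158240489ff48c9bcd3a0439b5638bcc39ff398bbcd2a0429b5628bcc29ff298a6bd120050403ba729fe186e40050403b5c289aee10407,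
    0x6fd10478f3a6c0006890a5a10417,
    0x7bb26de1002b50870504b4d36972206b40870504b4a3a6ae06ad096bf0b5d2,
    0x70d1be906881bbb0bd5571416872688035b65125a9bd54bd44bcf4a9c70d17a81be8574606f4235745025a9be847aa47a94a9c8bd53bd43bcf3a9be837aa37a93a98bbe717a818be629be506da09bdc18016890,
    0x6b8000106e4186be009f0008f6bd0a0819fe18b5d5b5c58b575a0759b56598db5d4b5c48b574a0749b56498cb5d3b5c38b573a0739b56398bb5d2b5c28b572a0729b56298aa2b00099fe0904178a06407,
    0x6c61116be06bd025258258d24248248c23238238bb5d2a0928b5728aa2b00407a06417,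
    0x6b806bd0050403b5d2a140,
    0x6de1bbb229506df0870504b543106de08729f087012b510504b4d3a6b806b918b5d26c80,
    0x20bbb0bd65bee06881bd55b6606872bd45b65035a9834343434a98cbd63bd53bd43bcf3a98bbed0be709bec06870abeb2986890,
    0x302a50bd7305b8940dd02c912305ba548bef3bea38b3bf10542e4838e205842d48cabdb3bda3a8b942c000942b18003ce2bcf3,
    0xb6f00b618288328638b1be5bf43051bc51bd5b9a5ba98d1be4bf43041bc41bd4b9a4ba98c28802530159244ac49c30d025286015a4ab44aa4ac4a8298bc93134a5398b028028b0af0184a618b09fbd7008f0031e00f50b6d338a3,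
    0xb6f00b61800b6e00b418b353305153525ba98d1be4bf4304141bd41bc4ba98c28802530159244ac49c30d025286015a4ab44aa4ac4a82980280af21809fbd7008fbc934a634a53900a74ad09780bf284032a0932b184ae02850b6d338a3,
    0x3c9004030e80b73dc039b3800a779e0970fe0b46308f0079f17a44033db0,
    0xbf7057e057d057c298b9c404041bc4b9a4ba98c217057f04ac4957b057a298578380bf42e280af0109f0008f0e8039a0939b18579020c41485854858448c3c70,
    0x74f075403315158d39b439a48c20b6d374d0384171d374c180074b074e36e90,
    0x74f075d0b6d315158d39b439a48c384074d074c180074b06e9074e3,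
    0x3a80049007418b753030cf3b953a98bb79510750f75b965a98db753030cf3b953a98b6e3030b43b943a98cb3a703a609359339f0930d339d09cb3a5039e039c0cb3a40bfa3bf94ba983962980af3971809f101090ed00db0a0df00de00dd0cba908f0ef0209399180e5000901398180e8313839b3839a38b0f50,
    0x10b793106057c0586097a1be41bd48c57e357d057c1a1bc420b38acb217057f04ac4957b181109f42e2920970af2339a3ab0e8008f000f50875793587400113c7320c2,
    0x1060586182357f38b1be4331bc41bd420f398c217057f04ac4957b1842e280af0109f0008f131380bf0e8339a38b005880589420c03c73,
    0xcf2b740200d92828820b602863a3505a35053535ba98d1be404a1bc4041bd4b9a4ba98c28802528601594b544ac49c324025286015a4b444aa4ac98bc92028a0184a618a09fbd7008f001231d3a31e032a280038a2,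
    0x302a50bc93b8950de02d81bae3ba553bf042e538e035a98b894ba5442e442d4a98cb6502a80bcf3,
    0xb430cf201b7400b610d92925359d28731be5b020b60871bd5288215ba1be424bff0a7b1bd41bc4b8c287025288015b4b644b54bc8324125286015a4b444aa4ac891008f218208709f22128bd7087129abc934a6380bf00111036c0870f5331e0b728524ae0a7,
    0xb42b7401ae00b62828724af3a053533a153525a98d041be4bf43a141bd41bc4a98c28802528601594b544ac49c32402530d015a4b444ab4ac9821809fbd7008f134a6380bfbc924ad280af2232a2831e3a2840109bea0970132b284ae0002852,
    0x29506bc1208705b54469726c510534a6ba36bb3b543b4d3a98ba2d004799381111896b806fb186c707a626891,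
    0x6bc00504b5436c500504b4d3a6b806c606be1a89b5d26c70,
    0x2a5229e02ad08729f105bc54c0722af0052ab4c0622ae1052aa4b652982a402b508702b4d3,
    0xc081bd7305b894bef379c01010b92a513cc0b9a8bee2be90b89abd633cf079d1,
    0xd51b68025bca087010b60871bd528631bc5b9a58adb91be4c0900491bd4a1bc4b9a4a98bc287025286015b4b644ac4bc8bc914a6189002840bd718731e133d290038a1,
    0xd5100b680287328810b60286292515905052515ba98d1be414904041bd41bc4ba98c28702528601594b644ac49c8111189bc934a6380bfbd708700284031e355911038a32851,
    0xb420d5100b68028721ae10b625462925159052515a98d1be4149041bd41bc4a98c28702528601594b644ac49c8111189134a6380bfbc924ad280afbd7087002840104036c20f524ae12851,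
    0xb6100b68028714af2905053533a9353598d04041be4bf43a91bd41bc498c28702528801594b644b549c8134a6380bf124ad280afbc91c09009f284132b1836c29bd708700b670002851,
    0x5b0b55229f0bc552af0352ae02598bc542ab42aa498c2b502990b542, 0xc0e0bc9305b894bee03d40bd63,
    0x34c0f0c0900b6125286215ab1bd4b9a4abc98000102bc93284055a233d3a0038a1,
    0x1bc4c0f003c090b70b600d920514828611515bd81bd41bc4b8c900bc90b70f5000872843285138a355a097,
    0x1a90b782b8a528721be5a28800b60a71bd554631bc5b8b8a4c0921481be4b1bd41bc4a9c10a71210b72843bc9055a000022851,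
    0x21b78028710b615461835359353598db8a41be491bd41bc498c00b700a7209728411041bc90b6702850,
    0x51be401c0904af01a4112050bfd81be4bf40abc900a720972850108711b7b670a7bc9187,
    0x20ec3106158a01be4249c0ec25860871bd4107257c01bc420b29cba20e057f04ac4a857b09009700008701870e8107020f50a757930220c4,
    0x107310601be4005860971bd480ec31060971be457f31bc4ab0f8021734b5457f04ac4957b1800870000970e81020301370f50b7588220802150870220c4,
    0xec3106058a0341bd48c0f8210601be4217210721bc49ba20e00f8021734b54a57b1800870e809700a70f5358b0a70bf2000872151010712208111170220c35880b75894,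
    0x3a803aa0b7630d938b04920cf30ea28a0f8505a10750ec5b965a98db76303a0cf30d43b953a98b6f303a0b430b53b943a98cb3a703a609359339f0930d339d09cb3a5039e039c0cb983232812396298a01839718a09f201090dc010a90ed00db090df00de00dd0cb9a08f300e522283a90a0ef0398280e8313839b3839a38b0e600f52,
    0x3a803aa0b7630d938b10d23a800cf38a0f85b795a10750ec50f75a98db763b753a130d430cf3a98b6f3b6e3a130b530b43a98cb3a703a609359339f0930d339d09cb3a5039e039c0cb983971809f202090dc000a908f0ed20db2810900f9090df00ee0b983972396293ab09780af0ef239828a0fc00093ac1399282303839438b3ad0000f52,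
    0xf8158a0141be4148ac1081140ec21bd420b3a920e057f04ac4980000870187010e809758c358d40100022083,
    0x201158a00f81586057f391be41bc49041bd420b298c20e057f04ac498008700000000b7030e830f51215120812164,
    0xf811082341bd48c321060871be4a0f810ec0a71bd457f31bc4b958e04b640f8057e14b54b8000001870087010e80b700a7020f50a720812150972164,
    0x10810404241bd48bac010f80a71be422b958e04b6421724b54b80e80970f50b758b20af2150b89107b46087588158f400012082,
    0x21b7730d538b02710d930ea290f8510759050ec5b965a98db7730cf390d530d43b953a98b7430b4390b630b53b943a98cb3af03a609366339f0932e339d09cb8111180ed1218a397189101090dc00db0a0df00de00dd0cba908f000ef13a929200e4180e830e511383ae3838c38b000e61,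
    0x102721b43b7730d538ab250ec58d0f620f85a02710d930ec507f10cf41075a9b773105210650d938130d430cf3a89bb7443b413b55b6f4239a0b630b530b43a98bc3af03a70a366339f0932e439d09cb82131a397189102090dc001a908f320db280fa010980ed20f9180df00ee0b89397280af0fc00f40300ef2030f513ad0970e62,
    0x271b7730d538b0f6110d29050f85b795a90ec5107598db773b763b753a90d530cf398b743b6f3b6e3a90b630b4398cb3af03a70936633593932e330d39cb80dc000908f0ed20db281098397280af10910f9180fa010b00ee1ba83ab1809f313180ef2910c00fc093ac180fd00f4093b6181043038394383b738b0fe00f51]) allWin_2264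
    (by decide +kernel)

set_option maxRecDepth 1000000 in
theorem allWin_2398 : AllWin painterTable 2398 :=
  chkMs_sound (ws := [
    0x1b7a0c184c1748c01b99087c1648c902b970b78c154c144b8c9ab8f5b8e5b8d59b8c5b8b5b9a8db7a0c0d4c281c0c4c272c0b4ac262c0a4ab9c255c2459c1f5c1e5b9ad81bf112c054c1d2c044c1c3bfe4bac1b5c1a5c195bad89c184c1748041b54c1648ba9c15498c14489bac0d4c0c4c0b4c0a4ba98c054c044bfe4ba89c1bf113bf6433bf54bbfd5bfc5bd9bfb234bf859b8bf64bf54b89bd8498bca19821972b890af1a5319c3c9a81a6319d2c890af0bf19a01a901a40ca9b19b091a8019f0ca9b08f118118a3122b8bc73bbf2c8ba199119a11a901a40cba19b0a1a8019f0cab1a7019e0cbc72bbf0cb1210cbabcb2bca2cab08f09f1ae01091b401af0b9bc71bbf2ca9b0091ac01aa0ba81011b1ae11ad0bbba3b741cba1ab0a891ae01ad1bb760b6f2cb1ab0b9b750b6e3c9b8a2010b1ae010a91b401af0b1bb01b90cb9a1ac0910ab1011a1b7031ba93232c9ab1111b3130b320b42cba91b611aa0b0cf1b943cb9a1ba31b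82c9ab8b8a40481bd49149a141498141bc4a891be41ab0b89b9c489ba1bd404b1491104b14a1b6004b1bc4bab9a4ab98c0e80,
    0xb7a0b990b98298c184c174c164c154a98cb8f5b8e5b8d5b8c5a98db7a0c0d4c281c0c4c271c0b4a9c255c245c1f5a9d1c8012c054c1d2c044ac1b5c1a5ad1c70bfb3bf64bfd5a98c184c174c164c154a98c0d4c0c4c0b4a9c054c044abf64a98c1ae31af38231aa398b2298138b0af2181ac38b09f198019a01c401a901a40cba919b0919a01c401a901a40cba19b0a1c601c50cbc70bbf0cba91ae31391b4333abcb0bca0ca9b08f1ae0109101af0a1b40b780b680cba91ac09101ad0a30b770b740cba1ab0a20b760b6f0cba981ae0109101af0a1b401bb01b90cba91ac091b7091b618b8a41481be481bd48c000e83,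
    0x1c9200b7a0b9918c184c174c16498cb8f5b8e5b8d598db7a0c0d4c281c0c49c255c2459d1c70c1d2c054c1b598c184c174c16498c0d4c0c49c05498c1ae21af28128a1181ac28a09f19a000303030cba919b09001c401a901a40cba91232922bcb0bca0cb9a08f201af091ae01b40b780b680cba91ac09001ae0b770b740cba98201af091ae01b401bb01b90cba91ac091b7091b618b8a41481be481bd48c0e800f52,
    0x11c184b7a0348b8f5b8e58dc184c1748cb7a014c255c0d481c401a901a40c9ab08f1ae1021b431af389bcb0b682c98b1ac28a20b772b743c9ab81b401bb00b62c9ab8b8a41481be481bd48c000e811042,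
    0xb7a114b8f5c1841ae01b41b780b683cab89b8a41ca0,
    0x3df11252030272039027b107f23a831240a78033c953dd0872b411409f003de103802092,
    0xc2e0129012818b7a3b993b983b973a98b10c2830390c27311f0c263a912b0c1d310c1c3a12a0bfb3a983280af0109f125008f02700740900a712409707f181260b473331398131390f8323ab793a9813039107390ec303a0f73ab963a98b1270,
    0xc2e01290b7a3b993b98398b10c2830390c273912b0c1d3982207428a0097125087000270b4731380f8380ec38b03801272,
    0x21b7a3b9938b0390c283804b08700000271b4731380f8380ec38b000381,
    0xb7b0c350c340c2f3a98c2d4c2c4c2b4c2a4c294ba98c00b7a0b990b980b973a98b8f4b8e4b8d4b8c4b8b4ba98cb470,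
    0x6e0065206b33606f033168027507658d06b306a38069306838cb065206730607550642230607458067306638065306438cba05d005c0905e003d0a9806c30005f006d2,
    0x5600306723606f033168027507f58d06b307b38069307a38cb3206075507e005718067307938065304d38cba0771809f20078020a908f05d02103e0a90770905e003d0a9807c303806c38b07d203f0,
    0x2a522ad029f0bc542af02ab42ae02aa498bc422229512a94222a8498ba922228c12a742ac22a6498ba29f000929e18b4d22a40,
    0x6a5006ba9569f069e1869b369a38b6a4006be55699369d069c169838a31809f202020a908f68c068e068d0a968b09694068f0a98697202869628a6950,
    0x3006bc4529806ac186a5006ba9569f069e18a0342c36ab369b3a98455345f313a96aa369a3a98b31809f202020a908f6a706a8068e0a96a6096a906940a98697202869628a6950,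
    0x5a02a7502b6632ad0876b610fe46b748c6ab269b36aa269a38a00870029e129f10711fb4d2002a41,
    0x3cb66b500442c36a7029f0ba92, 0xc3d228d0c396c3c4c3b2c3a3a289028b028a0a98ba9228c0,
    0x6a5006bc4529806ac186ab36aa38b10976a8008f0000976a918697202869628a2950,
    0xc3d32960bc66c084c3f2c3d2078028d1c39607d4c3c5c3b2b28e0294128f1a89bc42ba932950,
    0x6872a2a16ae00504b4a3be42a0b06e4032986b40046e63a291a28208fa2709b4c204070417,
    0x6db26ae06c410504b4a3be426b40046e63a2828111189a0b0a27187a621417a140,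
    0xae71b3e5a5c004b4826c609fe124ae60149a182a1729a8a5c09fe09a5b180407,
    0xa2c06b406ae005b4a3c472a0b0a0c18a06407b3e2,
    0x29f0876c5105242b50148b4d36e738b696230246e82148b4a36e638ba1111896ae06e418107a626951,
    0x6c500504b4d36c400504b4a3a6ae06be06bd1a89b5d26bf0,
    0x6dc0b4e668e005ba9369f068b13569e02598c4a4c4948b6c489c006a41c48668d005be5369d068b105c46469c105c45498a68c068e068d0a968b09694168f1a98be526da286db2687298b5e289a6ae0,
    0x2960c4b228f0b55605a0bc43ba92,
    0xc4c329c01629d4c0e5c3d32960bc6629b2078028d1c396b29a4c084c3c4b89ca297029802941b98bc422990,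
    0x2b41122095c0e2c083c3c40afb2ad0020fe0bc54,
    0x442056003e0c4e5058004c5057004b598c4d2055204a50542049598c44204f2048504d2047598c3e204e2046504d2045598cba03e000903d18c39203f0,
    0x442056003e0c4e5058004c5057004b598c4d2055204a50542049598c44204f2048504d2047598ba059003f002c394,
    0x30442056003e0c4e5058004c5057004b598c4d2055204a50542049598a0590c392bc6305a0,
    0x442056003e0c4e5058004c5057004b5980590c0e205b0,
    0x6dd0b55628f06a81bc45c07328e06dc1b4e668e0ba95c4a3a29802ac36a6105c06469f068b105c494a6ac02569e015a1313abb653b6c4abc986a706a8068e0a96a6096a906940a98be526da286db26a6098b5e289a006ae1,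
    0x2ad0b55329f0bc552af0352ae12598bc542ab482aa489cc072c4a3c062c493b652b6c398a29f0009829e09002a4102b4d3,
    0x2c5203d02007d4c58505902ca62d41052cf498c5722cc02c958c4b32cd0062ce48b2c612c8682cb22c758b9a289000982c409b6c20028c1,
    0xae70a5c004b4836c60b5759fe10433ae61042398b482a182a17298aa5c09fe09a5b180407,
    0x6872a3b16ae00504b4a3c5a26b4005046e63a3a2a29005046e53a39298a0b0009a2718b56204070417,
    0x12c4031042ac306b6c56f6268b003698406c5b5a69e006056f5369c006056f43a6ed0066ec46ee206056ef3a9868b00096eb18b642006e41,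
    0x6dd0b5566a80bc4529806a61356ac02598c073c063b65398b6a806a6096a918be526da286db268729b5e298a2950,
    0x12d506a61063400012c4068b10614ab653b6c3ab6ac006056fa369e0066f55a86f81066f956ed0066ec5a896a6000986f7096e40b642,
    0x22c530105e028e12bb4c0852c530103d006c42891c3c5c586b2ba02d8505902ca5b2d902d75c5e398c5d2c572b2dc0352cc025b2da42db42c94b9c82c60132d66c5c389a28e00092d518b652002951b6c3,
    0x2e622dd02e910ce5297006c0e42c530005e08728e12bb405c086a2c5203d0059007d4c585ab2bf0052e742ba0062d84a2e80050ef42d512e462ca5ad9eb2df12e562d90052d74c5e3a9829700092de1829e0b652,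
    0x68820029f0873cd30111b4d42b506e75869626ae06b409704b4a56e826e658a006ae16e4186ad09b5726bf02a41,
    0x2c521005e10103d12005c394c57205902ca62cc02c96a8c4b22cb22ce58ab0028912c4182b609c6520128c0,
    0x2c532dd100078028e12ba0972bb4c085c5d22c5305e10003e0870105909707d4c585c572b2ba02d862dc02db6a05902ca52cc0062c94ab80028e12d5182b809b66211c6532950,
    0x2ea22b90112bf097297029d405c0e62e6205d00105e0972e911728e02bb405c086a2c5305e103e00103d1059007d506c394ab2bf0052e742ba02d85a05902ca6ab80029712de182bc090029e102b663,
    0x2b720780000590c396c584c572c4b3a28902b618b4e228c0,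
    0x2b732b902ba02bb428e006c085c5d22b7303e0078087010087059097c396c584c572b28e02b818b552002951b4e3,
    0x2bd22be12b902bf100297106c0e42b732b902ba028e02bb406c085a2b730003e007810701059097c396c584ab29702bc0929e002b553,
    0x7b40a3c1006ae120970504b4a3c5a26b4005046e63a3a2800a0b1a2718a0c092417a06407b572,
    0x2951bbc20129e0976ae00504b4d32b5005046e7386962300504b4a36b4005046e638a1111896ae06e418b572016bf0,
    0x289001009701172c41972d5217694026269269e25259259dc6d370639b6c39b3268c069830605c6c46f6206057044968b1060503c5b49a69f00670556ed1063596eb10625970536ec396f539b69d006056ff46ed106051393106056f439a868c0009009868b16eb186fe09b6b26e416ad0,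
    0x28e0112de0970097012d516a9070f67146384691698b66670e69b65698e714538459252598259db66370e39b6539b2890112d50972c409728a0c6d669e136968b126925259259dc6d3339b6c39b708437f49149c6d470649b6c498ca29400670d56f8106384596ac0066fa5969f00670552c40066ec5969e0066f559a70d3384396fa3970536ec396f539ab82121896a700096a6096f7186e4129e0b6b2,
    0xa2c06b406ae00504b4a3c5a2a0b0a0c18a06407b5d2,
    0x28e070b070c0009700876940b4e6708637f698c6d670669b6c698eb4e5708537f598c6d570659b6c598dbe93708337f398c6d370639b6c398b709270a068c006c485c7431206057073320605339868c00605c6c36f62060570439200605c5b398a68c000968b096fe18b5e26ad0,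
    0x297128e00129407161008700976a90b5567146384698b66670e69b65698eb5557145384598b66570e59b65598dbee371438384389b66370e398b65389b28e028a070b08706b4e569f00670852c400637f59828a006c6d569e1067065968b006b6c598be937083837f389c6d370639b6c398ba6a700096a609715180029e1b5e2,
    0x6eb120046e8305b64230a466a441a4569875c014079a3f417804070417,
    0x6eb16f709768f0010175c11725259259d24249249c23239239bb6b273b29b6429a69400504a4736eb03593006239a472a4529a4629a8310044178968f06eb0975c09a3f417814176e40,
    0x6a60102069406eb1868f00175c18b5e573c51598b6b5359b64598db5e473c41498b6b4349b64498cb5e373c31398b6b3339b64398bb5e273c21298b6b273b29b64298a68f06eb0975c09a4841786e40,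
    0x30402020060504b6d371a06f6106050471d371b030a70605043398c79071806ee0a706050471c39c7807170ac772986f6010971909718186e80,
    0x68c0016eb168f06e83779405b6b26940a475875c124178968f0a3f417814176ad0,
    0x6a700168b1101069403025258258d24248248c23238238bb5e273c28b6b28a216eb1875c18968f0a4841786ad06e41,
    0x6a60102069406eb1868f00175c18b5e673c61698b6b6369b64698eb5e573c51598b6b5359b64598db5e373c31398b6b3339b64398bb5e273c21298b6b273b29b64298a68f06eb09a4909a4841786e40]) allWin_2333
    (by decide +kernel)

set_option maxRecDepth 1000000 in
theorem allWin_2431 : AllWin painterTable 2431 :=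
  chkMs_sound (ws := [
    0x3050870631e5320631d5a14149c72c332a39b71a206050472b3a7270718106050472a3871f06f6006050432a3971e0a305006050431e331a106050431d3a71e0a908f71b00605047293808f9c7d27242832060504728390afc7920504b6d3718206050471d38ac7c071e0ac790a71b10605047293027171279c7b17251ac781a982020920910a81096f6271828719287260a026e80,
    0x74f0754031e3758215158d39b4248c754272b30539a4a3bb072c332a3872b3a37f0b757072a37551812128454237b09385037f0b98756070d097728380af3842b6d374d074c171d38a126e920074b056d074e3,
    0xa4b0694010060503b5e268f0a4a41786ad0,
    0x6a700168b1101069403026268268e25258258d23238238bb5e273c28b6b28a216eb18a4918968f0a4841786ad06e41,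
    0x30513570970635369233c0870615a1414a31e433d4adcc8403051022ff206053491313931e333d3a832a397383ab73500605047373727006050472a3a81172d180108f09fc85121a718106050472a389127340971e2908fc85272d2809f127242890afc7d1727006050472a38ac8406f6006050473637250a79c7c071e0ac790a9872f000a109872e111a719186f61a0272609016e8232d0,
    0x1131d30ef22538b11590e840e749c75810539a4937e037b09831e333d3a37d073839b75a07373389072a39802937b29875a0737380af3172c337b1838d11133d3a82272c337b183137f2b8a70d17373809f3172c337b1838d11031d3a385137f2ba837b1a757072a3812b6d3384271d38a9759056d174b097003870877473,
    0x3570363033c116815158d284433d48c3050110605386436902ff206053498284333d383863738398b6f62060504739380af734105043863809f0008fc8406f6006050473839c85071e0a00a7c7d29872f00096f6097261832d0,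
    0x16a9120112009f68f16940928b00175c1816169b5f6687698b5e69ba868baa67a769b6b698e15159b5f5687598b5e59ba858baa57a759b6b598d13139bbc3687398b5e39ba838baa37a739b6b398b12129bbc2687298b5e29ba828baa27a729b6b298a68d068b0968f0986ae06e41,
    0x4d130527270060504b6d3c7d087329106050473a309fc4b2bd76b6732cb206050432b380af2020a7c89109f811c7d0a7c7928900012ac2,
    0x12c8a30004d106429262682698ae252582598adb6e4040b44b944a98cc8a33080060530b4c8839a8b100630d504d0063506400625a930d430c4c874a9c3080060530a43070c863a9b80540063532c7e30615a30c4c7f4ac83090330605bf948a3061c7e3ac7a3a8b92ec02c502f60b92ed09a2f902f50b9a08f2f722ef2b9808f0af2eb1112ee1ba82f822f41b8a2ec02c512f60ba2f902f50bac762c751ba08f09f2eb02c502f60b9a2ed02f902f50ba92ec02c502f60ba2f902ee1ba9c6f2c6e1b9a2eb02f802ee0ba122f40ba2f702ef0ba982fa12fe02fc1ba2fd12ee0bac6f1c6e1ba2f702fb0ba8c5e1c5c1b8a9305010a304092ff18b6d32ac0,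
    0x11116a9168f116169262698269e15159b5f52598259d13139232398239b12129bbc2687298b5e29a68d068b0968f0986ad16ae0,
    0x3290284406bbd530503560a70605148284332b38bc7d23097c4b0bc9604b67308f0001178c892c8c0872cb206050472c371f0879c792c851178a02002ac1,
    0x68204d1c8d3065016168eb6f50b658d04d22606401689353589dab6f40b648040b44b94498ac04d0063510063506400625a930d40b54c874a9c8c8d332060534a31f0060532543080060530b4c8839a831f0060532443070c8639a8b2030920615a31c0c7f4ac31b0c7e3ab892ec22c522f62b82ed2892f922f52b892eb22f822ee2b982f722ef2b89a2ec0202c502f60ba2ed0a931402f902f50ba92ec22c502f60b92f922f50b9a08f30e12f812ee1ba830f131713160ba2f902f50ba08fc761c751b82f812f41b8a09f2ec0202c502f60ba92ed0a31402f902f50ba930f031703151ba2fd12ee1ba92ec02fe22f60b92fd22ee2b9c760c6e1b9a30e02f802ee0ba2f722fb2ba98318131903150ba2fd02ee0bac6f1c5c2ba8931e3000130522ff290283042931a031d3a00012ac2,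
    0x28f06a80110008f28b06a9168f18bbb6bc868b5f668769b5e698ebbb4bc848b5f468749b5e498cbbb3bc838b5f368739b5e398bbbb2bc828b5f268729b5e298a6ae0,
    0x32900636c5328035620615914148c284332b38bc7d201c89209fc4b0bc9604b673c8f208f0000971275b29a8c891c7d289002ac26881,
    0x4d0c8d30650b6f60b668e05423604d0268a3535a153525a98db6f4b6e4a140b540b44a98c300630d50640063504d00625a930d40b5424a9c2005400615a31c030c4ac98c8d3c8a3a3006053431f00605325410060530b4a983080060532c431f0060532443070a931b03060a98b30e12eb1a809f2ec032602020ba92eb02c502f60b9a31402ed0a9326031703160ba102f60ba908f2c52c9432ed22f922f52b982ec22c522f62b92f922f52b9c762c752b982eb2122ee2b92f822f42b92f722ef2b980af022eb22c522f62b982ed22f922f52b982ec02c502f60b92f902f50b9c760c750b982eb2122ee2b92f812f41b92f722ef2b98a2ec032602c502f60ba92fa22fe22fc2b9a31402fd22ee2ba92eb02c502f60b92ed09a326031703160bac6f2c6e2ba2c502f60ba930e02f722fb2ba2eb0a92ec02c502f60b92f902f50b9c760c750b92f802f40b9a327031903150bac5e2c5c2ba2fe02fc0bac6f0c6e0ba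983290109328092ff18284313832b3832a38b002ac2,
    0x28f06a80110008f28b06a9168f18bbb6bc868b5f668769b5e698ebbb5bc858b5f568759b5e598dbbb3bce38bbc368739b5e398bbbb2bce28bbc268729b5e298a6ae0,
    0x691065136b232920534bd76c570bea68284332b38b0112c9608721c8c0879c8f001c890978c7c1c841079a012ac23950,
    0x6810692c973201626168ae0651269b7452590b658d064116168e935b94589dab7440b6480b440b54b944a89cc9733081060530b4931f006053254c8839a8b06500625064006259a32e40b54c874a9c10061531f0061513a93244c8639acb830f02b703160b9a31402f902f50ba908f30f12ec12c512f61b83141831713161b8a2ed11111b82f902f51b8a2ec22c522f61b82f922f52b8c761c750b8a30e1112ee1ba2f822f41ba8930f02b703160b9a314092f902f50b9a30f031913151ba2fd12ee1bac760c6e2ba981031e3305131a2932d02ac1,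
    0xaa10af004d00672b7460b668e0552b6f630368a06510b6604d126a9b745b6f5a2590b650b5525a98db744b6f4a2490b640b540b44a98c06500632e50640063504d00625a932e40b5430c4a9c8c973c8d3a3106053491006051430060532543080060530b4a981006051431f0060532443070a98b2ec132612121ba82eb12c512f61b8a31412ed1a830e12eb1a8930f032602b703160ba9302c502f60b9a31402ed0a9326031703160ba3030ba908f2ec2222c522f62b982ed2931422f922f52b982ec22c522f62b82f922f52b8930f22b703162b92f922f52b9c762c752b9830e2122ee2b92f822f42b980af2ec2222c522f62b982ed2931422f922f52b982ec12c512f61b82f912f51b8930f031703160b92f902f50b9c760c750b9830e2122ee2b92f812f41b98a30f03260203160ba931822b703152b9a31402fd22ee2ba9202c502f60b92ed09a326031703160bac6f2c6e2ba2c502f60ba930f031703160b92f902f50b9c760c750b9a821218328189329021828433331832b33281832a32ff18b00022ac1,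
    0x28e0c96228a006b4e5be93709268c006c485c743a68a26ae0,
    0x28f029808706b555bee30028e1289028a10605b4e3be94a68a229f0,
    0xac004d00671b7460b668e0551b6f6303680541b6e604d00b468a9b745b6f5b6e5a90b650b4598db744b6f4b6e4a90b640b4498c0650062504d00615932e430d49c8c973c8d3c8a3a9300605325430060530b49831f0060532443080060532c498b00202b703160ba932601010ba1030ba908f22c94392ed2982c522f62b982eb2980af2ec132612c512f61ba832f133913361b8a314133813351ba832612b703161bac9b0c9a0ba830e133713341ba809f3132612121ba82ec22c522f62b8a31412f922f52ba82eb12c512f61b82ed18a326031703160bac762c752ba2c502f60ba830e12f822f42ba2eb1a82ec12c512f61b82f912f51b8c760c750b82f812f41b8a9003260203160ba932712b703151bac9b0c9a0ba932603030ba2fe22fc2ba2c502f60ba9326031703160bac6f2c6e2ba2c502f60bac760c750ba9833a032809329098284303832b3833b38b002ac1,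
    0xc3b07090c3f10706bbd5b673c8f001c8c097c841a83950,
    0x690c9d306b685065006350642069259da8b6840b64b9449a8cc9d331f006053254c8839a8b0030f02b703160ba9314092f902f50b9a30f131703161ba2f902f51ba9c761c752b9a83050284333c033d39000132d2,
    0x6800691c9d306b685067206b745a0650060b650641060b5504d10635a98b684b744a0b640b44a8c020a82060534c9d3c973a831f0060532543080060530b4a8b326030f02b703160b9a31409202c502f60b92ed09a832613130ba2c502f61ba8931723162b1212b82f922f52b89c572c4b2b1212be890afc762c752ba329033e09284333f38b32d22ac0,
    0x5510af03206b6850650060b658067106b74530063589055206b6f5904d0060b458ab684b744b6f4a90b640b44a8cc9d3c9739c8d39a31f0060532543080060530b4a8b32602b703160b91010b9a2c502f60b9a8326130f12b713161b831418a326131713450ba809f222c5222b82ed28933902f62b9834422b713452b833823352b8c9b0c9a0b809f0af3261313131b831418a30f22b713162b833813351b8a212c512f61b82ed18a326131713161bac762c752ba2c512f61ba830f231713162b82f912f52b8c760c751b8a9284333a03280a3290a34638002ac1,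
    0x650c9d3b6860670b7460550b6f6054036a9835353535a98db684b744b6f4b6e4a98cc9d3c973c8d3c8a3a98b22c943980af32612c512f61ba33913361ba809f003260203160ba934702b703450bac9b0c9a0ba908f0020203160ba932612b703450bac9b0c9a0ba932603030ba33903360ba2c502f60ba9326031703160ba3232ba2c502f60bac760c750ba98b6732ac0,
    0x2d506a61042ac3b6556ac06fa66f816f969875c06e40b642,
    0x28e0c8920101012d516a9026269269e25259259db66370e39b6539b29400670d52d50063596ac00625970d3384396fa39b875c16e416a902950b6b2,
    0x2970c8f2294028f071606a90b5567146384698b66670e69b65698eb5557145384598b66570e59b65598dbee37143384398b66370e39b65398b6a902950b5e2,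
    0x74f075d031e32215158d39b4148c75820539a4a3bb07570755181275600af1275e00097384087a126e920074b0285074e3,
    0xce131e338b115158d3ae438c48c75810539a4937e037b0982075f1822100af385175a009f3bb17570974b1217590387028507473]) allWin_2398
    (by decide +kernel)

set_option maxRecDepth 1000000 in
theorem allWin_2451 : AllWin painterTable 2451 :=
  chkMs_sound (ws := [
    0x10542c8a307a016168e35158d06801616a8e25258ad9b7540480cf4b9548a9cc8a3b6e61016804d036064126a8925052525a98db6e4040b44b944a98cb07a006053594068006059caa49ca100630d504d0063506400625a930d430c4c874a9cb35813092c7e30605ca94a05410625220615a30c4c7f4acb20c7a30605bfa430910605bf94ba9834c22f72b890af34911111ba34d12f82ba809f3480051ab43030b9a34b0934a12e602c50ba91010b934e12f90b9aca80c762b9a08f34802e602c50b9a34b0934e02f90b9a34812e602c50ba34e02f90baca72c6f1ba9349034d010ba122f80ba34c02f70ba9348035412fe1ba34f12fd0baca70c6f0ba34c02f70baca62c5e1ba98357010a0093560a8355092ac0b6d3,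
    0x550c8d3260690168b7650d958d07a2260682168905253598dab7641480d9490cf4b95489acc8d3b6f606500b66804d20b4606413689a3535805253598adb6f41480b649040b44b94498acb0690060536641006250680061593594caa49ca06500632e505420635064006259a32e430c4c8749acb1010b365031c0bc3092130605ca94c7e30605c7f4ba980234822e622c52b9834b234e22f92b98349234d22f82b934c22f72b98a35a11111ba834d12f82b8a09f34a0302e602c50ba935c0934b034e02f90b9a35b135d03170ba34e12f91ba934a22e602c52b934e02f92b9ca81c761b9a08f35b034a02e602c50b935c09a35b035d03191ba935a0934b034e010b934f12f90b934d02f80b9a34a02e602c50b934e02fd2b9ca80c760b934c22f80b9a835e035f13191ba34f02fd1baca70c5e2ba891031e335723552835628364031d3a3571355232a3900022ac1,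
    0x28e06a616ac0972ac50604b663294070d5828f0764229506fb1,
    0xed20ee045622a50b8942038d1ba543bf042e49833bbe3bdb398b2a52bbd345428a42c2228a455038d142b28b9d3023ce0,
    0x5420551c8d30006911ae626b7660cf689a0d969e07b207a026168ea3515835158a0d9525a9db764b754a140d440cf4a98cc8d3cae60650060b658066236c8a33604d01689066216935258dab6f40b64814b6e404890b449acb069006366507a00605a140d443594a9c04d0060530d40640062530910615a0b5430c4ac9b836513581a831c10541060530c4a8b935a13491a809f34a0356006051ae43030ba935c0934802e602c50b934b09a367035d13171ba2121ba908f34a22e622c52b834b282ea03390b89122f92b834e23380b893492322f82b9834c22f72b8934d23371b8ca82c762b08f09f0af34822e622c52b8934b2834e22f92b8934a22e602c50b934e22f90b98ca82c762b8934921212b934d12f81b934c22f72b98a36b0369093570a836a09367034a02e602c50b935c0935d03191b9a34802e6020b934b0935412c50b9a35a03490a9348235422fe2b934f23380b9ca72c6f2b934c23370b90af34a035422fe2b934f22fd2b9ca72c6f2b934d02f72b9a368035f03190bacad1c5e2ba35412fe0baca70c6f0ba908f36c313932b3823831e3ab369032a39002ac2,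
    0x6b1b746c6a0c97336100d568b0691269b775259358d11060cf5068206b95589a24b7740d54890d940cf4b9548a9c0a8006400635c973bbf6100615890651060b6504d126c88316835358da9b7440480b6490b44b94498acb069006053664068006059caa49ca06500625064006259a32e40b54c874a9cb835b135a1834a12e612c51b835c1835a18a34b134e12f91b834d12f81b8a90035b02bd02b70ba935c034e02f90ba935b035d13170ba34e12f90ba908f34a22e612c51b834e12f91b834d22f82b8ca80c761b08f9a35b02bd02b70b9a35c034e02f90ba935b035f13191ba34f12fd1baca71c6f1ba9831e335713642936b03692833d02ac1,
    0x36e30af0069006b236368e1b450d95b7750d5589ad06b2c682c67016168beb765358da0691060d9506a2060cf5a904d00a908712060b650662060b45ac973bbf6c8d3cae6a0650060b658904d10635064126066216a0b550b45ad89b1b44b7740d548a0d949b7640480cf49a34b744b6f4a90480b640b44a9bc06902607a016a1515ad36643594ac0650060532e40640062504d00615a0b5430c4ac9b8367134a12121b8a34812e612c51b8a35c134b1a835a13491a8935b036702bd02b70ba935c09202e602c50b934b09a367135d03170ba3030ba908f34a2222e622c52b9834b2935c234e22f92b9835a234d22f82b9834a22ea13391b834e23381b834d23371b8935b235d23172b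934e22f92b9ca82c762b908f0af367035b02bd02b70b9a35c09367035f13170ba920202c50b934b092e602fe1b9a35e22bd02b70b934f22fd2b9ca72c6f2b90af834a2222e622c52b9834b2935c234e22f92b9835b235d03170b934e22f92b9835a234d22f82b9834a22e622c52b834e12f92b8ca80c762b834d22f81b8935e235f23192b934e02fd2b9ca71c760b98a0036b13691836a183640936c336d3932b336a1833b38b2840022ac1,
    0x2de1c8922d5128f02ac306b66429400670d580028f08776426fb1,
    0x2970001029810028e06a9126268268e24248248cb55371438b6638b0028f02951b5f2,
    0x1a460a61c682c6a0c973b77606900d568b06b1b76631368907b2b75606a13689ab7750d558b765058915b755980cf58adb7740d548b764b754a0cf489cc973bbf60650060b658c8d3cae631063589c8a3bf460661060b4589ab744b6f49b6e49a0b640b44a8cb0690062507a00615936643594ac0650062504d00615932e430d4acb8202bd02b70b9a36701010ba2020ba908f34a22222b9834b2982e622c52b983492980af367134a12e612c51b8a35c1836712bd02b70ba836f22ea13392b837513382b8cb71c9b0b8a35a137423371ba809f36702bd020b9a368135f12b70ba9cb61c9b0b9a36703030ba2ea03390ba3030ba98313671212c51ba834a22e623391b8a35c134e22f92ba8367135d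13170baca82c762ba834812121b834b182e612c50b8a35a134d22f82ba3491a834a12e622c52b834e12f92b8ca80c762b834d22f81b8a367035f13191bacad132ba2e602c50baca72c6f1ba89284303832b38b376036a0900936b0a33b3828402ac1,
    0x6b1c9d32620168b7850d558d06910635068006258a9b7840d94b9549a8cc9d3bca60650060b658064126c88316a0b5525ad89b6840b64b9449a8cb35b02bd02b70b9a35c0934e02f90b9a35b035d13170ba34e12f90ba98ca81c761b89a2843357037700390033d1,
    0x210672c97306b0a72626ae252525a89d34b784b774a8c069006351026068016a2525ad90d940d440cf4a9c8c9d3b6860672b746a06503604d036a835258350b458ad0424b684b744a980b640b540b44a98cb367035b02bd02b70b9a35c09202e602c50b934b09a8367035d03170ba2e602c50ba8935b22bd22b72b8935c234e22f92b9835b235d22b70b937502f92b98cb70c762b890af35b22bd22b72b8935c234e22f92b9835b035d23170b934e02f92b9ca82c761b98a36b0364092333f38b33d22840,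
    0x379006b11bb5bcb60671c9731b75bc7606b20635a9340cf42424a89b784b774b764a9dc0af006711b95bca6c973bbf69c8d306359ab6840b441414ab744b6f4ad89cb0690062507a0061590d540cf49c06500625020660970615a0b640b449cb810051ae436702bd02b70ba91010b2e602c50ba9835d13171b09f22222c52b8934b2982e623390b9837812bd22b71b837513382b81110bcb71c9b0bc809f0af35b136712bd12b71ba2e612c51ba835c134b1a8ca8110b8cb71c762b0af935b135d13171b834e22f92b89ca82c762b98a3310376009f36b0934638012840,
    0x28f0395329808706bee468a22950,
    0x11206b7852035bc76806b1b76681b75bba68ed907b10698b75598dab7841ae4b774b7649ab7549a8c000540871106051b4406710605b684c973bbf6b74489ac8d3cae6b6f4c8a3bf46b6e4a89b36711111b8a09f2e622c52b982ea13392b809f0af0036702020ba937a1312b71bacbc020ba908f2bd0cb72c9b0b36701ae4102c50ba2e623390ba9367035d03170bacb7132ba91010b92e612c51b9aca82c760b9a8b6732840,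
    0xc380cbd30b80cbb301b0cba30b70cb93a9836363636a98eb7a5b995b985b975a98d0b80cb83c28601b0cb53c27601c0cb4326a9c285c275c265a9d01b0caf3360ba0cac316ac1d5c1c5ad0b90cab306bfb5a98cbd3cbb3cba3cb93a98cb83cb53cb43a9caf3cac3acab3a98ca53ca43c9f3c9e3a98c9c3c993c983a9c953c8e3ac8b3a98cb096208e208a2cb980af084109710871ba09612108a1cba097108f108b1cba809f0840086030095008d0cba9085004400890ba0980094008c0cba9100880b0440095008d0cba0980094008c0cbac6b0c6a0c690cba908f0840086030095008d0cba9085004400890ba0980094008c0cba9100880b0440095008d0cba0980094008c0cbac6b0c6a0c690cba9084009700870ba09602008a0cba097008f008b0cba096008e008a0cba90a400990b0a6009f009c0cba0a5009e009b0cbac680c670c660cba0a4009d009a0cbac640c5f0c590cba980ac01090af00ae0a06700650ba90ad00a70a90ac00ab0a055020ba0aa0a054004d0ba90a900a80a2030ba0a70a1004d0ba06600640ba98b6830b631398b743139b6f323ab6e3a980b630391390b5303a0b43ab943a98b06c0,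
    0xc380cbd30b80cbb301b0cba39826262698eb7a5b995b98598d0b80cb833630cb53169c285c2759d01b0caf306c1d598cbd3cbb3cba398cb83cb539caf398ca53ca43c9f398c9c3c9939c95398cb0842086232095208d2cb98085204420892b90982094208c2cb98084209720872b92208f222cb9096208e208a2cb98a0bb1110871ba8097108f108b1cb8a09f08600bd030095008d0cba90bc0100890ba9100be0b203030cba9100880b0440095008d0cb90980094008c0cb9c6b0c6a0c690cb9a08f08600bd0203030cba9100880b30095008d0cb9a0bc004400890ba0980094008c0cba9100be0b0440095008d0cbac6b0c6a0c690cba90bb0100870ba097008f008b0cba9100bf0b0a6009f009c0cbac680c670c660cba98100ae090af006700650ba90ad090ac0055004d0ba90a9006600640ba98b683338b7430b439b6f3980b638b0006c2,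
    0xb1c380cbd330cbb3816168eb7a5b9958d0b803306c2858cbd3cbb38cb838ca53ca438c9c38cb08610bd1213131cba8110881b31095108d1cb8a0bc104410891ba0981094108c1cba80bb1110871ba097108f108b1cba89000bd0203030cba9100be0b0440095008d0cbac6b0c6a0c690cba908f000bd0203030cba9100be0b0440095008d0cbac6b0c6a0c690cba980ac00af006700650ba98b683138b74380b638b0006c1,
    0xc40231406b7a5cbd3ca54b0bd0202020c9ba0441095008d0cbc6b0c6a2c690cba98b68307c0,
    0x5600654030672261150168027507f58d06b307b38bc6b222063a858c6a207938ba10973b8008f0000972e81807c404806c48c0da30380fc38b05a02bb2]) allWin_2431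
    (by decide +kernel)

set_option maxRecDepth 1000000 in
theorem allWin_2505 : AllWin painterTable 2505 :=
  chkMs_sound (ws := [
    0xcc61cbd3b7a60c40cbb3b996820cba38b9868e01c1cb93b9768a9cbd4b7a6cbb4b996cba4b9869cb94369a8cb7a5b995b985b975a98dcbd3cb53cb439cbb3cba39a8cb9389ab01f0c9c4cb83c2860c41c994cb53c276901c0c984cb43269ac285c275c265a9dcb83cb53cb43a9b80c40c954caf3363203cac416ac1d5c1c5ad0b90c8b43306bfb5acaf3cac3acab3ab890c7004400950b90c809a09800940b9a08f2208e2b9808f0af0c61096111ba8097108f2b8a0c710ca104410950bca09800941bac6b2c6a0ba08f09f0840086004400950ba90c80909800940b9a0c51044009f1ba0c9109800940bca9c6b0c6a0b9a0c603008f0ba0a4209d2ba096008e0ba90c500a6009f0ba0a5109e1bac680c671ba0cb10a4009d1bca9c640c5f0b9a8b6840b641498b7441498b6f40b44a8b6e48a9c067010a0790906610b6404904914a0b5404a34a9c8b783b68403048030b640314a903b744030490314a803b6f40334a03b6e4a8906700b640314a10149079024a8100b541014a110b44a89b0662b94489a0006c2,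
    0x1033cc6001c02398cbd4cbb4cba498c26262698eb7a5b995b98598d01f0c9c4cb83c28601c0c994cb53169c285c2759d0c40c954caf306c1d598cbd3cbb3cba398cb83cb539caf398b0842086204420952b980c8209820942b98321208f2b9096208e2b98a0c618097108f1b8a09f08600bd03030ba90c8090cc02020ba90c7004400950b909800940b9c6b0c6a0b9a08f08600bd02020ba90c7004400950b9a0c8009800940ba90cc004400950bac6b0c6a0ba90c60097008f0ba90cd00a6009f0bac680c670ba980670b684348b7440b449b6f498248cb783b6840334803b744030b44903b6f498030b648b0006c2,
    0x1f113cc6034348c16168eb7a5b9958dcbd3cbb38b01f0c9c41306c285cb838203030b9a08f0bd108613131b8a0c8180cc03130ba80c61890c7204410951b809820941b8c6b0c6a2b89097108f2b98a0cc004400950b90a6109f1b9ac6b0c672b9a8b783338338b0670b684148b74480b648c000106c2,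
    0xcc601306b7a5cbd3000bd02020ba90cc004400950ba98c6b0c6a2b89ab783b68407c0,
    0x75b22d516a60060503b654002c408768b10605b6c3a6ac00603056fa469e006056f53a6f8106056f93c7720603056ec4a986a600096f718b642006e41,
    0x3d0222970c0e6ca8228e0bc66c7620590c396ba040ed42434c763a98143ba4a0df40de40dd4ba9c0e4c084c584ba98c2bf02e762ba02d8605902ca6ba3b942e542e44a92e742d842ca4ba9c2df036ca6226c5e3a2e542d74ccb3ac9829700092de18b65229e0,
    0x3106720306b406027511510607f59c6b20792063a858a30873c50970da3238b002e811706c30fc480005b129d2,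
    0xccd001f00d618cbd3cbb3cba3cb93a98b36363636a98eb7a5b995b985b975a98d01f0cb83c28601e0cb53c27601d0cb4326a9c285c275c265a9d0d80caf33601d0cac316ac1d5c1c5ad0d70cab306bfb5a9822980af11809f0008fc6b009700960a10a79c6800a40accc0a7c6429806701090790906618b7830d531398b773139b76323ab753a980d530391390d4303a0cf3ab953a98b0ce0,
    0x2ea22b902bf101297006c0e435d20105e0972e911728e02bb406c08531730103d09705e1170590c396c584ba2bf0062e742ba0062d84a059006042ca5ab80029712de182bc09b6620029e1,
    0xccd001f0cbd3cbb3cba398b26262698eb7a5b995b98598d01f0cb833601e0cb53169c285c2759d0d80caf306c1d5982212096298a018118a09f0008fc6b009709ccf097c68180670b783338b7730cf39b763980d938b000ce2,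
    0x261cbd3cbb38b16168eb7a5b9958d01f0cb8306c2858110971890087c6b00670b783138b77380d538b0ce00da1,
    0x260cbd306b7a5c6b0b7830da0,
    0x3a010e08701f2052211d00396026211c011a18e11e101c21311f6025211b009fcc630d6301c480af0b840b749ad11620c4401b5c01d31180c9a11910b921171dc98b0008f10009810f180087056009f22229228a027507459158d1140020307f5911500270,
    0x118110e08722140396026201f2bcc62c382d01c235ab8c11c011620c4301b5cab81110f189108710008705608702030271,
    0x10e002630396c562ccd3cc63c385cb056004c003c4e2,
    0x10cd63cd90cd53cd80cd43cd70cce3a98b7b6c356c346c2f6a98ecd63cd53cd43cce3a98cca3cc93cc83cc73a98cc53cc43cbf3cbe3a98dcb100050b00f00060b014000e000c000a0dcba9100050b20200080cba303000b00090dcba900f000d00070cb014000e000c000a0dcba00f000d000b00090dcbac560c550c540c4f0dcba98300160014001a0ba90150100180ba00f00170ba90160014001a0ba00f00190ba026001f0c380cba90150300180ba02400170ba025001e001c001b0dcba024001d0c370cba98b7a3b993b983b973a98b0270,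
    0x6a60102069406eb1868f00175c18b5e673c61698b6b6369b64698eb5e573c51598b6b5359b64598db5e473c41498b6b4349b64498cbeb273c21298be6273b29bd9298a68f06eb09a4909a4841786e40,
    0x6ae09fe1050403b5726be0050403a5a28a2b0a064070417,
    0x16a90973000872168e0208709f68f100694107968d00175c1816169bbc6687698b5e69ba868baa67a769b6b698ebbc568759b5e59ba858baa57a759b6b598d14149bbc4687498ba848baa47a7498b5e473c48b6b489cbec2a5628687273b289cdc27a7298beb273c28be6289a68d068b0968f0986ae06e41,
    0x28f06a80110008f68d06a9168f18bbb6bce68bbc668769b5e698ebbb5bce58bbc568759b5e598dbbb4bce48bbc468749b5e498cbed2be728bec268729beb298a6ae0,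
    0x2890c8c2102971070028e1076a9126268268e25258358db553138bee471438cb6638b7c62289128e09770b030b4e669f036828a0268b4e5258258dbe9370838c6d38ba106a708729e1bbc2,
    0x7786cdf0ca8277707760936c332b391476f48bef37754774498acb009722229a00cde208f0000971275b29a8cdd0cdb28900016872,
    0x76d0bea6c7608776c09b6d3bef476b476a4a8c30a73109fcde008f769022cdd0970075b097a80000a78cdb0a900016872,
    0xa4b069402005b5e4beb268f0a4a41786ad0,
    0x1110976a911768f1696526269269e14149bbc42498b5e49cbec268729beb29a68d068b0968f0986ad16ae0,
    0x2b7077d1bea6c9b0872c512e60a7c570bd7677709bef332b377c4828437770bef377548c9b013200872177b13289cde001cdd0978ce7171f18ce609a68a06871,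
    0xc3b0c3f087bbd5bd76bef300cde087ce709ce618a68a0,
    0x1042e50dd1bd730f54bef33bf032b377a4837c245428a38d0972a50bef308f42c2128a455042b28003cd1b8633ce2,
    0xde20dd2c3c0bbd3b89510a02ca1bbe3ba55858b40f549cbef332b378548b21101308f2a52bef338d28a42c045514592901003cd2b873,
    0x30c4b0bc96bbd4c570bae6bbe47760bdb476c034a98bbd3bbe3bdb3bda3a98bc96077b010a9c89075b0ac7d2986870,
    0x2b7087c5d221bc9634c570bea6158bbd3bbe38b1111891177b189c960c8918c8c271f18c8409a45f168a0,
    0xc5d0c570c4b0bc9604bbd3c960c8c0c8429868a0,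
    0xc440cee3bca64090ced3bbf64070cae64080cec336a98c094ceb4cea4bf44a98cce93ce8323ce53a98b22ce43980af32612c512f61ba33913361ba809f003260203160ba934702b703450bac9b0c9a0ba908f003260203160ba934702b703450bac9b0c9a0ba932603030ba33903360ba2c502f60ba9326031703160ba3232ba2c502f60bac760c750ba98bbd33cc0,
    0x28f029808706b555bee32950bbb2,
    0x2970001029810028e06a9126268268eb555258258dbee371438b6638b0028f02951bbc2,
    0xc760c96006bd75777077b106bea5776006bdb576c00635a98bef3bea3bdb3bda3a98bcde077b010a9cdd075b0acdb2986870,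
    0x42e50de0bc933bf00f5439448c0238422a82714097b6608745f02a90b863,
    0xe850df10de1bc9310a02d81bae38104439448c45f100977140a76ab02a91bee1073cd0b873,
    0xc4d0cee3bcb604404292ced3bc764280bba6942a0cec39bff69ea8c0f4b774b7649b7549acf85cf759bf44cf639ad8cc9d3bca6c973bbf684070cae683308fa9c094b744b6f4cf63a9ceb5cea49bf449ad8cb2e622c52b90af202bd02b70b9a201010ba1010ba2222b0af98212e612c51ba836712bd02b70ba82ea23392b8cf52c9b0b8a09f367035d03171ba3232ba2e602c50ba8ca82c760b8a90036702020ba937a02bd12b70bacf42c9b1ba910f2a50bbd3,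
    0x21bca3bcb41250bbf3bc7444f104b0bff39a8b4750580f85b795a89db783b773844e0b7538a9c0f310658bf7598ad1ae3b684b74489b6e4b6f30af89c093ceb383b55bf438a9dcb0008f0dc1008709f0fa000980ed2910918100ee2b809f10b213f1c090c7b910f0af0dc044d00ee0ca8010ed107a0ce044c0c8a9b8930fe0,
    0xdd030bc62bc93b89410a02d82bae3ba543bf042e498bbd3bbe3bdb398b0237c22a523cc2b9845428a42c00097a518003ce2bac3,
    0xcdf0c7627692c8f0bc96bd74777077b1bae6347760062498bd73bea3bdb398b222275b298ac96077b09c8c071f09ac890c7d298026870,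
    0xbc61bc93b8942d81bae3ba548bbd3bbe38b7b813cb11111ba2a513cc1ba87b51890042c0bc40ba90ba98003cf1bad3,
    0x2e62cdf0cb7097c762ca8097a00c8f1bb9306bef42b7002cb617770a77b106bae3bea4800c961c8c277b171f28c891c8528901687268a0,
    0xcbc0c9b0cb70c76298c8f0bc9604bd73c960c8c0c8429868a0,
    0xde030c0e2bb93b89410a02e72bae3ba543bf042e4983bd010b6522a82bac3,
    0xc0e1bb93b8942e71bae3ba5482a500fe0b6612a91bad3,
    0xc6b1cff3002bd1cbc205c0f4c6b0cfe32ea105d0548c680cfc32e6205d0448ccc1cf6306bff48a9cff3c9b006c094cfe333910506cfd48cfc32c5205cfb48cf638a9b36702020b9a37a02bd02b70ba9cbc0c9b0b9a36703030ba2ea03390ba2e602c50ba98367135d13171bacb71cdf0ba2e602c51baca80c761ba89002a51bc93,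
    0xc540d063cfa5cf93cef4b000bd0203030cba9100be0b0440095008d0cbac6b0c6a0c690cba98bca313f0,
    0xc55004d063cfa5cf93000bd02020ba90cc004400950bac6b0c6a0ba9803bca410a0,
    0xc560d063cfa5c6b0bcb310b0,
    0x12f00c6112bbf6147119d60cb290b640b449cc7603ff53fe59ceb5cea5bf44ac98dce83ce43ce53a9b4060405093fd43e949c40433fc43f703e74ab82ec13261312f61ba830e1809f2ec22c52ce43983f92832f133923361b83fa2809f0af2ec132612c5121ba832f1339122b8a2eb13131b8a0130a7892ec12c522f62b83f9189a3fb030e129b03342b9a3e502eb0a7930e129b022ba3e50a2f822f42ba98bbe33cc038d1,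
    0x972c440ced3bc7642514242941f441749c2bd0cf842e60cf759ccc1bf44cf639a836e311bbf6147119d60cb29c76041d43fe4aceb4cea49bf449a8cb42704260941e441649c406010932e44050ac3fd53e959db834a22e622c52b98414280af36f136712e612c51ba2ea13392ba841c1809f36f136711111ba2222ba834813131b8a0130a7834a22e612c51b841428a93fb035a1374229b0ba91012940b03097a35a137413371ba3491a934d12f81b9a8112a5038d2bbe3,
    0x4a004b112420d9344a21250366344918bc733af044b13a7090bf0b63448132e344718bc0dc00ed0908f0f85107543b09cf83ceb441733fe443a0cea3bf44ac89b446041e34390416393fd43e9490bfc8d444109f3b929109212809f0af0dc03ab143d098010ed0a70100a78013970a78445290fe0ba532aa1]) allWin_2451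
    (by decide +kernel)

set_option maxRecDepth 1000000 in
theorem allWin_2573 : AllWin painterTable 2573 :=
  chkMs_sound (ws := [
    0xafb417a2b0afc1049700441725259259d24249249c23239239bba62a3829b6a29a6bd02417045704473437a080045704470437924170457044724379afa4270044279af94279a8a5c09fe09a5b0981417aee0,
    0xafd104afe3a6c0006890af94170417,
    0x217a810504be8370d16f4205047aa396fa205039047a939caa5e09fe4170504d0e374600044a70504a5f39801d0d2c5a068900417,
    0x2f81c75077b1c96006bea577610635976c106359a3333978c392398abbea4bdb49bda49ac7770787278d306d0f57760063576c00625a9d0f478b4978a49ac877b1787187861a9cde07880978907171a9875b1018972418a68706f41,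
    0x2d712d812a50bae3ba543bf142e438e142d4a97b707af47ba0987b906fa1012a807a93,
    0x2c912d822ca0971305ba54bea3210542e4bdb393bf06fa1057af4d0f37ae178b39845427ab28a7ac17ad0113ce06e727aa3,
    0x12d812e72bae32521159ba5442e49c3bf03097057af48203bd087112a816fa277f36fc2,
    0x2d811305ba54bea37b6013057af4d0f387b51118942c07b4183cf077f36e71,
    0x2e71bae305ba547b70d0f3057af48002a5070d177f36fd1,
    0xc681cfe331d05542512e622ea0d0459c641cf63b755269ad054d044bff4a9ccfe331339206cfd4cfc32c5215cf63a1414acfb4bf44a8c9b427034d13742d19640602f813372d186b42603492d17640502eb2d165b9426016139d154d1439ca836f136712e612c51ba2ea13391ba834812e612c51b8a41c13491a8934a12e612c52b8414189a4340c5d0c3d0b9a45709309a35a137413371ba42f0a934d12f82b9a8bae338d12a50,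
    0xb1c4f0d0630440cfa513e0d1a3d0c58cf93d0b38cef3d0a38cb086113c1210881b8a0bd1212121cba0441095108d1cba81371097113d1ba89000bd02012f0ba90bb104400871bac4d0c440c3e0cba98bbf30dc00dd1,
    0xc55104d063cfa5149004d1a3d0c58cf93d0b38b0c710bd11111ba04410951ba8148189001450c4d0c440ba980dc003bbf40de1,
    0xc561d063cfa514a0d1a3d0c580440ccf1bc730dc00df1,
    0x870144219d60cb22c50cea4bf44ac3f802f813e943ef13f5598ce43ce53a3f702f4132c43e7583f633f4489b32ce431283290af2eb22c522f62b893ec28a3e502eb0a71093ed0a3ee18bdb337f20038d1,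
    0x418341b01a6641921041742e61cf742c51bf44cf63a894043139119d60cb22c50cea4cf63acb3f80414141643e94bc841a1415408f3ef13f558b90234822e622c52b9840e280af40b03490a740f09834822e622c52b893492840e2940b0a40f0938d0bdb33842,
    0x4901a5343f0a70db0107543b1417343a00b430dd13b55bf44adcb439041633e93c843e14380a8912129a3b9243c2912f0043d100012aa242e3,
    0x90d0630440cfa513b00971d0c513a0d24598cf93d0b3d1f398cef3d0a3d1e398cb084208620442095208d2cb981372136298a086008420bd01012f0ba04400872ba91380912d009701390ba98cae30dc00dd2,
    0x8100c0c55204d063cfa5cf9313b00871d1a3d0c5d0b313a0d245d1f398086204420952b8914628a1450138091471803cae4020de0,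
    0xd000e0c562d063cfa500d00971d1a3d0c513a0d245980a60ccc2bba30dc00df2,
    0x12e02c5006bf440cb02eb13e943eb02f70a73e8498ce5330602eb13e743ea32ef0a73e6498b3e500093e418bda337f0,
    0x3ea312e12c5006bf44cf60b740503e94d140b7840c134c0a740d53eb02f70a7043e85b8940b000a40a18bda33840,
    0x49087bf43bff4b7951a534351bf44b439041633e93c4380437298004361002aa142d3,
    0x90d0630440cfa513500971d0c5200962d2451340d2a5a98cf93d0b3d1f3d293a98cef3d0a3d1e3d283a98cb08400860044012f0ba910912d012c0a096012e0ba98bf430dd0,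
    0x30044004d063cfa500b0087104d1a3d0c513a0d2451340d2a5a98cf93d0b3d1f3d293a98b145012c09144180dd003bf44,
    0x300440d063cfa500d00971d1a3d0c513a0d2451340d2a5a98ccc0bff30df0,
    0x7c62001069f1002890694126268268eb4e5258258dbe9370838c6d38b33a269d168c106c485c7436f62060570738100605c6c38a0068c06ad1bbc2,
    0x7c6000973087c5d2bd76bbd5c570bea6bbe577602598bef3bea3bdb398b22323298acde02277b075b29cdd0cdb298006872,
    0x2a9179533cf0013d72a7e47a44ac79a0a7d28a7c3a7b39b0097a762a770970afa7a0a780a7801a7921178f36cc0,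
    0xa870bd633d803d718a8847a4489ca863a7b389b3ce290afa7f109f79d0b84308fa850a7909800a84296cc0b7f3,
    0x7d513cc0bef3352db133158d354d3448cbef3bea38b7cd17ce11111ba3cc17cf1ba87cc189007d40c4a0be50ba9877f06e61bd53,
    0x2a50c58087bd7305b894bef310a02d82bea3ba552ca02342e59bbe3339bba54bea342e4bdb39c837c22a523cc2b838d2845429a42c000987a509bd43003ce2,
    0xc081bd7305b894bef310a02d821305ba54bea3837c13cb12121ba87b822a513cc1b8a7b518942c071417082b9a810bd533cf1,
    0x3d1c7630590c396c584c5722c60c6f0a72c41067d852d40067d759810008769e128c1b6c3b652,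
    0x32c5205e09703d1003007d406c585c57205903282067d84803f069e169f08728c1c6d3b662,
    0x6d70aae403b4d0b7b14203b4a3a6ce26cc3a1606cd0,
    0x2a5200313005d3b4c07289c02951052a94a8a0b652052a84b6c39a8927b929a86b402a40b4d2b4a3,
    0xd3c11305d354bef3202020b9a87ce13cc07cf1ba8be91c742b8a97d60bd63,
    0xc6a1cff32b70c9b1b68406c095c9d33160c9a106d3d5bc6a0cfe33391cfd6d3a1cfc32c52cfb6d391cf6326a9d384d374bf44a9cc9732f610624239336206d364d2f39acf639ab83260203160b9a34702b703450bac9b0c9a0ba932603030ba33903360ba92c502f60b9a326131713160bacdf1d2e1ba2c502f61bac760c752ba98bd7300013cc2,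
    0xde030c0e2bc93b89510a02e72bae3353bf02598b894ba5442e498c3bd010b6522a82bd43,
    0xc0e1bc93352e71bae3158b894ba548c002a50b6612a91bd53,
    0x44032cff3cbc0c0f6c6b0cfe32ea1d056ccf0cfc32e62d0469ccc2cf63369a8c0f4d444d3f498bff498accff3c9b00604c095cfe32c51339206cfd4d385cfc32c52cfb6d374980389cf6389cab0036702020ba937a02bd02b70ba9cf40c9b0b9a36703030ba2ea03390ba92e602c50b9a367035d13170bacf50cdf0ba2e602c51ba9ca82c762b9a82a50bd73,
    0x34d246c100208716bbe5bea3c4b00605d0f3811257760158bdb378b38b977b222878629a70902271729a877b17871875b272428a7c5096ff16f426880,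
    0xb0d417a2b0b0e12417050403b6a26bd004172417045704470437af94278a5b004171417a0d407,
    0xb0f1006bd087016e41050403b5c2004417b0d497afb497045704470437a0f42786bd0004417b0e097050403b6a28a06407a5b087a354170417,
    0xa7410068d087016eb0976f711716169e15159d14149ba841498c12129bdc2d48298a68d0a7411417060504d0d23417060504d4739868d0a6f41714170467045724470044170467045714479a0b427a0c4279a08fa6e0a6d0986bd00417,
    0x6bd12097006ae0050403bcc26be1300044070504039ff296bd1006e4087050403b5c299fe01407a0d417,
    0x68e068d06a610168b116169e15159dbce4d4a49c68e06f71141706250044170615924349c8be727a828d4a2a75289a68d06f71210605ba84bdc26eb1060504d4829814176bd0,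
    0x47b1002016bbe5bea3c4b00605d0f38d4b17cb1897090d491868a07a81,
    0x2ca12c911305ba54bea37b70057af4d0f382ca1bdb30542e438e20542d4a7ba0bdb3bda3a7be0b9455042b0a8017bd2117a936e723ce0,
    0x87108f2cfe32c5132f2c9b0cfd4d38608f1cfc332339006cfb409d22c50cf63b6e4bf46a94060337136302eb2169d184d1649c4050069d4d49ca8d385d375bf45a9d185d165d4d5a98d46f332442ec132f2c9a006d365d2f3cf63a9d4c3d463d143a98b32f132612c512f61ba33913361ba83fa18213131b82eb18a2ec22c512f61b83f918a946e0c570c4b0b9a46d0946509a30e133713341ba2eb1a9c5702f41b9a8bea33cc038d1,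
    0x2d712d81d3c02a50bae3ba553bf13538e125a9ba5442e442d4a9c7b70151097af47ba09c86fa1117b902a807a93,
    0x972c6a0cfe32e612ea2cbc006d054d4454270374106d194842512e622ea006d0444260349206148d3f4d1758cd942422e6006bff44050d14306d154d4f589acfe331cfd6cfc32c52339036cf63a9cfd4d385cfb414ad375bf45ad9c4060337106d18448500624d14314ad165d4d5ad98b004340c5d0c570ba9457042f0a9836f12e612c51b2ea13391ba834812e612c51b8a41c131a835a137413371ba3491a834a11211b2e612c52be84142834d22f82b8a92a5038d1bea3,
    0x33408734c277b11632b305bdb477600578b47c418786271729a7bf0006ff16ec2,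
    0x1002c912d72130542e4bdb37ba07ae17ca3845427c928a6e707ac0877c836e92,
    0x8b0cfc3323390cfb608e22c50cf6316ad374bf44ac31c02eb2337126405016ad164d4d4ac31c02f72263ef016ad5644694ac98d2f3cf63ad463d143ad5533f63064674a98b022eb22c522f62b983ec28a46d010a46c0946503f909a46b02eb0a46a0a98bdb337f238d0,
    0x2db02e52bdb30542e47d906fa02a806f926e927c83,
    0x8f0cfc34192002e60a71616aed04414acd3f5bff5ad203492264260d156ad174d4f4ac41a134c0a71616aed5844784ac98cfc32c52339106cfb440502eb2063481547f581548448d375d16489cad31c02f7206d56489cf63d14383ef006469589ab34822e622c52b834928940e29a47c0457042f0a947b09349241409a847e147d1b847a0a938420038d1bdb3,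
    0x1008709a0972c52cf6306bf44405006d4d53ef130c4064695983eb006468589acf63d14330610646743ea3064665a98b46503ec09846409bda30037f1,
    0x208e0cf632e6106bff54260d156d4f43580064784940c10647749a8cf632347914764233ef116913149cd14346949da3eb00646849a8b475040e0a0184741a10bda33842,
    0x100970175c19725259259d24249249c23239239bbaa274529b6b29a6940004517060204d0d3868d068b0968f09814176ae0,
    0x30400030507272060504b6d371a071b106050471d38c7d2320605047df378709780afc792718206050471d38a1010ac89075b0a9207170a79c79072409ad5c07860ac772986f601097de0971818006e82,
    0x2f813050304110060504b6d371a006050471d38cdb087c7d272428cdd0870afc89178718cde08709f21c7d0a70110a78c79172418cdb087a9c8f02cb006050448839c89075b0ac7829870902cb096f60982ac06e81,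
    0x2eb02ef277b0ccb0a70605bdb3320605bda3a7760060578b376c006050378a4a87c4006257db2060513a7dd37da4abc897862229a78800097dc1717286f406ec2,
    0x2ef075b00605bda376c0060578a37db020a706057da39875b0009717186ec0,
    0x1076a39580a8e1815158d835483448c37f0a8d04a5174c18b6d371d3a8c18b00a8b06e5074e3,
    0xd650054f84bda04a7078a17e4000b77da0a798488000971c1874e0,
    0x30a07e93bf90b7057ea44a73bdb078c0b84bf0054f74317e807e7298bda378a37e6180bf13138b488371c38b7e5074e37480,
    0x3f530032c17f531515ad4ab44aa4bcbea04bf2057ea44a61a4a7200b78c3a0bf7f407ef14bf0054f747e71a7ed0b77eb14a51a78a0b709f8bdb27ec280af488271c29a7ee2b022374820056d100877e5097]) allWin_2505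
    (by decide +kernel)

set_option maxRecDepth 1000000 in
theorem allWin_2627 : AllWin painterTable 2627 :=
  chkMs_sound (ws := [
    0x30c130a10230d24a93a1515ad4ab44ac4ac7f707f60b8286130c3257f5215a4ab44aa4ac7f404a8294a71ab301000b908f4a53008790bf217eb18bef08709f227f4094a5200879b4a627eb18bef08709f0af1111a76b10af9014883a56d138a07e5097b6d087,
    0x1006bd85c8b006d69548a006d6851006d675489006d665ba98bd84d694d684d674d664ba98cd643a980bfd5f2980afd141809fcf6008fc8a048703f60a9d5e04860ad5d03ea0bc7a3a984880,
    0x328071a07ff63042305031e6a15158d14148c32b332a38bcdd07fe02097060504238c7d271820605047df38ac792735006050472838ac89078709c7c072d09ad5c0c772986f601097bf0971818006e82,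
    0x1135723052062576d10615936c432b49c7ff331e3ab71a00605047df38cdd0873178718cde08709fc7d2c89097327870978ac792c85097724272d0978ac89178718cdd087c79272428a9c8f077609d5c271f09ac890c7829870908040a6f60982ac0026e81,
    0xc7607fd0c8f206bd757770063576c0062598bef3bea3bdb398bcde278828a7fd0109789271f09a7690cdb298026870,
    0x2c502f608771f1c6f0970605bea3310605bdb397770062576c006031597fc478a49c87882328a7f917fa297fb07dc272d186ff16f426870,
    0x2f4071f00605bdb376c03ef106057ec3875b271728a7f806ec26ff0,
    0x8060bfa37e93057ea4bdb04a8021218bda378a37e618b488371c38b80500374e0,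
    0x3f5232c07f521515ad4ab44aa4ac32bea04a60a87f404a8280a13183378c3a78a380c18b12128bdb27ec28b0af80b212127e537483805056d0,
    0x30c1359332414b6530d34a9215b4ab44ac49c7f707f609830d125286115a4ab44aa4ac7f4094a81abef000910a08f32108790afbae323980a384a531087ab80e1117f60b131184a637eb28abbef08709f11285176b11731e07e5338a056d3,
    0x80904bf3057ea4bdb04a80217e618bda378a3808180bf488371c38b807074e37480,
    0x3f5232c07f521515ad4ab44aa4ac32bea04a60a87f404a8280a180c18121280afbdb37ec3878c380d0a0bf80b371c3ab32b27ca287ee3a1202748380702850,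
    0x30b030d132414e6315159d244ac49c30d125286115a4ab44aa4ac4a829bef04a60987f707f6097f404a829812980a280af1111821218a308709f4a637eb3880f1bef0874a534ad08790bf76b3139b775101a024883980712156d34ae02850,
    0xc951262316bbf65bf55bdc8b306bd85bc95006d795c8e006d765bc8b006d695b496106d785495106d755b48a006d685b98494206d77548f106d745b8489206358b9abf64d794d7849d6749d7749ba8bf54d7648d75489d74489ab49741415a489bd84d69489ad684d674a89bc0048b010d6d0ba9cf60b08f1298d6f298bd5f289b08f0af11d6e1b21b81011b12d6d0ba01b08f09f3333833893389a0bfcf63d14313d643ad5f0a798b48c3c8a348738948d33f63a9bc8d04040948e04860abc8a04870948d0abd5e348639b8d6c04041a48c1bd5e010ab8334861a8b9d6b248c0bd5d1b9c7e1b8a48830031e1,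
    0x36910033a07ff63281329036c6915158d14148c32b333b38b816006050478d38212189cde087c89178718c7c172d18a9c8f0c8c0c7b298709080409839506e81,
    0x357036b0068185305235600672c5a31e433d48c36b02ff17272060524831e333d3873838bc8426f62060504817380af71e187342050433b380af09f10c840a708f00c850a72ff006050472b3900c7d0a798c8426f6206050473838c85071e090097c7d18a80402ff096f609726182ac032d2,
    0x36b106284572710672c5934348c71a0060524831e331d3872b38bc85271e280afc8c1816006050433b3809fc7d0c850a7c96009f08fc8f077b076c298c7c1c850a771a006050472b380020a78c7c171e180087c7d0a970902cb096f6098002ac1,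
    0x2f4134c22ef22f70a777b00603bdb477600678b47c40067dd4987862229a81507871717286ec26ff0,
    0x31602f8234d0a72f420432a377b1cde006bea5776106bdb59777078710624776006159d0f378b39b81111821218a9c4b010911877b212878629787271f09875b272d18c8509a6f426ff16870,
    0x12c50972e61177690c760870625777006158bd73138bbef4bea48c76907fb18141a1137d06872,
    0x34d1012f41c750300605bea3777006057eb3876907f816ff137d0,
    0x415232407f521515ad4b444aa4acbea07f407eb17ef18bdb27ec28a76b0805274e27470,
    0x415232407f521515ad4b444aa4acbea07f407eb17ef1812128abdb37ec380bf80b3237750807274822850,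
    0x3f5232404bf21515ad4b444ab4acbea07f407eb17ef18137ec380bfbdb2819280af32b27ca2880b3a81a074822850,
    0x3250366281b215159d4b544ac49c324125286115a4b444aa4ac9bef04a60987f707f6097f4098bae212980a28a11118111184a617eb18babef08709f0176b1285131e0805256d238a0,
    0x35921032e13181b215159d4b544ac49c324125286115a4b444aa4ac9bef04a60987f707f6097f4098bae212980a28a1111821218a308709f337eb380280f1bef0874a637f4090bf0177511176b31380721255902850,
    0x30d130a132e24e6215159d4b544ac49c32412530d115a4b444ab4ac9bef030987f707f6097f409821218308709f337eb383130874a637f4090bf80f2bef08781c290af77524882976b3a78d1bea087981a101124ae02850,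
    0xcaf2c9c0c952c8e3a262626baec055c045bfe5badc95226c8e216bbf65bf55bdc8b206bd85bac9c006d8b5c99006d8a5c98006d895bac95006d795c8e006d765bc8b006d695ba49d006d88549c006d87549b006d865ba496006d785495006d755b48a006d685ba98c054c044bfe4bad8b4d8a4d894bad884d874d864ba98bf64bf54bd794d764bd784d754b98bd84d694d68498bac2121d851ba811d6e1b8318ba09f202020ba2020d840ba91010b10d6d0b900ba08fcf63ad143ad5f3a980bf222232980afcfc2d7f233d7e22398221222910978bcf6212d5f29d140978bac8d24042848e248628bc8a248d28bd7d249828bac970309499048c0bac8d04040948e0bc8a048709bad6c24040948c2bd5e248709bd7c048629bad7b049a0ad6c020bd5e0bad6b248c2bd5d2bc7e3a980231e0,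
    0x36b0363033e116815158d284433f48c3290012ff10605248284333f38238bc8426f6206050481738a310605041387342050433b38a09f0008fc8c02ff006050432a390097c8918226f6206050473938c84071e290097c8518a80400096f609726180032d2,
    0x2ff136b01006284532912cb00635936c436d48c284382539b71a006050432a38c85271e28ac890872121060504238c8c12ff106050433b38ac9608709f00c890978222ff206050433b38c8c087356206050472c39c792c850978ac8c171a006050432a3800c89107c84171e280087c850a970908040a81032d12ac2,
    0x3741c9a081f177b1c8f0bae604bea3824081e1210604d0f3877b17871871f172d18a9c4b0d49186ff168a0,
    0x2b702f51ca80872006bd75bef3769081d1837d0,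
    0x3661d3d081b115159d4b644ac49c82707f609811118111184a617eb18ba9bef08728408261747138a0,
    0x3250366181b115159d4b644ac49c82707f60981111811118a94a637eb3880f10bf71d3bef087828174731155a02850,
    0x359130a130d232e3254e624b55a4b644ac49c827020a8212120a980e20af4a637f70a0180f0a70bf7752bef087011281a09703285055a087,
    0x32e1d3d04e6115159d4b644b549c82707f70984a637eb380bf80f20af829100b7d180a7d3d0c09009f78d121bef087b6702850,
    0xcb81ca50c9c1c991c983a936363636ba9ec0d5c0c5c0b5c0a5ba9dc9c1c056c99136c98126bac055c045bfe5badc95126c8e116bbf65bf55bdc8b106bd85ba9d3e0ca4006d975c9f006d965c9e006d955ba9c9c006d8b5c99006d8a5c98006d895bac95006d795c8e006d765bc8b006d695ba98c0d4c0c4c0b4c0a4ba9d984d974d964d954ba98c054c044bfe4bad8b4d8a4d894ba8bf64bf54bd794d764b8bd84d6948ba9c303030d940ba92020d840ba10d6d0b00ba908fcf63a9d143a980bf32922980af1111809fcfe1d8f112831318113182087bacfc1d7f18111180087b11d1418cf6087ba9c971318499148c1bac8d14041848e1bc8a148718bad8e14041849e1bd7d148718bd7c149f18ba9c9d046f049a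0a9c9704a40ac8d048e0bc8a0ba9d7b149a1ad6c148c1bd7d0bad8d049a1bd7c0bc863a9831e12840,
    0x3641376032913629b033e116815158d34348c81600605248284334638238bc8c1816006050433b389c96087c8f0212ff106050433b380087c8c011734180087c840a97090804098395032d1,
    0xcbd0ca50ca40c9f0c9e3a98c186c176c166c156c146ba98ec185c175c165c155c145ba98dd060ca40c0c6c9f0c0b6c9e036ba9c0d5c0c5c0b5c0a5ba9dc9c0c056c99036c98026bac055c045bfe5badc95026c8e016bbf65bf55bdc8b006bd85ba98c184c174c164c154c144ba98c0d4c0c4c0b4c0a4ba9c054c044bfe4babf64bf54bbd84ba98c33a980bf22980af11809f0008fcff0202000b20b7a9cfe01000b10b7acfc000b00b7cf63a98c9d046f049a0a9c9704a40ac8d048e0bc8a0ba9d9a010ad8e020bd7d0bad8d049e0bd7c0bc883a982840,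
    0xa991a981b853bcf0b7a9a43db47a44b98aca960a8f38a973a951a000102a940,
    0x10a9b3a9f0a9e18835483448ca990aa4083b19f818aa541385d4579384a4a9d18b00a9c083f09f73,
    0xd9d04f84d9c02457a083b13483e083d29839b0585400983c1883f0,
    0x847084937ea423844010b857a083b18481842d31380bf39b384538b03846084a40383f0,
    0x3184924aa4855384724ab40bf1285400357a083b1b84f184e2930a784b083b0b10a708f84c342d308f0bf84d21022579122846384a483f33db0,
    0x85b157e185c294ab44ac49c57b157a2984408560984b0859298217085a0957b084e29842d39858380bf020af857109f84d101579085d43db13c70,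
    0x3c9013200e840e748c3ca0343c8180e830e73838c395418b94c280af0109f94d008f0094e094f4003c73,
    0x10bf4383a083918b6e4040b44b944a98cbf750557d5da65a98db6e4040b44b944a98c838039f0930d439d09c39e039c0c8370bf94a98031aa31ab34f634f43ca9813140cf330b41ba31b83ca9813529394ee350c3a4f53d654a98b82a2980af82b1809f1010982d082c0a0de00dd0c7d5082e0cba908f1000911806c074f090182f188364248835474f1883448c0e8313839b3839a38b2a80,
    0xda70bd84bf854fb0d694da554fa0d684da4520d674d9f54f90d664d9e5ba98bd84d694d684d674d664ba98c47734683ca980bf2247824692cb980af4e914ea1d4f1d4d1cba809f10142015a44e902020cba9004ea01a5019c0cba4ec04eb0c1010cbbff0bf40cba908f001aa01ab04f604f40cba91010a91010a4ee04ed0b4f504ef0cba98b9c4141498141494ab44f74a4f84a98c39b0,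
    0x9f509f6039b339a38b9ef03dc09f81800009f409f73,
    0x85e0da9384937ea4844085408481839b384538b00846385f40383f0,
    0x865086637ea48440854084818131380bf39b384538b008640867483f3,
    0x84708550a75db34b4486a384b057b284f000a784c0b7854084b08742d0b709f8682869083f32220c084d0b786428674,
    0x66c385b10157e34b5485c1a854085a0a80157b0986b08560b00984b0a08f39b385838b10970f508570a73120c184d1173db300875790b75874,
    0x57e185b0a75ee386e09786f34b644b54bc854085a0a80157b09108560a84b0908f009700a7857342d3a009786c0a70bf0186d20186921158800020c284d33db35894]) allWin_2573
    (by decide +kernel)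

set_option maxRecDepth 1000000 in
theorem allWin_2653 : AllWin painterTable 2653 :=
  chkMs_sound (ws := [
    0xda7003bfb33434bcbfd5bfc5bdbf64bf54bcbfb314bf85bd84b4d70d794dae551a024dad5bd794d764bc4fb014da55d694b4fa024dac550f1bd784d754bc4fa2d774dab5519224daa5bd774d744bca4fa014da45d6844f9114d9f5d674ab984fd24fc2b8328b0af4ff1819714fe28ab4e9184ea28ab09f19801970b50605051b950925081cbff2bf41cbd3f0d371cb9a4e902020c9a4ea01a5019c0cabff0bf41ca9b08f034e931a5319c3c8a94ea31a6020c9a850702319d1ca894ea38bff3d371c98d15347f2c98a4e9350408747834693c8a47734683c8a90bf1aa31ab3bff1bf41c8a950b3850a38ab1b7010b50e091ab04f604f40c9a00910ab81000b10b50d102b31ba891ab34f634f43c89a138139a4ee34ed3901850c0ab51841bc4b51749145144b8516430b9b9c44ab4804951544ee18b1bc40490495144abc39b3000f51,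
    0x875067624b44876284b0854084f18874257908642877483f25750,
    0x87a05db24b4486a284b0854084f188740b787820af8790868287b487723db0,
    0x87503167d24b6457e285c14ac4a57b186b08560a84b098854085a0987c1884d1211197218572579222208058c08720c4,
    0x85b157e15ef286f24b544ac49c57b1108560984b098854085a0987c18109784d18570b787d0a787913db186d220c2215020805894,
    0x535002c1d2c1c3ac054c044bfe4bacc1b5c1a5c195bad1bf2bfb3bf64c1c2bf54bbfd5bfc5bdbfb2bd84bf85ba4e80d8b4db7552d05370d894db65ba4d70d794dae551a0d764dad5b4fb0d694da55ba5360d884db5552c01f40d864db45ba30d784dac550f0b4fa0d684da45ba98c054c044bfe4babf64bf54bbd84bad8b4d8a4d894bad794d764bd694bad884d874d864bad784d754bd684ba98c4ff151b1a8504184e918ba09f19a01990a505050601a901a40cba51d051f051e0cba919801970b50605050b9201010c92020c9ba08f034e931a5319c3c9850401a6010c9458019d0c98a4ea3a4e93a980bf19821972b19a01990b51c01a901a40cbbba2cae2cb980250421a6219d2c9850721010c9d440d380c98b224ff24fe2b95042d191d181c9b4fd24fc2b52525242cb980af32321ae21ad2b981aa232d3f0d370c98b526282250a28b1aa21ab2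bff0bf40c9850b28ba1b7250d28224ed28b1aa21ab24f624f42c984ee28b021aa20cf20b42c9850c28ba1b7052b095270a528030b1ab04f604f40c9209ba50d210b4ee2b50c3a52b05270a52a0a5290a981be414852e4a144ab4a4b444aa4a9851845154b148b9c40484ab48ba53445144b24852f4b1bc40484ac48bac0f520e80,
    0x5ee167a0970267d35ef24b6485c2b20e085a0a886b08560a08f0e808571579120c487e220805751,
    0x5ee367d15ef186f34b644ac49c86b085609820e085a0988570b784d387d186d187f457533db120d02080,
    0x57f25ee0a767d15ef14b642172b86b084b0b820e08540a80284d30185713787d12787918844021320d03db12080,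
    0x5ef186f14b644b549c86b084b09820e08540988570b787d0a7885109f8861215088743db12080,
    0x1c281c271c263a9c0d4c0c4c0b4c0a4ba9cc255c245c1f5c1e5ba9d1bf112c054c1d2c044c261bfe4bac1b5c1a5c195bad1bf1bfb3bf64c1c1bf54bbfd5bfc5bdbfb1bd84bf85ba9b7a0d984dbc55450d974dbb520d964dba55440d954db95ba94e80d8b4db7552d05370d894db65ba4d70d794dae551a0d764dad5b4fb0d694da55ba98c0d4c0c4c0b4c0a4ba9c054c044bfe4babf64bf54bbd84ba9d984d974d964d954ba9d8b4d8a4d894bad794d764bd694ba98c1970198019a01a901a40cba90019b01a8019f0cba919a01990a19801970b2020cba908f4e931a5319c3c81a6019d0c8a94e93a980bf19821972b19a01990b850421a6219d2c8d440d380c8b95042980af1101a199019a01a901a40cba19b01a8019f0cba819a11991b51c1d44010cbc0f0c090cb853a15391cbc71bbf1c8c0f0c090c8ba4ff111a538151b1bd191d181cba809f212121a8211ae11ad1b81ac1d440d380c8ba53d1853c153b1ba211ae11ad1b81ab1d3f0d370c8b5261853b1b1ab1bff0bf40c850b18ba91b7152b185271a528131b1ab14f614f41c84ee18ba53e131b3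13131c850c18b1aa10cf10b41c852918ba9101091ae010a1b401af0b1bb01b90cba91ac01aa0a91010a1b701ab0b4f604f40cba91b601aa0a52a1a5292981be414852e494b644ac4982424a4b548518434b148b9c40484ab48ba94b4414a4ac481bc4a53f4a9c010e80,
    0x4c40043306bfb54be04bd18c8b34bc04bb18b3eb280af4b7109f000cb04b904b80ba908fb6e430d43e8498c05400094ba184af30384bf38b2cf0,
    0x4c401204c9531d92262426ae4d75caf4c1c5ad0d7206bfb5a4cf04cd24ce04bd0a98c953c8e3ac8b3a4cc04ca24cb04bb0a98b114b71a09f304c500c90a900a08f0cb2304b924b82b983eb231c09780afb6f44c9480b4447648ac020cb04b904b80b98b6e43eb24b70974c848a22328a4c6000a0540a4c714ba284d6303a4bf384d530540a4d43ab2cf20ce0,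
    0x1d9104c9c34e714e86cb844d76cb54c266a9e4e85cb844d75cb54c265a9d4cf1341d9226a4d75caf4c1c5ad0d7106bfb5a94e504e4094cf04cd298c9c3c993c983a9c953c8e3ac8b3a94df04de094cc04ca298b0ca04d9094d80908f0cb294dc280af210ca00c91a8214db04da0b8a31c1809fb74432e484c9430c40cb087a9c214c500c90a8314b924b82b8ab6f431c130d484b7130c40087a0cb14b904b80b8b6e44b7130d48a94c6101a0541a4dd29067006609079094c7184d631394e6384af394d439b0ce106c0,
    0x20d9b4c296cbe0d994dbd6dc40d8c4db86dbf0d7a4daf6dbe0d6a4da86ba98c295dbd5db85daf5da85ba98dd9b4d994d8c4d7a4d6a4ba98cd5b3d5a3ca980bf1212c1212cbd592d572cb980af1111c3131c1111cba1111c1111cbd541d4e1cba809f1010c14c014b0c1010c1010cba91010c1010c1010cba1010c1010cbd450d3e0cba908f0014d014e0cab0c8b0cba914f01540caf0c950cba15901570ccb80c9c0cbcbd0ca50cba90014d0cab0c8b0cba14f0caf0c950cbcb80c9c0cba14d03030cbcaf0c950cb3030cba914d014e0cab0c8b0cba15801560ccaf0c950cbcb80c9c0cba14d03030cbcaf0c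950cb3030cba15801550c3030cbcaf0c950cb1010cbcab0c8b0cba98c184242424a98c0d415c424a9c05415b415a4babf6404bbd84ba98cb6e0,
    0x1006bf65c95006d795496006d78549400635a98bf64d794d784d774a98c22980af11809f0008fcf63d143d5f3d643a98bc8d0109d6c04040ad6b29831e04883,
    0xcaf2c9c0221616aec055c045adc95206bf65ac9c006d8b5c99006d8a5ac95006d795a49d006d88549c006d875a496006d785a98c054c044ad8b4d8a4ad884d874a98bf64d794d78498ac11d6e1a8d1418a09f1010a10d6d0a910a08fcfc3cf63ad7f333ad7e323a98bcf62d142d5f29822222298b0afcfc2d7f2d7e298a32128ac9702094990ac8d0109ad8e040409ad7b04990ad6c0ad6b298020031e3,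
    0x2ff034f0a736a132900625310615914149c36c332a39bcdd071a106050436d309f88a0060504338c85271e29718206050488b38a1111809fc89178718cdd0879c8c0888072529c89098c7c272d2871e2109c7b2734098c79272428c7c09a1072f0a8889172e1a726091132d06e82,
    0xcb81ca50c9c1c9929262626a9ec0d5c0c5c0b5a9dc9c126c99116ac055c045adc95106bf65a9d3e0ca4006d975c9f006d965a9c9c006d8b5c99006d8a5ac95006d795a98c0d4c0c4c0b4a9d984d974d964a98c054c044ad8b4d8a4a8bf64d7948a9c2020d840a910d6d0a20a908fcfe3cfc333a9d8f33313a98bcf629d142981291298b0af3131811118b09fcfe1d8f1811118acfc1d7f18a9c9712184991ac8d1118ad8e140418a9c9d0109c97020ac8d0a9d9a046f0ad8e0adc829811284031e3,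
    0xcbd0ca50ca40c9f29836363636a98ec185c175c165c155a98dd060ca4036c9f026a9c0d5c0c5c0b5a9dc9c026c99016ac055c045adc95006bf65a98c184c174c164c154a98c0d4c0c4c0b4a9c054c044abf64a98c33231303a98bcf62980298b0af218118b09f0008fcff01000a10a79cfe000a00a7cfc298c9d0109c97020ac8d0a9d9a046f0ad8e0ad8d298002843,
    0x83a154d33a82348951106557d58d140b448c1ae31b639b838039e188e488f38009788c0871274f29a00008788d0978944000f532a82,
    0xdcb0bfb3bf64bfd54d70d794dae520d784dac54fa0d774dab5a98bf64d794d784d774a98c4fd280af4ff1809f1980506054e054d0cbff0bf40cba908f031aa31ab3d3f0d370ca9850b350a398b1b7000950d181be404851648c0f5039b3,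
    0x53510213c054c1d234ac1b5c1a5adc054c044ac1c72bfb314bfd5bf64a4e8024db7552d0ad8b4d8a4ac5360db5552c0ad884d874ac94d70d794dae54fa124dac59d794d7849ca819a01980a08f5381854f1a5541311a911a41cab51d1a00a08f09f506255401a91cae2cb894ff284fd253808790af1ae31ad3a526381aa31ab3d440d380c9803852639a53b350a39ab1ab21ae2d3f0d371c8b952628a101091b70209a20a10a52b18528250d2953e0a140494b4495184a5344ac12000e810f53,
    0x535001c281c2729c0d4c0c4c0b4a9cc255c245c1f5a9d11c05454c1c044ac1b5c1a5ad1c71bfb3bf64bfd5a9b7a0d984dbc55450d974dbb55440d964dba5a94e80d8b4db7552d0a4d70d794dae5a98c0d4c0c4c0b4a9c054c044abf64a9d984d974d964a9d8b4d8a4ad794a98c198019a01c401a901a40cba919b0919a01980a908f1ac31ae31ad3981ab3953d3555398b506294ea2981ab3955638b0af0119a01c401a901a40cba19b0a819a15541d440c090cb8a53818231ae31ad3a833c0f0c090c8a53d38b09f21211ad1a81ac11ae1d440d380cb8a53d1853c1a1ab11ae1d3f0d370cb852618a91b7152b1850d1a5281a53e291ae0109101af0a1b401bb01b90cba91ac0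91b70952b181be41482494b648518494b449c01000e83,
    0x496354910d72064d75caf4c9535480547094b723eb29a20974c944c5031c04b924b82b9ab6f408f4c604d632cf22bb0,
    0x310c4233cb841d910654c5c9c354a10654b5b4e504df0b84cf1caf4c95354809209700874c520c9290283140604db04da0bc812894b7231c0879a4c510cb240504b924b82bc8a31c189b7440b44932e48b6f430d489c4c61210006704d630ce2]) allWin_2627
    (by decide +kernel)

set_option maxRecDepth 1000000 in
theorem allWin_2678 : AllWin painterTable 2678 :=
  chkMs_sound (ws := [
    0xcbf0dca4cbe3d9b4bc2a6c296becbf0dc94dce6cbe0d994dbd6bdd40dc74dcd6dc40d8c4db86bdcf0dc64dcc6dbf0d7a4daf6ba98c2a5c295bdce5dbd5bdcd5db85bdcc5daf5ba98ddca4d9b4bdc94d994bdc74d8c4bdc64d7a4ba98c1313c14c314b3cd1a3d4e3cd063d3e3ca981313c14c314b3cd1a3d4e3ca93333c3333cad5b3d5a3ca98b1212c1212cb1212cb98d592d572c98b0af15d116811641cb167115f1c3131cba14c114b1c1111cab1111c1111cb3131cba8d591d571c1111cad541d4e1ca8b09f15d016801640cb15e016a01660cb1010cd450d3e0cba914c0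14b0cd540d4e0cd450d3e0ca9b16901650c3030cb1010c3030cbad540d4e0c1010cab1010c1010cbd450d3e0cba9d590d570c3030c3030ca9d540d4e0c1010cad450d3e0ca9b08f0314d314e3cab3c8b3ca9814f31543caf3c953ca915931573ccb83c9c3cacbd3ca53ca980314d3cab3c8b3ca914f3caf3c953cacb83c9c3ca914d33333cacaf3c953cacab3c8b3ca98b14f0154016c0caf0c950cba914d014e0cab0c8b0ca9b16f016e0cb80c9c0cba1540caf0c950cab17901760ccbd0ca50cbcb80c9c0cba914f01540caf0c950ca915901570ccb80c9c0cacbd0ca50ca9b14f016b0caf0c950cba14d0cab0c8b0cab16b0cb80c9c0cb2020cba14f0caf0c950cacb80c9c0cab16b03030cbcab0c8b0cbcaf0c950cba914d314e3cac0c8e0ca915831560ccb50c990cacbb0ca40ca914d33030cacb50c990cacac0c8e0ca9b16d016c0caf0c950cba14e0cab0c8b0cab17801750ccb80c9c0cb3030cba15801560ccaf0c950cacb80c9c0cab16b03030cbcab0c8b0cbcaf0c950cba15831553c3030cacb50c990cacac0c8e0cab17701740c3030cbcab0c8b0cbcaf0c950cbcac0c8e0cba98c184c0d417a498c17417c417b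498bc0d417a49c0c42417b4a9bc05415b4ac04414abbf64bf54ba98cb6e3b6f0,
    0x55721006c055c9c0063549d0062598c054d8b4d88498cd141809fcf6008fcfc2d7f2d7e298ac97040409d7b1831e032b2,
    0x5572cb81ca502116169ec0d5c0c59dc9c106c0559d3e0ca4006d9759c9c006d8b598c0d4c0c49d984d97498c054d8b489c10d6d09cf60908fcfe2cfc29d8f2d7f298acf61d141811118a09fcfe1d8f18931404189c9d046f09c9709d7b1831e1284032b2,
    0x5582cbd0ca50ca41826262698ec185c175c16598dd060ca40169c0d5c0c59dc9c006c05598c184c174c16498c0d4c0c49c05498c3222cfc298acf618118a09f0008fcff00090097cfe18c9d046f09c9709d9a18002842,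
    0x55b1c1d214c1b5c0544e8014db75d8b45360db55d8849819a008f4ff1855401a901a40cab08f09f1ab21ae2b763b6f3cb8952628a1b70009852b0951840494b448c000e810f523943,
    0x55c201c281c0d4c0c49cc255c2459d54c1c054c1b59b7a0d984dbc55450d974dbb594e80d8b4db7598c0d4c0c49c0549d984d9749d8b498c19a0001c401a901a40cba919b0919a0908f1ac21ae21ad2981ab2955628a19a1001c401a901a40cba84ff181ac21ae2c0f0c090cb853d28a09f1ac1011ae1d440d380cba853d1891b7152b189201af091ae01b401bb01b90cba91ac091b70952b181be41482494b648518494b449c010e800f52,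
    0xc4104230654c54e50c9c34df0b1087310ca04db04da0ba831c189b74432e48c0006704d632bb1,
    0xcc82cc40dd84cbf2dca4cbe2d9b4bac2b6c2a6c296baecc40dd74dda6cbf0dc94dce6cbe0d994dbd6baddb0dd64dd96dd40dc74dcd6dc40d8c4db86ba98c2b5c2a5c295badda5dce5dbd5badd95dcd5db85ba98ddd84dca4d9b4badd74dc94d994badd64dc74d8c4ba98c15d216821642cb15e216a21662cb1212cd062d3e2cb9814c214b2cd1a2d4e2cd062d3e2c98b15d216821642cb167215f2c3232cb914c214b2c3232c9b1212c1212cbd59212cb9812d572c32d4e2cd062d3e2c981232cd1a2d4e2c9d592d572c98ba167115f1c184117e1c3131cba167115f1c1111cb1111cba81111c1111cb1111cb83131c8ba09f15e017d0d540d4e0cba1010c185017f0cd450d3e0cba915e016a01660cb1010c3030cb9d540d4e0c1010c9ba1010c1010c1010cba1010c1010cbd450d3e0cba916901650c3030cb1010c3030cb93030c1010c9b1010c1010cb3030cb9d540d4e0c1010c9d450d3e0c9ba08f14f2154216c2caf2c952cb9814d214e2cab2c8b2c98b16f216e2cb82c9c2cb91542caf2c952c9b17921762ccbd2ca52cbc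b82c9c2cb9814f21542caf2c952c9815921572ccb82c9c2c9cbd2ca52c98b14f216b2caf2c952cb914d2cab2c8b2c9b16b2cb82c9c2cb2222cb914f2caf2c952c9cb82c9c2c9b16b23232cbcab2c8b2cbcaf2c952cb9818721882cac2c8e2c9818b21562ccb52c992c9cbb2ca42c9818723232c9cb52c992c9cac2c8e2c98ba16f016c016e0cb80c9c0cba9154016c0caf0c950cb914e0cab0c8b0c9ba301890cbd0ca50cba16e0cb80c9c0cbcaf0c950cba916f016e0cb80c9c0cb91540caf0c950c9b17901760ccbd0ca50cb3030cb915901570ccb80c9c0c9cbd0ca50c9ba0020cb80c9c0cba16b0caf0c950cbcab0c8b0cba16b03030cbcaf0c950cbcb80c9c0cba916d216c0cb50c990cb914e2cac0c8e0c9b17821750ccbb0ca40cb3030cb915821560ccb50c990c9cbb0ca40c9b16b23030cbcac0c8e0cbcb50c990cb918b018a0c3030c9cba0c9f0c9cb40c980c9ba301860cb80c9c0cba16c0caf0c950cbcab0c8b0cba17801750c3030cbcaf0c950cbcb80c9c0cba17701740c3030cbcac0c8e0cbcb50c990cbcb40c980cba98c184c0d415c498c17417c48c16418d418c498bac0d4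15c49c0c415b49c0b4249bac054c044bfe4ba98cb6f2b740,
    0x102d1a31005c0d4d3e0d98480087cf61d14189cfe2d8f28a2840c9d08731e132b2,
    0xd0602501d45220c184c1748cd3e0c0d4821cfe189201087c9d087cff207012842,
    0xc28114c255c0d4b7a014dbc5d98481c401a901a40c9ab08f011ae11ac2c0f0c090c8ba53d1891ae01b40366232e3c9ba80451841be404894b648bac0e803941,
    0xcc91cc50dde4cc41dd84cbf1dca4cbe1d9b4ba9c2c6c2b6c2a6c296ba9ecc50ddd4ddf6cc40dd74dda6cbf0dc94dce6cbe0d994dbd6ba98c2c5c2b5c2a5c295ba9ddf5dda5dce5dbd5ba98ddde4dd84dca4d9b4ba9ddd4dd74dc94d994ba98c15e117d1d1a1d4e1cba1111c185117f1cd061d3e1cba815e116a11661cb1111c3131cb8d1a1d4e1cd061d3e1c8ba167115f1c184117e1c3131cba167115f1c1111cb3131cba816911651c3131cb1111c3131cb83131c3131c8b1111c1111cb1111cb83131cd061d3e1c8d1a1d4e1c8ba91010c3030c1010c3030cba91010c185017f0c1010cba1010c1010cb1010cba91010c1010c1010cba1010c1010cb1010cba1010c1010cb1010cbd450d3e0c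ba908f16f116c116e1cb81c9c1cba8154116c1caf1c951cb814e1cab1c8b1c8ba311891cbd1ca51cba16e1cb81c9c1cbcaf1c951cba816f116e1cb81c9c1cb81541caf1c951c8b17911761ccbd1ca51cb3131cb815911571ccb81c9c1c8cbd1ca51c8ba0121cb81c9c1cba16b1caf1c951cbcab1c8b1cba16b13131cbcaf1c951cbcb81c9c1cba818f116c1cb51c991cb81881cac1c8e1c8b19411751ccbb1ca41cb3131cb818b11561ccb51c991c8cbb1ca41c8b18e13131cbcac1c8e1cbcb51c991cb818b118a1c3131c8cba1c9f1c8cb41c981c8ba916c016e01890cbd0ca50cba93016e0cb80c9c0cba16c0caf0c950cbcab0c8b0cba9301890cbd0ca50cba16e0cb80c9c0cbcaf0c950cba17901760c3030cbcb80c9c0cbcbd0ca50cba9301890cbb0ca40cba16c0cb50c990cbcac0c8e0cba17811750c3030cbcb50c990cbcbb0ca40cba17711741c3030cbcb40c980cbcba0c9f0cbcb90c9e0cba98c184c0d48c17417c48c16418d48c154348ba9c0d4c0c4c0b4c0a4ba98cb741b680,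
    0xcbd00605c184cff055d0,
    0xcca0de54cc50dde4cc40dd84cbf0dca4cbe0d9b4ba98c2d6c2c6c2b6c2a6c296ba98ec2d5c2c5c2b5c2a5c295ba98dde54dde4dd84dca4d9b4ba98c1010c3030c1010c3030cba91010c185017f0c1010cba1010c1010cb1010cba91010c1010c1010cba1010c1010cb1010cba1010c1010cb1010cbd060d3e0cba9816c016e01890cbd0ca50cba93016e0cb80c9c0cba16c0caf0c950cbcab0c8b0cba9301890cbd0ca50cba16e0cb80c9c0cbcaf0c950cba17901760c3030cbcb80c9c0cbcbd0ca50cba9301890cbb0ca40cba16c0cb50c990cbcac0c8e0cba19401750c3030cbcb50c990cbcbb0ca40cba19601950c3030cbcb40c980cbcba0c9f0cbcb90c9e0cba98c184c174c164c154c144ba98cb680,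
    0x5650cab4c8b306bfb54be04bd1800a755e0974b9008fb6e456448c55f04af30384bf38b2d70,
    0x49435490064d75caf41d9251a6cac4c1c5a4be2cab4a4cf04cd284ce04bd0a95670974c9430c4419097ac5680b6f40a40ac08f55e25660874c94ccc208fc0afc64255e24c848a000255f14af31394d53a4bf384d43ab2d720ce0,
    0x2c520005e02ba128e106c0852c5203d0010590970635a456445c4c084c584a98c3c5006252df10615945b438e49c8745229506ac087b653,
    0xd81cb84c9c34e71061616a9e0554c5c265a9d4cf1344e7126a4d75caf4c1c5ad0d7106bfb5a94e504e4094cf04cd2984db04d80908f56725690870af566109fb74432e4856b49cc68131c13484b9153b4a358130d4de9087a956a055f14d631394e6384af394d439b0ce106c0,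
    0x20d9b4c296cc70d994dbd6dea0d8c4db86de80d7a4daf6de70d6a4da86ba98c295dbd5db85daf5da85ba98dd5b3a980bfd592980afd541809fd45008fcbd0202020ba9cb801010bacaf000bcab3a98c184242424a98c0d415c424a9c05415b415a4babf6404bbd84ba98cb750,
    0x5490c953064d75caf456c031c09755e2566087b6f44c948c4c600ce04d632d72,
    0x1d20d81c9c3cb841d910654c54e5011caf44cf0931c0975672569087b7440b449ccf09732e48cc68131c130d4894c6131067002704d630ce2,
    0xcc80cc73dca4d9b4bcc2a6c296becc80dc94dce6cc70d994dbd6bded0dc74dcd6dea0d8c4db86bdec0dc64dcc6de80d7a4daf6ba98c2a5c295bdce5dbd5bdcd5db85bdcc5daf5ba98dd063d1a313d5b3a98b0298d59298b0af018d5418b09fd45008f333333cab3a98bcbd0cb80caf0a9cbb03030a9bcb8020acb50cac0abcaf0cab3a98c184c0d417a498c17417c417b498bc0d417a49c0c42417b4a9bc05415b4ac04414abbf64bf54ba98cb753b760,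
    0xd81cb84c9c30654c504404e505661b74432e48c067002704d6329d1,
    0xcd42cc90cc82cc73add84dca4d9b4bacc2b6c2a6c296baecc90dd74dda6cc80dc94dce6cc70d994dbd6badef0dd64dd96ded0dc74dcd6dea0d8c4db86ba98c2b5c2a5c295badda5dce5dbd5badd95dcd5db85ba98d22222298d062d1a2d59298ba018018d5418ba09fd45008fcbd2cb82caf298cbb2cb52cac298bacbd0cb809cbb0309cba0cb409bacb80cb50cac3a98c184c0d415c498c17417c48c16418d418c498bac0d415c49c0c415b49c0b4249bac054c044bfe4ba98cb762b770,
    0xcd51cca0cc91cc81cc73a9dde4dd84dca4d9b4ba9cc2c6c2b6c2a6c296ba9ecca0ddd4ddf6cc90dd74dda6cc80dc94dce6cc70d994dbd6ba98c2c5c2b5c2a5c295ba9ddf5dda5dce5dbd5ba98d1111811118d061d1a18ba9d45087cbd1cb818cbb1cb51831318ba9cbd0cbb0cba0cb43a98c184c0d48c17417c48c16418d48c154348ba9c0d4c0c4c0b4c0a4ba98cb771b780]) allWin_2653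
    (by decide +kernel)

set_option maxRecDepth 1000000 in
theorem allWin_2721 : AllWin painterTable 2721 :=
  chkMs_sound (ws := [
    0xcd60cca0cc90cc80cc73a98de54dde4dd84dca4d9b4ba98cc2d6c2c6c2b6c2a6c296ba98ec2d5c2c5c2b5c2a5c295ba98dd060cbd0cbb0cba0cb93a98c184c174c164c154c144ba98cb780,
    0xb081a642b0c1a263b3d2a243ab162a4e0004427b4b0a7aef0a7b1738b150042714079aff417804070417,
    0x16d709702b4d0b7b5420afaad46d84aa70aae4ba89c6d706fd27992aaa1aac4aab49c8aa90009aa818df72a4d0,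
    0x5d60220de30df0a70ce33c958fd044c2c3c2c580b7a9909561e5ab89dc5d604351022d842e70a790a590429085b68612e5290529061c66a59075ad988ff00098fe1802df84006d71,
    0xab800087abb09712df85b652b6c3aaba07bd2ab918abe42aa42a84a82a64a8b9abd4abc498cab400098aaf09ab72029ab628aab50,
    0xac40a290b6c312df85b652aba06fa2ab9180479e42aa42a84a98ac548cabf023038138ba9820203802ab638aab70,
    0x9270a3d0b652df85aba02aa4ac548cabf0a982028ac728aac60,
    0x91d013da95bfa3bf94b3a409151919090d2b88c901466b550a32020b9a90b090f090e0ca9dfc2dfb0bdfa2bc9a08f917191a09181ca914290c2b0af8991c38453ab3990009916123891c48454a91b48c008741,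
    0x91d08d72049130d38d825ce55ee5ad339391a66d567c59adbc359330d49381caa39d93718c83c87398dcab91e043b09250ba92609240ca83a513a429270113f5439e139c1c891f0bfa3bf9490e0ab93a703a609935039f08c849b93609340c3a419190ba98928243c208f90af92a13b9108f929192c108fa39722e522e41b892b18a09f0e50398098857333ab92e101a92d2399042d3992f10f502aa1,
    0x5ca05c9500d7bfb312a0dfe35cf05d4000d7dfd3a985c5280af5c6109fdf9008f25358d5c805ce3b7951385cd35cc395c718b5cb0,
    0x5ca1325d955c95c1d312a2bfb3a23d200d703c1c40af5df05de0d12a0dfe3a5dd15dc1a5cf0a985d6008f5d515d7087015c6087a09f325d8290af5ce55db59d04b25c525c608795e55a5c825ce32385e43ab0f845db385da4a5ce35cc38ab1074228ac12605db35c72800025cb1,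
    0x5fa123c2855ca154c3c275237291ec35ea4923249c2649a8bcc285c275923615ed5c26598cad12b1c1d3c1c3ab5c9523d25e93c1d5c1c5a8bd12a1bfb3a95f805f70a5f605f509d5f405df05ec5a12a0dfe3a985d705e60a5d60908f04b290af5e7109f25259d5e815ef30395ce39b12605f9385eb15ef313a1495ce4a5ee4abc015cb21270,
    0x94b1108503c09412500ec594a1800010dd20ce00e8394910fe0,
    0x12433102725ff41250a76241124222902733aa207f33a829b108790939550973490848c956095720380,
    0x10cfa3e070614023e0e063a98b7a4b994b984b974a98c6150c28410c2745c40c264a95fa0c1d410c1c4a12a0bfb4a98b7a3b993b983b973a98c283c273c263a9c1d3c1c3abfb3a98b0280af60c1809f1010960e060d0a125060f0ba908f202093a818075000901074181414814149345864a108458a4ba9814149814149106424abf74a9814049149586404a57d4ada64a98cb473331398131390f8323ab793a9813039107390ec303a0f73ab963a98b3c90,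
    0xe080c294c2f0dbd4e050db84e040daf4dff0da84ba98d2a3a980bfd242980afd0c1809fcfa008fb7a01f8010a9c28010ac1d01f70bbfb3a98b8f4242424a98c2541fb424a9c1b41fa41f94babfd404bbf84ba98cb790,
    0x5ca05d955c95c1d35f405dd0960425d50975d7008f60655ce35db39b605000015cb2,
    0x5fa11527b25d95c283609160a2c27395fa1c1d395f806080d5f409860708701009711027004b2175e8203055ef45cb20380,
    0xe08003c2f3c2a4c294bcc340dce4c2f0dbd4be0b0dcd4e050db84be0a0dcc4e040daf4ba98bfb3d24298c1d30afd0c18c28309fcfa008f231f833398bb7a01fc09b990139bc28010ac2701f73abc1d0bfb3a98b8f4c2541fe498b8e41ff43498bc2541fe49c244349bc1b41fa4ac1a41fd4abbfd4bfc4ba98cb7930f80,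
    0x8ec004b122366367d55e8230d33466d5a366332e4359330d4ab93c093a0b93b09250c9a83af03a70994709460ab8444192b1809f3b9292a28993f193e1c93d2809f0af1194410af92e290fd00f409019452839437af380387d490394848b012aa20fe0,
    0x12b1055d95c2835f80e0d385d708702705ce55e715ef360b10380,
    0xe08002c342c2f3ac2b4c2a4c294bacc350dda4c340dce4c2f0dbd4bae0e0dd94e0b0dcd4e050db84ba98c1d2d0c18c28209fcfa008f321fc283220428bab7a0109b9901f809b98020509bac280c270c1c3a98b8f4c2541fb498b8e420648b8d41ff4207498bac2541fb49c2441fa49c1f420749bac1b4c1a4c194ba98c020f80,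
    0x1c351c341c2f3a9c2c4c2b4c2a4c294ba9cb7b0ddf4c350dda4c340dce4c2f0dbd4ba98c281cfa087b7a1118b9911f8183120518ba9b7a0b990b980c263a98b8f4c2548b8e4148b8d41ff48b8c4348ba9c254c244c1f4c1e4ba98c0f81b470,
    0x89b1021361e5c58489a28983ac3c489928973ac20242a928961002a71,
    0x10a22b4161e5c5831489d2c08389a2c3c48992cb10032489c10fe22a90,
    0x442000561c6b303d003e1c4e605803605702698c4e504c504b598dc4d2e16505520604a58ccc2049589c442e15504f306048504d206047598ba100087059103f10203c584,
    0x30442056003e006c4e5058026057116904c504b59d8c4d20552268ccc289e16504a58049589da24059003f002c583,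
    0x56002c6b303e006c4e505800604c5805700604b589059003f0c584c082,
    0x2c41cdb220060504b6c36f6268b0060504c5b3a69e00605246ed106051496f536ec39b69c00605046f436ed10605046ef39a868b000986eb09006e41bd92,
    0x12d506a610605b6546ac0060534870e33843813138b6536fa38c9bc79268b0060504b6c369e00605046f538a6f810605246ed1060514a86f936ec3a8b96a6000986f709bd926e40,
    0x3cc330003105d3b4c4a389c029512a95a8a0b65235923339b2a94c4932a84b6c39c8c072be53a892c4637b92c45398aaa600098a3b092a40b4a3b4d2,
    0x2c5305e1ca8228e0c086332890c586b25c7633ba50de50dd5b9c085c585b98d2ba036059026b2e452d852ca5b9d832c75328e00689e51212b9c5d2c572b983562062da52dc0062db52c41062c95b98a82d40de40dd4b7d5482e4ba893ba489e4a0de47d54a0dd489f4ab9c084d3c4ac584e1c4ab981447522e442da4a92d842db4a2ca42c94ab98c2d9006052d74e1b3356206052d64e1a3a8928e000982d5092950b6c3b652,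
    0x2e622e90002971c0e62bf03682df02689c0e52e752e5598d2e620005e0870de6ca72828e1262ba01689c0852d858d2c520003d087289106c5850590062ca58bca62062d75ccb389ac0e42e742e5498c084c584b2e441414b2d842ca4bd982d74e1b389ac6ac08a40a82de090029e1b652,
    0x2d506a60060504b6536ac00605046fa36f810605046f93980075c16e40bd92,
    0x8af1130605bfa4c7a30605bf94b8a9040c08ac0ba88a5188a728a61b8a98a918ae18ab1ba88ad08aa0b8a9202020b9a40e134c02f70bae1f1e1b0ba908f356000988a809488303971c39b006f91,
    0x8af05992d5d364b63092c7e326a41551515a8d64b4ca94acd5d30625c7e30615a30c4c7f4acb8ba03040c08bb0b9a88b918b81a895b420605bfa4c7a30605bf94b2040c08ac0b98a918a4140349034d02f80ba940e034c02f70b9a08f348135412fe1ba834f02fd0b8a34c02f70b8a8b518b41a8a51a809f022234c222b9840e234d02f72b98e1f2ccb2b898a528a728a62b98bc03ef0b980af02222222b9840e034c02f70b9e1f0e1b0b988a528a718a61b98ae08ab1b98a22129a8b7010a8b60a8a82880b333a7ee3a8bd3ab8a8071c396f9231d0,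
    0x10542d5e38c7126262698ae15251525a89d359464f4caa498acd5e330910625c863069259da148c84930d4c8749a8cb35814dd10615a64b4ca94ac4dc14b7130920615a30c4c7f4ac8b95b42063530920625b50a4bfa4bf94b8c9a34802e602c50b9a34b034e02f90ba9349034d02f80ba34c02f70ba9842600680060564f4940508c50ab8ba0108bb0ba40c08ac0ba9840e234c22f72b88a52893030b908f0af4141349134d12f81ba8348135412c50ba34e02fd1ba88b518b41a8414234d12f82b8ca71c6f1b88bf18be1b8a09f3491348135412fe0ba8414134d12f81b834f12fd0b8a40e234c22f81b8e1f2ccb2b8a40e11111b834c02f70b8a8b518b41a8a728a62ba8a51a8940e234c22f71b8e1f0e1b0b88a718a61b89a8b718a81a8b61a98c6371d38b3570355090093560a8a8171d388c4135507363a112ac031d2,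
    0x59b004c8b4cab306bfb50d7006dfe5e26459a0e25459c006dfd534a98cab3e263e253e243a98b59725952b980af594159815961ba809f136020096008e0ba914600a4009d0bae1e0e1d0ba908fb6e430d43e8498c05401050a4959918b6e35643830d350a3959918b2cf0,
    0x8dc05b42d6b34c963092c7f6a3f634156d6b3265b4216a80bf64c5ca95a3f553535a89bd64c4ca94a4c94c7f4abc41a08da0b88bc03ef0b98d918b41a809f414034d02f80b935f03190b34f02fd0ba908f40e234c22f72b898a728a62b840e234d02f72b9e1f2c5e2b908f8bc03ef1b808f9a8b62129a101288b718a82980b38db3a72838b0070d16f92,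
    0x8dc0599233265b4216a1515ad64c464b4acd6b30625d5d30615a4c9430c4acb8e408ba0a8df18b91a9835a03490a08f368135f03191ba35412fe0ba88d918b51a809f222222b8940e234c22f72b98e1f2c5e2b898a528a728a62b988e518dd2b890af40e2222f72b89414034c22f80b98ca62c5e2b898a528a728be1b98bc13ef0b98a36a01098b70a8de1848837ca3980b3a7df38b6f926fa0,
    0x5b424c71d6c33136665b4235968c71369a366525153598ad359464f40d44caa4a89c40430632e549f3068c85ad6c363e10632e50542264c7216925259da832e430c4c8749acb5b810635314dd10625a841543651ca94a8c214c710615a31c1c7f4acb942700680060564f4a40508c509b8e4040c08bb0ba9834a0202e602c50ba34b0a935c034e02f90ba92034d02f80ba908f35a18d918414134d12f81b88b418a35e135d03170ba34e02f90ba08f09f3492222222b89414134d12f82b89348235422c50b934e02f90b9ca71c6f1b988b528b4298bf18be1b9840e21212b834c22f72b88a5289a414135a134d12f81ba835e135f13191ba34f02fd0ba88d918b41a840e234d12f81b8e1f2c6f1b88bf18be1b8a9357035628a8283640a8b718c423690972c30387283848838b62973639b70d131d22ac0,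
    0xac00542d5e35b40a726110d468c7106a9359536650afd36513581a940430ac03091120632e54c720630d5a31c14b71a9b36643594a415436513581a8932e414a4dc130d40b5430c4a931c14b71a98bc42600680060564f4940508c509b41a08da0b9834a01010b2e602c50ba935c034b0a92020a908f414135a13491a8368135d03170ba2e602fe1ba88d918b51a809fca72c6f2b414234d22f82b8ca72c6f2b898b528b4298bf28be2b9840e21212b834c22f72b88a52890af4142349234d22f82b9834a035422fe2b934e02f90b98414234d22f82b8ca72c6f2b8940e234c212b834d02f72b898b528b4298bf18be2b98a5298a118e610af8b71a9368135a135f13190b8a8d91840e234c22f72b8cad1c5e2b88a728a62b8a349135412fe1b88b518a40e234d12f81b8ca62c6f1b88a728be1b8a09f108e600af3570a8de187753039488397df388e739b6fa12ac031d2,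
    0x44718ec08d8104235ef58eb232e38ea2b8d518cd08cc098ca0988d6039f064f398e91838e28e828a00978ce1212a810385748cb22aa28d400e60]) allWin_2678
    (by decide +kernel)

set_option maxRecDepth 1000000 in
theorem allWin_2754 : AllWin painterTable 2754 :=
  chkMs_sound (ws := [
    0x54a0c954caf30b9233a3636aecaf4cac4acc1d5c1c5ad1d92cab306bfb5a5a70e2b45a9006e2c5e2a4a0d7006dfe5e264a5a60e2945a50e284a59a0e254a98caf3cac3acab3ae2b3e2a3ae263ae293e283ae253a98b59e159d1a859418a09f0c601480096008f0b9a0c500a6009f0ba0a5009e0ba91460096008e0b90a4009d0b9a08f13621462096208e2b981480097008f0b9ccc2e1d2b98594259825962b959725952b980af136222096208e2b9814600a4009d0b9e1e0e1d0b98594259815961b959725952b98ab6f44c9480b4447648ab6e44c848ac32328a5a404c9400a0540a59924c718b6f31385a83a4c9330a4c718b6e34c8380540a0b435643859f0ab2cf20ce0,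
    0x33632ea207800105e09728e0bc66c0842ba006042d858c5d22dc006042db58ac76305e0970590c39603e02d4126811c39605901689c5842ca48cc572e1c52cc0062c948ab11118928e02d518012950b662c6d3,
    0x11d7b35b8106255b61069259da36640d44caa4a9cd7b30632e5dc83060b554c710615a932e4c8749acb8ee042704060ba0680060564f48c50b9835a18d918414134d12f81b88b418a935b02bd02b70b9a35c0934e02f90b9a35b035f13191ba34f12fd1ba908f414134d22f81b8ca71c6f1b88bf28be2b89a76b38b7136b08ed18ef33770a33d070d1,
    0x4c725b81d7b34c620632e54c71060b5505410630c5a936e35b411206255b82063595a0bf366432e4b8cf464f40d443594a8b8c840b5430c4a8b9c42708f5064f49104050a40608c509cb836702bd02b70ba302e602c50b9a35c034b0a908f35a1368135f13191ba834912e602c50b8a318b51a893232b8d928b4298ca72c6f2b8bf28be2b890af775336a18de188f439414235a22222b947a134d22f81be9835e235f23192b934f22fd2b9ca72c6f1b988d928b4298bf28be2b9876b38b71a36b08de178d386fa1284070d2,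
    0x28e02d512de09728f00604b6630028908769e168b106c653c6d4a2940060370d469f0067054a86a7029e06e41baa2,
    0x54112364c7130d69d7b336d6c30542169b15159d32e430d49c36e3015b421097265b8216a15259d240641e514a3664359498c0bf406042700bf42604050ba835d02e60a2b702c509b08f349235422fe2b88b52890af35a1414237412f82b8a367035d03191bacad1c6f2ba88d918bf28be2ba835412fe1b8b518a9414134d12f82b8ca71c6f2b88bf28be1b89a8f6135a18d918a36814340102b70b2bd03191bcea08fcb618f828e3528f718ba11f77c34883977539b10376011f36b0a78d382840016fa2,
    0x8fc1235ef5366432e38eb18cf398fb039f064f3988f908cc0908f138ce185748cb10e508fa20e6079b1,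
    0x1d91c9c4cb830c41cb5322b1cb43a9c286c276c266a9ecb84cb54cb44a9cc285c275c265a9d0d81c1d601d12336acaf4cac4acc1d5c1c5ad1d91cab306bfb5a95ae006e0d5e3645ac0e3445ad006e375e2f4a95a70e2b45a9006e2c5e2a4a0d7006dfe5e264a98cb83cb53cb43a9caf3cac3acab3a9e363e343e2f3a9e2b3e2a3ae263a98b0840086004400950ba90c8009800940ba90c601008f0ba2020ba908f1462096208e2b8097008f0b895942980af0c611481096108f1b8a0c7004400950ba09800940ba81481097108f1b8ccf1e2e1b8a59e159d1a5ab15aa1ba809f0c611481096108f1b8a0c500a6009f0ba0a5009e0ba81481097108f1b8c681c671b8a59e159d1a59825962ba81461096108e1b83030b859418a14610a4109d1b8e1e0e1d0b859815961b8a9b74432e484c9424a9b6f424853b4ab6e430d48a9c5a4101a0541a59f29067006609079094c718b74313856b3932e31398b6f323853b3ab6e330d38a079095a4156b3a0541a59f206609b0ce106c0,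
    0x56500404cab306bfb50d7006dfe5e26459a0e25459c006dfd5e244a985af280af5981809fe1e008f34348c054000959918b6e35643830d350a395b418b2d70,
    0x56501425e23333ab3636aecaf4cac4acc1d5c1c5ad0d72cab306bfb5a5a70e2b45a9006e2c5e2a4a0d7006dfe5e264a5a60e2945a50e284a59a0e254a985ab185b51a09f09700a600a50a90a40a08fccc2225ab09780afc6425af25980978ab6f44c9485a84ab6e44c848ac22228a5a4000a0540a59924c718b6f313813a4c935a83a5b818b6e34c8385b70a0b43564385b60ab2d720ce0,
    0xd811422c1cb83cb53cb43a9bc286c276c266a9ecb84cb54cb44a9cc285c275c265a9d0d81c1d601d12336acaf4cac4acc1d5c1c5ad0d71cab306bfb5a95ae006e0d5e3645ac0e3445ad006e375e2f4a95a70e2b45a9006e2c5e2a4a0d7006dfe5e264a9804400980909700960a908f0a4295942980afccf111809fc6815ab185b510087a0a4159818e1e087a9b74432e4856b49b6f414853b4a30d4e1e087a9c5a4101a0541a59f29067006609079094c718b74313856b3932e31398b6f323853b3ab6e330d38a07b095b9356b3a5b71a5b6206a09b0ce106c0,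
    0x278001f314a2ccd55bf01296e1925c468e01f3e1825bd381da31ef38cb11c0215bc34e74b11900d731d94b9832019201f21da2b98017201e212b901d21ef2b981d820d8232b901d24e72b90d721d92b98a00972087075507458d5ba00097057125807533383a838b5bb05be20740,
    0xe3c0cbe5cc73c2f61e50e3b3e0561e40e3a3e0461df0e393dff6a98cc73e3b3e3a3e393a98cbe3e383e2d3e273a98cb1d421cd2b980af211d511ce1ba809f001cb02020ba91cc000d01cf0bae190e180e170cba908fb7a5c2851dc51db5a98d0170019001f01da0ba9c2851d701d60a91d800d801d90bac1d51d6025a0d701d90bbfb5a98b7a31de3151398c283139c1d31dd305abfb3a98b04b0,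
    0x54a004c954caf306c1d55a70345a602498caf3e2b3e29398b59e1809f0c600cd00a6009f0ba908f13621462096208e2b981480097008f0b9c642c5f2b9859425ab15aa1b959725952b98a14148cb6f34c938b5a400ce02cf2,
    0x54a01d91c9c4cb830c4133936369ecb84cb549cc285c2759d1d91caf306c1d595ae006e0d5e3645ac0e34495a70e2b498cb83cb539caf39e363e3439e2b398b08600bd004400950ba90c80900908f0c621482096208f2b890c7004400950b909800940b981462096208e2b8097008f0b8959e259d29594298a0c610cc004400950ba859e181481097108f1b8ccf1e2e1b85ab15aa1b8a09f0c611481097108f1b8a0cd00a6009f0bac681c671ba859e15ab15aa1ba89b74432e484c949b6f430d489cb74332e384c939b6f330d389b5a41110006700ce2,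
    0x56500404caf306c1d55a70e2b45a60e294985fb0970a6008fc6425af25ab0978a14148cb6f34c938b5fc00ce02d72,
    0xd815fd4116122d233339b36369ecb84cb549cc285c2759d0d81caf306c1d595ae006e0d5e3645ac0e34495a70e2b49804400970908fc6820a4295ab2594298a5fb1044087ccf1118a09fc6815ab189b74432e484c949b6f430d489cb74332e384c939b6f330d389b5fc12106b002700ce2,
    0x27801296149314a2ccd511c0025fe3041da2b5bf0261ef3345c4611b1130cf01820d821ef2c9a08f5ba15ff500870007e0871013027210540741,
    0xe460cbf5cc83cd72cc73ac346c2f6ae1ed0e453e0b61e50e3b3e056a20e443e0a61e40e3a3e046a98cc83cc73ae453e3b3ae443e3a3a98cbf3cbe3ae3f3e383ae3e3e2d3a98cb022200d21cf2b98321d421cd2b98a1e6131a81d511ce1b8a09f1e801cb000d01cf0b9a1e7000e01e90ba2020ba91cc000d01cf0b9e190e180e170cb9a08fb7a5c2851dc598d0172019201f21da2b98b9951d721d6298a1001a000a9019001f01da0b9ac2851d709017001e01d92b9c2751d629a1ea01d80a0d8020bac1d501d01d92bc1c5a98b7a31ec38b9931eb38ac2831dd39c2731d629ac1d3c1c3a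98b04b20270,
    0xc4104c9c4cb8306c2855ae006e0d5148cb83e3638b000bd004400950ba908f0c611481097108f1b8a0cc004400950bac681c671ba859e15ab15aa1ba8914148cb74332e38b0006702bb1,
    0xd810404cb8306c2855ae006e0d5e3648044087c6815ab18914148cb74332e38b06b0027029d1,
    0x129600c300e211c05fe314b01f21da2ba1207e0027003075504c1,
    0x1f51e4a0cc45cc93cd81cc83cd71cc73a9c356c346c2f6a9e1f60e493e0e61ed0e453e0b61e50e3b3e056a98cc93cc83cc73a9e493e453e3b3a98cc43cbf3cbe3a9e483e3f3e383a98cb1e813100d11cf1b8a1e611cb1a81cc100d11cf1b81d511ce1b8a90050006000e01e90ba91e8000d01cf0ba91e7000e01e90ba00d01cf0bae190e180e170cba908fb7a5c2858d1101a101a8019101f11da1b8ab9951d718017101e11ef1b8b9851ee1c2658a91010901a00190a01f01da0ba9c28501800170a01e01d91bac27501d01ef0bc265a98b7a31ec38b9931eb38b9831f43258a9c283c273c263a98b010270,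
    0x10df64cda0df54e4b0df44e470dee4e3d0deb4ba98c366e146e0f6e0c6e096ba98edf64df54df44dee4deb4ba98de64de44ddc4dd54dc54ba98dcd2d3d2c3d2b3dca980bf222222dc222222dcbd272d262d252dcb980af212121dc212121dc212121dcba212121dc212121dcbd1d1d1c1d1b1dcba809f202020dc202020dc202020dc202020dcba9202020dc202020dc202020dcba202020dc202020dcbd090d080d070dcba908f202020dc034002c00280dc035002d00290dccce0cc70cbe0dcba9036002e002a0dc037002f002b0dccd40cc80cbf0dcba202020dccd50cc90cc40dcbcd60cca0cc50dcba9202020dc034002c00280dccce0cc70cbe0dcba036002e002a0dccd40cc80cbf0dcbcd50cc90cc40dcba034002c00280dccce0cc70cbe0dcbcd40cc80cbf0dcbcce0cc70cbe0dcba9034002c00280dc035002d00290dccce0cc70cbe0dcba202020dccd40cc80cbf0dcbcd50cc90cc40dcba034002c00280dccce0cc70cbe0dcbcd40cc80cbf0dcb202020dcba202020dccce0cc70cbe0dcbcd40cc80cbf0dcb202020dcbcce0cc70cbe0dcba98c2d434343434ba98c2c4242424ba9c2b41414bac2a404bc294ba98cb7a0,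
    0x61f102c4e3625062418075261f1e154e160b761d261c3861b36193d61a36183d9ca0261e36160006170,
    0x11c1c4f2c553c56522f022e09039611f68e0021c102620252801f30d629b0c4201c28b0bfc0b840b749bd05601296128692023f623e6821b023c623b6921a0e4d6dcbea11c0117122c2234022d20bf22b2b22a2bdc201211910b941170dba11a10bf910f097229022522242b22802376a92271226023d6ba921909721f2b2366b923a6ba921809721e323569a2396ab92386ab9dce8056010f09812029128a1252048148ac1140021390021d1001241,
    0x560065260f6c6a4c6b0a7067307e0057107938065304d38bc07556285ab3a85047509f0a712f462956275c90475e1d0a76265c9b8d00871103e08709f00009703d18021303f0c3c4,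
    0x11c1c562039600e322f0129601f223f60c4223c6e4f5cba0204b3056004c0c4e5,
    0x11c0c56222f0039602621296a21c001f22454247623f623c6c9e24400b832486cdab229022522242b21f2b01b2b246621e3a9edc81110f18900056004c0020312551241,
    0x8960be92aca0acc4acb48c69b269a28699269828ba1097ac9008f000097ac8186e60b4a2,
    0x3d12890c4b2c573c58605c3c40590052ca482d400595949c3b22cc0158e1c42c948cc3a2e5642cb2052ce48b304205958489a28900092c4180028c1b6c2,
    0x95c0c58261e58992897295b4ba2a6295a02a70,
    0x561c6b203d003e1260580168c4e504c58dc4d2e16505520604a58a05710604b58ccc28e1e28da9c442e155c3e4e585ca04f306048504e4060465ce1d3e5749a8b03e000903d1803f0c582]) allWin_2721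
    (by decide +kernel)

set_option maxRecDepth 1000000 in
theorem allWin_2784 : AllWin painterTable 2784 :=
  chkMs_sound (ws := [
    0x561c694c6b203d003e106c4e5c4d2e165c442e155ba05800604c505520604a5a05710604b5e1e2904f3060485ae1d29b810108703f10590970203c584,
    0x44303d005608703e106c4e505800604c505710604b598c4d2055226ccc298e16504a5049598da0003f1059087c582c083,
    0x560c6b203e0c4e605803605702698c4e504c504b598d059003f0c0e2, 0xb1b0b4d2aae4b1a2b193ab1806cd0b492,
    0x30be9220e5d5896028c135aca02598e5d42a742a6498cc4a2ad42acf298be52ace2acd298baac90009ac8186e60b4a2,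
    0x2c5203d0289006c585059006352d40062598c5842ca42cf498cc572e1c4328206052c948c4b3e5e42cb306052ce48be1b2e1a389a289000982c40928c002b6c3,
    0x9660230605bf94e1b0c7a3e1a0b8ac08a61965095d1b8ab09640b8aa095f0ba98304000995e18488303871c38b6ec0,
    0x966012d5d3221616ae1515ad30c4c7f4ac30920605bf94a2f802fe02fd0a92f70a8d5d3c7e3ac7a3a2f402fc02ee0a92fb0a8b8da096e28be18ac0a996d096b296719650a9b3ef08a90a96c095f0ab98023ec22f722ef2b983f902f802f40b9ccb2e1a2b9896828be195d2b93ef096c0b980af0222222ef2b983ec02f702fb0b9e1b0e1a0b9896828a6195d1b98ab09640b98a3042128a96a010a9690a0295e1880b303a71c387ee3a8bd3ab6ec24880,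
    0x30913080d5e39781262626a9e252525a9d30d430c4c874a9c4b714c710615a30c4c7f4ac30910605bf94a92c502f9092f802f70a98d5e39771060532c4c863a9d5d3c7e3ac7a3a92f602f5092f402ef0a98b40508c5098da096e293f709760996d096b29b83ec22f722ef2b82f802f40b899682980af2eb13f912f812ee1b8a2ec02c502f60ba2f902f50ba83f912f812f41b8c6f1c6e1b8a974196f1a8be19671ba809f2eb13f912f812ee1b8a2fa02fe02fc0ba2fd02ee0ba83f912f812f41b8c6f1c6e1b8a974196f1a8be19671ba83ec1112ef1b83030b896818a3ec12f712fb1b8e1b0e1a0b88a6195d1b8a996a195e1a9691a9752930502ff093040995e1876b313971d3813973639b48812ac0,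
    0x2030c364b491d2ca93a5db566c56745acd3a429270415364b3ca93a8991f08372033f531314a930c4c7f3ad891f09982cb3a503a4293409952b898919881a9871a898a093b098c0ba98d098b1ca90f190e0ca08f999919960b9171a89396243c238e22e522d72bc2cf2bc9898f298e2980af399291628a2323a23ab874391b3ab9974ac3992994280391c40af8742102aa092f097,
    0x9a298510543986016168e3a8507458d079306639054383958d04d406448cb0a720aa2054204d2c9806620642b8a5ba0024c73049782b98401313c59923092ba9897b097a0908f9791803d197c1a08f09f06c374f38b97b097a0903d097c0a9979092d4097d1b974f380097e197f22cf0,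
    0xe680cab306bfb520e26306dfe50b90e25306e6756360e24306dfd5a98cab3e263e253e243a98c8b3e663e653e643a98cb5972595262d2cb980af1361594162b1ba5981596162e1cba809f136062a0096008e008a0cba91062c0b0a4009d009a0cbae1e0e1d0e5f0cba908f0a700aa0054004d0ba9635030a96340054020ba62f0a59903090ba98b6e3133e839830d313930c350a3abf93a98b2cf0,
    0x99a0d6b326309216a1515ad4c94c7f4ac2f8031902fd0a98d6b3c7e3a2f4031502ee0a98b8da08be196d09671b3ef096c0b98023ec22f722ef2b983f902f802f40b9c5e2c5c2b9896828be19671b93ef096c0b98a3042128a96a095e2880b38db3a72838b6ec27050,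
    0x99a0d6b3264ba216a1515ad4c9430c4ac2f8031902fe0a98d6b3d5d3a2f4031502fc0a98b8da08be196d09671b3ef096c0b98023ec22f722ef2b983fa033703340b9c5e2c5c2b9896828f7195d2b98dd299c0b980af023ec22f722ef2b983f902f802f40b9c5e2c5c2b9896828be19671b93ef096c0b98a328010996a0a99b1832b37ca3880b3a7df38b6ec24880,
    0x63d104e0d6c3054230d663e10b56978136a932e58c8530c5c87598ad314c7106c7f5a932e431c18c8430c4c87498c7f49ac40508c508c84930982f828be282f728da09ad6c399a10605324499e08dc2060532c4c86399760a31b1c7e3a3092f42967282ef296d09ab2f818be18111182f4196728ab09f31702f90a2f602f509b30e02f802ee0ba92ec02fe22f60b92fd22ee2b92f722fb2b9a30f031703160ba2f902ee1ba1111bc6f1c6e2bca09f08f30e1318031913151ba899d183f912f8111b82fd02ee0b896f18a3ec22f812fb2b8c5e2c6e1b88be195d2b8a93042128a305095e2896a19752976b331d3a72838b70512ac04882,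
    0x40430ac030911232e64c7206a252525a9d30d40b5434a9c31c14b71a4c9430c4ac92c502f9092f8098d6c38dc2060524dc839771060532c4a9d6b3d5d3a92f602f5092f4098b40508c5098da093f709760996d09b830e12eb1a326031703160ba2c502f60ba899d19741a809f2eb23f922f822ee2b8932f033903360b933803350b983fa133713341b8c6f2c6e2b89974296f298f719672b983ec22f722ef2b833703340b89682890af2eb23f922f822ee2b892ec02c502f60b92f902f50b983f912f812f41b8c6f1c6e1b89974296f298be19671b983ec22f722ef2b82f802f40b8968289a30e13fa133713341b8a327031903150bae351c5c2ba82eb12fe02fc0b8a99d18f7195d2ba9741a83f912f812f41b8c6f1c6e1b88be19671b8a9328199b1896a1a932902ff093280999b1877531397df381398e739b0148822ac0,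
    0x9ae04c93349b4267656745ad139af264c3ca93adb4c93c7f3ac93609ab193409a91c8396298f28a9ac09aa0c9a8098d198b0b9a43c238e22e522d72bc2cf2bc9a08f99909960b98e28922329a42d3436284c391629b0001009ad18742,
    0x91d13213676564c34c93c6042231466c564b330c3ca3a509ab193409a91b89b60927091f0b99b509ac09aa1ba93b098c1ca908f9b919b81a89396243c22e522d722cf2cb9898f2898e2890af92d2229a39439ba399428b9b7087422aa0,
    0x8ec08d819ae0971367d536638eb23594939166c567c59dc64f33593caa398ba93c09260a830d30b549bc2b99250924098c39c1114c9439e1c7f4ab91f03a5192700bf99bd03a703a609d838039f09b94708c83ac3a509340b9839723b9292c29843c2922928298a444192b18929192c108fa9bb22e4192b28ba09f113392e0970ef00e60857492f29ad12aa2,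
    0x9ae18ec08d81366367d504b20491359366d5a3a5143b092609927098139c6236633593ad30d30b539c429c39c139e10cf993a09250a91f098b9bf03a709be3a9360994709460a9c51bc892e292d29a397144413b91a892b180209f92e139722e522e42b892b28928243c208f93ab12e712e42b893d1809f944112f210f503ad0872aa2139b709787d4,
    0x6e08704d365810674065ff55bb1063a859079306638b04d306448bc06720652c079204d2c9a5ba0239783c63c24c7263e2b905423092b9a899f000908f97b197a1803d197c1a821809f06c374f39790978b97b197a1803d197c0a89791888d3999f003e09a40a997b092d4197d1b9039a6489a509a7203f02cf1,
    0xe760caf325d2cac3a1616aec1d5c1c5ad0b92cab306bfb5a01b0e2b306e7555ad006e745a0b90e26306dfe5a20e29306e6f56450e28306e6e5a0b90e25306e675a98caf3cac3acab3ae2b3e2a3ae263ae293e283ae253a98c953c8e3ac8b3ae6d3e6c3ae663ae6b3e6a3ae653a98cb6371598163a1ba59d16391ba8594162b1b8a09f1370084009700870ba96380096008f008a0cb9a0a400990b0a6009f009c0cba0a5009e009b0cba962a0096008e008a0cb90a4009d009a0cb9a08f136262a2096208e208a2cb981013d0b097008f008b0cb9ccc2e1d2e5f2cb981362594262b2b9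5ab15aa162e2cb95972595262d2cb980af136262a2096208e208a2cb981062c0b0a4009d009a0cb9e1e0e1d0e5f0cb981362594262b2b95981596162e1cb95972595262d2cb98a0a720aa2054204d2b98635262f298a200ac00ab0a90ad0055004d0b9a63d091062f09a0aa0054030b963509a0a70066004d0b962f29a63c063b0a4c7063e0ba6340a054010ba4c703092ba98b6f32380b4347638a1363f3a4c9330c3a98b6e34c83863f38a0b436443830c33f539c7f398ab2cf20ef0,
    0x3e0cdf20103d120c396c5840590062ca48c5723282062c948c4b22cb2062ce48ba11118928902c4180128c0c6d2,
    0x8c71d7b311264c71369a158c85a252525a98d32e40b54c874a9c40608c5098d7b349f3dc83c863a8999e09760a8b2b702f90931602f509b08f30e130f031913160ba83f912f812ee1b82fd12f50b8a99d196f1a893f922f822f42b8c6f2c6e1b898be19671b98a305076b396a19c7233c08ef3932d07051,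
    0x8c7136e305411206244c720614a0532e40530d4ad31702f9098d7b3210605324431608dc2060532c42f60ab30e1327131913151ba82eb12fe12f60b8a940608c5098be199e03f70a9671b83f9230e22f822ee2b9831822b703152b933802ee2b9899d296f2983fa133713341b8c6f2c6e2b88f719672b890af30e2318231923152b983f922f8212b82fd22ee2b8999d296f2983f922f822f42b8c6f2c6e1b88be29671b89a3290328199b1833e0977538f43978d38b2ac048817052,
    0x2890c8922c4128a0c65604c6d36f6268c00604c6c3a69f00604705369d0066ff4a80068c076426e41,
    0xac0054112264c711691515ad32e430d4ac40604050a831702c50a08fd7b38dc1060532c4999e03f70a831602f60908fb2eb22fe23360b899742980af30e1326031703151ba82fe12fc1ba99d19741a83f912f812f42b8c6f1c6e2b88be29672b8a3fa133712f42b8e351c6e2b88be29672b812f930e131913151b83fa133723342b8e352e7b1b8a99d18f719c81ba811f33a03280a32909832b303878d387753ab2ac04881,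
    0x8fc15d5132e32467d59cc1a36630d439cb29149cd132e40b539bc29dcb39713af03a60a947064f38c849b92b1893c0926099c90b93a092409dc444192c1a908f39729ca22e41c9892b28a000e5085732aa192e097029ad0a7,
    0x8ec0025d5232e3349ce167d566d5ad36630330d485b5ab32e30b549c429bc93c09260993a09250ab8397144413b91a899bf09470c3a709be39460ca92b18444292c2939722e522e42b8992b280af92e2320387d49b710f402aa10e60,
    0x6e033265bb016807553a858d067307938065304d38cb320af206720652b980ac2055212b9054204d2b98a31809f202020a908f99f003e09a40a997b0903d097c0a9807c303806c38b03f007d2]) allWin_2754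
    (by decide +kernel)

set_option maxRecDepth 1000000 in
theorem allWin_2817 : AllWin painterTable 2817 :=
  chkMs_sound (ws := [
    0x25c1e7f0cb8301b1cb5322a1cb43a9262626a9ec285c275c265a9d01b1caf3360ba1cac316ac1d5c1c5ad0b91cab306bfb5a90b80e36306e0d501b0e34306e7e55ad006e7d5a901b0e2b306e7555ad006e745a0b90e26306dfe5a98cb83cb53cb43a9caf3cac3acab3a9e363e343e2f3a9e2b3e2a3ae263a98c9c3c993c983a9c953c8e3ac8b3a9e7c3e7a3e793a9e6d3e6c3ae663a98cb0840086030095008d0cba9085004400890ba0980094008c0cba9084009700870ba2008f020cba303030cba908f62a2096208e208a2cb8097008f008b0cb89594262b2b980af1371084109710871ba86381096108f108a1cb8a100880b0440095008d0cba0980094008c0cba81113d1b097108f108b1cb8ccf1e2e1e781cb8a6371598163a1ba59d16391ba5ab15aa16461cba809f1371084109710871ba86381096108f108a1cb8a0a400990b0a6009f009c0cba0a5009e009b0cba81113d1b097108f108b1cb8c681c671c661cb8a6371598163a1ba59d16391ba5ab15aa162e2cba862a1096108e108a1cb80a4009d009a0cb8594162b1b8a1162c1b0a4109d109a1cb8e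1e0e1d0e5f0cb85981596162e1cb8a9210ac10ab1a80ad1055104d1b8a63d181162f18a0aa1054131b863518a0a71066104d1b864718a90ac01090af00ae0a06700650ba90ad00a70a90ac00ab0a055020ba0aa0a054004d0ba90a900a80a2030ba0a70a1004d0ba06600640ba98b7432384c9333a932e31398b6f313853b3a138b6e303830d38a9649323a0b5330c3a86483a0b4364a38c8738a9b0ef106c0,
    0x11408298500307942698611693a8507459d13138b054206628a5ba0034c7298410359929831809f2008f34248c9cf000900972d4114806c303803874f39b9d409d52002d71,
    0xe851031406bfb5cab31d901306dfe5e26380b91041306e675e253859c21406dfd58e2438ba95941809f59725952b8959815961b809f0af136020096008e0ba914600a4009d0bae1e0e1d0ba908fb6e34c8385643ab054010a30d3009b0159928b6e44c843e84a863f414a830c450a4a8bf948a9c00012d72,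
    0x9f206e031065406735ff65bb10693a8507458d33338b5ba02380792066284c728a0087212189d608709f11118008799cf000972d41814048248c06c3131487d839a648b9d7003f02d712bb2,
    0xe87003caf4c1d60b92c8e43316ac1d5c1c5adcaf3cac3ab0d803406e7555ad006e745ae2b3e2a3ab5a6104e29306e6f55a50042306e6e5ae293e283ab9822cab406bfb522e26406dfe50d713406e67598cab3e263e25398ba59e159d1a5941a809f0c6014802008f0b9a1460096008e0b9a0c500a6009f0ba0a5109e0ba0a4009d0ba908f1462096208e2b8914800a4208f0b9ccc2e1d2b9859425ab15aa1b9859725952b890af136222096208e2b9814600a4009d0b98c642c5f2b89594259825962b9859725952b89a13138b6f3338a53b3a56439b6e330d384c839ab1259928054256439ba24141489b6f430d48a4c9490b4447648ab6e430d484c849a0b4464448ac1000a10a5a4000a0540ab59924c714c9404a63f4a30c43f549c7f49ac82d72000ce1,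
    0x44205436580060755335bb0063a85138067207928a3097249d600408f0307c4139b001097031489cf00306c4903f02bb2,
    0x1d71e890cb830c413322b123a9cb84cb54cb44a9c262626a9ec285c275c265a9d1d91caf3364e71cac316ac1d5c1c5ad1d91cab306bfb5a91da0e36306e0d51ef0e34306e7e55ad006e7d5a91d90e2b306e7555ad006e745a1d90e26306dfe5a98cb83cb53cb43a9caf3cac3acab3a9e363e343e2f3a9e2b3e2a3ae263a98b0840086004400950ba90c8009800940ba90c601008f0ba2020ba908f1462096208e2b8097008f0b895942980af0c611481096108f1b8a0c7004400950ba09800940ba81481097108f1b8ccf1e2e1b8a59e159d1a5ab15aa1ba809f0c611481096108f1b8a0c500a6009f0ba0a5009e0ba81481097108f1b8c681c671b8a59e159d1a5ab15aa1ba81461096108e1b83030b859418a14610a4109d1b8e1e0e1d0b859815961b8a95a4101a0541a59f29067006609079094c718b7442484c9434a932e41498b6f414853b4a148b6e404830d48a9649424a0b5430c4a86484a0b4464a48c8748a9cb77323853c333a936631398b76313853b3a138b75303835938a95b93649456b324a0d433593a8036484a0cf30364a48caa38a9b0ce106c0,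
    0x2042a20543986016168e3a8507458d5ba0984180542066289da28a009700879d8006c303874f38b9d909db22e50,
    0xe8b0cab306bfb520e26306dfe50d70e25306e67559c0e24306dfd5a985af280af5981809fe1e008f054000959918b7531340d398359313964b350a3abfa3a98b2e50,
    0xa629860210673065ff55bb1063a859079206628a5ba04c72800879cf000979d812bb39dd3a88d39b9dc029d206c02e51,
    0xe8d025e2caf3cac3ab1616aec1d5c1c5ad0d72cab306bfb5a0d80e2b306e7555ad006e745a0d70e26306dfe5a5a60e29306e6f55a50e28306e6e5a0d70e25306e675a985ab185b51a09f09700a600a50a90a40a08fccc2225ab09780afc6425af25980978a22228a5a4000a0540a59924c718b763526380cf350a38a1313a64c323a98b75350b3864b38a0cf364438359341539ca9398ab2e520ce0,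
    0x4d3044265800607555bb0063a858067207929a00879cf09de1179df3039038b0006c129d2,
    0x1d71e8f022c1cb83cb53cb43a9b262626a9ec285c275c265a9d0d81caf33601d1cac316ac1d5c1c5ad0d71cab306bfb5a901f0e36306e0d501e0e34306e7e55ad006e7d5a90d80e2b306e7555ad006e745a0d70e26306dfe5a9804400980909700960a908f0a4295942980afccf111809fc6815ab185b510087a0a4159818e1e087a95a4101a0541a59f29067006609079094c718b77323853c333a936631398b76313853b3a138b753038338a964e323a0d433593a864d3a0cf364f38caa38a9b010ce0,
    0x5d6211033a859ec103074491012629ed15c82900979e80879eb39ea38b009e909ee266a0,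
    0xe950bfb312a0dfe35cf066e0dfd3a985c5280af5c6109fdf9008f5c80b79313139866d313966c366b3ada93a98b66a0,
    0x66f06772c1d3c1c3ab22bfb3a5f4010e743a12a0dfe3a5dd05dc0a5cf0a985d5111a09f5d705c60a08f121280af04b25d828a5c8212600f83238107366b38a136743a676366c3a98b79303867538a107303867438ab0266a0,
    0x3df007539fd012409761d29f90879fc39fb38b9fa066a02092,
    0x67e1e98067f1c283c273c263a9b12b1c1d311c1c3a12a1bfb3a910e0d30390e7e311f0e7d3a95f4010e743a12a0dfe3a985d705e6095d60908f12425d8280af5e7109f5e810112600f831386783967d3239867b36753a138b79303866d38a9136743a67a366c3a86793a0f7303867c38a9b66a11270,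
    0x115104065233065ff56581060745923066383959b067206027506b3066206076506a390af002e81020306c49e400005a1,
    0x2103067206027511510607659c6b265800607458a06c22e800ce39e5005b0,
    0x12803df08712520302729e710307650742912622b40033c959e601270,
    0x278001f3e5c2666066518c2e66696e9c698eccd365f06146e9b398cc6365e06686e9a398c38365d06676c37398dcb11c011b0965c05bf02376965b0664023669659011809dcb11a0119065a01170dcb98120172b00f20192b026201f2c382cb9802420172b025201e201c201b2dcb92201d2c372cb98024225b2b225211620c42e765cb9024201d222b222a2dcb925f225e20b92e685cb98a10f1809f303093030a908f65506540905606560a910f0911406570a9807532383a838b027222807f28a65800740,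
    0xe9d0cce3c2f61e50e943e9961e40e8e3e9761df0e8c3e966a98cce3e943e8e3e8c3a98cc73e8a3e883e863a98cbe3e843e773e693a98dcb321d4224f224d2dcb980af112491b25611d4124b1cba25712551254124e1dcba809f102490b1024a0b303000b00090dcba9202024c0cb00f000d000b00090dcbae5c0e5b0e5a0e590dcba908f002580200170ba9259000f00190ba026001f0c380cba92580024030ba1d7025c0ba1d6025a0ba92580024025b0ba225011600c4001b0dcba1d6025a0ba25f025e00b9025d0dcba98b7a3231dc323a98c28326431db3a9c1d303abfb3a98b04b0,
    0x27a0cd7227c0226097278087039227b28a002790,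
    0xe760caf306c1d501b0e2b306e75564503306e6f598caf3e2b3e29398c953e6d3e6b398cb6841598163a1ba809f13700bb009700870ba9100bf0b0a6009f009c0cba908f136262a2096208e208a2cb981013d0b097008f008b0cb9c642c5f2c592cb981362594262b2b95ab15aa16461cb95972595262d2cb98a0ad00ac0055004d0ba963d0963c04c7063e0ba98b6f30384c938b0ef02cf2,
    0x25c1e7f0cb8331cb53916169ec285c2759d01b1caf306c1d590b80e36306e0d520e34306e7e5901b0e2b306e75598cb83cb539caf39e363e3439e2b398c9c3c9939c9539e7c3e7a39e6d398cb08600bd030095008d0cba90bc004400890ba90bb03030ba908f1372084209720872b986382096208f208a2cb89100880b0440095008d0cb90980094008c0cb9862a2096208e208a2cb8097008f008b0cb896372598263a2b959d26392b9594262b2b98a13710bb109710871ba8100be0b0440095008d0cba86841598163a1ba81113d1b097108f108b1cb8ccf1e2e1e781cb85ab15aa16461cb8a09f13710bb1110871ba81113d1b097108f108b1cb8a100bf0b0a6009f009c0cbac681c671c661cba86841598163a1ba5ab15aa16461cba890ad10ac1055104d1ba863d189100ae090af006700650ba90ad090ac0055004d0ba90a9006600640ba98b7431384c93932e38b6f3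03830d38964939b1106c00ef2,
    0xe870c954caf306c1d51d90e2b306e7555a60043306e6f598caf3e2b3e29398b59e1809f0c600cd00a6009f0ba908f13621462096208e2b981480097008f0b9c642c5f2b9859425ab15aa1b959725952b98a5a40b6f40484c948cb7635263864c38b0ce02d72,
    0x1d71e890230c41139cb84cb549c16169ec285c2759d1d91caf306c1d591da0e36306e0d51ef0e34306e7e591d90e2b306e75598cb83cb539caf39e363e3439e2b398b08600bd004400950ba90c80900908f0c621482096208f2b890c7004400950b909800940b981462096208e2b8097008f0b8959e259d29594298a0c610cc004400950ba859e181481097108f1b8ccf1e2e1b85ab15aa1b8a09f0c611481097108f1b8a0cd00a6009f0bac681c671ba859e15ab15aa1ba895a410670b7441484c94932e48b6f404830d48964949cb77313853c3936638b76303835938964e39b1106c00ce2,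
    0xe8d0caf306c1d50d80e2b306e7555a60e29306e6f5985fb0970a6008fc6425af25ab0978a5a40b7635263864c38b0ce02e52,
    0x6850116122d2cb83cb539b16169ec285c2759d0d81caf306c1d5901f0e36306e0d501e0e34306e7e590d80e2b306e7559804400970908fc6820a4295ab2594298a5fb1044087ccf1118a09fc6815ab1895a410670b77313853c3936638b76303835938964e39b01000ce2,
    0x66f0c1d35f405dd185c609768608704b25d828a12600f8303867638b0066a2,
    0x67e1e98066f1c283c2739b12b1c1d3910e0d30390e7e395f409800970104b160708702705e820f831386763967d3867b3967a39b11038066a2,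
    0x278001f3e5c26660c2e666968eccd365f061468cc6365e066868c38365d066768dcb11c065c065b06590dcb8120182b00f20192b9014201a2b026201f2c382cb98120182b025201e201c201b2dcb981226a2b225211620c42e765cb98a216541810f189202020a908f655005606560a986580105ff302720741]) allWin_2784
    (by decide +kernel)

set_option maxRecDepth 1000000 in
theorem allWin_2832 : AllWin painterTable 2832 :=
  chkMs_sound (ws := [
    0xeac0cd43cd72cce3ac346c2f6ae1ed0ea93eab61e50e943e996a20ea83eaa61e40e8e3e976a98cd43cce3aea93e943aea83e8e3a98cc83cc73aea73e8a3aea63e883a98cbf3cbe3aea53e843aea43e773a98dcb122492b1224a2b00f200d200b20092dcb98122492b222224b2cb9321d4224f224d2dcb98a25612661b257125512681cba25611d4124b1cba825712551254124e1dcb8a09f2650102670ba100050b20300080cba91024a0b303000b00090dcb9a00f000d00070cb014000e000c000a0dcba303000b00090dcba9202024c0cb00f000d000b00090dcb9e5c0e5b0e5a0e590dcb9a08f022582220172b98259200f20192b9026201f2c382cb982582024232b91d7225c2b91d6225a2b98a25900150200180ba9258000f00170b9a0160014001a0ba2020ba9259000f00190b9026001f0c380cb9a26903030ba024025a0ba1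d7025c0ba9258202400170b9025001e001c001b0dcb9024025a2b9a26903026a0ba024025b0ba225011600c4001b0dcba024001d022b022a0dcba98b7a3c2831dc398b99326c326b398ac28326439c273139ac1d3c1c3a98b04b20270,
    0x2760cd8227e127f0117122908727d227500127910390,
    0xc41e7f0cb8306c2850b802306e0d58cb83e3638c9c3e7c38cb000bd00440095008d0cba908f13710bb1110871ba81113d1b097108f108b1cb8a100be0b0440095008d0cbac681c671c661cba86841598163a1ba5ab15aa16461cba890ac00af006700650ba98b74303832e38b06c02ca1,
    0x11162c9c4cb8306c2855ae02406e0d58cb83e3638b0bd0044030b9a08f0c610cd10a610950ba859e1891482097208f2b8c681c672b85ab25aa1b89a23238b0670b74404832e48c06c02bb1,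
    0x1d71e8f0cb8306c28501f0e36306e0d58044087c6815ab1890670b77303836638b0ce029d1,
    0x27b1e980c2830390e0d385d708702705e710f8303867d38b038066a1,
    0x129611c1c4f3c544c555e5c2ccd323c24bd0262cc62c382dba655005606561a890314020270075504c1,
    0x26f1eb70cd53cd81cd43cd71cce3a9c356c346c2f6a9e1f60eb53eb661ed0ea93eab61e50e943e996a98cd53cd43cce3a9eb53ea93e943a98cc93cc83cc73a9eb43ea73e8a3a98cc43cbf3cbe3a9eaf3ea53e843a98dcb2651112671ba110051b21310081cba81124a1b00f100d100b10091dcb8a25612661b257125512681cba25611d4124b1cba8212124c1cb00f100d100b10091dcb825712551254124e1dcb8a9100050b00f00060b014000e000c000a0dcba9100050b20200080cba303000b00090dcba900f000d00070cb014000e000c000a0dcba00f000d000b00090dcbae5c0e5b0e5a0e590dcba908f25910151210181ba8258100f10171b8a0161014101a1ba2121ba8259100f10191b8026101f1c381cb8a26913131ba024125a1ba1d7125c1ba826d102410171b8025101e101c101b1dcb8024126e1b8a9300160014001a0ba90150100180ba00f00170ba90160014001a0ba00f00190ba026001f0c380cba90150300180ba02400170ba025001e001c001b0dcba024001d0c3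70cba98b7a3c2838b99326c38b983238a9c283c273c263a98b010270,
    0x20cd93e5422760cd83e552277033e4e298cd92cd82cd7298a11c0c2e32750274181211f28a0390,
    0x10cda3eb90eb83eae0ead3e9f0e9e3a98e4e0a7e55109fe54008fcd9003a0910e4e0a7cd7298b7b3232323a98c3531313a9c34303ac2f3a98b0390,
    0xeba0e4c4cda0c364b7b0, 0xb8f0b8a003c0,
    0xc2d001c2b0a701c2a0a7c292cb89000102c180c1718c1618ac153c144a89b00b8a3,
    0x10ebd5c360e140e0f0e0c0e094ba98c290c7c2a30bfc2b20af1109f0008fc2d03010c2a33030c7ba9c2c02003b010c7bac2b00000c7b0000c7c294ba98ebc5c360c2c1e140c2b2e0f0c2a3e0c0deb4e094ba98c2d020200020c7ba9c2c0100010c7bac2b00000c7b0000c7c294ba98db8f0,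
    0xebe0ebd0ebc0]) allWin_2817
    (by decide +kernel)

/-! ### The game on a graph -/

section Graph

variable {V : Type*} [Fintype V] [DecidableEq V] {G : SimpleGraph V} {ρ : V → ℕ}

theorem PainterWins.painterWinsIn {U : Finset V} {f : V → ℕ} (h : PainterWins ρ U f)
    (hG : ∀ u v, ρ u = ρ v → ¬ G.Adj u v) {r fuel : ℕ} {t : V → ℕ}
    (hf : ∀ v ∈ U, f v + t v ≤ r) (hs : ∑ v ∈ U, f v ≤ fuel) : PainterWinsIn G r fuel U t := by
  induction h generalizing t fuel with
  | @intro U f σ h1 hσ hw ih =>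
    cases fuel with
    | zero =>
      refine Finset.eq_empty_of_forall_notMem fun v hv => ?_
      have := h1 v hv
      have := Finset.single_le_sum (f := f) (fun _ _ => Nat.zero_le _) hv
      omega
    | succ fuel =>
      refine .inr fun S hS hn => ⟨σ S, (hσ S hS hn).1,
        fun u hu v hv => hG u v ((hσ S hS hn).2 u hu v hv), .inr ⟨fun v hv => ?_, ?_⟩⟩
      · have := (hw S hS hn).one_le v hv
        have := hf v (Finset.mem_sdiff.1 hv).1
        omega
      · refine ih S hS hn (fun v hv => ?_) (Nat.lt_succ_iff.1 (lt_of_lt_of_le ?_ hs))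
        · have := (hw S hS hn).one_le v hv
          have := hf v (Finset.mem_sdiff.1 hv).1
          beta_reduce at *
          omega
        · obtain ⟨x, hx⟩ := hn
          refine (Finset.sum_le_sum_of_subset Finset.sdiff_subset).trans_lt
            (Finset.sum_lt_sum (fun v _ => Nat.sub_le _ _) ⟨x, hS hx, ?_⟩)
          have := h1 x (hS hx)
          simp only [hx, if_true]
          omega

theorem PainterWinsIn.painterWins (hG : ∀ u v, ¬ G.Adj u v → ρ u = ρ v) {r fuel : ℕ}
    {U : Finset V} {t : V → ℕ} (h : PainterWinsIn G r fuel U t) (ht : ∀ v ∈ U, t v < r) :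
    PainterWins ρ U (fun v => r - t v) := by
  induction fuel generalizing U t with
  | zero => rw [show U = ∅ from h]; exact .empty
  | succ fuel ih =>
    rcases h with rfl | h
    · exact .empty
    · refine .of_forall (fun v hv => Nat.sub_pos_of_lt (ht v hv)) fun S hS hn => ?_
      obtain ⟨I, hI, hr, h⟩ := h S hS hn
      refine ⟨I, hI, fun u hu v hv => hG u v (hr u hu v hv), ?_⟩
      rcases h with h | ⟨h1, h⟩
      · rw [h]; exact .empty
      · exact (ih h h1).mono subset_rfl fun v _ => by rw [Nat.sub_sub]

theorem PainterWinsIn.mono {r r' fuel : ℕ} (hr : r ≤ r') {U : Finset V} {t : V → ℕ}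
    (h : PainterWinsIn G r fuel U t) : PainterWinsIn G r' fuel U t := by
  induction fuel generalizing U t with
  | zero => exact h
  | succ fuel ih =>
    refine h.imp_right fun h S hS hn => ?_
    obtain ⟨I, hI, hI', h⟩ := h S hS hn
    exact ⟨I, hI, hI', h.imp_right fun h => ⟨fun v hv => (h.1 v hv).trans_le hr, ih h.2⟩⟩

end Graph

/-- The complete multipartite graph with parts of sizes `n i` has paintability `r + 1`, if Painter
wins a position that contains it and Lister wins a position contained in it. -/
theorem paintability_eq_succ {k r : ℕ} {n : Fin k → ℕ} {p l : List Row} (hp : Win p) (hl : ¬ Win l)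
    (hr : 0 < r) (hn : ∀ i : Fin k, n i ≤ (p.getD i []).length)
    (htp : ∀ q ∈ p, ∀ a ∈ q, a ≤ r + 1) (hk : l.length ≤ k)
    (hn' : ∀ i : Fin k, (l.getD i []).length ≤ n i) (htl : ∀ q ∈ l, ∀ a ∈ q, r ≤ a) :
    paintability (SimpleGraph.completeMultipartiteGraph fun i => Fin (n i)) = r + 1 := by
  have tok_mem : ∀ {s : List Row} {v : ℕ × ℕ}, v ∈ cells s → ∃ q ∈ s, tok s v ∈ q := by
    intro s v hv
    have hv' := fst_lt_of_mem_cells hv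
    rw [mem_cells] at hv
    rw [List.getD_eq_getElem _ _ hv'] at hv
    refine ⟨s[v.1], List.getElem_mem _, ?_⟩
    rw [tok, List.getD_eq_getElem _ _ hv', List.getD_eq_getElem _ _ hv]
    exact List.getElem_mem _
  have hP : Paintable (SimpleGraph.completeMultipartiteGraph fun i => Fin (n i)) (r + 1) := by
    have h : PainterWins (fun v : Σ i, Fin (n i) => (v.1 : ℕ)) Finset.univ fun _ => r + 1 := by
      have hc : ∀ v : Σ i, Fin (n i), ((v.1 : ℕ), (v.2 : ℕ)) ∈ cells p := fun v =>
        mem_cells.2 (v.2.2.trans_le (hn v.1))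
      refine PainterWins.of_embedding hp (fun v => (v.1, v.2)) (fun v _ => hc v) ?_
        (fun _ _ _ _ h => h) fun v _ => ?_
      · rintro ⟨i, j⟩ - ⟨i', j'⟩ - h
        obtain ⟨h1, h2⟩ := Prod.mk.inj h
        obtain rfl := Fin.ext h1
        obtain rfl := Fin.ext h2
        rfl
      · obtain ⟨q, hq, h⟩ := tok_mem (hc v)
        exact htp q hq _ h
    exact ⟨_, h.painterWinsIn (fun u v h => by simpa using Fin.ext h) (fun _ _ => le_rfl) le_rfl⟩
  refine le_antisymm (Nat.sInf_le hP) (le_csInf ⟨_, hP⟩ fun r' ⟨fuel, h⟩ => ?_)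
  by_contra hr'
  have h := (h.mono (Nat.le_of_lt_succ (not_le.1 hr'))).painterWins
    (ρ := fun v : Σ i, Fin (n i) => (v.1 : ℕ)) (fun u v h => by simpa [Fin.ext_iff] using h)
    fun _ _ => hr
  have hc : ∀ v ∈ cells l, ∃ h : v.1 < k, v.2 < n ⟨v.1, h⟩ := by
    intro v hv
    have hv' := fst_lt_of_mem_cells hv
    rw [mem_cells] at hv
    exact ⟨hv'.trans_le hk, hv.trans_le (hn' ⟨v.1, hv'.trans_le hk⟩)⟩
  obtain ⟨v₀, hv₀⟩ : (cells l).Nonempty := by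
    rw [Finset.nonempty_iff_ne_empty]
    intro h
    exact hl (by rw [Win, h]; exact .empty)
  have : Nonempty (Σ i, Fin (n i)) := ⟨⟨v₀.1, (hc v₀ hv₀).1⟩, v₀.2, (hc v₀ hv₀).2⟩
  choose! φ hφ using fun v hv => (⟨⟨⟨v.1, (hc v hv).1⟩, v.2, (hc v hv).2⟩, rfl, rfl⟩ :
    ∃ w : Σ i, Fin (n i), (w.1 : ℕ) = v.1 ∧ (w.2 : ℕ) = v.2)
  refine hl (h.of_embedding φ (fun _ _ => Finset.mem_univ _) (fun u hu v hv he => ?_)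
    (fun u hu v hv he => ?_) fun v hv => ?_)
  · exact Prod.ext ((hφ u hu).1.symm.trans ((congrArg (fun w => (w.1 : ℕ)) he).trans (hφ v hv).1))
      ((hφ u hu).2.symm.trans ((congrArg (fun w => (w.2 : ℕ)) he).trans (hφ v hv).2))
  · exact (hφ u hu).1.symm.trans (he.trans (hφ v hv).1)
  · obtain ⟨q, hq, h⟩ := tok_mem hv
    exact htl q hq _ h

theorem win_six : Win (List.replicate 6 [8, 8, 8]) :=
  (domB_sound (by decide +kernel)).win (allWin_2832 2831 (by decide))

theorem win_seven : Win (List.replicate 3 [8, 8] ++ List.replicate 4 [8, 8, 8]) :=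
  (domB_sound (by decide +kernel)).win (allWin_2832 2827 (by decide))

/-- `χ_P(K_{2⋆1,3⋆5}) = 8`, `χ_P(K_{3⋆6}) = 8`, `χ_P(K_{2⋆4,3⋆3}) = 8`, and
`χ_P(K_{2⋆3,3⋆4}) = 8`. -/
theorem paintability_eq_eight :
    paintability (SimpleGraph.completeMultipartiteGraph
      (fun i : Fin 6 => Fin (if (i : ℕ) < 1 then 2 else 3))) = 8 ∧
    paintability (SimpleGraph.completeMultipartiteGraph (fun _ : Fin 6 => Fin 3)) = 8 ∧
    paintability (SimpleGraph.completeMultipartiteGraph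
      (fun i : Fin 7 => Fin (if (i : ℕ) < 4 then 2 else 3))) = 8 ∧
    paintability (SimpleGraph.completeMultipartiteGraph
      (fun i : Fin 7 => Fin (if (i : ℕ) < 3 then 2 else 3))) = 8 := by
  exact ⟨
    paintability_eq_succ win_six not_win_six (by decide) (by decide) (by decide) (by decide)
      (by decide) (by decide),
    paintability_eq_succ win_six not_win_six (by decide) (by decide) (by decide) (by decide)
      (by decide) (by decide),
    paintability_eq_succ win_seven not_win_seven (by decide) (by decide) (by decide) (by decide)
      (by decide) (by decide),
    paintability_eq_succ win_seven not_win_seven (by decide) (by decide) (by decide) (by decide)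
      (by decide) (by decide)⟩
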